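/- Let δ̄ > 0, let (u, v) ∈ S(δ̄), and let ε > 0. Then there is a constant h₁ > 0, depending on δ̄, ε and on the pair (u, v), such that η_u(h) ≤ (1/2) · h^{−ε} whenever 0 < h < h₁. -/

import Mathlib

noncomputable section

open MeasureTheory Metric Set
open scoped RealInnerProductSpace

abbrev R2 : Type := EuclideanSpace ℝ (Fin 2)

/-- `p` is a subgradient of `f` at `x`. -/
def SubgradAt (f : R2 → ℝ) (x p : R2) : Prop :=
  ∀ y : R2, f x + ⟪p, y - x⟫ ≤ f y

/-- `ψ` is a (canonically extended) potential of the optimal transport between `U₁` and `U₂`: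
it is convex on `ℝ²`, all its subgradients lie in `closure U₂`, and its gradient map pushes
the Lebesgue measure restricted to `U₁` forward to the Lebesgue measure restricted to `U₂`. -/
def IsOTPotential (U₁ U₂ : Set R2) (ψ : R2 → ℝ) : Prop :=
  ConvexOn ℝ Set.univ ψ ∧
  (∀ x p : R2, SubgradAt ψ x p → p ∈ closure U₂) ∧
  MeasureTheory.Measure.map (fun x => gradient ψ x) (MeasureTheory.volume.restrict U₁) =
    MeasureTheory.volume.restrict U₂

/-- `S` is a centred section of `w` at `x₀` of height `h`:
`S = {w < w x₀ + p · (· - x₀) + h}` for a slope `p` chosen so that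
the centre of mass of `S` is `x₀`. -/
def IsCentredSection (w : R2 → ℝ) (x₀ : R2) (h : ℝ) (S : Set R2) : Prop :=
  ∃ p : R2, S = {x : R2 | w x < w x₀ + ⟪p, x - x₀⟫ + h} ∧
    (∫ x in S, (x - x₀) ∂(MeasureTheory.volume)) = 0

/-- Dilation of `S` about `x₀` by factor `t`. -/
def dilate (x₀ : R2) (t : ℝ) (S : Set R2) : Set R2 :=
  (fun x => x₀ + t • (x - x₀)) '' S

/-- The (closed) ellipse centred at `0` with half-axis `A` in unit direction `e` and
half-axis `B` in the orthogonal unit direction `f`. -/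
def ellipse (e f : R2) (A B : ℝ) : Set R2 :=
  {x : R2 | (⟪x, e⟫ / A) ^ 2 + (⟪x, f⟫ / B) ^ 2 ≤ 1}

/-- `w` is an Alexandrov solution of `det D² w = χ_Ω` in `ℝ²`: the Lebesgue measure of the
subdifferential image of any Borel set `E` equals the Lebesgue measure of `E ∩ Ω`. -/
def AlexandrovSol (w : R2 → ℝ) (Ω : Set R2) : Prop :=
  ∀ E : Set R2, MeasurableSet E →
    MeasureTheory.volume (⋃ x ∈ E, {p : R2 | SubgradAt w x p}) =
      MeasureTheory.volume (E ∩ Ω)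

/-- Membership of the pair `(u, v)` in the normalized family `S(δ̄)`, together with the
associated data: the domains `Ω₁, Ω₂`, and, for each height `h ∈ (0,1]`, the ellipse
`E_h = ellipse (e h) (f h) (L h) (l h)` centred at `0` (long half-axis `L h` in unit
direction `e h`, short half-axis `l h` in the orthogonal unit direction `f h`, area `hπ`,
so `L h * l h = h`), whose perpendicular ellipse is
`E_h^⊥ = ellipse (f h) (e h) (L h) (l h)`.  The eccentricity is `η_u(h) = L h / l h`. -/
def InSFamily (δb : ℝ) (u v : R2 → ℝ) (Ω₁ Ω₂ : Set R2)
    (L l : ℝ → ℝ) (e f : ℝ → R2) : Prop :=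
  ConvexOn ℝ Set.univ u ∧ ConvexOn ℝ Set.univ v ∧
  Convex ℝ Ω₁ ∧ Convex ℝ Ω₂ ∧
  (interior Ω₁).Nonempty ∧ (interior Ω₂).Nonempty ∧
  (0 : R2) ∈ frontier Ω₁ ∧ (0 : R2) ∈ frontier Ω₂ ∧
  (fun x => gradient u x) '' Ω₁ = Ω₂ ∧ (fun y => gradient v y) '' Ω₂ = Ω₁ ∧
  AlexandrovSol u Ω₁ ∧ u 0 = 0 ∧ SubgradAt u 0 0 ∧
  AlexandrovSol v Ω₂ ∧ v 0 = 0 ∧ SubgradAt v 0 0 ∧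
  (∀ y ∈ Ω₂, v y = ⨆ x : R2, (⟪x, y⟫ - u x)) ∧
  L 1 = 1 ∧ l 1 = 1 ∧
  (∀ h : ℝ, h ∈ Set.Ioc (0 : ℝ) 1 →
    ‖e h‖ = 1 ∧ ‖f h‖ = 1 ∧ ⟪e h, f h⟫ = 0 ∧
    0 < l h ∧ l h ≤ L h ∧ L h * l h = h ∧
    (∃ S : Set R2, IsCentredSection u 0 h S ∧
      (∃ xh : R2, (fun z => xh + δb • z) '' ellipse (e h) (f h) (L h) (l h) ⊆ Ω₁ ∩ S) ∧
      S ⊆ (fun z => δb⁻¹ • z) '' ellipse (e h) (f h) (L h) (l h)) ∧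
    (∃ S : Set R2, IsCentredSection v 0 h S ∧
      (∃ yh : R2, (fun z => yh + δb • z) '' ellipse (f h) (e h) (L h) (l h) ⊆ Ω₂ ∩ S) ∧
      S ⊆ (fun z => δb⁻¹ • z) '' ellipse (f h) (e h) (L h) (l h)))

/-- `z ↦ t • x` cone over `Ω` with vertex `0` (closed): the tangent cone of `Ω` at `0`. -/
def tangentConeZero (Ω : Set R2) : Set R2 :=
  closure {y : R2 | ∃ t : ℝ, 0 ≤ t ∧ ∃ x ∈ Ω, y = t • x}

/-- The planar cross product (determinant) of two vectors. -/
def det2 (a b : R2) : ℝ := a 0 * b 1 - a 1 * b 0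

/-- `r` is the unit direction of the right tangent ray of `∂Ω` at `0`:
it lies in the tangent cone of `Ω` at `0` and the whole tangent cone lies
(weakly) counterclockwise from it. -/
def IsRightTangent (Ω : Set R2) (r : R2) : Prop :=
  ‖r‖ = 1 ∧ r ∈ tangentConeZero Ω ∧ ∀ x ∈ tangentConeZero Ω, 0 ≤ det2 r x

/-- `l` is the unit direction of the left tangent ray of `∂Ω` at `0`:
it lies in the tangent cone of `Ω` at `0` and the whole tangent cone lies
(weakly) clockwise from it. -/
def IsLeftTangent (Ω : Set R2) (l : R2) : Prop :=
  ‖l‖ = 1 ∧ l ∈ tangentConeZero Ω ∧ ∀ x ∈ tangentConeZero Ω, det2 l x ≤ 0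

/-- The open cone of direction `e` and opening angle `θ`. -/
def cone2 (e : R2) (θ : ℝ) : Set R2 :=
  {y : R2 | ∃ lam : ℝ, 0 < lam ∧ ∃ w : R2, ‖w‖ = 1 ∧
    InnerProductGeometry.angle w e < θ ∧ y = lam • w}

theorem exists_subgradAt {u : R2 → ℝ} (hu : ConvexOn ℝ univ u) (x : R2) :
    ∃ p, SubgradAt u x p := by
  have hc : Continuous u := hu.locallyLipschitz.continuous
  have hconv : Convex ℝ {z : R2 × ℝ | u z.1 < z.2} := by
    have := hu.convex_strict_epigraph
    simpa using this
  have hopen : IsOpen {z : R2 × ℝ | u z.1 < z.2} :=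
    isOpen_lt (hc.comp continuous_fst) continuous_snd
  obtain ⟨F, hF⟩ := geometric_hahn_banach_open_point hconv hopen (x := (x, u x)) (by simp)
  set β := F (0, 1) with hβ
  have hsplit : ∀ (z : R2) (t : ℝ), F (z, t) = F (z, 0) + t * β := by
    intro z t
    have : (z, t) = (z, (0 : ℝ)) + t • ((0 : R2), (1 : ℝ)) := by simp
    rw [this, map_add, map_smul, smul_eq_mul]
  have hneg : β < 0 := by
    have := hF (x, u x + 1) (by simp)
    rw [hsplit x (u x + 1), hsplit x (u x)] at this
    linarith
  let G : R2 →L[ℝ] ℝ := F.comp (ContinuousLinearMap.inl ℝ R2 ℝ)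
  have hG : ∀ z, G z = F (z, 0) := fun z => rfl
  let p := (InnerProductSpace.toDual ℝ R2).symm ((-β)⁻¹ • G)
  have hp : ∀ z, ⟪p, z⟫ = (-β)⁻¹ * F (z, 0) := by
    intro z
    rw [← hG, InnerProductSpace.toDual_symm_apply]; rfl
  refine ⟨p, fun y => ?_⟩
  rw [hp]
  have hsub : F (y - x, 0) = F (y, 0) - F (x, 0) := by
    rw [← hG, ← hG, ← hG, map_sub]
  rw [hsub]
  refine le_of_forall_pos_lt_add fun ε hε => ?_
  have := hF (y, u y + ε) (by simpa using hε)
  rw [hsplit y, hsplit x] at this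
  have h2 : F (y, 0) - F (x, 0) < (-β) * (u y + ε - u x) := by nlinarith
  have h3 : (-β)⁻¹ * (F (y, 0) - F (x, 0)) < u y + ε - u x := by
    rw [inv_mul_lt_iff₀ (by linarith)]; exact h2
  linarith

theorem subgradAt_of_eventually {u : R2 → ℝ} (hu : ConvexOn ℝ univ u) {x p : R2}
    (h : ∀ᶠ y in nhds x, u x + ⟪p, y - x⟫ ≤ u y) : SubgradAt u x p := by
  intro y
  have ht : Filter.Tendsto (fun t : ℝ => x + t • (y - x)) (nhds 0) (nhds x) := by
    have : Continuous (fun t : ℝ => x + t • (y - x)) := by fun_prop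
    simpa using this.tendsto 0
  have h1 : ∀ᶠ t : ℝ in nhdsWithin 0 (Ioi 0), u x + ⟪p, (x + t • (y - x)) - x⟫ ≤
      u (x + t • (y - x)) := (ht.eventually h).filter_mono nhdsWithin_le_nhds
  have h2 : ∀ᶠ t : ℝ in nhdsWithin 0 (Ioi 0), t < 1 :=
    nhdsWithin_le_nhds (Iio_mem_nhds one_pos)
  obtain ⟨t, ⟨h3, h4⟩, h5⟩ := ((h1.and h2).and self_mem_nhdsWithin).exists
  have h5 : 0 < t := h5
  have h6 := hu.2 (mem_univ x) (mem_univ y) (by linarith : 0 ≤ 1 - t) h5.le (by ring)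
  have h7 : (1 - t) • x + t • y = x + t • (y - x) := by
    rw [sub_smul, smul_sub, one_smul]; abel
  rw [h7] at h6
  simp only [add_sub_cancel_left, inner_smul_right, smul_eq_mul] at h3 h6
  nlinarith

theorem subgradAt_gradient {u : R2 → ℝ} {x : R2}
    (hd : DifferentiableAt ℝ u x) {p : R2} (hp : SubgradAt u x p) : gradient u x = p := by
  have hg := hd.hasGradientAt
  have hmin : IsLocalMin (fun y => u y - ⟪p, y⟫) x := by
    refine Filter.Eventually.of_forall fun y => ?_
    have := hp y
    rw [inner_sub_right] at this
    show u x - _ ≤ u y - _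
    linarith
  have h1 : HasFDerivAt (fun y => u y - ⟪p, y⟫)
      ((InnerProductSpace.toDual ℝ R2) (gradient u x) - (InnerProductSpace.toDual ℝ R2) p) x :=
    hg.hasFDerivAt.sub ((InnerProductSpace.toDual ℝ R2) p).hasFDerivAt
  have h2 := hmin.hasFDerivAt_eq_zero h1
  exact (InnerProductSpace.toDual ℝ R2).injective (sub_eq_zero.mp h2)

theorem ConvexOn.ae_differentiableAt_R2 {u : R2 → ℝ} (hu : ConvexOn ℝ univ u) :
    ∀ᵐ x, DifferentiableAt ℝ u x := by
  have hl := hu.locallyLipschitz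
  have hx : ∀ x : R2, ∃ t : Set R2, t ∈ nhds x ∧ ∀ᵐ y, y ∈ t → DifferentiableAt ℝ u y := by
    intro x
    obtain ⟨K, t, ht, hK⟩ := hl x
    refine ⟨interior t, isOpen_interior.mem_nhds (mem_interior_iff_mem_nhds.2 ht), ?_⟩
    filter_upwards [(hK.mono interior_subset).ae_differentiableWithinAt_of_mem (μ := volume)] with y hy hyt
    exact (hy hyt).differentiableAt (isOpen_interior.mem_nhds hyt)
  choose t ht htd using hx
  obtain ⟨s, hs, hcov⟩ := TopologicalSpace.countable_cover_nhds ht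
  have : ∀ᵐ y, ∀ x ∈ s, y ∈ t x → DifferentiableAt ℝ u y :=
    (ae_ball_iff hs).2 fun x _ => htd x
  filter_upwards [this] with y hy
  have hyu : y ∈ ⋃ x ∈ s, t x := by rw [hcov]; trivial
  simp only [mem_iUnion] at hyu
  obtain ⟨x, hxs, hyt⟩ := hyu
  exact hy x hxs hyt

theorem exists_subgradAt_of_mem_image {u : R2 → ℝ} (hu : ConvexOn ℝ univ u)
    (h0 : SubgradAt u 0 0) {Ω Ω' : Set R2} (him : (fun x => gradient u x) '' Ω = Ω') {y : R2}
    (hy : y ∈ Ω') : ∃ x, (x ∈ Ω ∨ x = 0) ∧ SubgradAt u x y := by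
  rw [← him] at hy
  obtain ⟨x, hx, rfl⟩ := hy
  by_cases hd : DifferentiableAt ℝ u x
  · obtain ⟨p, hp⟩ := exists_subgradAt hu x
    exact ⟨x, Or.inl hx, by simpa [subgradAt_gradient hd hp] using hp⟩
  · refine ⟨0, Or.inr rfl, ?_⟩
    simpa [gradient_eq_zero_of_not_differentiableAt hd] using h0

/-- Off a null set, all subgradients lie in the target domain. -/
theorem volume_subgrad_diff_eq_zero {u : R2 → ℝ} (hu : ConvexOn ℝ univ u) {Ω Ω' : Set R2}
    (hΩ : Convex ℝ Ω) (him : (fun x => gradient u x) '' Ω = Ω') (hm : AlexandrovSol u Ω) :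
    volume ({p | ∃ x, SubgradAt u x p} \ Ω') = 0 := by
  set N := {x : R2 | ¬ DifferentiableAt ℝ u x} with hN
  have hNm : MeasurableSet N := (measurableSet_of_differentiableAt ℝ u).compl
  have hN0 : volume N = 0 := hu.ae_differentiableAt_R2
  set E := N ∪ (interior Ω)ᶜ with hE
  have hEm : MeasurableSet E := hNm.union isOpen_interior.measurableSet.compl
  have h1 := hm E hEm
  have h2 : volume (E ∩ Ω) = 0 := by
    refine measure_mono_null (t := N ∪ frontier Ω) ?_
      (measure_union_null hN0 (hΩ.addHaar_frontier volume))
    rintro x ⟨hx | hx, hxΩ⟩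
    · exact Or.inl hx
    · exact Or.inr ⟨subset_closure hxΩ, hx⟩
  rw [h2] at h1
  refine measure_mono_null ?_ h1
  rintro p ⟨⟨x, hx⟩, hp⟩
  simp only [mem_iUnion, mem_ofPred_eq]
  refine ⟨x, ?_, hx⟩
  by_contra hxE
  simp only [hE, hN, mem_union, mem_ofPred_eq, mem_compl_iff, not_or, not_not] at hxE
  apply hp
  rw [← him]
  exact ⟨x, interior_subset hxE.2, subgradAt_gradient hxE.1 hx⟩

/-- All subgradients lie in the closure of the target domain. -/
theorem subgrad_mem_closure {u : R2 → ℝ} (hu : ConvexOn ℝ univ u) {Ω' : Set R2}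
    (hi : (interior Ω').Nonempty)
    (hnull : volume ({p | ∃ x, SubgradAt u x p} \ Ω') = 0)
    {V : R2 → ℝ} (hV : Continuous V) (hF : ∀ y ∈ Ω', ∀ x, ⟪y, x⟫ ≤ u x + V y)
    {x p : R2} (hp : SubgradAt u x p) : p ∈ closure Ω' := by
  by_contra hpc
  obtain ⟨b, hb⟩ := hi
  obtain ⟨r, hr, hbr⟩ := Metric.nhds_basis_closedBall.mem_iff.1 (mem_interior_iff_mem_nhds.1 hb)
  obtain ⟨M, hM⟩ := (isCompact_closedBall b r).bddAbove_image hV.continuousOn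
  have hM' : ∀ y ∈ closedBall b r, V y ≤ M := fun y hy => hM (mem_image_of_mem V hy)
  have hlow : ∀ z, ⟪b, z⟫ + r * ‖z‖ - M ≤ u z := by
    intro z
    rcases eq_or_ne z 0 with rfl | hz
    · have := hF b (hbr (by simp [hr.le])) 0
      have h2 := hM' b (by simp [hr.le])
      simp at this ⊢; linarith
    · have hn : 0 < ‖z‖ := norm_pos_iff.2 hz
      set y := b + (r / ‖z‖) • z with hy
      have hyb : y ∈ closedBall b r := by
        simp [hy, mem_closedBall, dist_eq_norm, norm_smul, abs_of_pos hr, hn.ne']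
      have h1 := hF y (hbr hyb) z
      have h2 := hM' y hyb
      have h3 : ⟪y, z⟫ = ⟪b, z⟫ + r * ‖z‖ := by
        rw [hy, inner_add_left, inner_smul_left, real_inner_self_eq_norm_sq]
        simp; field_simp
      linarith
  have hopen : (closure Ω')ᶜ ∈ nhds p := isClosed_closure.isOpen_compl.mem_nhds hpc
  obtain ⟨ρ, hρ, hpρ⟩ := Metric.mem_nhds_iff.1 hopen
  set D := ‖b - p‖ + r with hD
  have hDpos : 0 < D := by positivity
  set t := min (1/2) (ρ / (2 * D)) with ht
  have htpos : 0 < t := by positivity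
  have ht1 : t ≤ 1/2 := min_le_left _ _
  have htD : t * D < ρ := by
    have : t ≤ ρ / (2 * D) := min_le_right _ _
    calc t * D ≤ ρ / (2 * D) * D := by gcongr
      _ = ρ / 2 := by field_simp
      _ < ρ := by linarith
  set c := p + t • (b - p) with hcdef
  have hsub : ball c (t * r / 2) ⊆ {p | ∃ x, SubgradAt u x p} \ Ω' := by
    intro q hq
    rw [mem_ball, dist_eq_norm] at hq
    refine ⟨?_, fun hqΩ => ?_⟩
    · have hu' : ∀ z, ⟪p, z⟫ - (⟪p, x⟫ - u x) ≤ u z := by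
        intro z; have := hp z; rw [inner_sub_right] at this; linarith
      set C := (1 - t) * (⟪p, x⟫ - u x) + t * M with hC
      have hco : ∀ z, t * r / 2 * ‖z‖ - C ≤ u z - ⟪q, z⟫ := by
        intro z
        have h1 := hu' z
        have h2 := hlow z
        have h3 : ⟪q, z⟫ = ⟪c, z⟫ + ⟪q - c, z⟫ := by rw [inner_sub_left]; ring
        have h4 : ⟪q - c, z⟫ ≤ t * r / 2 * ‖z‖ :=
          (real_inner_le_norm _ _).trans (by gcongr)
        have h5 : ⟪c, z⟫ = (1 - t) * ⟪p, z⟫ + t * ⟪b, z⟫ := by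
          rw [hcdef, inner_add_left, inner_smul_left, inner_sub_left]; simp; ring
        have h6 : (1 - t) * (⟪p, z⟫ - (⟪p, x⟫ - u x)) ≤ (1 - t) * u z :=
          mul_le_mul_of_nonneg_left h1 (by linarith)
        have h7 : t * (⟪b, z⟫ + r * ‖z‖ - M) ≤ t * u z :=
          mul_le_mul_of_nonneg_left h2 htpos.le
        rw [h3, h5, hC]; nlinarith
      have hcont : Continuous fun z => u z - ⟪q, z⟫ := by
        have := hu.locallyLipschitz.continuous
        fun_prop
      have htend : Filter.Tendsto (fun z => u z - ⟪q, z⟫) (Filter.cocompact R2) Filter.atTop := by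
        refine Filter.tendsto_atTop_mono hco ?_
        refine Filter.tendsto_atTop_add_const_right _ _ ?_
        exact (tendsto_norm_cocompact_atTop).const_mul_atTop (by positivity)
      obtain ⟨z0, hz0⟩ := hcont.exists_forall_le htend
      refine ⟨z0, fun z => ?_⟩
      have := hz0 z
      rw [inner_sub_right]; linarith
    · have hqρ : q ∈ ball p ρ := by
        rw [mem_ball, dist_eq_norm]
        have h1 : q - p = (q - c) + t • (b - p) := by rw [hcdef]; abel
        rw [h1]
        calc _ ≤ ‖q - c‖ + ‖t • (b - p)‖ := norm_add_le _ _
          _ ≤ t * r / 2 + t * ‖b - p‖ := by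
            rw [norm_smul, Real.norm_of_nonneg htpos.le]; linarith
          _ ≤ t * D := by rw [hD]; nlinarith
          _ < ρ := htD
      exact hpρ hqρ (subset_closure hqΩ)
  have hpos : 0 < volume (ball c (t * r / 2)) := measure_ball_pos _ _ (by positivity)
  exact absurd (measure_mono_null hsub hnull) hpos.ne'

/-- Duality facts for a pair of transport potentials between the open convex sets `A` and `B`. -/
structure DualPair (u v : R2 → ℝ) (A B : Set R2) : Prop where
  cu : ConvexOn ℝ univ u
  cv : ConvexOn ℝ univ v
  oA : IsOpen A
  oB : IsOpen B
  cA : Convex ℝ A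
  cB : Convex ℝ B
  zA : (0 : R2) ∈ closure A
  zB : (0 : R2) ∈ closure B
  nA : (0 : R2) ∉ A
  nB : (0 : R2) ∉ B
  u0 : u 0 = 0
  v0 : v 0 = 0
  un : ∀ x, 0 ≤ u x
  vn : ∀ y, 0 ≤ v y
  subB : ∀ x y, SubgradAt u x y → y ∈ closure B
  subA : ∀ x y, SubgradAt v y x → x ∈ closure A
  dualA : ∀ x y, x ∈ A → (SubgradAt u x y ↔ SubgradAt v y x)
  dualB : ∀ x y, y ∈ B → (SubgradAt u x y ↔ SubgradAt v y x)
  eqA : ∀ x y, x ∈ A → SubgradAt u x y → u x + v y = ⟪y, x⟫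
  eqB : ∀ x y, y ∈ B → SubgradAt u x y → u x + v y = ⟪y, x⟫
  massu : ∀ E, MeasurableSet E → volume {y | ∃ x ∈ E, SubgradAt u x y} = volume (E ∩ A)
  massv : ∀ E, MeasurableSet E → volume {x | ∃ y ∈ E, SubgradAt v y x} = volume (E ∩ B)

theorem AlexandrovSol.mass_interior {u : R2 → ℝ} {Ω : Set R2} (hm : AlexandrovSol u Ω)
    (hΩ : Convex ℝ Ω) (E : Set R2) (hE : MeasurableSet E) :
    volume {y | ∃ x ∈ E, SubgradAt u x y} = volume (E ∩ interior Ω) := by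
  have h1 := hm E hE
  have h2 : (⋃ x ∈ E, {p : R2 | SubgradAt u x p}) = {y | ∃ x ∈ E, SubgradAt u x y} := by
    ext y; simp
  rw [← h2, h1]
  apply measure_congr
  have : (interior Ω : Set R2) =ᵐ[volume] Ω :=
    interior_ae_eq_of_null_frontier (hΩ.addHaar_frontier volume)
  exact (Filter.EventuallyEq.refl _ E).inter this.symm

theorem DualPair.of_inSFamily {δb : ℝ} {u v : R2 → ℝ} {Ω₁ Ω₂ : Set R2} {L l : ℝ → ℝ}
    {e f : ℝ → R2} (h : InSFamily δb u v Ω₁ Ω₂ L l e f) :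
    DualPair u v (interior Ω₁) (interior Ω₂) := by
  obtain ⟨cu, cv, c1, c2, i1, i2, z1, z2, im1, im2, mu, u0, su, mv, v0, sv, hleg, -⟩ := h
  have hvc : Continuous v := cv.locallyLipschitz.continuous
  have huc : Continuous u := cu.locallyLipschitz.continuous
  have cl1 : closure (interior Ω₁) = closure Ω₁ := c1.closure_interior_eq_closure_of_nonempty_interior i1
  have cl2 : closure (interior Ω₂) = closure Ω₂ := c2.closure_interior_eq_closure_of_nonempty_interior i2
  -- `v` is the Legendre transform on `Ω₂`
  have hgr : ∀ y ∈ Ω₂, ∃ x0, SubgradAt u x0 y ∧ (∀ x, ⟪y, x⟫ ≤ u x + v y) ∧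
      u x0 + v y = ⟪y, x0⟫ := by
    intro y hy
    obtain ⟨x0, -, hx0⟩ := exists_subgradAt_of_mem_image cu su im1 hy
    have hb : ∀ x, ⟪x, y⟫ - u x ≤ ⟪x0, y⟫ - u x0 := by
      intro x
      have := hx0 x
      rw [inner_sub_right, real_inner_comm, real_inner_comm x0 y] at this
      linarith
    have hv : v y = ⟪x0, y⟫ - u x0 := by
      rw [hleg y hy]
      exact le_antisymm (ciSup_le hb) (le_ciSup (f := fun x => ⟪x, y⟫ - u x) ⟨_, by rintro _ ⟨x, rfl⟩; exact hb x⟩ x0)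
    refine ⟨x0, hx0, fun x => ?_, ?_⟩
    · have := hb x; rw [real_inner_comm]; linarith
    · rw [hv, real_inner_comm]; ring
  have fenB : ∀ y ∈ Ω₂, ∀ x, ⟪y, x⟫ ≤ u x + v y := fun y hy => by
    obtain ⟨_, _, h, _⟩ := hgr y hy; exact h
  have subB : ∀ x y, SubgradAt u x y → y ∈ closure Ω₂ := fun x y hxy =>
    subgrad_mem_closure cu i2 (volume_subgrad_diff_eq_zero cu c1 im1 mu) hvc fenB hxy
  have fenBc : ∀ y ∈ closure Ω₂, ∀ x, ⟪y, x⟫ ≤ u x + v y := by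
    intro y hy x
    have hcl : IsClosed {y | ⟪y, x⟫ ≤ u x + v y} :=
      isClosed_le (by fun_prop) (by fun_prop)
    exact hcl.closure_subset_iff.2 (fun y hy => fenB y hy x) hy
  -- upper bound of `v` at subgradients
  have hvle : ∀ x y, SubgradAt u x y → v y ≤ ⟪y, x⟫ - u x := by
    intro x y hxy
    obtain ⟨b, hb⟩ := i2
    have hyc := subB x y hxy
    have hseg : ∀ t : ℝ, t ∈ Ioo (0 : ℝ) 1 → v (y + t • (b - y)) ≤
        (1 - t) * (⟪y, x⟫ - u x) + t * v b := by
      intro t ht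
      have hmem : y + t • (b - y) ∈ Ω₂ := by
        have := c2.combo_closure_interior_mem_interior hyc hb (a := 1 - t) (b := t)
          (by linarith [ht.2]) ht.1 (by ring)
        have h7 : (1 - t) • y + t • b = y + t • (b - y) := by
          rw [sub_smul, smul_sub, one_smul]; abel
        rw [h7] at this
        exact interior_subset this
      obtain ⟨xt, -, -, hxt⟩ := hgr _ hmem
      have h1 := hxy xt
      have h2 := fenB b (interior_subset hb) xt
      have h3 : ⟪y + t • (b - y), xt⟫ = (1 - t) * ⟪y, xt⟫ + t * ⟪b, xt⟫ := by
        rw [inner_add_left, inner_smul_left, inner_sub_left]; simp; ring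
      rw [inner_sub_right] at h1
      rw [h3] at hxt
      nlinarith [ht.1, ht.2]
    have t1 : Filter.Tendsto (fun t : ℝ => v (y + t • (b - y))) (nhdsWithin 0 (Ioi 0)) (nhds (v y)) := by
      have : Continuous (fun t : ℝ => v (y + t • (b - y))) := by fun_prop
      have := this.tendsto 0
      simp only [zero_smul, add_zero] at this
      exact this.mono_left nhdsWithin_le_nhds
    have t2 : Filter.Tendsto (fun t : ℝ => (1 - t) * (⟪y, x⟫ - u x) + t * v b)
        (nhdsWithin 0 (Ioi 0)) (nhds (⟪y, x⟫ - u x)) := by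
      have : Continuous (fun t : ℝ => (1 - t) * (⟪y, x⟫ - u x) + t * v b) := by fun_prop
      have := this.tendsto 0
      simp only [sub_zero, one_mul, zero_mul, add_zero] at this
      exact this.mono_left nhdsWithin_le_nhds
    refine le_of_tendsto_of_tendsto t1 t2 ?_
    filter_upwards [Ioo_mem_nhdsGT (zero_lt_one)] with t ht using hseg t ht
  -- attained dual value on `Ω₁`
  have hgr' : ∀ x ∈ Ω₁, ∃ y0, SubgradAt v y0 x ∧ u x + v y0 = ⟪y0, x⟫ := by
    intro x hx
    obtain ⟨y0, hy0, hs⟩ := exists_subgradAt_of_mem_image cv sv im2 hx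
    have hy0c : y0 ∈ closure Ω₂ := by
      rcases hy0 with h | rfl
      · exact subset_closure h
      · exact frontier_subset_closure z2
    refine ⟨y0, hs, le_antisymm ?_ (fenBc y0 hy0c x)⟩
    obtain ⟨y', hy'⟩ := exists_subgradAt cu x
    have h1 := hvle x y' hy'
    have h2 := hs y'
    rw [inner_sub_right, real_inner_comm, real_inner_comm y0 x] at h2
    linarith
  have fenA : ∀ x ∈ Ω₁, ∀ z, ⟪z, x⟫ ≤ u x + v z := by
    intro x hx z
    obtain ⟨y0, hs, he⟩ := hgr' x hx
    have := hs z
    rw [inner_sub_right, real_inner_comm, real_inner_comm y0 x] at this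
    linarith
  have subA : ∀ x y, SubgradAt v y x → x ∈ closure Ω₁ := fun x y hxy =>
    subgrad_mem_closure cv i1 (volume_subgrad_diff_eq_zero cv c2 im2 mv) huc
      (fun x hx y => by rw [real_inner_comm]; linarith [fenA x hx y]) hxy
  have un : ∀ x, 0 ≤ u x := fun x => by have := su x; simpa [u0] using this
  have vn : ∀ x, 0 ≤ v x := fun x => by have := sv x; simpa [v0] using this
  have eqA : ∀ x y, x ∈ Ω₁ → SubgradAt u x y → u x + v y = ⟪y, x⟫ := fun x y hx hs =>
    le_antisymm (by linarith [hvle x y hs]) (fenA x hx y)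
  have eqB : ∀ x y, y ∈ closure Ω₂ → SubgradAt u x y → u x + v y = ⟪y, x⟫ := fun x y hy hs =>
    le_antisymm (by linarith [hvle x y hs]) (fenBc y hy x)
  refine ⟨cu, cv, isOpen_interior, isOpen_interior, c1.interior, c2.interior,
    cl1 ▸ frontier_subset_closure z1, cl2 ▸ frontier_subset_closure z2, z1.2, z2.2, u0, v0, un, vn,
    fun x y h => cl2 ▸ subB x y h, fun x y h => cl1 ▸ subA x y h, ?_, ?_,
    fun x y hx hs => eqA x y (interior_subset hx) hs,
    fun x y hy hs => eqB x y (subset_closure (interior_subset hy)) hs,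
    fun E hE => mu.mass_interior c1 E hE, fun E hE => mv.mass_interior c2 E hE⟩
  · intro x y hx
    have hx' := interior_subset hx
    constructor
    · intro hs z
      have h1 := eqA x y hx' hs
      have h2 := fenA x hx' z
      rw [inner_sub_right, real_inner_comm, real_inner_comm y x]
      linarith
    · intro hs
      obtain ⟨y0, hs0, he⟩ := hgr' x hx'
      have h1 := hs y0
      rw [inner_sub_right, real_inner_comm, real_inner_comm y x] at h1
      refine subgradAt_of_eventually cu ?_
      filter_upwards [isOpen_interior.mem_nhds hx] with x' hx''
      have h2 := fenA x' (interior_subset hx'') y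
      rw [inner_sub_right]
      linarith
  · intro x y hy
    have hy' := interior_subset hy
    constructor
    · intro hs
      have h1 := eqB x y (subset_closure hy') hs
      refine subgradAt_of_eventually cv ?_
      filter_upwards [isOpen_interior.mem_nhds hy] with y' hy''
      have h2 := fenB y' (interior_subset hy'') x
      rw [inner_sub_right, real_inner_comm, real_inner_comm y x]
      linarith
    · intro hs
      obtain ⟨y', hy''⟩ := exists_subgradAt cu x
      have h1 := hvle x y' hy''
      have h2 := hs y'
      rw [inner_sub_right, real_inner_comm, real_inner_comm y x] at h2
      intro z
      have h3 := fenB y hy' z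
      rw [inner_sub_right]
      linarith

/-- Subgradients in coordinates: `(p, q)` is a subgradient of `u` at `(a, b)`. -/
def Sb (u : ℝ → ℝ → ℝ) (a b p q : ℝ) : Prop :=
  ∀ s t, u a b + p * (s - a) + q * (t - b) ≤ u s t

/-- Convexity of a function of two real variables. -/
def Cvx (u : ℝ → ℝ → ℝ) : Prop :=
  ∀ a b c d t, 0 ≤ t → t ≤ 1 →
    u ((1 - t) * a + t * c) ((1 - t) * b + t * d) ≤ (1 - t) * u a b + t * u c d

/-- Duality facts for a pair of transport potentials, in coordinates. -/
structure Core (u v : ℝ → ℝ → ℝ) (A B : Set (ℝ × ℝ)) : Prop where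
  cu : Cvx u
  cv : Cvx v
  uc : Continuous fun z : ℝ × ℝ => u z.1 z.2
  vc : Continuous fun z : ℝ × ℝ => v z.1 z.2
  us : ∀ a b, ∃ p q, Sb u a b p q
  vs : ∀ a b, ∃ p q, Sb v a b p q
  oA : IsOpen A
  oB : IsOpen B
  cA : Convex ℝ A
  cB : Convex ℝ B
  zA : (0, 0) ∈ closure A
  zB : (0, 0) ∈ closure B
  nA : (0, 0) ∉ A
  nB : (0, 0) ∉ B
  u0 : u 0 0 = 0
  v0 : v 0 0 = 0
  un : ∀ a b, 0 ≤ u a b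
  vn : ∀ a b, 0 ≤ v a b
  subB : ∀ a b p q, Sb u a b p q → (p, q) ∈ closure B
  subA : ∀ a b p q, Sb v p q a b → (a, b) ∈ closure A
  dualA : ∀ a b p q, (a, b) ∈ A → (Sb u a b p q ↔ Sb v p q a b)
  dualB : ∀ a b p q, (p, q) ∈ B → (Sb u a b p q ↔ Sb v p q a b)
  eqA : ∀ a b p q, (a, b) ∈ A → Sb u a b p q → u a b + v p q = a * p + b * q
  eqB : ∀ a b p q, (p, q) ∈ B → Sb u a b p q → u a b + v p q = a * p + b * q
  massu : ∀ E, MeasurableSet E →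
    volume {y : ℝ × ℝ | ∃ x ∈ E, Sb u x.1 x.2 y.1 y.2} = volume (E ∩ A)
  massv : ∀ E, MeasurableSet E →
    volume {x : ℝ × ℝ | ∃ y ∈ E, Sb v y.1 y.2 x.1 x.2} = volume (E ∩ B)

/-- The frame `(a, b) ↦ a (c, s) + b (-s, c)` as a homeomorphism. -/
def frameMap (c s : ℝ) (h : c ^ 2 + s ^ 2 = 1) : ℝ × ℝ ≃ₜ R2 where
  toFun z := !₂[z.1 * c - z.2 * s, z.1 * s + z.2 * c]
  invFun x := (x 0 * c + x 1 * s, - x 0 * s + x 1 * c)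
  left_inv z := by
    ext
    · simp; linear_combination z.1 * h
    · simp; linear_combination z.2 * h
  right_inv x := by
    ext i; fin_cases i
    · simp; linear_combination x 0 * h
    · simp; linear_combination x 1 * h
  continuous_toFun := by fun_prop
  continuous_invFun := by fun_prop

/-- The linear map `(a, b) ↦ a z + b w` of the plane. -/
def planeMap (z w : ℝ × ℝ) : ℝ × ℝ →ₗ[ℝ] ℝ × ℝ where
  toFun x := (x.1 * z.1 + x.2 * w.1, x.1 * z.2 + x.2 * w.2)
  map_add' x y := by ext <;> simp <;> ring
  map_smul' r x := by ext <;> simp <;> ring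

theorem det_planeMap (z w : ℝ × ℝ) : LinearMap.det (planeMap z w) = z.1 * w.2 - z.2 * w.1 := by
  rw [← LinearMap.det_toMatrix (Module.Basis.finTwoProd ℝ), Matrix.det_fin_two]
  simp [LinearMap.toMatrix_apply, planeMap]
  ring

theorem volume_planeMap_image (z w : ℝ × ℝ) (E : Set (ℝ × ℝ)) :
    volume (planeMap z w '' E) = ENNReal.ofReal |z.1 * w.2 - z.2 * w.1| * volume E := by
  rw [Measure.addHaar_image_linearMap, det_planeMap]

theorem frameMap_measurePreserving (c s : ℝ) (h : c ^ 2 + s ^ 2 = 1) :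
    MeasurePreserving (frameMap c s h) := by
  have h1 : MeasurePreserving (planeMap (c, s) (-s, c)) := by
    refine ⟨(LinearMap.continuous_of_finiteDimensional _).measurable, ?_⟩
    rw [Measure.map_linearMap_addHaar_eq_smul_addHaar, det_planeMap]
    · have : c * c + s * s = 1 := by linear_combination h
      simp [this]
    · rw [det_planeMap]
      have : c * c + s * s = 1 := by linear_combination h
      simp [this]
  have h2 := (EuclideanSpace.volume_preserving_symm_measurableEquiv_toLp (Fin 2)).symm
  have h3 := (volume_preserving_finTwoArrow ℝ).symm
  have h4 := (h2.comp h3).comp h1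
  convert h4 using 1
  ext z i
  fin_cases i <;> simp [frameMap, planeMap, MeasurableEquiv.finTwoArrow] <;> ring

theorem frameMap_inner (c s : ℝ) (h : c ^ 2 + s ^ 2 = 1) (z w : ℝ × ℝ) :
    ⟪frameMap c s h z, frameMap c s h w⟫ = z.1 * w.1 + z.2 * w.2 := by
  simp [frameMap, PiLp.inner_apply, Fin.sum_univ_two]
  linear_combination (z.1 * w.1 + z.2 * w.2) * h

theorem frameMap_combo (c s : ℝ) (h : c ^ 2 + s ^ 2 = 1) (z w : ℝ × ℝ) (r t : ℝ) :
    frameMap c s h (r * z.1 + t * w.1, r * z.2 + t * w.2) =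
      r • frameMap c s h z + t • frameMap c s h w := by
  ext i; fin_cases i <;> simp [frameMap] <;> ring

theorem subgradAt_frameMap (c s : ℝ) (h : c ^ 2 + s ^ 2 = 1) (u : R2 → ℝ) (a b p q : ℝ) :
    Sb (fun a b => u (frameMap c s h (a, b))) a b p q ↔
      SubgradAt u (frameMap c s h (a, b)) (frameMap c s h (p, q)) := by
  have key : ∀ z : ℝ × ℝ, ⟪frameMap c s h (p, q), frameMap c s h z - frameMap c s h (a, b)⟫ =
      p * (z.1 - a) + q * (z.2 - b) := by
    intro z
    rw [inner_sub_right, frameMap_inner, frameMap_inner]; ring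
  constructor
  · intro hs y
    obtain ⟨z, rfl⟩ := (frameMap c s h).surjective y
    have := hs z.1 z.2
    rw [key]; simp only at this; linarith
  · intro hs x y
    have := hs (frameMap c s h (x, y))
    rw [key] at this; simp only at this ⊢; linarith

theorem DualPair.mass_frame {u : R2 → ℝ} {A : Set R2} (c s : ℝ) (h : c ^ 2 + s ^ 2 = 1)
    (hm : ∀ E, MeasurableSet E → volume {y | ∃ x ∈ E, SubgradAt u x y} = volume (E ∩ A))
    (E : Set (ℝ × ℝ)) (hE : MeasurableSet E) :
    volume {y : ℝ × ℝ | ∃ x ∈ E, Sb (fun a b => u (frameMap c s h (a, b))) x.1 x.2 y.1 y.2} =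
      volume (E ∩ frameMap c s h ⁻¹' A) := by
  have hp := frameMap_measurePreserving c s h
  have he := (frameMap c s h).measurableEmbedding
  have h1 := hm (frameMap c s h '' E) (he.measurableSet_image.2 hE)
  have h2 := hp.measure_preimage_emb he {y | ∃ x ∈ frameMap c s h '' E, SubgradAt u x y}
  have h3 := hp.measure_preimage_emb he (frameMap c s h '' E ∩ A)
  rw [← h3, ← h2] at h1
  convert h1 using 2
  · ext y
    simp [subgradAt_frameMap]
  · rw [preimage_inter, preimage_image_eq _ (frameMap c s h).injective]

theorem DualPair.cvx_frame {u : R2 → ℝ} (c s : ℝ) (h : c ^ 2 + s ^ 2 = 1)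
    (hu : ConvexOn ℝ univ u) : Cvx fun a b => u (frameMap c s h (a, b)) := by
  intro a b c' d t h0 h1
  have := hu.2 (mem_univ (frameMap c s h (a, b))) (mem_univ (frameMap c s h (c', d)))
    (by linarith : 0 ≤ 1 - t) h0 (by ring)
  rw [← frameMap_combo] at this
  simpa using this

theorem DualPair.core {u v : R2 → ℝ} {A B : Set R2} (hd : DualPair u v A B) (c s : ℝ)
    (h : c ^ 2 + s ^ 2 = 1) :
    Core (fun a b => u (frameMap c s h (a, b))) (fun a b => v (frameMap c s h (a, b)))
      (frameMap c s h ⁻¹' A) (frameMap c s h ⁻¹' B) := by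
  have hz : frameMap c s h (0, 0) = 0 := by ext i; fin_cases i <;> simp [frameMap]
  have cvx : ∀ {C : Set R2}, Convex ℝ C → Convex ℝ (frameMap c s h ⁻¹' C) := by
    intro C hC x hx y hy r t hr ht hrt
    have := hC hx hy hr ht hrt
    rw [← frameMap_combo] at this
    exact this
  have sb : ∀ {u : R2 → ℝ}, ConvexOn ℝ univ u → ∀ a b, ∃ p q,
      Sb (fun a b => u (frameMap c s h (a, b))) a b p q := by
    intro u hu a b
    obtain ⟨y, hy⟩ := exists_subgradAt hu (frameMap c s h (a, b))
    obtain ⟨z, rfl⟩ := (frameMap c s h).surjective y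
    exact ⟨z.1, z.2, (subgradAt_frameMap ..).2 hy⟩
  exact {
    cu := DualPair.cvx_frame c s h hd.cu
    cv := DualPair.cvx_frame c s h hd.cv
    uc := hd.cu.locallyLipschitz.continuous.comp (frameMap c s h).continuous
    vc := hd.cv.locallyLipschitz.continuous.comp (frameMap c s h).continuous
    us := sb hd.cu
    vs := sb hd.cv
    oA := hd.oA.preimage (frameMap c s h).continuous
    oB := hd.oB.preimage (frameMap c s h).continuous
    cA := cvx hd.cA
    cB := cvx hd.cB
    zA := by rw [← (frameMap c s h).preimage_closure, mem_preimage, hz]; exact hd.zA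
    zB := by rw [← (frameMap c s h).preimage_closure, mem_preimage, hz]; exact hd.zB
    nA := by rw [mem_preimage, hz]; exact hd.nA
    nB := by rw [mem_preimage, hz]; exact hd.nB
    u0 := by simp only [hz, hd.u0]
    v0 := by simp only [hz, hd.v0]
    un := fun _ _ => hd.un _
    vn := fun _ _ => hd.vn _
    subB := fun a b p q hs => by
      rw [← (frameMap c s h).preimage_closure, mem_preimage]
      exact hd.subB _ _ ((subgradAt_frameMap ..).1 hs)
    subA := fun a b p q hs => by
      rw [← (frameMap c s h).preimage_closure, mem_preimage]
      exact hd.subA _ _ ((subgradAt_frameMap ..).1 hs)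
    dualA := fun a b p q hm => by
      rw [subgradAt_frameMap, subgradAt_frameMap]; exact hd.dualA _ _ hm
    dualB := fun a b p q hm => by
      rw [subgradAt_frameMap, subgradAt_frameMap]; exact hd.dualB _ _ hm
    eqA := fun a b p q hm hs => by
      have := hd.eqA _ _ hm ((subgradAt_frameMap ..).1 hs)
      rw [frameMap_inner] at this; simp only at this ⊢; linarith
    eqB := fun a b p q hm hs => by
      have := hd.eqB _ _ hm ((subgradAt_frameMap ..).1 hs)
      rw [frameMap_inner] at this; simp only at this ⊢; linarith
    massu := DualPair.mass_frame c s h hd.massu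
    massv := DualPair.mass_frame c s h hd.massv }

theorem Core.swap {u v : ℝ → ℝ → ℝ} {A B : Set (ℝ × ℝ)} (h : Core u v A B) :
    Core (fun a b => v b a) (fun a b => u b a) (Prod.swap ⁻¹' B) (Prod.swap ⁻¹' A) := by
  have hs : ∀ {w : ℝ → ℝ → ℝ} {a b p q : ℝ}, Sb (fun a b => w b a) a b p q ↔ Sb w b a q p := by
    intro w a b p q
    constructor
    · intro hs s t; have := hs t s; simp only at this; linarith
    · intro hs s t; have := hs t s; simp only; linarith
  have hcl : ∀ C : Set (ℝ × ℝ), closure (Prod.swap ⁻¹' C) = Prod.swap ⁻¹' closure C :=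
    fun C => ((Homeomorph.prodComm ℝ ℝ).preimage_closure C).symm
  have hcv : ∀ {C : Set (ℝ × ℝ)}, Convex ℝ C → Convex ℝ (Prod.swap ⁻¹' C) :=
    fun hC x hx y hy r t hr ht hrt => hC hx hy hr ht hrt
  have hmp : MeasurePreserving (Prod.swap : ℝ × ℝ → ℝ × ℝ) := Measure.measurePreserving_swap
  have hme : MeasurableEmbedding (Prod.swap : ℝ × ℝ → ℝ × ℝ) := MeasurableEquiv.prodComm.measurableEmbedding
  have mass : ∀ {w : ℝ → ℝ → ℝ} {C : Set (ℝ × ℝ)}, (∀ E, MeasurableSet E →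
      volume {y : ℝ × ℝ | ∃ x ∈ E, Sb w x.1 x.2 y.1 y.2} = volume (E ∩ C)) → ∀ E, MeasurableSet E →
      volume {y : ℝ × ℝ | ∃ x ∈ E, Sb (fun a b => w b a) x.1 x.2 y.1 y.2} =
        volume (E ∩ Prod.swap ⁻¹' C) := by
    intro w C hm E hE
    have h1 := hm (Prod.swap ⁻¹' E) (measurable_swap hE)
    rw [← hmp.measure_preimage_emb hme, ← hmp.measure_preimage_emb hme (Prod.swap ⁻¹' E ∩ C)] at h1
    refine Eq.trans (congrArg volume ?_) h1
    ext y
    constructor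
    · rintro ⟨x, hx, h⟩
      exact ⟨x.swap, by simpa using hx, hs.1 h⟩
    · rintro ⟨x, hx, h⟩
      exact ⟨x.swap, by simpa using hx, hs.2 (by simpa using h)⟩
  exact {
    cu := fun a b c d t h0 h1 => h.cv b a d c t h0 h1
    cv := fun a b c d t h0 h1 => h.cu b a d c t h0 h1
    uc := h.vc.comp continuous_swap
    vc := h.uc.comp continuous_swap
    us := fun a b => by obtain ⟨p, q, hpq⟩ := h.vs b a; exact ⟨q, p, hs.2 hpq⟩
    vs := fun a b => by obtain ⟨p, q, hpq⟩ := h.us b a; exact ⟨q, p, hs.2 hpq⟩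
    oA := h.oB.preimage continuous_swap
    oB := h.oA.preimage continuous_swap
    cA := hcv h.cB
    cB := hcv h.cA
    zA := by rw [hcl]; exact h.zB
    zB := by rw [hcl]; exact h.zA
    nA := h.nB
    nB := h.nA
    u0 := h.v0
    v0 := h.u0
    un := fun a b => h.vn b a
    vn := fun a b => h.un b a
    subB := fun a b p q hh => by rw [hcl]; exact h.subA _ _ _ _ (hs.1 hh)
    subA := fun a b p q hh => by rw [hcl]; exact h.subB _ _ _ _ (hs.1 hh)
    dualA := fun a b p q hm => hs.trans ((h.dualB _ _ _ _ hm).symm.trans hs.symm)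
    dualB := fun a b p q hm => hs.trans ((h.dualA _ _ _ _ hm).symm.trans hs.symm)
    eqA := fun a b p q hm hh => by
      have h1 := hs.1 hh
      have := h.eqB _ _ _ _ hm ((h.dualB _ _ _ _ hm).2 h1)
      linarith
    eqB := fun a b p q hm hh => by
      have h1 := hs.1 hh
      have := h.eqA _ _ _ _ hm ((h.dualA _ _ _ _ hm).2 h1)
      linarith
    massu := mass h.massv
    massv := mass h.massu }

/-- One-sided scale information: `w` and `A` are normalized by the box with half-sides `M`, `m`. -/
structure HalfScale (w : ℝ → ℝ → ℝ) (A : Set (ℝ × ℝ)) (κ M m h : ℝ) : Prop where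
  bd : ∀ a b, |a| ≤ κ * M → |b| ≤ κ * m → w a b ≤ h / κ
  fat : ∃ a₀ b₀, ∀ a b, |a - a₀| ≤ κ * M → |b - b₀| ≤ κ * m →
    (a, b) ∈ A ∧ |a| ≤ M / κ ∧ |b| ≤ m / κ
  out : ∀ a b, w a b < h → w (-a) (-b) < h → |a| ≤ M / κ ∧ |b| ≤ m / κ

theorem centroid_bound {S Q : Set R2} (hS : MeasurableSet S) (hb : Bornology.IsBounded S)
    (h0 : ∫ x in S, x = 0) {n : R2} {t m : ℝ} (ht : ∀ x ∈ S, ⟪n, x⟫ ≤ t) (hQS : Q ⊆ S)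
    (hQ : MeasurableSet Q) (hm : ∀ x ∈ Q, ⟪n, x⟫ ≤ t - m) :
    m * volume.real Q ≤ t * volume.real S := by
  have hfin : volume S ≠ ⊤ := hb.measure_lt_top.ne
  have hintg : IntegrableOn (fun x : R2 => x) S := by
    obtain ⟨R, hR⟩ := hb.exists_norm_le
    exact Measure.integrableOn_of_bounded hfin (by fun_prop)
      (ae_restrict_of_forall_mem hS fun x hx => hR x hx)
  have hint2 : IntegrableOn (fun x : R2 => t - ⟪n, x⟫) S :=
    (integrableOn_const hfin).sub (hintg.const_inner n)
  have h1 : ∫ x in S, (t - ⟪n, x⟫) = t * volume.real S := by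
    have hc : IntegrableOn (fun _ : R2 => t) S := integrableOn_const hfin
    rw [integral_sub hc (hintg.const_inner n), integral_inner hintg, h0]
    simp [mul_comm]
  have h2 : ∫ x in Q, (t - ⟪n, x⟫) ≤ ∫ x in S, (t - ⟪n, x⟫) :=
    setIntegral_mono_set hint2 (ae_restrict_of_forall_mem hS fun x hx => by
      have := ht x hx; simp only [Pi.zero_apply]; linarith) (ae_of_all _ hQS)
  have h3 : m * volume.real Q ≤ ∫ x in Q, (t - ⟪n, x⟫) := by
    have hQfin : volume Q ≠ ⊤ := ((measure_mono hQS).trans_lt hb.measure_lt_top).ne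
    have := setIntegral_mono_on (f := fun _ => m) (integrableOn_const hQfin)
      (hint2.mono_set hQS) hQ (fun x hx => by have := hm x hx; linarith)
    simpa [mul_comm] using this
  linarith

theorem volume_real_box (a b r s : ℝ) (hr : 0 ≤ r) (hs : 0 ≤ s) :
    volume.real (Icc (a - r) (a + r) ×ˢ Icc (b - s) (b + s)) = (2 * r) * (2 * s) := by
  rw [Measure.real, Measure.volume_eq_prod, Measure.prod_prod, Real.volume_Icc, Real.volume_Icc,
    ENNReal.toReal_mul, ENNReal.toReal_ofReal (by linarith), ENNReal.toReal_ofReal (by linarith)]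
  ring

theorem HalfScale.of_section {w : R2 → ℝ} (hw : ConvexOn ℝ univ w) (hn : ∀ x, 0 ≤ w x)
    (hw0 : w 0 = 0) {Ω S : Set R2} {c s : ℝ} (hcs : c ^ 2 + s ^ 2 = 1) {M m h d : ℝ}
    (hM : 0 < M) (hm : 0 < m) (hd : 0 < d) (hd1 : d ≤ 1) (hh : 0 < h)
    (hS : IsCentredSection w 0 h S) {a₀ b₀ : ℝ}
    (hin : ∀ a b, ((a - a₀) / M) ^ 2 + ((b - b₀) / m) ^ 2 ≤ d ^ 2 →
      frameMap c s hcs (a, b) ∈ Ω ∩ S)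
    (hout : ∀ a b, frameMap c s hcs (a, b) ∈ S → (a / M) ^ 2 + (b / m) ^ 2 ≤ (d⁻¹) ^ 2) :
    HalfScale (fun a b => w (frameMap c s hcs (a, b))) (frameMap c s hcs ⁻¹' interior Ω)
      (d ^ 5 / 128) M m h := by
  have hbox : ∀ a b, |a - a₀| ≤ d / 2 * M → |b - b₀| ≤ d / 2 * m →
      frameMap c s hcs (a, b) ∈ Ω ∩ S := by
    intro a b ha hb
    refine hin a b ?_
    have h1 : ((a - a₀) / M) ^ 2 ≤ (d / 2) ^ 2 := by
      rw [sq_le_sq, abs_div, abs_of_pos hM, abs_of_pos (half_pos hd), div_le_iff₀ hM]; exact ha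
    have h2 : ((b - b₀) / m) ^ 2 ≤ (d / 2) ^ 2 := by
      rw [sq_le_sq, abs_div, abs_of_pos hm, abs_of_pos (half_pos hd), div_le_iff₀ hm]; exact hb
    nlinarith
  have hSb : ∀ a b, frameMap c s hcs (a, b) ∈ S → |a| ≤ M / d ∧ |b| ≤ m / d := by
    intro a b hab
    have h1 := hout a b hab
    have h2 : (a / M) ^ 2 ≤ (d⁻¹) ^ 2 := by nlinarith [sq_nonneg (b / m)]
    have h3 : (b / m) ^ 2 ≤ (d⁻¹) ^ 2 := by nlinarith [sq_nonneg (a / M)]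
    rw [sq_le_sq, abs_div, abs_of_pos hM, abs_of_pos (inv_pos.2 hd), div_le_iff₀ hM] at h2
    rw [sq_le_sq, abs_div, abs_of_pos hm, abs_of_pos (inv_pos.2 hd), div_le_iff₀ hm] at h3
    constructor
    · rw [div_eq_inv_mul]; exact h2
    · rw [div_eq_inv_mul]; exact h3
  have hd5 : d ^ 5 ≤ d := by
    calc d ^ 5 = d * d ^ 4 := by ring
      _ ≤ d * 1 := by gcongr; exact pow_le_one₀ hd.le hd1
      _ = d := mul_one d
  have hd5' : 0 < d ^ 5 := by positivity
  obtain ⟨p, rfl, hcen⟩ := hS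
  simp only [sub_zero, hw0, zero_add] at hcen hbox hSb
  set S := {x : R2 | w x < ⟪p, x⟫ + h} with hSdef
  have hSo : IsOpen S := isOpen_lt hw.locallyLipschitz.continuous (by fun_prop)
  have hSc : Convex ℝ S := by
    have : ConvexOn ℝ univ (fun x => w x - ⟪p, x⟫) :=
      hw.sub ((innerSL ℝ p).toLinearMap.concaveOn convex_univ)
    refine Eq.subst (Set.ext fun x => ?_) (this.convex_lt h)
    show x ∈ univ ∧ w x - ⟪p, x⟫ < h ↔ w x < ⟪p, x⟫ + h
    simp [sub_lt_iff_lt_add']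
  have hSsub : S ⊆ frameMap c s hcs '' (Icc (0 - M / d) (0 + M / d) ×ˢ Icc (0 - m / d) (0 + m / d)) := by
    intro x hx
    obtain ⟨⟨a, b⟩, rfl⟩ := (frameMap c s hcs).surjective x
    obtain ⟨h1, h2⟩ := hSb a b hx
    refine ⟨(a, b), ⟨?_, ?_⟩, rfl⟩
    · simpa using abs_le.1 h1
    · simpa using abs_le.1 h2
  have hcomp : IsCompact (frameMap c s hcs '' (Icc (0 - M / d) (0 + M / d) ×ˢ Icc (0 - m / d) (0 + m / d))) :=
    (isCompact_Icc.prod isCompact_Icc).image (frameMap c s hcs).continuous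
  have hvol : ∀ K : Set (ℝ × ℝ), volume.real (frameMap c s hcs '' K) = volume.real K := by
    intro K
    have := (frameMap_measurePreserving c s hcs).measure_preimage_emb
      (frameMap c s hcs).measurableEmbedding (frameMap c s hcs '' K)
    rw [preimage_image_eq _ (frameMap c s hcs).injective] at this
    simp [Measure.real, this]
  have hsec : ∀ a b, |a| ≤ d ^ 5 / 128 * M → |b| ≤ d ^ 5 / 128 * m → frameMap c s hcs (a, b) ∈ S := by
    intro a b ha hb
    by_contra hnot
    obtain ⟨F, hF⟩ := geometric_hahn_banach_open_point hSc hSo hnot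
    set n := (InnerProductSpace.toDual ℝ R2).symm F with hn'
    have hFn : ∀ x, F x = ⟪n, x⟫ := fun x => by rw [hn', InnerProductSpace.toDual_symm_apply]
    obtain ⟨⟨n1, n2⟩, hn12⟩ := (frameMap c s hcs).surjective n
    have hFc : ∀ a b, F (frameMap c s hcs (a, b)) = n1 * a + n2 * b := by
      intro a b; rw [hFn, ← hn12, frameMap_inner]
    set t := n1 * a + n2 * b with ht
    set N := |n1| * M + |n2| * m with hN
    have hNpos : 0 < N := by
      by_contra hle
      have e1 : |n1| = 0 := by
        by_contra hne
        have : 0 < |n1| := lt_of_le_of_ne (abs_nonneg _) (Ne.symm hne)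
        have := mul_pos this hM
        have := mul_nonneg (abs_nonneg n2) hm.le
        linarith
      have e2 : |n2| = 0 := by
        by_contra hne
        have : 0 < |n2| := lt_of_le_of_ne (abs_nonneg _) (Ne.symm hne)
        have := mul_pos this hm
        have := mul_nonneg (abs_nonneg n1) hM.le
        linarith
      rw [abs_eq_zero] at e1 e2
      have h1 := hF (frameMap c s hcs (a₀, b₀)) (hbox a₀ b₀ (by simp; positivity) (by simp; positivity)).2
      rw [hFc, hFc, e1, e2] at h1
      simp at h1
    have htN : t ≤ d ^ 5 / 128 * N := by
      have h1 : n1 * a ≤ |n1| * |a| := by rw [← abs_mul]; exact le_abs_self _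
      have h2 : n2 * b ≤ |n2| * |b| := by rw [← abs_mul]; exact le_abs_self _
      have h3 : |n1| * |a| ≤ |n1| * (d ^ 5 / 128 * M) := by gcongr
      have h4 : |n2| * |b| ≤ |n2| * (d ^ 5 / 128 * m) := by gcongr
      rw [ht, hN]; linarith
    have hcb := centroid_bound (S := S)
      (Q := frameMap c s hcs '' (Icc (a₀ - d / 4 * M) (a₀ + d / 4 * M) ×ˢ
        Icc (b₀ - d / 4 * m) (b₀ + d / 4 * m))) (n := n) (t := t) (m := d / 4 * N)
      hSo.measurableSet (hcomp.isBounded.subset hSsub) hcen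
      (fun x hx => by have := hF x hx; rw [hFc, hFn] at this; exact this.le) ?_
      ((frameMap c s hcs).measurableEmbedding.measurableSet_image.2 (measurableSet_Icc.prod measurableSet_Icc)) ?_
    · rw [hvol, volume_real_box _ _ _ _ (by positivity) (by positivity)] at hcb
      have hSvol : volume.real S ≤ (2 * (M / d)) * (2 * (m / d)) := by
        rw [← volume_real_box 0 0 (M / d) (m / d) (by positivity) (by positivity), ← hvol]
        exact measureReal_mono hSsub hcomp.measure_lt_top.ne
      have h1 : t * volume.real S ≤ d ^ 5 / 128 * N * ((2 * (M / d)) * (2 * (m / d))) := by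
        calc t * volume.real S ≤ d ^ 5 / 128 * N * volume.real S := by gcongr
          _ ≤ _ := by gcongr
      have h2 : d ^ 5 / 128 * N * ((2 * (M / d)) * (2 * (m / d))) = d ^ 3 * N * M * m / 32 := by
        field_simp; ring
      have h3 : d / 4 * N * (2 * (d / 4 * M) * (2 * (d / 4 * m))) = d ^ 3 * N * M * m / 16 := by
        ring
      have h4 : 0 < d ^ 3 * N * M * m := by positivity
      linarith
    · rintro _ ⟨⟨x, y⟩, ⟨hx, hy⟩, rfl⟩
      simp only [mem_Icc] at hx hy
      refine (hbox x y ?_ ?_).2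
      · rw [abs_le]; constructor <;> nlinarith
      · rw [abs_le]; constructor <;> nlinarith
    · rintro _ ⟨⟨x, y⟩, ⟨hx, hy⟩, rfl⟩
      simp only [mem_Icc] at hx hy
      have hshift : ∀ σ₁ σ₂ : ℝ, |σ₁| = 1 → |σ₂| = 1 → n1 * σ₁ = |n1| → n2 * σ₂ = |n2| →
          n1 * x + n2 * y ≤ t - d / 4 * N := by
        intro σ₁ σ₂ g1 g2 g3 g4
        have h1 := hF (frameMap c s hcs (x + d / 4 * M * σ₁, y + d / 4 * m * σ₂)) (hbox _ _ ?_ ?_).2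
        · rw [hFc, hFc] at h1
          have : n1 * (x + d / 4 * M * σ₁) + n2 * (y + d / 4 * m * σ₂) =
            n1 * x + n2 * y + d / 4 * N := by
            rw [hN, ← g3, ← g4]; ring
          linarith
        · have : |d / 4 * M * σ₁| = d / 4 * M := by rw [abs_mul, g1, abs_of_pos (by positivity), mul_one]
          have := abs_le.1 this.le
          rw [abs_le]; constructor <;> linarith
        · have : |d / 4 * m * σ₂| = d / 4 * m := by rw [abs_mul, g2, abs_of_pos (by positivity), mul_one]
          have := abs_le.1 this.le
          rw [abs_le]; constructor <;> linarith
      have sg : ∀ r : ℝ, ∃ σ : ℝ, |σ| = 1 ∧ r * σ = |r| := by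
        intro r
        rcases le_total 0 r with hr | hr
        · exact ⟨1, by simp, by rw [abs_of_nonneg hr]; ring⟩
        · exact ⟨-1, by simp, by rw [abs_of_nonpos hr]; ring⟩
      obtain ⟨σ₁, g1, g3⟩ := sg n1
      obtain ⟨σ₂, g2, g4⟩ := sg n2
      have := hshift σ₁ σ₂ g1 g2 g3 g4
      rwa [← hFn, hFc]
  have hneg : ∀ a b : ℝ, frameMap c s hcs (-a, -b) = - frameMap c s hcs (a, b) := by
    intro a b
    have := frameMap_combo c s hcs (a, b) (0, 0) (-1) 0
    simpa using this
  refine ⟨fun a b ha hb => ?_, ⟨a₀, b₀, fun a b ha hb => ?_⟩, fun a b h1 h2 => ?_⟩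
  · have h1 : w _ < _ := hsec a b ha hb
    have h2 : w _ < _ := hsec (-a) (-b) (by rwa [abs_neg]) (by rwa [abs_neg])
    have h3 := hn (frameMap c s hcs (-a, -b))
    rw [hneg, inner_neg_right] at h2
    rw [hneg] at h3
    have h4 : w (frameMap c s hcs (a, b)) ≤ 2 * h := by linarith
    refine h4.trans ?_
    rw [le_div_iff₀ (by positivity)]
    nlinarith
  · have hk : d ^ 5 / 128 ≤ d / 4 := by linarith
    have ha' : |a - a₀| < d / 2 * M := by
      refine lt_of_le_of_lt ha ?_
      apply mul_lt_mul_of_pos_right _ hM; linarith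
    have hb' : |b - b₀| < d / 2 * m := by
      refine lt_of_le_of_lt hb ?_
      apply mul_lt_mul_of_pos_right _ hm; linarith
    refine ⟨?_, ?_⟩
    · have ho : IsOpen (frameMap c s hcs '' {z : ℝ × ℝ | |z.1 - a₀| < d / 2 * M ∧ |z.2 - b₀| < d / 2 * m}) := by
        have o1 : IsOpen {z : ℝ × ℝ | |z.1 - a₀| < d / 2 * M} := isOpen_lt (by fun_prop) continuous_const
        have o2 : IsOpen {z : ℝ × ℝ | |z.2 - b₀| < d / 2 * m} := isOpen_lt (by fun_prop) continuous_const
        exact (frameMap c s hcs).isOpenMap _ (o1.inter o2)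
      refine interior_maximal ?_ ho (mem_image_of_mem _ ⟨ha', hb'⟩)
      rintro _ ⟨z, hz, rfl⟩
      exact (hbox z.1 z.2 hz.1.le hz.2.le).1
    · have := hSb a b (hbox a b ha'.le hb'.le).2
      have hk2 : d ^ 5 / 128 ≤ d := by linarith
      exact ⟨this.1.trans (div_le_div_of_nonneg_left hM.le (by positivity) hk2),
        this.2.trans (div_le_div_of_nonneg_left hm.le (by positivity) hk2)⟩
  · have hk2 : d ^ 5 / 128 ≤ d := by linarith
    have key : |a| ≤ M / d ∧ |b| ≤ m / d := by
      rcases le_total 0 ⟪p, frameMap c s hcs (a, b)⟫ with hp | hp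
      · refine hSb a b ?_
        show w _ < _
        linarith
      · have := hSb (-a) (-b) (by
          show w _ < _
          rw [hneg a b, inner_neg_right, ← hneg a b]; linarith)
        simpa using this
    exact ⟨key.1.trans (div_le_div_of_nonneg_left hM.le (by positivity) hk2),
      key.2.trans (div_le_div_of_nonneg_left hm.le (by positivity) hk2)⟩

/-- Two-sided scale information for the pair of potentials. -/
structure Scale (u v : ℝ → ℝ → ℝ) (A B : Set (ℝ × ℝ)) (κ L l : ℝ) : Prop where
  hu : HalfScale u A κ L l (L * l)
  hv : HalfScale v B κ l L (L * l)

theorem Scale.of_inSFamily {δb : ℝ} (hδ : 0 < δb) {u v : R2 → ℝ} {Ω₁ Ω₂ : Set R2} {L l : ℝ → ℝ}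
    {e f : ℝ → R2} (hS : InSFamily δb u v Ω₁ Ω₂ L l e f) {h : ℝ} (hh : h ∈ Ioc (0 : ℝ) 1) :
    ∃ c s, ∃ hcs : c ^ 2 + s ^ 2 = 1,
      Scale (fun a b => u (frameMap c s hcs (a, b))) (fun a b => v (frameMap c s hcs (a, b)))
        (frameMap c s hcs ⁻¹' interior Ω₁) (frameMap c s hcs ⁻¹' interior Ω₂)
        (min δb 1 ^ 5 / 128) (L h) (l h) := by
  have hd := DualPair.of_inSFamily hS
  obtain ⟨-, -, -, -, -, -, -, -, -, -, -, -, -, -, -, -, -, -, -, hall⟩ := hS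
  obtain ⟨he, hf, hef, hl, hlL, hLl, ⟨S, hSc, ⟨x, hx⟩, hSo⟩, ⟨T, hTc, ⟨y, hy⟩, hTo⟩⟩ := hall h hh
  have hLp : 0 < L h := hl.trans_le hlL
  have hcs : (e h) 0 ^ 2 + (e h) 1 ^ 2 = 1 := by
    have := EuclideanSpace.norm_sq_eq (e h)
    rw [he] at this
    simp [Fin.sum_univ_two] at this
    linarith
  have hff : (f h) 0 ^ 2 + (f h) 1 ^ 2 = 1 := by
    have := EuclideanSpace.norm_sq_eq (f h)
    rw [hf] at this
    simp [Fin.sum_univ_two] at this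
    linarith
  have hef' : (e h) 0 * (f h) 0 + (e h) 1 * (f h) 1 = 0 := by
    rw [PiLp.inner_apply] at hef
    simp [Fin.sum_univ_two] at hef
    linarith
  refine ⟨(e h) 0, (e h) 1, hcs, ?_⟩
  set Φ := frameMap ((e h) 0) ((e h) 1) hcs with hΦ
  have ie : ∀ z : ℝ × ℝ, ⟪Φ z, e h⟫ = z.1 := by
    intro z
    simp [hΦ, frameMap, PiLp.inner_apply, Fin.sum_univ_two]
    linear_combination z.1 * hcs
  obtain ⟨σ, hσ, if'⟩ : ∃ σ : ℝ, σ ^ 2 = 1 ∧ ∀ z : ℝ × ℝ, ⟪Φ z, f h⟫ = σ * z.2 := by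
    refine ⟨-(e h) 1 * (f h) 0 + (e h) 0 * (f h) 1, ?_, ?_⟩
    · linear_combination ((f h) 0 ^ 2 + (f h) 1 ^ 2) * hcs + hff -
        ((e h) 0 * (f h) 0 + (e h) 1 * (f h) 1) * hef'
    · intro z
      simp [hΦ, frameMap, PiLp.inner_apply, Fin.sum_univ_two]
      linear_combination z.1 * hef'
  set d := min δb 1 with hdd
  have hdp : 0 < d := lt_min hδ one_pos
  have hd1 : d ≤ 1 := min_le_right _ _
  have hdδ : d ≤ δb := min_le_left _ _
  have hpos : 0 < h := hh.1
  have hlin : ∀ (z z' : ℝ × ℝ), Φ z = Φ z' + Φ (z.1 - z'.1, z.2 - z'.2) := by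
    intro z z'
    have h1 := frameMap_combo ((e h) 0) ((e h) 1) hcs z' (z.1 - z'.1, z.2 - z'.2) 1 1
    rw [hΦ]
    rw [one_smul, one_smul] at h1
    rw [← h1]
    simp
  have hsm : ∀ (z : ℝ × ℝ) (r : ℝ), Φ (r * z.1, r * z.2) = r • Φ z := by
    intro z r
    have := frameMap_combo ((e h) 0) ((e h) 1) hcs z (0, 0) r 0
    simpa using this
  rw [hLl.symm] at hSc hTc
  have gen : ∀ (E : Set R2) (M m : ℝ), 0 < M → 0 < m →
      (∀ z : ℝ × ℝ, Φ z ∈ E ↔ (z.1 / M) ^ 2 + (z.2 / m) ^ 2 ≤ 1) →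
      ∀ (w : R2 → ℝ), ConvexOn ℝ univ w → (∀ x, 0 ≤ w x) → w 0 = 0 → ∀ (Ω S : Set R2) (x : R2),
      IsCentredSection w 0 (L h * l h) S → (fun z => x + δb • z) '' E ⊆ Ω ∩ S →
      S ⊆ (fun z => δb⁻¹ • z) '' E →
      HalfScale (fun a b => w (Φ (a, b))) (Φ ⁻¹' interior Ω) (d ^ 5 / 128) M m (L h * l h) := by
    intro E M m hM hm hE w hw hn hw0 Ω S x hsec hin hout
    obtain ⟨⟨a₀, b₀⟩, rfl⟩ := Φ.surjective x
    refine HalfScale.of_section hw hn hw0 hcs hM hm hdp hd1 (by positivity) hsec (a₀ := a₀) (b₀ := b₀) ?_ ?_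
    · intro a b hab
      apply hin
      refine ⟨Φ (δb⁻¹ * (a - a₀), δb⁻¹ * (b - b₀)), (hE _).2 ?_, ?_⟩
      · have h1 : (δb⁻¹ * (a - a₀) / M) ^ 2 + (δb⁻¹ * (b - b₀) / m) ^ 2 =
          (δb⁻¹) ^ 2 * (((a - a₀) / M) ^ 2 + ((b - b₀) / m) ^ 2) := by ring
        simp only
        rw [h1]
        calc _ ≤ (δb⁻¹) ^ 2 * d ^ 2 := by gcongr
          _ ≤ (δb⁻¹) ^ 2 * δb ^ 2 := by gcongr
          _ = 1 := by field_simp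
      · simp only
        rw [← hsm]
        simp only
        rw [hlin (a, b) (a₀, b₀)]
        congr 3 <;> field_simp
    · intro a b hab
      obtain ⟨x, hxE, hx⟩ := hout hab
      obtain ⟨z, rfl⟩ := Φ.surjective x
      have h1 := (hE z).1 hxE
      have h2 : (δb⁻¹ * z.1, δb⁻¹ * z.2) = (a, b) := Φ.injective (by rw [hsm]; exact hx)
      simp only [Prod.mk.injEq] at h2
      rw [← h2.1, ← h2.2]
      have h3 : (δb⁻¹ * z.1 / M) ^ 2 + (δb⁻¹ * z.2 / m) ^ 2 =
          (δb⁻¹) ^ 2 * ((z.1 / M) ^ 2 + (z.2 / m) ^ 2) := by ring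
      rw [h3]
      calc _ ≤ (δb⁻¹) ^ 2 * 1 := by gcongr
        _ ≤ (d⁻¹) ^ 2 * 1 := by gcongr
        _ = _ := mul_one _
  have hσd : ∀ r t : ℝ, (σ * r / t) ^ 2 = (r / t) ^ 2 := by
    intro r t
    rw [mul_div_assoc, mul_pow, hσ, one_mul]
  constructor
  · refine gen _ _ _ hLp hl (fun z => ?_) u hd.cu hd.un hd.u0 Ω₁ S x hSc hx hSo
    simp only [ellipse, mem_ofPred_eq, ie, if', hσd]
  · refine gen _ _ _ hl hLp (fun z => ?_) v hd.cv hd.vn hd.v0 Ω₂ T y hTc hy hTo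
    simp only [ellipse, mem_ofPred_eq, ie, if', hσd]
    rw [add_comm]

theorem exists_small_drop (M ε : ℝ) (hε : 0 < ε) (m : ℕ) :
    ∃ N : ℕ, ∀ S : ℕ → ℝ, (∀ k ≤ N, |S k| ≤ M) → ∃ k, k + m ≤ N ∧ S k - S (k + m) ≤ ε := by
  obtain ⟨J, hJ⟩ := exists_nat_gt (2 * M / ε)
  refine ⟨J * m, fun S hb => ?_⟩
  by_contra hcon
  push Not at hcon
  have key : ∀ j ≤ J, S (j * m) ≤ S 0 - j * ε := by
    intro j
    induction j with
    | zero => simp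
    | succ j ih =>
      intro hj
      have h1 := hcon (j * m) (by rw [← Nat.succ_mul]; exact Nat.mul_le_mul_right m hj)
      have h2 := ih (by omega)
      rw [← Nat.succ_mul] at h1
      push_cast
      have : S (j.succ * m) = S ((j + 1) * m) := rfl
      linarith
  have h1 := key J le_rfl
  have h2 := abs_le.1 (hb 0 (Nat.zero_le _))
  have h3 := abs_le.1 (hb (J * m) le_rfl)
  rw [div_lt_iff₀ hε] at hJ
  linarith

theorem Cvx.combo {u : ℝ → ℝ → ℝ} (hu : Cvx u) {a b c d t x y : ℝ} (h0 : 0 ≤ t) (h1 : t ≤ 1)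
    (hx : x = (1 - t) * a + t * c) (hy : y = (1 - t) * b + t * d) :
    u x y ≤ (1 - t) * u a b + t * u c d := by
  rw [hx, hy]; exact hu a b c d t h0 h1

/-- The five abscissas at which near-linearity is tested. -/
def testPts : Finset ℝ := {-1, -1/2, 0, 1/2, 1}

theorem abs_le_one_of_mem_testPts {p : ℝ} (hp : p ∈ testPts) : |p| ≤ 1 := by
  simp only [testPts, Finset.mem_insert, Finset.mem_singleton] at hp
  rcases hp with rfl | rfl | rfl | rfl | rfl <;> norm_num [abs_le]

theorem Cvx.exists_small_slope_drop (C ε₁ : ℝ) (hC : 0 < C) (hε₁p : 0 < ε₁) (m : ℕ) :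
    ∃ N : ℕ, ∀ U : ℝ → ℝ → ℝ, Cvx U →
      (∀ k ≤ N, ∀ s t : ℝ, |s| ≤ 1 → |t| ≤ (1 / 4) ^ k → 0 ≤ U s t ∧ U s t ≤ C * (1 / 4) ^ k) →
      ∃ k, k + m ≤ N ∧ ∀ p ∈ testPts, ∀ i ∈ ({1, -1} : Finset ℝ),
        (U p (i * (1 / 4) ^ k) - U p 0) / (1 / 4) ^ k -
        (U p (i * (1 / 4) ^ (k + m)) - U p 0) / (1 / 4) ^ (k + m) ≤ ε₁ / 2 := by
  obtain ⟨N, hN⟩ := exists_small_drop (10 * C) (ε₁ / 2) (by positivity) m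
  refine ⟨N, fun U hU hb => ?_⟩
  have hPabs : ∀ p ∈ testPts, |p| ≤ 1 := fun p hp => abs_le_one_of_mem_testPts hp
  let D : ℕ → ℝ × ℝ → ℝ := fun k z => (U z.1 (z.2 * (1 / 4) ^ k) - U z.1 0) / (1 / 4) ^ k
  have hDb : ∀ k ≤ N, ∀ z ∈ testPts ×ˢ ({1, -1} : Finset ℝ), |D k z| ≤ C := by
    intro k hk z hz
    rw [Finset.mem_product] at hz
    have hz2 : |z.2| = 1 := by
      have := hz.2
      simp only [Finset.mem_insert, Finset.mem_singleton] at this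
      rcases this with h | h <;> simp [h]
    have hpk : (0 : ℝ) < (1 / 4) ^ k := by positivity
    have h1 := hb k hk z.1 (z.2 * (1 / 4) ^ k) (hPabs _ hz.1)
      (by rw [abs_mul, hz2, abs_of_pos hpk, one_mul])
    have h2 := hb k hk z.1 0 (hPabs _ hz.1) (by simp)
    simp only [D]
    rw [abs_div, abs_of_pos hpk, div_le_iff₀ hpk, abs_le]
    constructor <;> linarith
  have hDm : ∀ k j, ∀ z, D (k + j) z ≤ D k z := by
    intro k j z
    simp only [D]
    have hpk : (0 : ℝ) < (1 / 4) ^ k := by positivity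
    have hpj : (0 : ℝ) < (1 / 4) ^ j := by positivity
    have hpj1 : ((1 : ℝ) / 4) ^ j ≤ 1 := pow_le_one₀ (by norm_num) (by norm_num)
    rw [div_le_div_iff₀ (by positivity) hpk, pow_add]
    have := hU.combo (a := z.1) (b := 0) (c := z.1) (d := z.2 * (1 / 4) ^ k) hpj.le hpj1
      (x := z.1) (y := z.2 * ((1 / 4) ^ k * (1 / 4) ^ j)) (by ring) (by ring)
    nlinarith
  have hcard : ((testPts ×ˢ ({1, -1} : Finset ℝ)).card : ℝ) ≤ 10 := by
    have h1 : testPts.card ≤ 5 := Finset.card_le_five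
    have h2 : ({1, -1} : Finset ℝ).card ≤ 2 := Finset.card_le_two
    rw [Finset.card_product]
    exact_mod_cast Nat.mul_le_mul h1 h2
  obtain ⟨k, hkN, hk⟩ := hN (fun k => ∑ z ∈ testPts ×ˢ ({1, -1} : Finset ℝ), D k z) (by
    intro k hk
    calc |∑ z ∈ testPts ×ˢ ({1, -1} : Finset ℝ), D k z| ≤ ∑ z ∈ testPts ×ˢ ({1, -1} : Finset ℝ), |D k z| :=
          Finset.abs_sum_le_sum_abs _ _
      _ ≤ ∑ z ∈ testPts ×ˢ ({1, -1} : Finset ℝ), C := Finset.sum_le_sum (hDb k hk)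
      _ ≤ 10 * C := by rw [Finset.sum_const, nsmul_eq_mul]; gcongr)
  refine ⟨k, hkN, fun p hp i hi => ?_⟩
  rw [← Finset.sum_sub_distrib] at hk
  have := Finset.single_le_sum (f := fun z => D k z - D (k + m) z)
    (fun z _ => sub_nonneg.2 (hDm k m z)) (Finset.mem_product.2 ⟨hp, hi⟩ : (p, i) ∈ testPts ×ˢ ({1, -1} : Finset ℝ))
  exact this.trans hk

theorem Cvx.near_linear {U : ℝ → ℝ → ℝ} (hU : Cvx U) {C ε₁ σ T i p : ℝ} (hC : 0 < C)
    (hε₁p : 0 < ε₁) (hσp : 0 < σ) (hTp : 0 < T) (hσC : 2 * C * σ ≤ ε₁ / 2)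
    (hbT : ∀ s t : ℝ, |s| ≤ 1 → |t| ≤ T → 0 ≤ U s t ∧ U s t ≤ C * T)
    (hbσ : ∀ s t : ℝ, |s| ≤ 1 → |t| ≤ σ * T → 0 ≤ U s t ∧ U s t ≤ C * (σ * T))
    (hi : i ∈ ({1, -1} : Finset ℝ)) (hp1 : |p| ≤ 1)
    (hd : (U p (i * T) - U p 0) / T - (U p (i * (σ * T)) - U p 0) / (σ * T) ≤ ε₁ / 2) :
    ∃ α, |α| ≤ C ∧ ∀ t, 0 ≤ t → t ≤ T → |U p (i * t) - α * t| ≤ ε₁ * T := by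
  have hσT : 0 < σ * T := by positivity
  have hi1 : |i| = 1 := by
    simp only [Finset.mem_insert, Finset.mem_singleton] at hi
    rcases hi with h | h <;> simp [h]
  obtain ⟨α, hα⟩ : ∃ α, α = (U p (i * T) - U p 0) / T := ⟨_, rfl⟩
  have hαT : α * T = U p (i * T) - U p 0 := by rw [hα]; field_simp
  obtain ⟨α', hα'⟩ : ∃ α', α' = (U p (i * (σ * T)) - U p 0) / (σ * T) := ⟨_, rfl⟩
  rw [← hα, ← hα'] at hd
  have hαT' : α' * (σ * T) = U p (i * (σ * T)) - U p 0 := by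
    rw [hα', div_mul_cancel₀]; exact hσT.ne'
  have h0 := hbσ p 0 hp1 (by simpa using hσT.le)
  have h0' := hbT p (i * T) hp1 (by rw [abs_mul, hi1, abs_of_pos hTp, one_mul])
  have hαC : |α| ≤ C := by
    rw [hα, abs_div, abs_of_pos hTp, div_le_iff₀ hTp, abs_le]
    have := hbT p 0 hp1 (by simpa using hTp.le)
    constructor <;> linarith
  refine ⟨α, hαC, fun t ht0 htT => ?_⟩
  have hup : U p (i * t) ≤ U p 0 + α * t := by
    have h1 : t / T ≤ 1 := (div_le_one hTp).2 htT
    have h2 := hU.combo (a := p) (b := 0) (c := p) (d := i * T) (by positivity) h1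
      (x := p) (y := i * t) (by ring) (by field_simp; ring)
    have h3 : (1 - t / T) * U p 0 + t / T * U p (i * T) = U p 0 + α * t := by
      rw [hα]; field_simp; ring
    linarith
  have hCσ : C * (σ * T) ≤ ε₁ / 4 * T := by nlinarith
  rw [abs_le]
  constructor
  · rcases le_total t (σ * T) with hts | hts
    · have h1 := hbT p (i * t) hp1 (by rw [abs_mul, hi1, abs_of_nonneg ht0, one_mul]; exact htT)
      have h2 : α * t ≤ C * (σ * T) :=
        (mul_le_mul_of_nonneg_right (le_abs_self α) ht0).trans (by gcongr)
      nlinarith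
    · have htp : 0 < t := hσT.trans_le hts
      have h1 : (σ * T) / t ≤ 1 := (div_le_one htp).2 hts
      have h2 := hU.combo (a := p) (b := 0) (c := p) (d := i * t) (by positivity) h1
        (x := p) (y := i * (σ * T)) (by ring) (by field_simp; ring)
      have h3 : α' * t ≤ U p (i * t) - U p 0 := by
        have h4 : α' * (σ * T) ≤ (σ * T) / t * (U p (i * t) - U p 0) := by rw [hαT']; linarith
        rw [div_mul_eq_mul_div, le_div_iff₀ htp] at h4
        have h5 : (σ * T) * (α' * t) ≤ (σ * T) * (U p (i * t) - U p 0) := by linarith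
        exact le_of_mul_le_mul_left h5 hσT
      have h4 : (α - ε₁ / 2) * t ≤ α' * t := by gcongr; linarith
      nlinarith
  · have := h0.2
    nlinarith

theorem Cvx.near_independent {U : ℝ → ℝ → ℝ} (hU : Cvx U) {C ε₁ T i : ℝ}
    (hε₁p : 0 < ε₁) (hTp : 0 < T) (lin : ∀ p ∈ testPts, ∃ α, |α| ≤ C ∧ ∀ t, 0 ≤ t → t ≤ T →
      |U p (i * t) - α * t| ≤ ε₁ * T) :
    ∃ α, ∀ s t, |s| ≤ 1 / 2 → 0 ≤ t → t ≤ T → |U s (i * t) - α * t| ≤ 11 * ε₁ * T := by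
  obtain ⟨α1, -, l1⟩ := lin (-1) (by simp [testPts])
  obtain ⟨α2, -, l2⟩ := lin (-1/2) (by simp [testPts])
  obtain ⟨α3, -, l3⟩ := lin 0 (by simp [testPts])
  obtain ⟨α4, -, l4⟩ := lin (1/2) (by simp [testPts])
  obtain ⟨α5, -, l5⟩ := lin 1 (by simp [testPts])
  have mid : ∀ p q r α β γ, (∀ t, 0 ≤ t → t ≤ T → |U p (i * t) - α * t| ≤ ε₁ * T) →
      (∀ t, 0 ≤ t → t ≤ T → |U q (i * t) - β * t| ≤ ε₁ * T) →
      (∀ t, 0 ≤ t → t ≤ T → |U r (i * t) - γ * t| ≤ ε₁ * T) → q = (p + r) / 2 →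
      β ≤ α + 4 * ε₁ := by
    intro p q r α β γ hp hq hr hpr
    have h1 := hU.combo (a := p) (b := i * T) (c := r) (d := i * 0) (t := 1 / 2) (by norm_num)
      (by norm_num) (x := q) (y := i * (T / 2)) (by rw [hpr]; ring) (by ring)
    have h2 := (abs_le.1 (hp T hTp.le le_rfl)).2
    have h3 := (abs_le.1 (hr 0 le_rfl hTp.le)).2
    have h4 := (abs_le.1 (hq (T / 2) (by linarith) (by linarith))).1
    have h5 : β * T ≤ (α + 4 * ε₁) * T := by nlinarith
    exact le_of_mul_le_mul_right h5 hTp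
  have e1 := mid _ _ _ _ _ _ l2 l3 l4 (by norm_num)
  have e2 := mid _ _ _ _ _ _ l4 l3 l2 (by norm_num)
  have e3 := mid _ _ _ _ _ _ l3 l2 l1 (by norm_num)
  have e4 := mid _ _ _ _ _ _ l3 l4 l5 (by norm_num)
  refine ⟨α3, fun s t hs ht0 htT => ?_⟩
  have f2 := abs_le.1 (l2 t ht0 htT)
  have f3 := abs_le.1 (l3 t ht0 htT)
  have f4 := abs_le.1 (l4 t ht0 htT)
  have g2 : U (-1/2) (i * t) ≤ α3 * t + 5 * ε₁ * T := by nlinarith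
  have g4 : U (1/2) (i * t) ≤ α3 * t + 5 * ε₁ * T := by nlinarith
  have g3 : α3 * t - ε₁ * T ≤ U 0 (i * t) := by linarith
  have hs' := abs_le.1 hs
  have hεT : 0 < ε₁ * T := by positivity
  rw [abs_le]
  constructor
  · rcases le_total 0 s with h | h
    · have h1 := hU.combo (a := -1/2) (b := i * t) (c := s) (d := i * t) (t := (1/2) / (s + 1/2))
        (by positivity) ((div_le_one (by linarith)).2 (by linarith)) (x := 0) (y := i * t)
        (by field_simp; ring) (by ring)
      set μ := (1/2) / (s + 1/2) with hμ
      have hμ1 : 1 / 2 ≤ μ := by rw [hμ, le_div_iff₀ (by linarith)]; linarith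
      have hμ2 : μ ≤ 1 := (div_le_one (by linarith)).2 (by linarith)
      have h2 : (1 - μ) * U (-1/2) (i * t) ≤ (1 - μ) * (α3 * t + 5 * ε₁ * T) :=
        mul_le_mul_of_nonneg_left g2 (by linarith)
      have h3 : μ * (α3 * t - 11 * ε₁ * T) ≤ μ * U s (i * t) := by nlinarith
      have := le_of_mul_le_mul_left h3 (by linarith)
      linarith
    · have h1 := hU.combo (a := 1/2) (b := i * t) (c := s) (d := i * t) (t := (1/2) / (1/2 - s))
        (by apply div_nonneg <;> linarith) ((div_le_one (by linarith)).2 (by linarith)) (x := 0) (y := i * t)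
        (by have h2 : (1/2) / (1/2 - s) * (1/2 - s) = 1/2 := div_mul_cancel₀ _ (by linarith)
            linarith) (by ring)
      set μ := (1/2) / (1/2 - s) with hμ
      have hμ1 : 1 / 2 ≤ μ := by rw [hμ, le_div_iff₀ (by linarith)]; linarith
      have hμ2 : μ ≤ 1 := (div_le_one (by linarith)).2 (by linarith)
      have h2 : (1 - μ) * U (1/2) (i * t) ≤ (1 - μ) * (α3 * t + 5 * ε₁ * T) :=
        mul_le_mul_of_nonneg_left g4 (by linarith)
      have h3 : μ * (α3 * t - 11 * ε₁ * T) ≤ μ * U s (i * t) := by nlinarith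
      have := le_of_mul_le_mul_left h3 (by linarith)
      linarith
  · have h1 := hU.combo (a := -1/2) (b := i * t) (c := 1/2) (d := i * t) (t := s + 1/2)
        (by linarith) (by linarith) (x := s) (y := i * t) (by ring) (by ring)
    have h2 : (1 - (s + 1/2)) * U (-1/2) (i * t) ≤ (1 - (s + 1/2)) * (α3 * t + 5 * ε₁ * T) :=
        mul_le_mul_of_nonneg_left g2 (by linarith)
    have h3 : (s + 1/2) * U (1/2) (i * t) ≤ (s + 1/2) * (α3 * t + 5 * ε₁ * T) :=
        mul_le_mul_of_nonneg_left g4 (by linarith)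
    nlinarith

/-- If a convex function grows linearly in `t` at all dyadic scales, then at some scale its
variation in the other variable is small. -/
theorem Cvx.exists_flat_scale (C ε : ℝ) (hC : 0 < C) (hε : 0 < ε) :
    ∃ n : ℕ, ∀ U : ℝ → ℝ → ℝ, Cvx U →
      (∀ k ≤ n, ∀ s t : ℝ, |s| ≤ 1 → |t| ≤ (1 / 4) ^ k → 0 ≤ U s t ∧ U s t ≤ C * (1 / 4) ^ k) →
      ∃ k ≤ n, ∀ s t y₁ y₂ : ℝ, |s| ≤ 1 / 4 → |t| ≤ (1 / 4) ^ k / 4 → Sb U s t y₁ y₂ →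
        |y₁| ≤ ε * (1 / 4) ^ k ∧ |y₂| ≤ 2 * C := by
  set ε₁ := ε / 100 with hε₁
  have hε₁p : 0 < ε₁ := by positivity
  obtain ⟨m, hm⟩ := exists_pow_lt_of_lt_one (show 0 < ε₁ / (4 * C) by positivity)
    (show (1 / 4 : ℝ) < 1 by norm_num)
  set σ := (1 / 4 : ℝ) ^ m with hσ
  have hσp : 0 < σ := by positivity
  have hσC : 2 * C * σ ≤ ε₁ / 2 := by
    rw [lt_div_iff₀ (by positivity)] at hm
    linarith
  obtain ⟨N, hN⟩ := Cvx.exists_small_slope_drop C ε₁ hC hε₁p m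
  refine ⟨N, fun U hU hb => ?_⟩
  obtain ⟨k, hkm, hdrop⟩ := hN U hU hb
  refine ⟨k, by omega, ?_⟩
  set T := (1 / 4 : ℝ) ^ k with hT
  have hTp : 0 < T := by positivity
  have hkm' : (1 / 4 : ℝ) ^ (k + m) = σ * T := by rw [pow_add, mul_comm]
  have hbT := hb k (by omega)
  have hbσ := hb (k + m) hkm
  rw [← hT] at hbT
  rw [hkm'] at hbσ
  have hσT : 0 < σ * T := by positivity
  have hσ1 : σ ≤ 1 := pow_le_one₀ (by norm_num) (by norm_num)
  have flat : ∀ i ∈ ({1, -1} : Finset ℝ), ∃ α, ∀ s t, |s| ≤ 1 / 2 → 0 ≤ t → t ≤ T →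
      |U s (i * t) - α * t| ≤ 11 * ε₁ * T := fun i hi =>
    hU.near_independent hε₁p hTp fun p hp => hU.near_linear hC hε₁p hσp hTp hσC hbT hbσ hi
      (abs_le_one_of_mem_testPts hp) (by have := hdrop p hp i hi; rwa [hkm'] at this)
  intro s t y₁ y₂ hs ht hsub
  have hs' := abs_le.1 hs
  have ht' := abs_le.1 ht
  constructor
  · obtain ⟨i, hi, r, hr0, hrT, hir⟩ : ∃ i ∈ ({1, -1} : Finset ℝ), ∃ r, 0 ≤ r ∧ r ≤ T ∧ t = i * r := by
      rcases le_total 0 t with h | h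
      · exact ⟨1, by simp, t, h, by linarith, by ring⟩
      · exact ⟨-1, by simp, -t, by linarith, by linarith, by ring⟩
    obtain ⟨α, hα⟩ := flat i hi
    rw [hir] at hsub
    have h1 := hsub (s + 1/4) (i * r)
    have h2 := hsub (s - 1/4) (i * r)
    have h3 := abs_le.1 (hα s r (by rw [abs_le]; constructor <;> linarith) hr0 hrT)
    have h4 := abs_le.1 (hα (s + 1/4) r (by rw [abs_le]; constructor <;> linarith) hr0 hrT)
    have h5 := abs_le.1 (hα (s - 1/4) r (by rw [abs_le]; constructor <;> linarith) hr0 hrT)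
    have h6 : ε = 100 * ε₁ := by rw [hε₁]; ring
    have hεT : 0 < ε₁ * T := by positivity
    rw [abs_le, h6]
    constructor <;> nlinarith
  · have h1 := hsub s (t + T/2)
    have h2 := hsub s (t - T/2)
    have h3 := hbT s t (by linarith) (by rw [abs_le]; constructor <;> linarith)
    have h4 := hbT s (t + T/2) (by linarith) (by rw [abs_le]; constructor <;> linarith)
    have h5 := hbT s (t - T/2) (by linarith) (by rw [abs_le]; constructor <;> linarith)
    have h6 : y₂ * T ≤ (2 * C) * T := by nlinarith
    have h7 : (-(2 * C)) * T ≤ y₂ * T := by nlinarith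
    exact abs_le.2 ⟨le_of_mul_le_mul_right h7 hTp, le_of_mul_le_mul_right h6 hTp⟩

/-- A centred parallelogram `{|α a + β b| ≤ 1, |γ a + δ b| ≤ 1}` of area `4 h`. -/
structure Bx where
  α : ℝ
  β : ℝ
  γ : ℝ
  δ : ℝ
  h : ℝ
  hh : 0 < h
  hdet : h * (α * δ - β * γ) = 1

namespace Bx

/-- The gauge of the parallelogram. -/
def g (X : Bx) (a b : ℝ) : ℝ := max |X.α * a + X.β * b| |X.γ * a + X.δ * b|

theorem g_le {X : Bx} {a b r : ℝ} :
    X.g a b ≤ r ↔ |X.α * a + X.β * b| ≤ r ∧ |X.γ * a + X.δ * b| ≤ r := max_le_iff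

theorem g_nonneg (X : Bx) (a b : ℝ) : 0 ≤ X.g a b := (abs_nonneg _).trans (le_max_left _ _)

theorem g_mul (X : Bx) (t a b : ℝ) : X.g (t * a) (t * b) = |t| * X.g a b := by
  have h1 : X.α * (t * a) + X.β * (t * b) = t * (X.α * a + X.β * b) := by ring
  have h2 : X.γ * (t * a) + X.δ * (t * b) = t * (X.γ * a + X.δ * b) := by ring
  rw [g, h1, h2, abs_mul, abs_mul, g, mul_max_of_nonneg _ _ (abs_nonneg t)]

theorem g_add (X : Bx) (a b c d : ℝ) : X.g (a + c) (b + d) ≤ X.g a b + X.g c d := by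
  refine g_le.2 ⟨?_, ?_⟩
  · rw [show X.α * (a + c) + X.β * (b + d) = (X.α * a + X.β * b) + (X.α * c + X.β * d) by ring]
    exact (abs_add_le _ _).trans (add_le_add (le_max_left _ _) (le_max_left _ _))
  · rw [show X.γ * (a + c) + X.δ * (b + d) = (X.γ * a + X.δ * b) + (X.γ * c + X.δ * d) by ring]
    exact (abs_add_le _ _).trans (add_le_add (le_max_right _ _) (le_max_right _ _))

theorem abs_det_le (X : Bx) (a b c d : ℝ) : |a * d - b * c| ≤ 2 * X.h * (X.g a b * X.g c d) := by
  have h1 : a * d - b * c = X.h * ((X.α * a + X.β * b) * (X.γ * c + X.δ * d) -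
      (X.γ * a + X.δ * b) * (X.α * c + X.β * d)) := by
    linear_combination -(a * d - b * c) * X.hdet
  rw [h1, abs_mul, abs_of_pos X.hh]
  have h2 := abs_sub ((X.α * a + X.β * b) * (X.γ * c + X.δ * d))
    ((X.γ * a + X.δ * b) * (X.α * c + X.β * d))
  rw [abs_mul, abs_mul] at h2
  have h3 : |X.α * a + X.β * b| * |X.γ * c + X.δ * d| ≤ X.g a b * X.g c d :=
    mul_le_mul (le_max_left _ _) (le_max_right _ _) (abs_nonneg _) (X.g_nonneg _ _)
  have h4 : |X.γ * a + X.δ * b| * |X.α * c + X.β * d| ≤ X.g a b * X.g c d :=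
    mul_le_mul (le_max_right _ _) (le_max_left _ _) (abs_nonneg _) (X.g_nonneg _ _)
  have h5 := mul_le_mul_of_nonneg_left (h2.trans (add_le_add h3 h4)) X.hh.le
  linarith

theorem exists_dual (X : Bx) {a b : ℝ} (h0 : 0 < X.g a b) :
    ∃ c d, a * d - b * c = X.h ∧ X.g c d ≤ 1 / X.g a b := by
  rcases le_total |X.γ * a + X.δ * b| |X.α * a + X.β * b| with h | h
  · have hg : X.g a b = |X.α * a + X.β * b| := max_eq_left h
    have hr : X.α * a + X.β * b ≠ 0 := abs_pos.1 (hg ▸ h0)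
    obtain ⟨r, hrr⟩ : ∃ r, r = X.α * a + X.β * b := ⟨_, rfl⟩
    rw [← hrr] at hg hr
    refine ⟨-X.β * X.h / r, X.α * X.h / r, ?_, ?_⟩
    · field_simp; rw [hrr]; ring
    · rw [hg]
      have e1 : X.α * (-X.β * X.h / r) + X.β * (X.α * X.h / r) = 0 := by ring
      have e2 : X.γ * (-X.β * X.h / r) + X.δ * (X.α * X.h / r) = 1 / r := by
        rw [← X.hdet]; ring
      exact g_le.2 ⟨by rw [e1]; simp, by rw [e2]; rw [abs_div, abs_one]⟩
  · have hg : X.g a b = |X.γ * a + X.δ * b| := max_eq_right h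
    have hr : X.γ * a + X.δ * b ≠ 0 := abs_pos.1 (hg ▸ h0)
    obtain ⟨r, hrr⟩ : ∃ r, r = X.γ * a + X.δ * b := ⟨_, rfl⟩
    rw [← hrr] at hg hr
    refine ⟨-X.δ * X.h / r, X.γ * X.h / r, ?_, ?_⟩
    · field_simp; rw [hrr]; ring
    · rw [hg]
      have e1 : X.γ * (-X.δ * X.h / r) + X.δ * (X.γ * X.h / r) = 0 := by ring
      have e2 : X.α * (-X.δ * X.h / r) + X.β * (X.γ * X.h / r) = -(1 / r) := by
        rw [← X.hdet]; ring
      exact g_le.2 ⟨by rw [e2]; rw [abs_neg, abs_div, abs_one], by rw [e1]; simp⟩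

theorem continuous_g (X : Bx) : Continuous fun z : ℝ × ℝ => X.g z.1 z.2 := by
  unfold g; fun_prop

/-- The image of `{|s| ≤ r, |t| ≤ r}` in the coordinates adapted to `X` is `{g ≤ r}`. -/
theorem volume_ball (X : Bx) (a b : ℝ) {r : ℝ} (hr : 0 ≤ r) :
    volume {z : ℝ × ℝ | X.g (z.1 - a) (z.2 - b) ≤ r} = ENNReal.ofReal (4 * r ^ 2 * X.h) := by
  have himg : {z : ℝ × ℝ | X.g (z.1 - a) (z.2 - b) ≤ r} =
      (fun z : ℝ × ℝ => (a, b) + z) '' (planeMap (X.h * X.δ, -(X.h * X.γ)) (-(X.h * X.β), X.h * X.α) ''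
        (Icc (0 - r) (0 + r) ×ˢ Icc (0 - r) (0 + r))) := by
    ext z
    constructor
    · intro hz
      obtain ⟨h1, h2⟩ := g_le.1 hz
      refine ⟨(z.1 - a, z.2 - b), ⟨(X.α * (z.1 - a) + X.β * (z.2 - b),
        X.γ * (z.1 - a) + X.δ * (z.2 - b)), ?_, ?_⟩, by ext <;> simp⟩
      · rw [mem_prod]
        exact ⟨by simpa [abs_le] using h1, by simpa [abs_le] using h2⟩
      · ext
        · simp [planeMap]; linear_combination (z.1 - a) * X.hdet
        · simp [planeMap]; linear_combination (z.2 - b) * X.hdet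
    · rintro ⟨-, ⟨⟨s, t⟩, hst, rfl⟩, rfl⟩
      rw [mem_prod] at hst
      simp only [zero_sub, zero_add] at hst
      refine g_le.2 ⟨?_, ?_⟩
      · have : X.α * ((a, b) + planeMap (X.h * X.δ, -(X.h * X.γ)) (-(X.h * X.β), X.h * X.α) (s, t)).1
            - X.α * a + X.β * (((a, b) + planeMap (X.h * X.δ, -(X.h * X.γ)) (-(X.h * X.β), X.h * X.α) (s, t)).2 - b)
            = s := by
          simp [planeMap]; linear_combination s * X.hdet
        rw [mul_sub, this]; exact abs_le.2 hst.1
      · have : X.γ * ((a, b) + planeMap (X.h * X.δ, -(X.h * X.γ)) (-(X.h * X.β), X.h * X.α) (s, t)).1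
            - X.γ * a + X.δ * (((a, b) + planeMap (X.h * X.δ, -(X.h * X.γ)) (-(X.h * X.β), X.h * X.α) (s, t)).2 - b)
            = t := by
          simp [planeMap]; linear_combination t * X.hdet
        rw [mul_sub, this]; exact abs_le.2 hst.2
  rw [himg, image_add_left, measure_preimage_add, volume_planeMap_image]
  have h1 := volume_real_box 0 0 r r hr hr
  have h2 : volume (Icc (0 - r) (0 + r) ×ˢ Icc (0 - r) (0 + r)) = ENNReal.ofReal (2 * r * (2 * r)) := by
    rw [← h1, Measure.real, ENNReal.ofReal_toReal]
    exact ((isCompact_Icc.prod isCompact_Icc).measure_lt_top).ne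
  rw [h2, ← ENNReal.ofReal_mul (abs_nonneg _)]
  congr 1
  have : X.h * X.δ * (X.h * X.α) - -(X.h * X.γ) * -(X.h * X.β) = X.h := by
    linear_combination X.h * X.hdet
  simp only [this, abs_of_pos X.hh]; ring

end Bx

/-- `u` and `A` are normalized by the parallelogram `X`. -/
structure HS (u : ℝ → ℝ → ℝ) (A : Set (ℝ × ℝ)) (κ : ℝ) (X : Bx) : Prop where
  bd : ∀ a b, X.g a b ≤ κ → u a b ≤ X.h / κ
  fat : ∃ a₀ b₀, ∀ a b, X.g (a - a₀) (b - b₀) ≤ κ → (a, b) ∈ A ∧ X.g a b ≤ 1 / κ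
  out : ∀ a b, u a b < X.h → u (-a) (-b) < X.h → X.g a b ≤ 1 / κ

theorem Cvx.mul_le {u : ℝ → ℝ → ℝ} (hu : Cvx u) (h0 : u 0 0 = 0) {t a b : ℝ} (ht : 0 ≤ t)
    (ht1 : t ≤ 1) : u (t * a) (t * b) ≤ t * u a b := by
  have := hu.combo (a := 0) (b := 0) (c := a) (d := b) ht ht1 (x := t * a) (y := t * b)
    (by ring) (by ring)
  rwa [h0, mul_zero, zero_add] at this

theorem HS.g_le_mul {u : ℝ → ℝ → ℝ} {A A' : Set (ℝ × ℝ)} {κ t : ℝ} {X X' : Bx} (hu : Cvx u)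
    (h0 : u 0 0 = 0) (hκ : 0 < κ) (h : HS u A κ X) (h' : HS u A' κ X') (ht : 0 < t) (ht1 : t ≤ 1)
    (hth : t * (X.h / κ) < X'.h) (a b : ℝ) : X'.g a b ≤ 1 / (κ ^ 2 * t) * X.g a b := by
  refine le_of_forall_pos_le_add fun ε hε => ?_
  obtain ⟨r, hr⟩ : ∃ r, r = X.g a b + ε * (κ ^ 2 * t) := ⟨_, rfl⟩
  have hg := X.g_nonneg a b
  have hrp : 0 < r := by rw [hr]; positivity
  have key : ∀ σ : ℝ, |σ| = κ / r → u (t * (σ * a)) (t * (σ * b)) < X'.h := by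
    intro σ hσ
    refine (hu.mul_le h0 ht.le ht1).trans_lt (lt_of_le_of_lt ?_ hth)
    refine mul_le_mul_of_nonneg_left (h.bd _ _ ?_) ht.le
    rw [X.g_mul, hσ, div_mul_eq_mul_div, div_le_iff₀ hrp]
    gcongr
    rw [hr]; linarith [show 0 < ε * (κ ^ 2 * t) by positivity]
  have h1 := key (κ / r) (abs_of_pos (by positivity))
  have h2 := key (-(κ / r)) (by rw [abs_neg]; exact abs_of_pos (by positivity))
  have h3 := h'.out _ _ h1 (by
    rwa [show -(t * (κ / r * a)) = t * (-(κ / r) * a) by ring,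
      show -(t * (κ / r * b)) = t * (-(κ / r) * b) by ring])
  rw [X'.g_mul, X'.g_mul, abs_of_pos ht, abs_of_pos (by positivity : 0 < κ / r)] at h3
  have h4 : X'.g a b = (t * (κ / r * X'.g a b)) * (r / (t * κ)) := by field_simp
  have h5 : X'.g a b ≤ 1 / κ * (r / (t * κ)) := by
    rw [h4]; exact mul_le_mul_of_nonneg_right h3 (by positivity)
  refine h5.trans (le_of_eq ?_)
  rw [hr]; field_simp

/-- The one-sided properties of a potential used for volume estimates. -/
structure Pot (u : ℝ → ℝ → ℝ) (A : Set (ℝ × ℝ)) : Prop where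
  cu : Cvx u
  u0 : u 0 0 = 0
  un : ∀ a b, 0 ≤ u a b
  cA : Convex ℝ A
  zA : (0, 0) ∈ closure A
  massu : ∀ E, MeasurableSet E →
    volume {y : ℝ × ℝ | ∃ x ∈ E, Sb u x.1 x.2 y.1 y.2} = volume (E ∩ A)

theorem Core.pot_u {u v : ℝ → ℝ → ℝ} {A B : Set (ℝ × ℝ)} (h : Core u v A B) : Pot u A :=
  ⟨h.cu, h.u0, h.un, h.cA, h.zA, h.massu⟩

theorem Core.pot_v {u v : ℝ → ℝ → ℝ} {A B : Set (ℝ × ℝ)} (h : Core u v A B) : Pot v B :=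
  ⟨h.cv, h.v0, h.vn, h.cB, h.zB, h.massv⟩

theorem HS.volume_ball_inter {u : ℝ → ℝ → ℝ} {A : Set (ℝ × ℝ)} {κ r : ℝ} {X : Bx} (hP : Pot u A)
    (hκ : 0 < κ) (hκ1 : κ ≤ 1) (h : HS u A κ X) (hr : 0 < r) (hr1 : r ≤ 1) :
    ENNReal.ofReal (4 * (r * κ / 2 * κ) ^ 2 * X.h) ≤
      volume ({z : ℝ × ℝ | X.g z.1 z.2 ≤ r} ∩ A) := by
  obtain ⟨a₀, b₀, hfat⟩ := h.fat
  obtain ⟨⟨a, b⟩, hab, haA⟩ : ∃ z : ℝ × ℝ, X.g z.1 z.2 < r / 2 ∧ z ∈ A := by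
    have ho : IsOpen {z : ℝ × ℝ | X.g z.1 z.2 < r / 2} := isOpen_lt X.continuous_g continuous_const
    obtain ⟨z, hz, hzA⟩ := mem_closure_iff.1 hP.zA _ ho (by simp [Bx.g, hr])
    exact ⟨z, hz, hzA⟩
  obtain ⟨μ, hμ⟩ : ∃ μ, μ = r * κ / 2 := ⟨_, rfl⟩
  have hμ0 : 0 < μ := by rw [hμ]; positivity
  have hrκ : r * κ ≤ 1 := mul_le_one₀ hr1 hκ.le hκ1
  have hμ1 : μ ≤ 1 := by rw [hμ]; linarith
  rw [← hμ, ← X.volume_ball ((1 - μ) * a + μ * a₀) ((1 - μ) * b + μ * b₀) (by positivity)]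
  refine measure_mono fun z hz => ?_
  obtain ⟨s, hs⟩ : ∃ s, s = (z.1 - (1 - μ) * a) / μ := ⟨_, rfl⟩
  obtain ⟨t, ht⟩ : ∃ t, t = (z.2 - (1 - μ) * b) / μ := ⟨_, rfl⟩
  have hz1 : z.1 = (1 - μ) * a + μ * s := by rw [hs]; field_simp; ring
  have hz2 : z.2 = (1 - μ) * b + μ * t := by rw [ht]; field_simp; ring
  have hz' : X.g (z.1 - ((1 - μ) * a + μ * a₀)) (z.2 - ((1 - μ) * b + μ * b₀)) ≤ μ * κ := hz
  have hst := hfat s t (by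
    rw [hz1, hz2, show (1 - μ) * a + μ * s - ((1 - μ) * a + μ * a₀) = μ * (s - a₀) by ring,
      show (1 - μ) * b + μ * t - ((1 - μ) * b + μ * b₀) = μ * (t - b₀) by ring, X.g_mul,
      abs_of_pos hμ0] at hz'
    exact le_of_mul_le_mul_left hz' hμ0)
  refine ⟨?_, ?_⟩
  · change X.g z.1 z.2 ≤ r
    rw [hz1, hz2]
    have h1 := X.g_add ((1 - μ) * a) ((1 - μ) * b) (μ * s) (μ * t)
    rw [X.g_mul, X.g_mul, abs_of_pos hμ0, abs_of_nonneg (by linarith)] at h1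
    have h2 : (1 - μ) * X.g a b ≤ 1 * (r / 2) :=
      mul_le_mul (by linarith) hab.le (X.g_nonneg _ _) zero_le_one
    have h3 : μ * X.g s t ≤ μ * (1 / κ) := mul_le_mul_of_nonneg_left hst.2 hμ0.le
    have h4 : μ * (1 / κ) = r / 2 := by rw [hμ]; field_simp
    linarith
  · have := hP.cA haA hst.1 (by linarith : 0 ≤ 1 - μ) hμ0.le (by ring)
    convert this using 1
    ext
    · simp [hz1]
    · simp [hz2]

theorem volume_slab_inter_le {z₁ z₂ w₁ w₂ h p q : ℝ} (hdet : z₁ * w₂ - z₂ * w₁ = h) (hh : 0 < h)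
    (hp : 0 < p) (hq : 0 < q) :
    volume {y : ℝ × ℝ | |z₁ * y.1 + z₂ * y.2| ≤ p ∧ |w₁ * y.1 + w₂ * y.2| ≤ q} ≤
      ENNReal.ofReal (4 * (p * q / h)) := by
  let X : Bx := ⟨z₁ / p, z₂ / p, w₁ / q, w₂ / q, p * q / h, by positivity, by
    rw [← hdet]; have : z₁ * w₂ - z₂ * w₁ ≠ 0 := by rw [hdet]; exact hh.ne'
    field_simp⟩
  have h1 := X.volume_ball 0 0 zero_le_one
  have h2 : 4 * 1 ^ 2 * X.h = 4 * (p * q / h) := by simp [X]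
  rw [← h2, ← h1]
  refine measure_mono fun y hy => Bx.g_le.2 ?_
  simp only [X, sub_zero]
  rw [show z₁ / p * y.1 + z₂ / p * y.2 = (z₁ * y.1 + z₂ * y.2) / p by ring,
    show w₁ / q * y.1 + w₂ / q * y.2 = (w₁ * y.1 + w₂ * y.2) / q by ring, abs_div, abs_div,
    abs_of_pos hp, abs_of_pos hq]
  exact ⟨(div_le_one hp).2 hy.1, (div_le_one hq).2 hy.2⟩

theorem Sb.comp_planar {u : ℝ → ℝ → ℝ} {c h z₁ z₂ w₁ w₂ s t y₁ y₂ : ℝ} (hh : 0 < h)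
    (hs : Sb u (c * (s * z₁ + t * w₁)) (c * (s * z₂ + t * w₂)) y₁ y₂) :
    Sb (fun s t => u (c * (s * z₁ + t * w₁)) (c * (s * z₂ + t * w₂)) / h) s t
      (c * (z₁ * y₁ + z₂ * y₂) / h) (c * (w₁ * y₁ + w₂ * y₂) / h) := by
  intro s' t'
  have h1 := hs (c * (s' * z₁ + t' * w₁)) (c * (s' * z₂ + t' * w₂))
  rw [show u (c * (s * z₁ + t * w₁)) (c * (s * z₂ + t * w₂)) / h +
      c * (z₁ * y₁ + z₂ * y₂) / h * (s' - s) + c * (w₁ * y₁ + w₂ * y₂) / h * (t' - t) =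
      (u (c * (s * z₁ + t * w₁)) (c * (s * z₂ + t * w₂)) +
        y₁ * (c * (s' * z₁ + t' * w₁) - c * (s * z₁ + t * w₁)) +
        y₂ * (c * (s' * z₂ + t' * w₂) - c * (s * z₂ + t * w₂))) / h by ring]
  exact div_le_div_of_nonneg_right h1 hh.le

theorem Cvx.comp_planar {u : ℝ → ℝ → ℝ} (hu : Cvx u) {c h z₁ z₂ w₁ w₂ : ℝ} (hh : 0 < h) :
    Cvx (fun s t => u (c * (s * z₁ + t * w₁)) (c * (s * z₂ + t * w₂)) / h) := by
  intro a b a' b' t h0 h1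
  have := hu.combo h0 h1 (a := c * (a * z₁ + b * w₁)) (b := c * (a * z₂ + b * w₂))
    (c := c * (a' * z₁ + b' * w₁)) (d := c * (a' * z₂ + b' * w₂))
    (x := c * (((1 - t) * a + t * a') * z₁ + ((1 - t) * b + t * b') * w₁))
    (y := c * (((1 - t) * a + t * a') * z₂ + ((1 - t) * b + t * b') * w₂)) (by ring) (by ring)
  simp only
  rw [← mul_div_assoc, ← mul_div_assoc, ← add_div]
  gcongr

/-- The normalizing parallelograms shrink by any prescribed factor after boundedly many scales. -/
theorem exists_contraction (κ K : ℝ) (hκ : 0 < κ) (hκ1 : κ ≤ 1) (hK : 0 < K) :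
    ∃ n : ℕ, ∀ (u : ℝ → ℝ → ℝ) (A : Set (ℝ × ℝ)), Pot u A → ∀ X : ℕ → Bx,
      (∀ k ≤ n, HS u A κ (X k)) → (∀ k ≤ n, (X k).h = (X 0).h * (1 / 4) ^ k) →
      ∀ a b, K * (X 0).g a b ≤ (X n).g a b := by
  obtain ⟨D, hD⟩ : ∃ D, D = 2 / κ ^ 3 := ⟨_, rfl⟩
  have hD2 : 2 ≤ D := by
    rw [hD, le_div_iff₀ (by positivity)]
    have : κ ^ 3 ≤ 1 := pow_le_one₀ hκ.le hκ1
    linarith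
  obtain ⟨c, hc⟩ : ∃ c, c = κ / (D * (1 + K)) := ⟨_, rfl⟩
  have hc0 : 0 < c := by rw [hc]; positivity
  have hc1 : c ≤ 1 := by
    rw [hc, div_le_one (by positivity)]
    nlinarith
  have hcD : c * (D * (1 + K)) = κ := by rw [hc]; field_simp
  obtain ⟨r, hr⟩ : ∃ r, r = c / (8 * (D * (1 + K))) := ⟨_, rfl⟩
  have hr0 : 0 < r := by rw [hr]; positivity
  have hrD : r * (8 * (D * (1 + K))) = c := by rw [hr]; field_simp
  have hr1 : r ≤ 1 := by
    rw [hr, div_le_one (by positivity)]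
    nlinarith
  obtain ⟨ν, hν⟩ : ∃ ν, ν = r * κ / 2 * κ := ⟨_, rfl⟩
  have hν0 : 0 < ν := by rw [hν]; positivity
  obtain ⟨n, hn⟩ := Cvx.exists_flat_scale (1 / κ) (ν ^ 2 * c ^ 2 * κ / 4) (by positivity)
    (by positivity)
  refine ⟨n, fun u A hP X hX hXh a b => ?_⟩
  by_contra hcon
  push Not at hcon
  have hh0 := (X 0).hh
  have up : ∀ k ≤ n, ∀ a b, (X k).g a b ≤ D * (X n).g a b := by
    intro k hk a b
    have h1 := (hX n le_rfl).g_le_mul hP.cu hP.u0 hκ (hX k hk) (t := κ / 2) (by positivity)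
      (by linarith) (by
        rw [hXh n le_rfl, hXh k hk]
        have : ((1 : ℝ) / 4) ^ n ≤ (1 / 4) ^ k := pow_le_pow_of_le_one (by norm_num) (by norm_num) hk
        have h3 : (X 0).h * (1 / 4) ^ n ≤ (X 0).h * (1 / 4) ^ k := by gcongr
        have h4 : 0 < (X 0).h * (1 / 4) ^ n := by positivity
        have h5 : κ / 2 * ((X 0).h * (1 / 4) ^ n / κ) = (X 0).h * (1 / 4) ^ n / 2 := by field_simp
        linarith) a b
    rwa [show 1 / (κ ^ 2 * (κ / 2)) = D by rw [hD]; field_simp] at h1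
  have down : ∀ k ≤ n, ∀ a b, (X k).g a b * (1 / 4) ^ k ≤ D * (X 0).g a b := by
    intro k hk a b
    have hpk : (0 : ℝ) < (1 / 4) ^ k := by positivity
    have hpk1 : ((1 : ℝ) / 4) ^ k ≤ 1 := pow_le_one₀ (by norm_num) (by norm_num)
    have h1 := (hX 0 (Nat.zero_le _)).g_le_mul hP.cu hP.u0 hκ (hX k hk) (t := κ / 2 * (1 / 4) ^ k)
      (by positivity) (mul_le_one₀ (by linarith) hpk.le hpk1) (by
        rw [hXh k hk]
        have h4 : 0 < (X 0).h * (1 / 4) ^ k := by positivity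
        have h5 : κ / 2 * (1 / 4) ^ k * ((X 0).h / κ) = (X 0).h * (1 / 4) ^ k / 2 := by field_simp
        linarith) a b
    calc (X k).g a b * (1 / 4) ^ k
        ≤ 1 / (κ ^ 2 * (κ / 2 * (1 / 4) ^ k)) * (X 0).g a b * (1 / 4) ^ k := by gcongr
      _ = D * (X 0).g a b := by rw [hD]; field_simp
  have hgn : 0 < (X n).g a b := by
    rcases ((X n).g_nonneg a b).lt_or_eq with h | h
    · exact h
    · have h1 := up 0 (Nat.zero_le _) a b
      rw [← h] at h1 hcon
      have h2 : K * (X 0).g a b ≤ K * (D * 0) := by gcongr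
      linarith
  obtain ⟨z₁, hz₁⟩ : ∃ z, z = ((X n).g a b)⁻¹ * a := ⟨_, rfl⟩
  obtain ⟨z₂, hz₂⟩ : ∃ z, z = ((X n).g a b)⁻¹ * b := ⟨_, rfl⟩
  have hz : (X n).g z₁ z₂ = 1 := by
    rw [hz₁, hz₂, (X n).g_mul, abs_of_pos (inv_pos.2 hgn), inv_mul_cancel₀ hgn.ne']
  have hz0 : 1 < K * (X 0).g z₁ z₂ := by
    rw [hz₁, hz₂, (X 0).g_mul, abs_of_pos (inv_pos.2 hgn), mul_left_comm, inv_mul_eq_div,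
      one_lt_div hgn]
    exact hcon
  have hz0' : 0 < (X 0).g z₁ z₂ := pos_of_mul_pos_right (zero_lt_one.trans hz0) hK.le
  obtain ⟨w₁, w₂, hdet, hw⟩ := (X 0).exists_dual hz0'
  have hwK : (X 0).g w₁ w₂ ≤ K := hw.trans (by rw [div_le_iff₀ hz0']; exact hz0.le)
  have gz : ∀ k ≤ n, (X k).g z₁ z₂ ≤ D := fun k hk => by
    have := up k hk z₁ z₂; rwa [hz, mul_one] at this
  have gw : ∀ k ≤ n, (X k).g w₁ w₂ * (1 / 4) ^ k ≤ D * K := fun k hk =>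
    (down k hk w₁ w₂).trans (by gcongr)
  obtain ⟨k, hk, hflat⟩ := hn _ (hP.cu.comp_planar (c := c) (z₁ := z₁) (z₂ := z₂) (w₁ := w₁)
    (w₂ := w₂) hh0) (by
      intro k hk s t hs ht
      refine ⟨div_nonneg (hP.un _ _) hh0.le, ?_⟩
      rw [div_le_iff₀ hh0]
      have h1 := (hX k hk).bd (c * (s * z₁ + t * w₁)) (c * (s * z₂ + t * w₂)) (by
        rw [(X k).g_mul, abs_of_pos hc0, ← hcD]
        gcongr
        refine ((X k).g_add _ _ _ _).trans ?_
        rw [(X k).g_mul, (X k).g_mul]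
        have h1 : |s| * (X k).g z₁ z₂ ≤ 1 * D :=
          mul_le_mul hs (gz k hk) ((X k).g_nonneg _ _) zero_le_one
        have h2 : |t| * (X k).g w₁ w₂ ≤ D * K :=
          (mul_le_mul_of_nonneg_right ht ((X k).g_nonneg _ _)).trans
            (by rw [mul_comm]; exact gw k hk)
        linarith)
      refine h1.trans (le_of_eq ?_)
      rw [hXh k hk]; ring)
  have hpk : (0 : ℝ) < (1 / 4) ^ k := by positivity
  have hhk := (X k).hh
  have hsub : {y : ℝ × ℝ | ∃ x ∈ {z : ℝ × ℝ | (X k).g z.1 z.2 ≤ r}, Sb u x.1 x.2 y.1 y.2} ⊆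
      {y : ℝ × ℝ | |z₁ * y.1 + z₂ * y.2| ≤ ν ^ 2 * c * κ / 4 * (X k).h ∧
        |w₁ * y.1 + w₂ * y.2| ≤ 2 * (1 / κ) * (X 0).h / c} := by
    rintro ⟨y₁, y₂⟩ ⟨⟨x₁, x₂⟩, hx, hy⟩
    have hx' : (X k).g x₁ x₂ ≤ r := hx
    obtain ⟨s, hs⟩ : ∃ s, s = (x₁ * w₂ - x₂ * w₁) / (c * (X 0).h) := ⟨_, rfl⟩
    obtain ⟨t, ht⟩ : ∃ t, t = (z₁ * x₂ - z₂ * x₁) / (c * (X 0).h) := ⟨_, rfl⟩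
    have e1 : c * (s * z₁ + t * w₁) = x₁ := by
      rw [hs, ht]; field_simp; linear_combination x₁ * hdet
    have e2 : c * (s * z₂ + t * w₂) = x₂ := by
      rw [hs, ht]; field_simp; linear_combination x₂ * hdet
    have hs4 : |s| ≤ 1 / 4 := by
      rw [hs, abs_div, abs_of_pos (by positivity : 0 < c * (X 0).h), div_le_iff₀ (by positivity)]
      refine ((X k).abs_det_le _ _ _ _).trans ?_
      have h1 : (X k).g x₁ x₂ * ((X k).g w₁ w₂ * (1 / 4) ^ k) ≤ r * (D * K) :=
        mul_le_mul hx' (gw k hk) (mul_nonneg ((X k).g_nonneg _ _) hpk.le) hr0.le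
      have h2 : 2 * (X k).h * ((X k).g x₁ x₂ * (X k).g w₁ w₂) =
          2 * (X 0).h * ((X k).g x₁ x₂ * ((X k).g w₁ w₂ * (1 / 4) ^ k)) := by
        rw [hXh k hk]; ring
      rw [h2, ← hrD]
      have h3 : 2 * (X 0).h * ((X k).g x₁ x₂ * ((X k).g w₁ w₂ * (1 / 4) ^ k)) ≤
        2 * (X 0).h * (r * (D * K)) := by gcongr
      have h4 : 0 ≤ (X 0).h * r * D := by positivity
      linarith
    have ht4 : |t| ≤ (1 / 4) ^ k / 4 := by
      rw [ht, abs_div, abs_of_pos (by positivity : 0 < c * (X 0).h), div_le_iff₀ (by positivity)]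
      refine ((X k).abs_det_le _ _ _ _).trans ?_
      have h1 : (X k).g z₁ z₂ * (X k).g x₁ x₂ ≤ D * r :=
        mul_le_mul (gz k hk) hx' ((X k).g_nonneg _ _) (by linarith)
      have h3 : 2 * (X k).h * ((X k).g z₁ z₂ * (X k).g x₁ x₂) ≤ 2 * (X k).h * (D * r) := by gcongr
      refine h3.trans ?_
      rw [hXh k hk, ← hrD]
      have h4 : 0 ≤ (X 0).h * (1 / 4) ^ k * r * D * K := by positivity
      linarith
    obtain ⟨f1, f2⟩ := hflat s t _ _ hs4 ht4 (Sb.comp_planar hh0 (by rw [e1, e2]; exact hy))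
    rw [abs_div, abs_mul, abs_of_pos hc0, abs_of_pos hh0, div_le_iff₀ hh0] at f1 f2
    refine ⟨?_, ?_⟩
    · refine le_of_mul_le_mul_left (f1.trans (le_of_eq ?_)) hc0
      rw [hXh k hk]; ring
    · rw [le_div_iff₀ hc0]
      linarith
  have hm := hP.massu {z : ℝ × ℝ | (X k).g z.1 z.2 ≤ r}
    (isClosed_le (X k).continuous_g continuous_const).measurableSet
  have h1 := (hX k hk).volume_ball_inter hP hκ hκ1 hr0 hr1
  rw [← hm, ← hν] at h1
  have h2 := h1.trans ((measure_mono hsub).trans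
    (volume_slab_inter_le hdet hh0 (by positivity) (by positivity)))
  rw [ENNReal.ofReal_le_ofReal_iff (by positivity)] at h2
  have h3 : 4 * (ν ^ 2 * c * κ / 4 * (X k).h * (2 * (1 / κ) * (X 0).h / c) / (X 0).h) =
      2 * (ν ^ 2 * (X k).h) := by field_simp
  rw [h3] at h2
  have : 0 < ν ^ 2 * (X k).h := by positivity
  linarith

theorem Sb.mono {u : ℝ → ℝ → ℝ} {a b p q a' b' p' q' : ℝ} (h : Sb u a b p q)
    (h' : Sb u a' b' p' q') : 0 ≤ (a - a') * (p - p') + (b - b') * (q - q') := by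
  have h1 := h a' b'
  have h2 := h' a b
  linarith

theorem Sb.mono_fst {u : ℝ → ℝ → ℝ} {p p' x x' y y' q : ℝ} (h : Sb u p x y q)
    (h' : Sb u p' x' y' q) (hp : p < p') : y ≤ y' := by
  have := h.mono h'
  rw [sub_self, mul_zero, add_zero] at this
  by_contra hc
  push Not at hc
  have := mul_neg_of_neg_of_pos (sub_neg.2 hp) (sub_pos.2 hc)
  linarith

theorem Sb.mono_snd {u : ℝ → ℝ → ℝ} {p x x' y y' q q' : ℝ} (h : Sb u p x y q)
    (h' : Sb u p x' y' q') (hq : q < q') : x ≤ x' := by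
  have := h.mono h'
  rw [sub_self, zero_mul, zero_add] at this
  by_contra hc
  push Not at hc
  have := mul_neg_of_pos_of_neg (sub_pos.2 hc) (sub_neg.2 hq)
  linarith

theorem Sb.mono_snd_le {u : ℝ → ℝ → ℝ} {p x x' y y' q q' : ℝ} (h : Sb u p x y q)
    (h' : Sb u p x' y' q') (hx : x < x') : q ≤ q' := by
  by_contra hc
  push Not at hc
  exact absurd (h'.mono_snd h hc) (not_le.2 hx)

theorem Sb.mono_fst_le {u : ℝ → ℝ → ℝ} {p p' x x' y y' q : ℝ} (h : Sb u p x y q)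
    (h' : Sb u p' x' y' q) (hy : y < y') : p ≤ p' := by
  by_contra hc
  push Not at hc
  exact absurd (h'.mono_fst h hc) (not_le.2 hy)

theorem Sb.exchange {u : ℝ → ℝ → ℝ} {p x x' y y' q : ℝ} (h : Sb u p x y q)
    (h' : Sb u p x' y' q) : Sb u p x y' q := by
  intro s t
  have h1 := h p x'
  have h2 := h' p x
  have h3 := h' s t
  linarith

theorem Core.young {u v : ℝ → ℝ → ℝ} {A B : Set (ℝ × ℝ)} (h : Core u v A B) {p q : ℝ}
    (hB : (p, q) ∈ closure B) (a b : ℝ) : a * p + b * q ≤ u a b + v p q := by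
  have hcl : IsClosed {y : ℝ × ℝ | a * y.1 + b * y.2 ≤ u a b + v y.1 y.2} :=
    isClosed_le (by fun_prop) (continuous_const.add h.vc)
  have hsub : B ⊆ {y : ℝ × ℝ | a * y.1 + b * y.2 ≤ u a b + v y.1 y.2} := by
    rintro ⟨p, q⟩ hy
    obtain ⟨c, d, hcd⟩ := h.vs p q
    have h1 := (h.dualB c d p q hy).2 hcd
    have h2 := h.eqB c d p q hy h1
    have h3 := h1 a b
    simp only [mem_ofPred_eq]
    linarith
  exact closure_minimal hsub hcl hB

/-- A slope in the second variable at a partial minimum extends to a full subgradient. -/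
theorem Cvx.exists_slope {u : ℝ → ℝ → ℝ} (hu : Cvx u) {p x q : ℝ}
    (hmin : ∀ t, u p x - q * x ≤ u p t - q * t) : ∃ y, Sb u p x y q := by
  obtain ⟨w, hw⟩ : ∃ w : ℝ → ℝ → ℝ, ∀ a b, w a b = u a b - q * b - (u p x - q * x) :=
    ⟨_, fun _ _ => rfl⟩
  let S : Set ℝ := {r | ∃ a b, a < p ∧ r = w a b / (a - p)}
  have key : ∀ a b c d, a < p → p < c → w a b / (a - p) ≤ w c d / (c - p) := by
    intro a b c d ha hc
    have hac : 0 < c - a := by linarith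
    have h0 : 0 ≤ (p - a) / (c - a) := div_nonneg (by linarith) hac.le
    have h1 : (p - a) / (c - a) ≤ 1 := (div_le_one hac).2 (by linarith)
    have hθ : (p - a) / (c - a) * (c - a) = p - a := div_mul_cancel₀ _ hac.ne'
    obtain ⟨θ, hθe⟩ : ∃ θ, θ = (p - a) / (c - a) := ⟨_, rfl⟩
    rw [← hθe] at h0 h1 hθ
    have h2 := hu.combo h0 h1 (a := a) (b := b) (c := c) (d := d) (x := p)
      (y := (1 - θ) * b + θ * d) (by linarith) rfl
    have h3 := hmin ((1 - θ) * b + θ * d)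
    have h4 : 0 ≤ (1 - θ) * w a b + θ * w c d := by
      rw [hw, hw]; linarith
    rw [div_le_iff_of_neg (by linarith), div_mul_eq_mul_div, div_le_iff₀ (by linarith)]
    have h5 : 0 ≤ ((1 - θ) * w a b + θ * w c d) * (c - a) := mul_nonneg h4 hac.le
    have h6 : ((1 - θ) * w a b + θ * w c d) * (c - a) = (c - p) * w a b + (p - a) * w c d := by
      linear_combination (w c d - w a b) * hθ
    linarith
  have hne : S.Nonempty := ⟨_, p - 1, 0, by linarith, rfl⟩
  have hbdd : BddAbove S := ⟨w (p + 1) 0 / (p + 1 - p), by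
    rintro r ⟨a, b, ha, rfl⟩
    exact key _ _ _ _ ha (by linarith)⟩
  refine ⟨sSup S, fun s t => ?_⟩
  suffices h : sSup S * (s - p) ≤ w s t by rw [hw] at h; linarith
  rcases lt_trichotomy s p with h | h | h
  · have := le_csSup hbdd ⟨s, t, h, rfl⟩
    rwa [div_le_iff_of_neg (by linarith)] at this
  · rw [h, sub_self, mul_zero, hw]; linarith [hmin t]
  · have : sSup S ≤ w s t / (s - p) := csSup_le hne (by
      rintro r ⟨a, b, ha, rfl⟩
      exact key _ _ _ _ ha h)
    rwa [le_div_iff₀ (by linarith)] at this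

/-- Existence and bounds for the fibres of the partial Legendre transform. -/
theorem Core.fibre {u v : ℝ → ℝ → ℝ} {A B : Set (ℝ × ℝ)} (hc : Core u v A B)
    {p q y₁ y₂ V U R : ℝ} (hy : (y₁, y₂) ∈ closure B) (hq : 0 < q) (hqy : 2 * q ≤ y₂) (hR : 0 < R)
    (hV : v y₁ y₂ + |p * y₁| ≤ V) (hU : ∀ p', |p' - p| ≤ R → u p' 0 ≤ U) :
    (∃ x y, Sb u p x y q) ∧
      ∀ x y, Sb u p x y q → q * |x| ≤ U + V ∧ R * |y| ≤ U + V := by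
  have hV0 : 0 ≤ V := (add_nonneg (hc.vn _ _) (abs_nonneg _)).trans hV
  have hcoer : ∀ x, q * x - u p x ≤ V - q * |x| := by
    intro x
    rcases le_total 0 x with h | h
    · have h1 := hc.young hy p x
      have h2 := neg_abs_le (p * y₁)
      have h3 : x * (2 * q) ≤ x * y₂ := mul_le_mul_of_nonneg_left hqy h
      rw [abs_of_nonneg h]; linarith
    · have := hc.un p x
      rw [abs_of_nonpos h]; linarith
  constructor
  · obtain ⟨r, hr⟩ : ∃ r, r = (U + V) / q := ⟨_, rfl⟩
    have hu0 : u p 0 ≤ U := hU p (by simpa using hR.le)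
    have hU0 := (hc.un p 0).trans hu0
    have hr0 : 0 ≤ r := by rw [hr]; positivity
    have hrq : q * r = U + V := by rw [hr]; field_simp
    have hcont : Continuous fun x => u p x - q * x :=
      (hc.uc.comp (continuous_const.prodMk continuous_id)).sub (by fun_prop)
    obtain ⟨x, hx, hmin⟩ := isCompact_Icc.exists_isMinOn (nonempty_Icc.2 (neg_le_self hr0))
      hcont.continuousOn
    have hglob : ∀ t, u p x - q * x ≤ u p t - q * t := by
      intro t
      by_cases ht : |t| ≤ r
      · exact hmin (abs_le.1 ht)
      · push Not at ht
        have h0 : u p x - q * x ≤ u p 0 - q * 0 := hmin ⟨by linarith, hr0⟩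
        have h1 := hcoer t
        have h2 : q * r ≤ q * |t| := mul_le_mul_of_nonneg_left ht.le hq.le
        linarith
    obtain ⟨y, hy⟩ := hc.cu.exists_slope hglob
    exact ⟨x, y, hy⟩
  · intro x y h
    have h1 := hcoer x
    have h0 : 0 ≤ q * |x| := by positivity
    constructor
    · have h2 := h p 0
      have h3 := hU p (by simpa using hR.le)
      rw [sub_self, mul_zero] at h2
      linarith
    · have h2 := h (p + R) 0
      have h3 := h (p - R) 0
      have h4 := hU (p + R) (by simp [abs_of_pos hR])
      have h5 := hU (p - R) (by simp [abs_of_pos hR])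
      rw [← abs_of_pos hR, ← abs_mul, abs_le]
      constructor <;> linarith

/-- Over the rectangle `[a, b] × [c, d]` the fibres of the partial Legendre transform of `u`
exist and are bounded by `C`. -/
structure Fib (u : ℝ → ℝ → ℝ) (a b c d C : ℝ) : Prop where
  ex : ∀ p ∈ Icc a b, ∀ q ∈ Icc c d, ∃ x y, Sb u p x y q
  bd : ∀ p ∈ Icc a b, ∀ q ∈ Icc c d, ∀ x y, Sb u p x y q → |x| ≤ C ∧ |y| ≤ C

theorem isClosed_fibre {u : ℝ → ℝ → ℝ} (hu : Continuous fun z : ℝ × ℝ => u z.1 z.2) :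
    IsClosed {w : (ℝ × ℝ) × (ℝ × ℝ) | Sb u w.1.1 w.2.1 w.2.2 w.1.2} := by
  have : {w : (ℝ × ℝ) × (ℝ × ℝ) | Sb u w.1.1 w.2.1 w.2.2 w.1.2} = ⋂ s : ℝ, ⋂ t : ℝ,
      {w | u w.1.1 w.2.1 + w.2.2 * (s - w.1.1) + w.1.2 * (t - w.2.1) ≤ u s t} := by
    ext w; simp [Sb, mem_ofPred_eq]
  rw [this]
  refine isClosed_iInter fun s => isClosed_iInter fun t => isClosed_le ?_ continuous_const
  have : Continuous fun w : (ℝ × ℝ) × (ℝ × ℝ) => u w.1.1 w.2.1 :=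
    hu.comp ((continuous_fst.comp continuous_fst).prodMk (continuous_fst.comp continuous_snd))
  fun_prop

theorem measurable_sSup_section {K : Set (ℝ × ℝ)} {S : Set ((ℝ × ℝ) × (ℝ × ℝ))} (hS : IsCompact S)
    (hK : MeasurableSet K) (hne : ∀ z ∈ K, ∃ w, (z, w) ∈ S) {g : ℝ × ℝ → ℝ} (hg : Continuous g) :
    ∃ f : ℝ × ℝ → ℝ, Measurable f ∧ ∀ z ∈ K, ∃ w, (z, w) ∈ S ∧ f z = g w := by
  classical
  have hcomp : ∀ z, IsCompact {r | ∃ w, (z, w) ∈ S ∧ g w = r} := by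
    intro z
    have h1 : {r | ∃ w, (z, w) ∈ S ∧ g w = r} =
        (fun w : (ℝ × ℝ) × (ℝ × ℝ) => g w.2) '' (S ∩ {w | w.1 = z}) := by
      ext r
      constructor
      · rintro ⟨w, hw, rfl⟩
        exact ⟨(z, w), ⟨hw, rfl⟩, rfl⟩
      · rintro ⟨⟨z', w⟩, ⟨hw, rfl⟩, rfl⟩
        exact ⟨w, hw, rfl⟩
    rw [h1]
    exact (hS.inter_right (isClosed_eq continuous_fst continuous_const)).image
      (hg.comp continuous_snd)
  refine ⟨K.indicator fun z => sSup {r | ∃ w, (z, w) ∈ S ∧ g w = r}, ?_, ?_⟩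
  · refine measurable_of_Ici fun r => ?_
    have hc : IsCompact (Prod.fst '' (S ∩ {w | r ≤ g w.2})) :=
      (hS.inter_right (isClosed_le continuous_const (hg.comp continuous_snd))).image continuous_fst
    have h2 : (K.indicator fun z => sSup {r | ∃ w, (z, w) ∈ S ∧ g w = r}) ⁻¹' Ici r =
        (K ∩ Prod.fst '' (S ∩ {w | r ≤ g w.2})) ∪ (Kᶜ ∩ {_z | r ≤ 0}) := by
      ext z
      by_cases hz : z ∈ K
      · simp only [mem_preimage, indicator_of_mem hz, mem_Ici, mem_union, mem_inter_iff, hz,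
          true_and, mem_compl_iff, not_true_eq_false, false_and, or_false]
        obtain ⟨w, hw⟩ := hne z hz
        constructor
        · intro h
          obtain ⟨w', hw', h'⟩ := (hcomp z).sSup_mem ⟨_, w, hw, rfl⟩
          exact ⟨(z, w'), ⟨hw', by rw [mem_ofPred_eq, h']; exact h⟩, rfl⟩
        · rintro ⟨⟨z', w'⟩, ⟨hw', h'⟩, rfl⟩
          exact le_trans h' (le_csSup (hcomp _).bddAbove ⟨w', hw', rfl⟩)
      · simp [hz]
    rw [h2]
    exact (hK.inter hc.isClosed.measurableSet).union (hK.compl.inter (MeasurableSet.const _))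
  · intro z hz
    rw [indicator_of_mem hz]
    obtain ⟨w, hw⟩ := hne z hz
    obtain ⟨w', hw', h'⟩ := (hcomp z).sSup_mem ⟨_, w, hw, rfl⟩
    exact ⟨w', hw', h'.symm⟩

theorem Fib.exists_selection {u : ℝ → ℝ → ℝ} (hu : Continuous fun z : ℝ × ℝ => u z.1 z.2)
    {a b c d C : ℝ} (h : Fib u a b c d C) :
    ∃ X Y : ℝ × ℝ → ℝ, Measurable X ∧ Measurable Y ∧
      ∀ p ∈ Icc a b, ∀ q ∈ Icc c d, Sb u p (X (p, q)) (Y (p, q)) q := by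
  have hS : IsCompact (((Icc a b ×ˢ Icc c d) ×ˢ (Icc (-C) C ×ˢ Icc (-C) C)) ∩
      {w : (ℝ × ℝ) × (ℝ × ℝ) | Sb u w.1.1 w.2.1 w.2.2 w.1.2}) :=
    ((isCompact_Icc.prod isCompact_Icc).prod (isCompact_Icc.prod isCompact_Icc)).inter_right
      (isClosed_fibre hu)
  have hne : ∀ z ∈ Icc a b ×ˢ Icc c d, ∃ w, (z, w) ∈
      ((Icc a b ×ˢ Icc c d) ×ˢ (Icc (-C) C ×ˢ Icc (-C) C)) ∩
      {w : (ℝ × ℝ) × (ℝ × ℝ) | Sb u w.1.1 w.2.1 w.2.2 w.1.2} := by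
    rintro ⟨p, q⟩ ⟨hp, hq⟩
    obtain ⟨x, y, hxy⟩ := h.ex p hp q hq
    have := h.bd p hp q hq x y hxy
    exact ⟨(x, y), ⟨⟨⟨hp, hq⟩, abs_le.1 this.1, abs_le.1 this.2⟩, hxy⟩⟩
  have hK : MeasurableSet (Icc a b ×ˢ Icc c d) := measurableSet_Icc.prod measurableSet_Icc
  obtain ⟨X, hX, hX'⟩ := measurable_sSup_section hS hK hne continuous_fst
  obtain ⟨Y, hY, hY'⟩ := measurable_sSup_section hS hK hne continuous_snd
  refine ⟨X, Y, hX, hY, fun p hp q hq => ?_⟩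
  obtain ⟨w, hw, h1⟩ := hX' (p, q) ⟨hp, hq⟩
  obtain ⟨w', hw', h2⟩ := hY' (p, q) ⟨hp, hq⟩
  rw [h1, h2]
  exact Sb.exchange hw.2 hw'.2

theorem integral_of_slope {φ ψ : ℝ → ℝ} {a b C : ℝ} (hab : a ≤ b)
    (h : ∀ s ∈ Icc a b, ∀ t ∈ Icc a b, φ s + ψ s * (t - s) ≤ φ t)
    (hC : ∀ s ∈ Icc a b, |ψ s| ≤ C) :
    ∫ s in a..b, ψ s = φ b - φ a := by
  have hmono : MonotoneOn ψ (Icc a b) := by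
    intro s hs t ht hst
    rcases hst.eq_or_lt with rfl | hst
    · exact le_rfl
    by_contra hc
    push Not at hc
    have := mul_neg_of_neg_of_pos (sub_neg.2 hc) (sub_pos.2 hst)
    linarith [h s hs t ht, h t ht s hs]
  have hlip : ∀ s ∈ Icc a b, ∀ t ∈ Icc a b, |φ t - φ s - ψ s * (t - s)| ≤ |ψ t - ψ s| * |t - s| := by
    intro s hs t ht
    rw [← abs_mul, abs_of_nonneg (by linarith [h s hs t ht])]
    refine le_trans ?_ (le_abs_self _)
    linarith [h t ht s hs]
  have hlip' : ∀ s ∈ Icc a b, ∀ t ∈ Icc a b, φ s - φ t ≤ C * |s - t| := by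
    intro s hs t ht
    have h1 := h s hs t ht
    have h2 : ψ s * (s - t) ≤ |ψ s| * |s - t| := by rw [← abs_mul]; exact le_abs_self _
    have h3 := mul_le_mul_of_nonneg_right (hC s hs) (abs_nonneg (s - t))
    linarith
  have hcont : ContinuousOn φ (Icc a b) := by
    have : LipschitzOnWith (Real.toNNReal C) φ (Icc a b) :=
      LipschitzOnWith.of_le_add_mul' C fun s hs t ht => by
        have := hlip' s hs t ht
        rw [Real.dist_eq]; linarith
    exact this.continuousOn
  refine integral_eq_of_hasDerivAt_off_countable_of_le φ ψ hab
    hmono.countable_not_continuousWithinAt hcont ?_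
    (MonotoneOn.intervalIntegrable (by rwa [uIcc_of_le hab]))
  rintro x ⟨hx, hx'⟩
  have hxI : x ∈ Icc a b := Ioo_subset_Icc_self hx
  have hnh : Icc a b ∈ nhds x := Icc_mem_nhds hx.1 hx.2
  have hca : ContinuousAt ψ x := by
    by_contra hcon
    exact hx' ⟨hxI, fun hcw => hcon (hcw.continuousAt hnh)⟩
  rw [hasDerivAt_iff_isLittleO, Asymptotics.isLittleO_iff]
  intro ε hε
  filter_upwards [hnh, Metric.continuousAt_iff'.1 hca ε hε] with t ht htε
  rw [Real.dist_eq] at htε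
  rw [Real.norm_eq_abs, Real.norm_eq_abs, smul_eq_mul, mul_comm (t - x)]
  exact (hlip x hxI t ht).trans (mul_le_mul_of_nonneg_right htε.le (abs_nonneg _))

theorem volume_between {f g : ℝ → ℝ} (hf : Measurable f) (hg : Measurable g) {p p' C : ℝ}
    (hp : p ≤ p') (hfC : ∀ s ∈ Icc p p', |f s| ≤ C) (hgC : ∀ s ∈ Icc p p', |g s| ≤ C)
    (hfg : ∀ s ∈ Icc p p', f s ≤ g s) :
    volume {z : ℝ × ℝ | z.1 ∈ Ioo p p' ∧ z.2 ∈ Ioo (f z.1) (g z.1)} =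
        ENNReal.ofReal (∫ s in p..p', (g s - f s)) ∧
      volume {z : ℝ × ℝ | z.1 ∈ Icc p p' ∧ z.2 ∈ Icc (f z.1) (g z.1)} =
        ENNReal.ofReal (∫ s in p..p', (g s - f s)) := by
  have hintg : ∀ k : ℝ → ℝ, Measurable k → (∀ s ∈ Icc p p', |k s| ≤ C) →
      IntegrableOn k (Icc p p') := fun k hk hkC =>
    Measure.integrableOn_of_bounded (by simp) hk.aestronglyMeasurable
      ((ae_restrict_iff' measurableSet_Icc).2 (Filter.Eventually.of_forall hkC))
  have h1 := volume_regionBetween_eq_integral (hintg f hf hfC) (hintg g hg hgC)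
    measurableSet_Icc hfg
  constructor
  · have h2 := volume_regionBetween_eq_integral ((hintg f hf hfC).mono_set Ioo_subset_Icc_self)
      ((hintg g hg hgC).mono_set Ioo_subset_Icc_self) measurableSet_Ioo
      (fun s hs => hfg s (Ioo_subset_Icc_self hs))
    rw [intervalIntegral.integral_of_le hp, integral_Ioc_eq_integral_Ioo]
    exact h2
  · rw [intervalIntegral.integral_of_le hp, ← integral_Icc_eq_integral_Ioc]
    refine Eq.trans ?_ h1
    rw [← Measure.volume_eq_prod, Measure.volume_eq_prod,
      Measure.prod_apply (measurableSet_region_between_cc hf hg measurableSet_Icc),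
      Measure.prod_apply (measurableSet_regionBetween hf hg measurableSet_Icc)]
    congr 1
    ext s
    by_cases hs : s ∈ Icc p p'
    · have e1 : Prod.mk s ⁻¹' {z : ℝ × ℝ | z.1 ∈ Icc p p' ∧ z.2 ∈ Icc (f z.1) (g z.1)} =
          Icc (f s) (g s) := by
        ext x; exact and_iff_right hs
      have e2 : Prod.mk s ⁻¹' regionBetween f g (Icc p p') = Ioo (f s) (g s) := by
        ext x; exact and_iff_right hs
      rw [e1, e2, Real.volume_Icc, Real.volume_Ioo]
    · have e1 : Prod.mk s ⁻¹' {z : ℝ × ℝ | z.1 ∈ Icc p p' ∧ z.2 ∈ Icc (f z.1) (g z.1)} = ∅ := by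
        ext x
        simp only [mem_preimage, mem_ofPred_eq, mem_empty_iff_false, iff_false, not_and]
        exact fun h => absurd h hs
      have e2 : Prod.mk s ⁻¹' regionBetween f g (Icc p p') = ∅ := by
        ext x
        simp only [mem_preimage, regionBetween, mem_ofPred_eq, mem_empty_iff_false, iff_false,
          not_and]
        exact fun h => absurd h hs
      rw [e1, e2]

/-- Every intermediate slope is attained by a fibre. -/
theorem Fib.exists_between {u : ℝ → ℝ → ℝ} {a b c d C : ℝ} (h : Fib u a b c d C) {p p' t y y' η : ℝ}
    (hp : a ≤ p) (hpp : p < p') (hp' : p' ≤ b) (ht : t ∈ Icc c d) {x x' : ℝ} (h1 : Sb u p x y t)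
    (h2 : Sb u p' x' y' t) (hy : y ≤ η) (hy' : η ≤ y') :
    ∃ s ∈ Icc p p', ∃ w, Sb u s w η t := by
  choose! X Y hXY using fun s (hs : s ∈ Icc p p') => h.ex s ⟨hp.trans hs.1, hs.2.trans hp'⟩ t ht
  have hbd := fun s (hs : s ∈ Icc p p') =>
    (h.bd s ⟨hp.trans hs.1, hs.2.trans hp'⟩ t ht _ _ (hXY s hs)).2
  have hlip' : ∀ s ∈ Icc p p', ∀ r ∈ Icc p p',
      (u s (X s) - t * X s) - (u r (X r) - t * X r) ≤ C * |s - r| := by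
    intro s hs r hr
    have h1 := hXY s hs r (X r)
    have h2 : Y s * (s - r) ≤ |Y s| * |s - r| := by rw [← abs_mul]; exact le_abs_self _
    have h3 := mul_le_mul_of_nonneg_right (hbd s hs) (abs_nonneg (s - r))
    linarith
  have hcont : ContinuousOn (fun s => u s (X s) - t * X s) (Icc p p') := by
    have : LipschitzOnWith (Real.toNNReal C) (fun s => u s (X s) - t * X s) (Icc p p') :=
      LipschitzOnWith.of_le_add_mul' C fun s hs r hr => by
        have := hlip' s hs r hr
        rw [Real.dist_eq]; linarith
    exact this.continuousOn
  obtain ⟨s, hs, hmin⟩ := isCompact_Icc.exists_isMinOn (nonempty_Icc.2 hpp.le)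
    (hcont.sub (continuous_const.mul continuous_id).continuousOn : ContinuousOn
      (fun s => u s (X s) - t * X s - η * s) _)
  have hmin' : ∀ r ∈ Icc p p', u s (X s) - t * X s - η * s ≤ u r (X r) - t * X r - η * r :=
    fun r hr => hmin hr
  refine ⟨s, hs, X s, fun r w => ?_⟩
  rcases lt_or_ge r p with hr | hr
  · have e1 := h1 r w
    have e2 := hmin' p ⟨le_rfl, hpp.le⟩
    have e3 := hXY p ⟨le_rfl, hpp.le⟩ p x
    have e4 := mul_le_mul_of_nonneg_right hy (sub_nonneg.2 hr.le)
    linarith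
  rcases lt_or_ge p' r with hr' | hr'
  · have e1 := h2 r w
    have e2 := hmin' p' ⟨hpp.le, le_rfl⟩
    have e3 := hXY p' ⟨hpp.le, le_rfl⟩ p' x'
    have e4 := mul_le_mul_of_nonneg_right hy' (sub_nonneg.2 hr'.le)
    linarith
  · have e1 := hXY r ⟨hr, hr'⟩ r w
    have e2 := hmin' r ⟨hr, hr'⟩
    linarith

theorem volume_swap (S : Set (ℝ × ℝ)) : volume (Prod.swap ⁻¹' S) = volume S := by
  have : MeasurePreserving (MeasurableEquiv.prodComm : ℝ × ℝ ≃ᵐ ℝ × ℝ) :=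
    Measure.measurePreserving_swap
  exact this.measure_preimage_equiv S

/-- The area form of the Cauchy–Riemann equation for the partial Legendre transform. -/
theorem Core.rect_identity {u v : ℝ → ℝ → ℝ} {A B : Set (ℝ × ℝ)} (hc : Core u v A B)
    {a b c d C : ℝ} (h : Fib u a b c d C)
    (hAB : (∀ p ∈ Icc a b, ∀ q ∈ Icc c d, ∀ x y, Sb u p x y q → (p, x) ∈ A) ∨
      ∀ p ∈ Icc a b, ∀ q ∈ Icc c d, ∀ x y, Sb u p x y q → (y, q) ∈ B)
    {X Y : ℝ × ℝ → ℝ} (hX : Measurable X) (hY : Measurable Y)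
    (hXY : ∀ p ∈ Icc a b, ∀ q ∈ Icc c d, Sb u p (X (p, q)) (Y (p, q)) q)
    {p p' q q' : ℝ} (hp : a ≤ p) (hpp : p < p') (hp' : p' ≤ b)
    (hq : c ≤ q) (hqq : q < q') (hq' : q' ≤ d) :
    ∫ s in p..p', (X (s, q') - X (s, q)) = ∫ t in q..q', (Y (p', t) - Y (p, t)) := by
  have hP : ∀ s ∈ Icc p p', s ∈ Icc a b := fun s hs => ⟨hp.trans hs.1, hs.2.trans hp'⟩
  have hQ : ∀ t ∈ Icc q q', t ∈ Icc c d := fun t ht => ⟨hq.trans ht.1, ht.2.trans hq'⟩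
  have hpl : p ∈ Icc p p' := ⟨le_rfl, hpp.le⟩
  have hpr : p' ∈ Icc p p' := ⟨hpp.le, le_rfl⟩
  have hql : q ∈ Icc q q' := ⟨le_rfl, hqq.le⟩
  have hqr : q' ∈ Icc q q' := ⟨hqq.le, le_rfl⟩
  have hS : ∀ s ∈ Icc p p', ∀ t ∈ Icc q q', Sb u s (X (s, t)) (Y (s, t)) t :=
    fun s hs t ht => hXY s (hP s hs) t (hQ t ht)
  have hb := fun s (hs : s ∈ Icc p p') t (ht : t ∈ Icc q q') =>
    h.bd s (hP s hs) t (hQ t ht) _ _ (hS s hs t ht)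
  have hmX : ∀ t, Measurable fun s => X (s, t) := fun t => hX.comp (by fun_prop)
  have hmY : ∀ s, Measurable fun t => Y (s, t) := fun s => hY.comp (by fun_prop)
  have hXle : ∀ s ∈ Icc p p', X (s, q) ≤ X (s, q') := fun s hs =>
    (hS s hs q hql).mono_snd (hS s hs q' hqr) hqq
  have hYle : ∀ t ∈ Icc q q', Y (p, t) ≤ Y (p', t) := fun t ht =>
    (hS p hpl t ht).mono_fst (hS p' hpr t ht) hpp
  obtain ⟨v1, v2⟩ := volume_between (hmX q) (hmX q') hpp.le (fun s hs => (hb s hs q hql).1)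
    (fun s hs => (hb s hs q' hqr).1) hXle
  obtain ⟨w1, w2⟩ := volume_between (hmY p) (hmY p') hqq.le (fun t ht => (hb p hpl t ht).2)
    (fun t ht => (hb p' hpr t ht).2) hYle
  rw [← volume_swap] at w1 w2
  have hI1 : 0 ≤ ∫ s in p..p', (X (s, q') - X (s, q)) :=
    intervalIntegral.integral_nonneg hpp.le fun s hs => sub_nonneg.2 (hXle s hs)
  have hI2 : 0 ≤ ∫ t in q..q', (Y (p', t) - Y (p, t)) :=
    intervalIntegral.integral_nonneg hqq.le fun t ht => sub_nonneg.2 (hYle t ht)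
  have mS1o : MeasurableSet {z : ℝ × ℝ | z.1 ∈ Ioo p p' ∧ z.2 ∈ Ioo (X (z.1, q)) (X (z.1, q'))} :=
    measurableSet_regionBetween (hmX q) (hmX q') measurableSet_Ioo
  have mS1 : MeasurableSet {z : ℝ × ℝ | z.1 ∈ Icc p p' ∧ z.2 ∈ Icc (X (z.1, q)) (X (z.1, q'))} :=
    measurableSet_region_between_cc (hmX q) (hmX q') measurableSet_Icc
  have mS2 : MeasurableSet (Prod.swap ⁻¹'
      {z : ℝ × ℝ | z.1 ∈ Icc q q' ∧ z.2 ∈ Icc (Y (p, z.1)) (Y (p', z.1))}) :=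
    measurable_swap (measurableSet_region_between_cc (hmY p) (hmY p') measurableSet_Icc)
  -- subgradients over the open region between the graphs
  have key : ∀ s x y t, s ∈ Ioo p p' → x ∈ Ioo (X (s, q)) (X (s, q')) → Sb u s x y t →
      t ∈ Icc q q' ∧ y ∈ Icc (Y (p, t)) (Y (p', t)) := by
    intro s x y t hs hx hsb
    have hsI := Ioo_subset_Icc_self hs
    have ht : t ∈ Icc q q' :=
      ⟨(hS s hsI q hql).mono_snd_le hsb hx.1, hsb.mono_snd_le (hS s hsI q' hqr) hx.2⟩
    exact ⟨ht, (hS p hpl t ht).mono_fst hsb hs.1, hsb.mono_fst (hS p' hpr t ht) hs.2⟩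
  apply le_antisymm
  · rw [← ENNReal.ofReal_le_ofReal_iff hI2, ← v1, ← w2]
    rcases hAB with hA | hB
    · have e1 : {z : ℝ × ℝ | z.1 ∈ Ioo p p' ∧ z.2 ∈ Ioo (X (z.1, q)) (X (z.1, q'))} ∩ A =
          {z : ℝ × ℝ | z.1 ∈ Ioo p p' ∧ z.2 ∈ Ioo (X (z.1, q)) (X (z.1, q'))} := by
        refine inter_eq_left.2 ?_
        rintro ⟨s, x⟩ ⟨hs, hx⟩
        obtain ⟨y, t, hsb⟩ := hc.us s x
        exact hA s (hP s (Ioo_subset_Icc_self hs)) t (hQ t (key s x y t hs hx hsb).1) x y hsb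
      rw [← e1, ← hc.massu _ mS1o]
      refine measure_mono ?_
      rintro ⟨y, t⟩ ⟨⟨s, x⟩, ⟨hs, hx⟩, hsb⟩
      exact key s x y t hs hx hsb
    · refine le_trans (measure_mono ?_) ((hc.massv _ mS2).le.trans (measure_mono inter_subset_left))
      rintro ⟨s, x⟩ ⟨hs, hx⟩
      obtain ⟨y, t, hsb⟩ := hc.us s x
      have hk := key s x y t hs hx hsb
      exact ⟨(y, t), hk, (hc.dualB s x y t
        (hB s (hP s (Ioo_subset_Icc_self hs)) t (hQ t hk.1) x y hsb)).1 hsb⟩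
  · rw [← ENNReal.ofReal_le_ofReal_iff hI1, ← v2, ← w1]
    refine le_trans (measure_mono ?_) ((hc.massu _ mS1).le.trans (measure_mono inter_subset_left))
    rintro ⟨y, t⟩ ⟨ht, hy⟩
    have htI : t ∈ Icc q q' := Ioo_subset_Icc_self ht
    obtain ⟨s, hs, x, hsb⟩ := h.exists_between hp hpp hp' (hQ t htI) (hS p hpl t htI)
      (hS p' hpr t htI) hy.1.le hy.2.le
    exact ⟨(s, x), ⟨hs, (hS s hs q hql).mono_snd hsb ht.1, hsb.mono_snd (hS s hs q' hqr) ht.2⟩, hsb⟩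

/-- The conjugated gradient of the partial Legendre transform: `hodo u (p + i q) = y + i x`
where `(y, q)` is a subgradient of `u` at `(p, x)`. -/
def hodo (u : ℝ → ℝ → ℝ) (z : ℂ) : ℂ :=
  Classical.epsilon fun w => Sb u z.re w.im w.re z.im

theorem integral_of_slope' {φ ψ : ℝ → ℝ} {a b C : ℝ}
    (h : ∀ s ∈ Icc a b, ∀ t ∈ Icc a b, φ s + ψ s * (t - s) ≤ φ t)
    (hC : ∀ s ∈ Icc a b, |ψ s| ≤ C) {p p' : ℝ} (hp : p ∈ Icc a b) (hp' : p' ∈ Icc a b) :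
    ∫ s in p..p', ψ s = φ p' - φ p := by
  have key : ∀ p ∈ Icc a b, ∀ p' ∈ Icc a b, p ≤ p' → ∫ s in p..p', ψ s = φ p' - φ p :=
    fun p hp p' hp' hle => integral_of_slope hle
      (fun s hs t ht => h s ⟨hp.1.trans hs.1, hs.2.trans hp'.2⟩ t
        ⟨hp.1.trans ht.1, ht.2.trans hp'.2⟩)
      (fun s hs => hC s ⟨hp.1.trans hs.1, hs.2.trans hp'.2⟩)
  rcases le_total p p' with hle | hle
  · exact key p hp p' hp' hle
  · rw [intervalIntegral.integral_symm, key p' hp' p hp hle, neg_sub]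

theorem HasDerivAt.eq_of_slope_le {φ : ℝ → ℝ} {D y x : ℝ} (hD : HasDerivAt φ D x)
    (h : ∀ᶠ s in nhds x, φ x + y * (s - x) ≤ φ s) : D = y := by
  have h1 : IsLocalMin (fun s => φ s - y * s) x := by
    filter_upwards [h] with s hs
    linarith
  have h2 := h1.hasDerivAt_eq_zero (hD.sub ((hasDerivAt_id x).const_mul y))
  linarith

/-- A function on a rectangle both of whose partial integrals come from the same bounded measurable
`G` is holomorphic. -/
theorem differentiableOn_of_wedge {F : ℂ → ℂ} {G : ℝ → ℝ → ℂ} {a b c d C : ℝ}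
    (hG : Measurable (Function.uncurry G)) (hGC : ∀ s ∈ Icc a b, ∀ t ∈ Icc c d, ‖G s t‖ ≤ C)
    (h1 : ∀ p ∈ Icc a b, ∀ p' ∈ Icc a b, ∀ q ∈ Icc c d,
      F ⟨p', q⟩ - F ⟨p, q⟩ = ∫ s in p..p', G s q)
    (h2 : ∀ p ∈ Icc a b, ∀ q ∈ Icc c d, ∀ q' ∈ Icc c d,
      F ⟨p, q'⟩ - F ⟨p, q⟩ = Complex.I * ∫ t in q..q', G p t) :
    DifferentiableOn ℂ F (Ioo a b ×ℂ Ioo c d) := by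
  have hopen : IsOpen (Ioo a b ×ℂ Ioo c d) := isOpen_Ioo.reProdIm isOpen_Ioo
  have hsub : ∀ {p p' x : ℝ} {a b : ℝ}, p ∈ Icc a b → p' ∈ Icc a b → x ∈ uIcc p p' → x ∈ Icc a b :=
    fun hp hp' hx => (convex_Icc _ _).ordConnected.uIcc_subset hp hp' hx
  have hlip : ∀ z ∈ Icc a b ×ℂ Icc c d, ∀ w ∈ Icc a b ×ℂ Icc c d,
      dist (F w) (F z) ≤ (2 * C) * dist w z := by
    rintro ⟨p, q⟩ ⟨hp, hq⟩ ⟨p', q'⟩ ⟨hp', hq'⟩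
    have e1 : ‖∫ s in p..p', G s q'‖ ≤ C * |p' - p| :=
      intervalIntegral.norm_integral_le_of_norm_le_const fun s hs =>
        hGC s (hsub hp hp' (uIoc_subset_uIcc hs)) q' hq'
    have e2 : ‖Complex.I * ∫ t in q..q', G p t‖ ≤ C * |q' - q| := by
      rw [norm_mul, Complex.norm_I, one_mul]
      exact intervalIntegral.norm_integral_le_of_norm_le_const fun t ht =>
        hGC p hp t (hsub hq hq' (uIoc_subset_uIcc ht))
    rw [← h1 p hp p' hp' q' hq'] at e1
    rw [← h2 p hp q hq q' hq'] at e2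
    have hC0 : 0 ≤ C := (norm_nonneg _).trans (hGC p hp q hq)
    have e3 := Complex.abs_re_le_norm ((⟨p', q'⟩ : ℂ) - ⟨p, q⟩)
    have e4 := Complex.abs_im_le_norm ((⟨p', q'⟩ : ℂ) - ⟨p, q⟩)
    have e5 := norm_add_le (F ⟨p', q'⟩ - F ⟨p, q'⟩) (F ⟨p, q'⟩ - F ⟨p, q⟩)
    rw [sub_add_sub_cancel] at e5
    rw [dist_eq_norm, dist_eq_norm]
    simp only [Complex.sub_re, Complex.sub_im] at e3 e4
    have e6 := mul_le_mul_of_nonneg_left e3 hC0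
    have e7 := mul_le_mul_of_nonneg_left e4 hC0
    linarith
  have hcontC : ContinuousOn F (Icc a b ×ℂ Icc c d) :=
    (LipschitzOnWith.of_dist_le_mul (K := Real.toNNReal (2 * C)) fun w hw z hz => by
      have hC0 : 0 ≤ C := (norm_nonneg _).trans (hGC z.re hz.1 z.im hz.2)
      rw [Real.coe_toNNReal _ (by positivity)]
      exact hlip z hz w hw).continuousOn
  have hcont : ContinuousOn F (Ioo a b ×ℂ Ioo c d) :=
    hcontC.mono fun z hz => ⟨Ioo_subset_Icc_self hz.1, Ioo_subset_Icc_self hz.2⟩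
  refine (Complex.isConservativeOn_and_continuousOn_iff_isDifferentiableOn hopen).1 ⟨?_, hcont⟩
  intro z w hzw
  have hmem : ∀ x ∈ uIcc z.re w.re, ∀ y ∈ uIcc z.im w.im, x ∈ Icc a b ∧ y ∈ Icc c d := by
    intro x hx y hy
    have : (⟨x, y⟩ : ℂ) ∈ Ioo a b ×ℂ Ioo c d := hzw ⟨hx, hy⟩
    exact ⟨Ioo_subset_Icc_self this.1, Ioo_subset_Icc_self this.2⟩
  have hF1 : ∀ y ∈ uIcc z.im w.im, IntervalIntegrable (fun x : ℝ => F ⟨x, y⟩) volume z.re w.re := by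
    intro y hy
    refine ContinuousOn.intervalIntegrable (hcontC.comp ?_ fun x hx => hmem x hx y hy)
    exact (Complex.equivRealProdCLM.symm.continuous.comp
      (continuous_id.prodMk continuous_const)).continuousOn
  have hF2 : ∀ x ∈ uIcc z.re w.re, IntervalIntegrable (fun y : ℝ => F ⟨x, y⟩) volume z.im w.im := by
    intro x hx
    refine ContinuousOn.intervalIntegrable (hcontC.comp ?_ fun y hy => hmem x hx y hy)
    exact (Complex.equivRealProdCLM.symm.continuous.comp
      (continuous_const.prodMk continuous_id)).continuousOn
  rw [← add_eq_zero_iff_eq_neg, Complex.wedgeIntegral_add_wedgeIntegral_eq]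
  have e : ∀ x y : ℝ, (x : ℂ) + y * Complex.I = ⟨x, y⟩ := fun x y => by
    apply Complex.ext <;> simp
  simp only [e]
  have i1 : (∫ x in z.re..w.re, F ⟨x, w.im⟩) - ∫ x in z.re..w.re, F ⟨x, z.im⟩ =
      Complex.I * ∫ x in z.re..w.re, ∫ y in z.im..w.im, G x y := by
    rw [← intervalIntegral.integral_sub (hF1 _ right_mem_uIcc) (hF1 _ left_mem_uIcc),
      ← intervalIntegral.integral_const_mul]
    refine intervalIntegral.integral_congr fun x hx => ?_
    exact h2 x (hmem x hx _ left_mem_uIcc).1 _ (hmem x hx _ left_mem_uIcc).2 _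
      (hmem x hx _ right_mem_uIcc).2
  have i2 : (∫ y in z.im..w.im, F ⟨w.re, y⟩) - ∫ y in z.im..w.im, F ⟨z.re, y⟩ =
      ∫ y in z.im..w.im, ∫ x in z.re..w.re, G x y := by
    rw [← intervalIntegral.integral_sub (hF2 _ right_mem_uIcc) (hF2 _ left_mem_uIcc)]
    refine intervalIntegral.integral_congr fun y hy => ?_
    exact h1 _ (hmem _ left_mem_uIcc y hy).1 _ (hmem _ right_mem_uIcc y hy).1 y
      (hmem _ left_mem_uIcc y hy).2
  have i3 : (∫ x in z.re..w.re, ∫ y in z.im..w.im, G x y) =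
      ∫ y in z.im..w.im, ∫ x in z.re..w.re, G x y := by
    refine intervalIntegral_intervalIntegral_swap ?_
    refine Measure.integrableOn_of_bounded (M := C) ?_ hG.aestronglyMeasurable ?_
    · rw [Measure.volume_eq_prod, Measure.prod_prod, uIoc, uIoc, Real.volume_Ioc, Real.volume_Ioc]
      exact ENNReal.mul_ne_top ENNReal.ofReal_ne_top ENNReal.ofReal_ne_top
    · refine (ae_restrict_iff' (measurableSet_uIoc.prod measurableSet_uIoc)).2
        (Filter.Eventually.of_forall ?_)
      rintro ⟨x, y⟩ ⟨hx, hy⟩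
      have := hmem x (uIoc_subset_uIcc hx) y (uIoc_subset_uIcc hy)
      exact hGC x this.1 y this.2
  rw [smul_eq_mul, smul_eq_mul]
  rw [i3] at i1
  linear_combination Complex.I * i2 - i1

theorem Core.holo {u v : ℝ → ℝ → ℝ} {A B : Set (ℝ × ℝ)} (hc : Core u v A B)
    {a b c d C : ℝ} (h : Fib u a b c d C)
    (hAB : (∀ p ∈ Icc a b, ∀ q ∈ Icc c d, ∀ x y, Sb u p x y q → (p, x) ∈ A) ∨
      ∀ p ∈ Icc a b, ∀ q ∈ Icc c d, ∀ x y, Sb u p x y q → (y, q) ∈ B)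
    {z : ℂ} (hz : z ∈ Ioo a b ×ℂ Ioo c d) :
    DifferentiableAt ℂ (hodo u) z ∧ ∀ x y, Sb u z.re x y z.im → hodo u z = ⟨y, x⟩ := by
  obtain ⟨X, Y, hX, hY, hXY⟩ := h.exists_selection hc.uc
  have hbd := fun p hp q hq => h.bd p hp q hq _ _ (hXY p hp q hq)
  have hC0 : 0 ≤ C := by
    have := hbd z.re (Ioo_subset_Icc_self hz.1) z.im (Ioo_subset_Icc_self hz.2)
    exact (abs_nonneg _).trans this.1
  have ha : a ∈ Icc a b := ⟨le_rfl, (hz.1.1.trans hz.1.2).le⟩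
  have hcc : c ∈ Icc c d := ⟨le_rfl, (hz.2.1.trans hz.2.2).le⟩
  let m : ℝ → ℝ → ℝ := fun p q => u p (X (p, q)) - q * X (p, q)
  let n : ℝ → ℝ → ℝ := fun p q => (∫ s in a..p, X (s, c)) + ∫ t in c..q, Y (p, t)
  have hsub : ∀ {p p' x : ℝ} {a b : ℝ}, p ∈ Icc a b → p' ∈ Icc a b → x ∈ uIcc p p' → x ∈ Icc a b :=
    fun hp hp' hx => (convex_Icc _ _).ordConnected.uIcc_subset hp hp' hx
  have iX1 : ∀ q ∈ Icc c d, ∀ p ∈ Icc a b, ∀ p' ∈ Icc a b,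
      IntervalIntegrable (fun s => X (s, q)) volume p p' := fun q hq p hp p' hp' => by
    refine (intervalIntegrable_iff).2 (Measure.integrableOn_of_bounded (M := C) ?_ ?_ ?_)
    · rw [uIoc, Real.volume_Ioc]; exact ENNReal.ofReal_ne_top
    · exact (hX.comp (by fun_prop)).aestronglyMeasurable
    · exact (ae_restrict_iff' measurableSet_uIoc).2 (Filter.Eventually.of_forall fun s hs =>
        (hbd s (hsub hp hp' (uIoc_subset_uIcc hs)) q hq).1)
  have iY1 : ∀ q ∈ Icc c d, ∀ p ∈ Icc a b, ∀ p' ∈ Icc a b,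
      IntervalIntegrable (fun s => Y (s, q)) volume p p' := fun q hq p hp p' hp' => by
    refine (intervalIntegrable_iff).2 (Measure.integrableOn_of_bounded (M := C) ?_ ?_ ?_)
    · rw [uIoc, Real.volume_Ioc]; exact ENNReal.ofReal_ne_top
    · exact (hY.comp (by fun_prop)).aestronglyMeasurable
    · exact (ae_restrict_iff' measurableSet_uIoc).2 (Filter.Eventually.of_forall fun s hs =>
        (hbd s (hsub hp hp' (uIoc_subset_uIcc hs)) q hq).2)
  have iX2 : ∀ p ∈ Icc a b, ∀ q ∈ Icc c d, ∀ q' ∈ Icc c d,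
      IntervalIntegrable (fun t => X (p, t)) volume q q' := fun p hp q hq q' hq' => by
    refine (intervalIntegrable_iff).2 (Measure.integrableOn_of_bounded (M := C) ?_ ?_ ?_)
    · rw [uIoc, Real.volume_Ioc]; exact ENNReal.ofReal_ne_top
    · exact (hX.comp (by fun_prop)).aestronglyMeasurable
    · exact (ae_restrict_iff' measurableSet_uIoc).2 (Filter.Eventually.of_forall fun s hs =>
        (hbd p hp s (hsub hq hq' (uIoc_subset_uIcc hs))).1)
  have iY2 : ∀ p ∈ Icc a b, ∀ q ∈ Icc c d, ∀ q' ∈ Icc c d,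
      IntervalIntegrable (fun t => Y (p, t)) volume q q' := fun p hp q hq q' hq' => by
    refine (intervalIntegrable_iff).2 (Measure.integrableOn_of_bounded (M := C) ?_ ?_ ?_)
    · rw [uIoc, Real.volume_Ioc]; exact ENNReal.ofReal_ne_top
    · exact (hY.comp (by fun_prop)).aestronglyMeasurable
    · exact (ae_restrict_iff' measurableSet_uIoc).2 (Filter.Eventually.of_forall fun s hs =>
        (hbd p hp s (hsub hq hq' (uIoc_subset_uIcc hs))).2)
  have slope_p : ∀ p ∈ Icc a b, ∀ q ∈ Icc c d, ∀ x y, Sb u p x y q → ∀ p' ∈ Icc a b,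
      m p q + y * (p' - p) ≤ m p' q := by
    intro p hp q hq x y hxy p' hp'
    have e1 := hxy p' (X (p', q))
    have e2 := hXY p hp q hq p x
    simp only [m]; linarith
  have slope_q : ∀ p ∈ Icc a b, ∀ q ∈ Icc c d, ∀ x y, Sb u p x y q → ∀ q' ∈ Icc c d,
      -m p q + x * (q' - q) ≤ -m p q' := by
    intro p hp q hq x y hxy q' hq'
    have e1 := hxy p (X (p, q))
    have e2 := hXY p hp q' hq' p x
    simp only [m]; linarith
  have m1 : ∀ p ∈ Icc a b, ∀ p' ∈ Icc a b, ∀ q ∈ Icc c d,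
      m p' q - m p q = ∫ s in p..p', Y (s, q) := fun p hp p' hp' q hq =>
    (integral_of_slope' (φ := fun p => m p q) (fun s hs t ht => slope_p s hs q hq _ _
      (hXY s hs q hq) t ht) (fun s hs => (hbd s hs q hq).2) hp hp').symm
  have m2 : ∀ p ∈ Icc a b, ∀ q ∈ Icc c d, ∀ q' ∈ Icc c d,
      m p q' - m p q = - ∫ t in q..q', X (p, t) := fun p hp q hq q' hq' => by
    rw [integral_of_slope' (φ := fun q => -m p q) (fun s hs t ht => slope_q p hp s hs _ _
      (hXY p hp s hs) t ht) (fun s hs => (hbd p hp s hs).1) hq hq']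
    ring
  have n2 : ∀ p ∈ Icc a b, ∀ q ∈ Icc c d, ∀ q' ∈ Icc c d,
      n p q' - n p q = ∫ t in q..q', Y (p, t) := fun p hp q hq q' hq' => by
    simp only [n]
    rw [add_sub_add_left_eq_sub, intervalIntegral.integral_interval_sub_left
      (iY2 p hp c hcc q' hq') (iY2 p hp c hcc q hq)]
  have n1' : ∀ p ∈ Icc a b, ∀ p' ∈ Icc a b, ∀ q ∈ Icc c d, p < p' →
      n p' q - n p q = ∫ s in p..p', X (s, q) := fun p hp p' hp' q hq hpp => by
    have e0 := intervalIntegral.integral_interval_sub_left (iX1 c hcc a ha p' hp')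
      (iX1 c hcc a ha p hp)
    have e1 : ∫ s in p..p', (X (s, q) - X (s, c)) = ∫ t in c..q, (Y (p', t) - Y (p, t)) := by
      rcases hq.1.eq_or_lt with rfl | hlt
      · simp
      · exact hc.rect_identity h hAB hX hY hXY hp.1 hpp hp'.2 le_rfl hlt hq.2
    rw [intervalIntegral.integral_sub (iX1 q hq p hp p' hp') (iX1 c hcc p hp p' hp'),
      intervalIntegral.integral_sub (iY2 p' hp' c hcc q hq) (iY2 p hp c hcc q hq)] at e1
    simp only [n]
    linarith
  have n1 : ∀ p ∈ Icc a b, ∀ p' ∈ Icc a b, ∀ q ∈ Icc c d,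
      n p' q - n p q = ∫ s in p..p', X (s, q) := fun p hp p' hp' q hq => by
    rcases lt_trichotomy p p' with hlt | rfl | hlt
    · exact n1' p hp p' hp' q hq hlt
    · simp
    · rw [intervalIntegral.integral_symm, ← n1' p' hp' p hp q hq hlt, neg_sub]
  have ofR : ∀ {k : ℝ → ℝ} {p p' : ℝ}, IntervalIntegrable k volume p p' →
      IntervalIntegrable (fun s => (k s : ℂ)) volume p p' := fun hk => ⟨hk.1.ofReal, hk.2.ofReal⟩
  let F : ℂ → ℂ := fun z => m z.re z.im + n z.re z.im * Complex.I
  let G : ℝ → ℝ → ℂ := fun s t => Y (s, t) + X (s, t) * Complex.I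
  have hF : DifferentiableOn ℂ F (Ioo a b ×ℂ Ioo c d) := by
    refine differentiableOn_of_wedge (G := G) (C := 2 * C) ?_ ?_ ?_ ?_
    · exact (Complex.measurable_ofReal.comp hY).add
        ((Complex.measurable_ofReal.comp hX).mul_const _)
    · intro s hs t ht
      have e1 := norm_add_le (Y (s, t) : ℂ) (X (s, t) * Complex.I)
      rw [norm_mul, Complex.norm_I, mul_one, Complex.norm_real, Complex.norm_real,
        Real.norm_eq_abs, Real.norm_eq_abs] at e1
      have := hbd s hs t ht
      exact e1.trans (by linarith)
    · intro p hp p' hp' q hq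
      simp only [F, G]
      rw [intervalIntegral.integral_add (ofR (iY1 q hq p hp p' hp'))
        ((ofR (iX1 q hq p hp p' hp')).mul_const _), intervalIntegral.integral_mul_const,
        intervalIntegral.integral_ofReal, intervalIntegral.integral_ofReal,
        ← m1 p hp p' hp' q hq, ← n1 p hp p' hp' q hq]
      push_cast; ring
    · intro p hp q hq q' hq'
      simp only [F, G]
      rw [intervalIntegral.integral_add (ofR (iY2 p hp q hq q' hq'))
        ((ofR (iX2 p hp q hq q' hq')).mul_const _), intervalIntegral.integral_mul_const,
        intervalIntegral.integral_ofReal, intervalIntegral.integral_ofReal,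
        ← n2 p hp q hq q' hq', ← neg_neg (∫ t in q..q', X (p, t)), ← m2 p hp q hq q' hq']
      push_cast
      linear_combination (m p q' - m p q : ℂ) * Complex.I_sq
  have hopen : IsOpen (Ioo a b ×ℂ Ioo c d) := isOpen_Ioo.reProdIm isOpen_Ioo
  have hval : ∀ z ∈ Ioo a b ×ℂ Ioo c d, ∀ x y, Sb u z.re x y z.im → deriv F z = ⟨y, x⟩ := by
    rintro ⟨p, q⟩ ⟨hp, hq⟩ x y hxy
    simp only at hp hq hxy
    have hD : HasDerivAt F (deriv F ⟨p, q⟩) ⟨p, q⟩ :=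
      (hF.differentiableAt (hopen.mem_nhds ⟨hp, hq⟩)).hasDerivAt
    have hpI := Ioo_subset_Icc_self hp
    have hqI := Ioo_subset_Icc_self hq
    have d1 : HasDerivAt (fun s : ℝ => (⟨s, q⟩ : ℂ)) 1 p := by
      have := (Complex.ofRealCLM.hasDerivAt (x := p)).add_const ((q : ℂ) * Complex.I)
      simp only [Complex.ofRealCLM_apply, Complex.ofReal_one] at this
      refine this.congr_of_eventuallyEq (Filter.Eventually.of_forall fun s => ?_)
      apply Complex.ext <;> simp
    have d2 : HasDerivAt (fun t : ℝ => (⟨p, t⟩ : ℂ)) Complex.I q := by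
      have := ((Complex.ofRealCLM.hasDerivAt (x := q)).mul_const Complex.I).const_add (p : ℂ)
      simp only [Complex.ofRealCLM_apply, Complex.ofReal_one, one_mul] at this
      refine this.congr_of_eventuallyEq (Filter.Eventually.of_forall fun s => ?_)
      apply Complex.ext <;> simp
    have f1 := (Complex.reCLM.hasFDerivAt.comp_hasDerivAt p (hD.comp p d1)).eq_of_slope_le
      (y := y) (by
        filter_upwards [Icc_mem_nhds hp.1 hp.2] with s hs
        simpa [F] using slope_p p hpI q hqI x y hxy s hs)
    have f2 := (Complex.reCLM.hasFDerivAt.comp_hasDerivAt q (hD.comp q d2)).neg.eq_of_slope_le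
      (y := x) (by
        filter_upwards [Icc_mem_nhds hq.1 hq.2] with s hs
        simpa [F] using slope_q p hpI q hqI x y hxy s hs)
    apply Complex.ext
    · simpa using f1
    · simpa using f2
  have heq : ∀ z ∈ Ioo a b ×ℂ Ioo c d, hodo u z = deriv F z := by
    intro z hz
    obtain ⟨x, y, hxy⟩ := h.ex z.re (Ioo_subset_Icc_self hz.1) z.im (Ioo_subset_Icc_self hz.2)
    have := Classical.epsilon_spec (p := fun w : ℂ => Sb u z.re w.im w.re z.im) ⟨⟨y, x⟩, hxy⟩
    rw [hval z hz _ _ this]; rfl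
  refine ⟨?_, fun x y hxy => by rw [heq z hz, hval z hz x y hxy]⟩
  refine (((hF.deriv hopen).differentiableAt (hopen.mem_nhds hz))).congr_of_eventuallyEq ?_
  filter_upwards [hopen.mem_nhds hz] with w hw using heq w hw

/-- Harnack's inequality between a point of a disc and its centre. -/
theorem harnack_disc {f : ℂ → ℂ} {c w : ℂ} {R : ℝ} (hd : DifferentiableOn ℂ f (ball c R))
    (hn : ∀ z ∈ ball c R, 0 ≤ (f z).re) (hw : w ∈ ball c R) :
    (R - dist w c) * (f c).re ≤ 2 * R * (f w).re ∧
      (R - dist w c) * (f w).re ≤ 2 * R * (f c).re := by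
  have hR : 0 < R := nonempty_ball.1 ⟨_, hw⟩
  have hwR : dist w c < R := hw
  have hdn : 0 ≤ dist w c := dist_nonneg
  -- it suffices to treat `f + t` for small positive `t`
  have key : ∀ t : ℝ, 0 < t → |(f w).re - (f c).re| * R ≤ dist w c * ((f w).re + (f c).re + 2 * t) := by
    intro t ht
    obtain ⟨g, hg⟩ : ∃ g : ℂ → ℂ, g = fun z => f z + t := ⟨_, rfl⟩
    have hgp : ∀ z ∈ ball c R, 0 < (g z).re := fun z hz => by
      rw [hg]; simpa using add_pos_of_nonneg_of_pos (hn z hz) ht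
    have hgd : DifferentiableOn ℂ g (ball c R) := by rw [hg]; exact hd.add_const _
    have hc0 := hgp c (mem_ball_self hR)
    have hne : ∀ z ∈ ball c R, g z + (starRingEnd ℂ) (g c) ≠ 0 := fun z hz h0 => by
      have := congrArg Complex.re h0
      simp only [Complex.add_re, Complex.conj_re, Complex.zero_re] at this
      linarith [hgp z hz]
    have hle : ∀ z ∈ ball c R, ‖g z - g c‖ ≤ ‖g z + (starRingEnd ℂ) (g c)‖ := fun z hz => by
      rw [Complex.norm_def, Complex.norm_def]
      apply Real.sqrt_le_sqrt
      rw [Complex.normSq_apply, Complex.normSq_apply]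
      simp only [Complex.sub_re, Complex.sub_im, Complex.add_re, Complex.add_im, Complex.conj_re,
        Complex.conj_im]
      have := mul_pos (hgp z hz) hc0
      linarith
    have h1 := Complex.dist_le_div_mul_dist_of_mapsTo_ball (R₂ := 1)
      (f := fun z => (g z - g c) / (g z + (starRingEnd ℂ) (g c)))
      ((hgd.sub_const _).div (hgd.add_const _) hne) (by
        intro z hz
        rw [sub_self, zero_div, mem_closedBall_zero_iff, norm_div]
        exact div_le_one_of_le₀ (hle z hz) (norm_nonneg _)) hw
    rw [sub_self, zero_div, dist_zero_right, norm_div,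
      div_le_iff₀ (norm_pos_iff.2 (hne w hw)), one_div] at h1
    have h2 : ‖g w - g c‖ * R ≤ dist w c * ‖g w + (starRingEnd ℂ) (g c)‖ := by
      calc ‖g w - g c‖ * R ≤ R⁻¹ * dist w c * ‖g w + (starRingEnd ℂ) (g c)‖ * R :=
            mul_le_mul_of_nonneg_right h1 hR.le
        _ = dist w c * ‖g w + (starRingEnd ℂ) (g c)‖ := by field_simp
    have h3 := pow_le_pow_left₀ (by positivity) h2 2
    rw [mul_pow, mul_pow, Complex.sq_norm, Complex.sq_norm, Complex.normSq_apply,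
      Complex.normSq_apply] at h3
    simp only [Complex.sub_re, Complex.sub_im, Complex.add_re, Complex.add_im, Complex.conj_re,
        Complex.conj_im] at h3
    have hS : 0 ≤ (g w).re + (g c).re := (add_pos (hgp w hw) hc0).le
    have h4 : dist w c ^ 2 ≤ R ^ 2 := pow_le_pow_left₀ hdn hwR.le 2
    have h5 := mul_le_mul_of_nonneg_right h4 (mul_self_nonneg ((g w).im - (g c).im))
    have h6 : (|(g w).re - (g c).re| * R) ^ 2 ≤ (dist w c * ((g w).re + (g c).re)) ^ 2 := by
      rw [mul_pow, sq_abs, mul_pow]; linarith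
    have h7 := le_of_sq_le_sq h6 (by positivity)
    have e1 : (g w).re = (f w).re + t := by rw [hg]; simp
    have e2 : (g c).re = (f c).re + t := by rw [hg]; simp
    rw [e1, e2] at h7
    rw [add_sub_add_right_eq_sub] at h7
    linarith
  have hlim : |(f w).re - (f c).re| * R ≤ dist w c * ((f w).re + (f c).re) := by
    refine le_of_forall_pos_le_add fun ε hε => ?_
    have := key (ε / (2 * R)) (by positivity)
    have h2 : dist w c * (2 * (ε / (2 * R))) ≤ ε := by
      have : 2 * (ε / (2 * R)) = ε / R := by field_simp
      rw [this, mul_div_assoc', div_le_iff₀ hR, mul_comm]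
      exact mul_le_mul_of_nonneg_left hwR.le hε.le
    linarith
  have e1 := mul_le_mul_of_nonneg_right (neg_abs_le ((f w).re - (f c).re)) hR.le
  have e2 := mul_le_mul_of_nonneg_right (le_abs_self ((f w).re - (f c).re)) hR.le
  have e3 := mul_nonneg (sub_nonneg.2 hwR.le) (hn w hw)
  have e4 := mul_nonneg (sub_nonneg.2 hwR.le) (hn c (mem_ball_self hR))
  constructor <;> linarith

/-- Harnack's inequality in a truncated sector of opening `π / s`. -/
theorem sector_harnack {f : ℂ → ℂ} {s θ R₁ R₀ ρ φ κ : ℝ} (hs : 1 ≤ s) (hR₁ : 0 < R₁)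
    (hf : ∀ r ψ, R₁ < r → r < R₀ → s * |ψ - θ| < Real.pi / 2 →
      DifferentiableAt ℂ f ⟨r * Real.cos ψ, r * Real.sin ψ⟩ ∧
        0 ≤ (f ⟨r * Real.cos ψ, r * Real.sin ψ⟩).re)
    (hκ : 0 < κ) (hφ : κ ≤ Real.cos (s * (φ - θ))) (hφ' : s * |φ - θ| < Real.pi / 2) (hρ : 0 < ρ)
    (h1 : 4 * R₁ ^ s ≤ κ * ρ ^ s) (h0 : 2 * ρ ^ s ≤ κ * R₀ ^ s) (hR₀ : 0 < R₀) :
    κ ^ 3 / 16 * (R₁ / ρ) ^ s * (f ⟨ρ * Real.cos φ, ρ * Real.sin φ⟩).re ≤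
      (f ⟨2 ^ (1 / s) * R₁ * Real.cos θ, 2 ^ (1 / s) * R₁ * Real.sin θ⟩).re := by
  have hs0 : 0 < s := by linarith
  have hκ1 : κ ≤ 1 := hφ.trans (Real.cos_le_one _)
  obtain ⟨T, hT⟩ : ∃ T, T = R₁ ^ s := ⟨_, rfl⟩
  obtain ⟨W, hW⟩ : ∃ W, W = ρ ^ s := ⟨_, rfl⟩
  have hTp : 0 < T := hT ▸ Real.rpow_pos_of_pos hR₁ s
  have hWp : 0 < W := hW ▸ Real.rpow_pos_of_pos hρ s
  have hc0 : W ≤ W / κ := by rw [le_div_iff₀ hκ]; exact mul_le_of_le_one_right hWp.le hκ1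
  have hcκ : W / κ * κ = W := div_mul_cancel₀ _ hκ.ne'
  obtain ⟨c, hc⟩ : ∃ c, c = W / κ := ⟨_, rfl⟩
  rw [← hT, ← hW] at h1
  rw [← hW] at h0
  rw [← hc] at hc0 hcκ
  have hcp : 0 < c := hWp.trans_le hc0
  have hTc : 4 * T ≤ c := h1.trans ((mul_le_of_le_one_left hWp.le hκ1).trans hc0)
  let Z : ℂ → ℂ := fun w => Complex.exp (Complex.log w / s + θ * Complex.I)
  have hZ : ∀ w : ℂ, w ≠ 0 → Z w = ⟨‖w‖ ^ (1 / s) * Real.cos (w.arg / s + θ),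
      ‖w‖ ^ (1 / s) * Real.sin (w.arg / s + θ)⟩ := by
    intro w hw
    have e : Complex.log w / s + θ * Complex.I =
        ((Real.log ‖w‖ / s : ℝ) : ℂ) + ((w.arg / s + θ : ℝ) : ℂ) * Complex.I := by
      rw [Complex.log]; push_cast; ring
    have e2 : ‖w‖ ^ (1 / s) = Real.exp (Real.log ‖w‖ / s) := by
      rw [Real.rpow_def_of_pos (norm_pos_iff.2 hw), mul_one_div]
    simp only [Z]
    rw [e, Complex.exp_add, Complex.exp_mul_I, ← Complex.ofReal_exp, ← e2, ← Complex.ofReal_cos,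
      ← Complex.ofReal_sin]
    generalize Real.cos (w.arg / s + θ) = C
    generalize Real.sin (w.arg / s + θ) = S
    generalize ‖w‖ ^ (1 / s) = N
    apply Complex.ext <;> simp
  -- the disc
  have hdisc : ∀ w ∈ ball (c : ℂ) (c - T), T < w.re ∧ ‖w‖ < 2 * c := by
    intro w hw
    rw [mem_ball, dist_eq_norm] at hw
    have e1 := (Complex.abs_re_le_norm (w - c)).trans_lt hw
    have e2 := abs_lt.1 e1
    rw [Complex.sub_re, Complex.ofReal_re] at e2
    have e3 := norm_add_le (w - c) c
    rw [sub_add_cancel, Complex.norm_real, Real.norm_of_nonneg hcp.le] at e3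
    exact ⟨by linarith, by linarith⟩
  have hpow : ∀ x : ℝ, 0 < x → (x ^ (1 / s)) ^ s = x := fun x hx => by
    rw [← Real.rpow_mul hx.le, one_div, inv_mul_cancel₀ hs0.ne', Real.rpow_one]
  have hsect : ∀ w : ℂ, T < w.re → ‖w‖ < 2 * c → w ≠ 0 ∧ R₁ < ‖w‖ ^ (1 / s) ∧ ‖w‖ ^ (1 / s) < R₀ ∧
      s * |w.arg / s + θ - θ| < Real.pi / 2 := by
    intro w hw hw2
    have hwn : T < ‖w‖ := hw.trans_le ((le_abs_self _).trans (Complex.abs_re_le_norm w))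
    have hwp : 0 < ‖w‖ := hTp.trans hwn
    refine ⟨norm_pos_iff.1 hwp, ?_, ?_, ?_⟩
    · rw [← Real.rpow_lt_rpow_iff hR₁.le (by positivity) hs0, hpow _ hwp, ← hT]; exact hwn
    · rw [← Real.rpow_lt_rpow_iff (by positivity) hR₀.le hs0, hpow _ hwp]
      refine hw2.trans_le ?_
      rw [hc, mul_div_assoc', div_le_iff₀ hκ, mul_comm (R₀ ^ s)]
      exact h0
    · rw [add_sub_cancel_right, abs_div, abs_of_pos hs0, mul_div_cancel₀ _ hs0.ne']
      exact Complex.abs_arg_lt_pi_div_two_iff.2 (Or.inl (hTp.trans hw))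
  have hgd : DifferentiableOn ℂ (fun w => f (Z w)) (ball (c : ℂ) (c - T)) := by
    intro w hw
    obtain ⟨e1, e2⟩ := hdisc w hw
    obtain ⟨e3, e4, e5, e6⟩ := hsect w e1 e2
    have e7 := (hf _ _ e4 e5 e6).1
    rw [← hZ w e3] at e7
    refine DifferentiableAt.differentiableWithinAt (DifferentiableAt.comp w e7 ?_)
    have : DifferentiableAt ℂ Complex.log w :=
      (Complex.hasStrictDerivAt_log (Or.inl (hTp.trans e1))).hasDerivAt.differentiableAt
    exact ((this.div_const _).add_const _).cexp
  have hgn : ∀ w ∈ ball (c : ℂ) (c - T), 0 ≤ (f (Z w)).re := by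
    intro w hw
    obtain ⟨e1, e2⟩ := hdisc w hw
    obtain ⟨e3, e4, e5, e6⟩ := hsect w e1 e2
    rw [hZ w e3]
    exact (hf _ _ e4 e5 e6).2
  -- the bottom point
  have hb1 : dist ((2 * T : ℝ) : ℂ) c = c - 2 * T := by
    rw [Complex.dist_eq, ← Complex.ofReal_sub, Complex.norm_real, Real.norm_eq_abs, abs_sub_comm,
      abs_of_nonneg (by linarith)]
  have hb := (harnack_disc hgd hgn (w := ((2 * T : ℝ) : ℂ)) (by
    rw [mem_ball, hb1]; linarith)).1
  rw [hb1] at hb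
  have hZb : Z ((2 * T : ℝ) : ℂ) =
      ⟨2 ^ (1 / s) * R₁ * Real.cos θ, 2 ^ (1 / s) * R₁ * Real.sin θ⟩ := by
    rw [hZ _ (by rw [Complex.ofReal_ne_zero]; positivity), Complex.arg_ofReal_of_nonneg
      (by positivity), Complex.norm_real, Real.norm_of_nonneg (by positivity),
      Real.mul_rpow (by norm_num) hTp.le, zero_div, zero_add, hT, ← Real.rpow_mul hR₁.le,
      mul_one_div_cancel hs0.ne', Real.rpow_one]
  -- the deep point
  obtain ⟨w, hw⟩ : ∃ w : ℂ, w = W * (Complex.cos ((s * (φ - θ) : ℝ) : ℂ) +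
    Complex.sin ((s * (φ - θ) : ℝ) : ℂ) * Complex.I) := ⟨_, rfl⟩
  have hwarg : w.arg = s * (φ - θ) := by
    rw [hw]
    refine Complex.arg_mul_cos_add_sin_mul_I hWp ?_
    have : |s * (φ - θ)| < Real.pi / 2 := by rw [abs_mul, abs_of_pos hs0]; exact hφ'
    have := abs_lt.1 this
    constructor <;> linarith [Real.pi_pos]
  have hwn : ‖w‖ = W := by
    rw [hw, norm_mul, Complex.norm_cos_add_sin_mul_I, mul_one, Complex.norm_real,
      Real.norm_of_nonneg hWp.le]
  have hwre : w.re = W * Real.cos (s * (φ - θ)) := by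
    rw [hw, ← Complex.ofReal_cos, ← Complex.ofReal_sin]
    generalize Real.cos (s * (φ - θ)) = C
    generalize Real.sin (s * (φ - θ)) = S
    simp
  have hre : κ * W ≤ w.re := by rw [hwre, mul_comm]; exact mul_le_mul_of_nonneg_left hφ hWp.le
  have hreW : w.re ≤ W := by
    rw [hwre]; exact mul_le_of_le_one_right hWp.le (Real.cos_le_one _)
  have hw1 : dist w c ≤ c - w.re / 2 := by
    rw [dist_eq_norm]
    refine le_of_sq_le_sq ?_ (by linarith)
    rw [Complex.sq_norm, Complex.normSq_apply]
    have e1 : w.re * w.re + w.im * w.im = W ^ 2 := by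
      rw [← Complex.normSq_apply, ← Complex.sq_norm, hwn]
    simp only [Complex.sub_re, Complex.sub_im, Complex.ofReal_re, Complex.ofReal_im, sub_zero]
    have e2 : W ^ 2 ≤ c * w.re := by
      calc W ^ 2 = c * (κ * W) := by rw [← mul_assoc, hcκ, sq]
        _ ≤ c * w.re := mul_le_mul_of_nonneg_left hre hcp.le
    linarith [sq_nonneg w.re]
  have hmem : w ∈ ball (c : ℂ) (c - T) := by
    rw [mem_ball]
    linarith
  have hdp := (harnack_disc hgd hgn hmem).2
  have hZw : Z w = ⟨ρ * Real.cos φ, ρ * Real.sin φ⟩ := by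
    have e1 : W ^ (1 / s) = ρ := by
      rw [hW, ← Real.rpow_mul hρ.le, mul_one_div_cancel hs0.ne', Real.rpow_one]
    rw [hZ w (norm_pos_iff.1 (by rw [hwn]; exact hWp)), hwn, hwarg, e1,
      mul_div_cancel_left₀ _ hs0.ne', sub_add_cancel]
  simp only [hZb] at hb
  simp only [hZw] at hdp
  have hfw : 0 ≤ (f ⟨ρ * Real.cos φ, ρ * Real.sin φ⟩).re := by
    have := hgn w hmem; simpa only [hZw] using this
  have hfb : 0 ≤ (f ⟨2 ^ (1 / s) * R₁ * Real.cos θ, 2 ^ (1 / s) * R₁ * Real.sin θ⟩).re := by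
    have := hgn ((2 * T : ℝ) : ℂ) (by rw [mem_ball, hb1]; linarith)
    simpa only [hZb] using this
  have hfc := hgn c (mem_ball_self (by linarith))
  rw [Real.div_rpow hR₁.le hρ.le, ← hT, ← hW]
  generalize (f ⟨ρ * Real.cos φ, ρ * Real.sin φ⟩).re = x at *
  generalize (f ⟨2 ^ (1 / s) * R₁ * Real.cos θ, 2 ^ (1 / s) * R₁ * Real.sin θ⟩).re = y at *
  generalize (f (Z c)).re = m at *
  have e1 : κ * W / 4 * x ≤ 2 * c * m := by
    have a1 : κ * W / 4 * x ≤ (c - T - dist w c) * x :=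
      mul_le_mul_of_nonneg_right (by linarith) hfw
    have a2 : 2 * (c - T) * m ≤ 2 * c * m := mul_le_mul_of_nonneg_right (by linarith) hfc
    linarith
  have e2 : T * m ≤ 2 * c * y := by
    have a2 : 2 * (c - T) * y ≤ 2 * c * y := mul_le_mul_of_nonneg_right (by linarith) hfb
    linarith
  have e3 := mul_le_mul_of_nonneg_left e1 hTp.le
  have e4 := mul_le_mul_of_nonneg_left e2 (mul_pos two_pos hcp).le
  have e5 : T * (κ * W / 4 * x) ≤ 4 * c ^ 2 * y := by linarith
  have e6 : κ ^ 3 / 16 * (T / W) * x = T * (κ * W / 4 * x) / (4 * c ^ 2) := by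
    rw [← hcκ]; field_simp; try ring
  rw [e6, div_le_iff₀ (by positivity)]
  linarith

/-- The orthogonal map with first column `(c, s)` and determinant `τ = ± 1`. -/
def orthMap (c s τ : ℝ) (h : c ^ 2 + s ^ 2 = 1) (hτ : τ ^ 2 = 1) : ℝ × ℝ ≃ₜ ℝ × ℝ where
  toFun z := (c * z.1 - τ * s * z.2, s * z.1 + τ * c * z.2)
  invFun z := (c * z.1 + s * z.2, τ * (-s * z.1 + c * z.2))
  left_inv z := by
    ext
    · simp; linear_combination z.1 * h
    · simp; linear_combination (z.2 * τ ^ 2) * h + z.2 * hτ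
  right_inv z := by
    ext
    · simp; linear_combination z.1 * h + (s ^ 2 * z.1 - s * c * z.2) * hτ
    · simp; linear_combination z.2 * h + (c ^ 2 * z.2 - s * c * z.1) * hτ
  continuous_toFun := by fun_prop
  continuous_invFun := by fun_prop

theorem orthMap_measurePreserving (c s τ : ℝ) (h : c ^ 2 + s ^ 2 = 1) (hτ : τ ^ 2 = 1) :
    MeasurePreserving (orthMap c s τ h hτ) := by
  have e : (orthMap c s τ h hτ : ℝ × ℝ → ℝ × ℝ) = planeMap (c, s) (-(τ * s), τ * c) := by
    ext z <;> simp [orthMap, planeMap] <;> ring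
  have hd : |c * (τ * c) - s * -(τ * s)| = 1 := by
    have : c * (τ * c) - s * -(τ * s) = τ := by linear_combination τ * h
    rw [this]
    exact (pow_eq_one_iff_of_nonneg (abs_nonneg τ) two_ne_zero).1 (by rw [sq_abs]; exact hτ)
  rw [e]
  refine ⟨(LinearMap.continuous_of_finiteDimensional _).measurable, ?_⟩
  have hdet := det_planeMap (c, s) (-(τ * s), τ * c)
  simp only at hdet
  rw [Measure.map_linearMap_addHaar_eq_smul_addHaar]
  · rw [hdet, abs_inv, hd]; simp
  · rw [hdet]; intro h0; rw [h0] at hd; simp at hd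

/-- Change of orthonormal frame. -/
theorem Core.orth {u v : ℝ → ℝ → ℝ} {A B : Set (ℝ × ℝ)} (hc : Core u v A B) (c s τ : ℝ)
    (h : c ^ 2 + s ^ 2 = 1) (hτ : τ ^ 2 = 1) :
    Core (fun a b => u (c * a - τ * s * b) (s * a + τ * c * b))
      (fun a b => v (c * a - τ * s * b) (s * a + τ * c * b))
      (orthMap c s τ h hτ ⁻¹' A) (orthMap c s τ h hτ ⁻¹' B) := by
  obtain ⟨φ, hφ⟩ : ∃ φ, φ = orthMap c s τ h hτ := ⟨_, rfl⟩
  have hφe : ∀ a b, φ (a, b) = (c * a - τ * s * b, s * a + τ * c * b) := fun a b => by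
    rw [hφ]; rfl
  have hz : φ (0, 0) = (0, 0) := by rw [hφe]; simp
  have dot : ∀ a b p q : ℝ, (c * a - τ * s * b) * (c * p - τ * s * q) +
      (s * a + τ * c * b) * (s * p + τ * c * q) = a * p + b * q := fun a b p q => by
    linear_combination (a * p + b * q * τ ^ 2) * h + b * q * hτ
  have sb : ∀ {w : ℝ → ℝ → ℝ} {a b p q : ℝ},
      Sb (fun a b => w (c * a - τ * s * b) (s * a + τ * c * b)) a b p q ↔
        Sb w (c * a - τ * s * b) (s * a + τ * c * b) (c * p - τ * s * q) (s * p + τ * c * q) := by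
    intro w a b p q
    have key : ∀ x y : ℝ, (c * p - τ * s * q) * (c * x - τ * s * y - (c * a - τ * s * b)) +
        (s * p + τ * c * q) * (s * x + τ * c * y - (s * a + τ * c * b)) =
        p * (x - a) + q * (y - b) := fun x y => by
      linear_combination dot p q x y - dot p q a b
    constructor
    · intro hs x y
      obtain ⟨z, hz⟩ := φ.surjective (x, y)
      have e := hφe z.1 z.2
      rw [Prod.mk.eta, hz, Prod.mk.injEq] at e
      have := hs z.1 z.2
      have k := key z.1 z.2
      simp only at this
      rw [← e.1, ← e.2] at this k
      linarith
    · intro hs x y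
      have := hs (c * x - τ * s * y) (s * x + τ * c * y)
      have k := key x y
      simp only; linarith
  have ss : ∀ {w : ℝ → ℝ → ℝ}, (∀ a b, ∃ p q, Sb w a b p q) → ∀ a b, ∃ p q,
      Sb (fun a b => w (c * a - τ * s * b) (s * a + τ * c * b)) a b p q := by
    intro w hw a b
    obtain ⟨p, q, hpq⟩ := hw (c * a - τ * s * b) (s * a + τ * c * b)
    obtain ⟨z, hz⟩ := φ.surjective (p, q)
    have e := hφe z.1 z.2
    rw [Prod.mk.eta, hz, Prod.mk.injEq] at e
    exact ⟨z.1, z.2, sb.2 (by rw [← e.1, ← e.2]; exact hpq)⟩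
  have cvx : ∀ {w : ℝ → ℝ → ℝ}, Cvx w →
      Cvx fun a b => w (c * a - τ * s * b) (s * a + τ * c * b) := by
    intro w hw a b a' b' t h0 h1
    have := hw (c * a - τ * s * b) (s * a + τ * c * b) (c * a' - τ * s * b') (s * a' + τ * c * b')
      t h0 h1
    refine le_trans (le_of_eq ?_) this
    simp only
    congr 1 <;> ring
  have cset : ∀ {C : Set (ℝ × ℝ)}, Convex ℝ C → Convex ℝ (φ ⁻¹' C) := by
    intro C hC x hx y hy r t hr ht hrt
    have := hC hx hy hr ht hrt
    rw [mem_preimage]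
    convert this using 1
    rw [show r • x + t • y = (r * x.1 + t * y.1, r * x.2 + t * y.2) from rfl, hφe,
      show x = (x.1, x.2) from rfl, show y = (y.1, y.2) from rfl, hφe, hφe]
    ext <;> simp <;> ring
  have mass : ∀ {w : ℝ → ℝ → ℝ} {C : Set (ℝ × ℝ)}, (∀ E, MeasurableSet E →
      volume {y : ℝ × ℝ | ∃ x ∈ E, Sb w x.1 x.2 y.1 y.2} = volume (E ∩ C)) → ∀ E, MeasurableSet E →
      volume {y : ℝ × ℝ | ∃ x ∈ E, Sb (fun a b => w (c * a - τ * s * b) (s * a + τ * c * b))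
        x.1 x.2 y.1 y.2} = volume (E ∩ φ ⁻¹' C) := by
    intro w C hm E hE
    have hp : MeasurePreserving φ := by rw [hφ]; exact orthMap_measurePreserving c s τ h hτ
    have he := φ.measurableEmbedding
    have h1 := hm (φ '' E) (he.measurableSet_image.2 hE)
    rw [← hp.measure_preimage_emb he, ← hp.measure_preimage_emb he (φ '' E ∩ C), preimage_inter,
      preimage_image_eq _ φ.injective] at h1
    rw [← h1]
    congr 1
    ext y
    constructor
    · rintro ⟨x, hx, hs⟩
      refine ⟨φ x, mem_image_of_mem _ hx, ?_⟩
      rw [show x = (x.1, x.2) from rfl, show y = (y.1, y.2) from rfl, hφe, hφe]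
      exact sb.1 hs
    · rintro ⟨-, ⟨x, hx, rfl⟩, hs⟩
      rw [show x = (x.1, x.2) from rfl, show y = (y.1, y.2) from rfl, hφe, hφe] at hs
      exact ⟨x, hx, sb.2 hs⟩
  have hcont : ∀ {w : ℝ → ℝ → ℝ}, (Continuous fun z : ℝ × ℝ => w z.1 z.2) →
      Continuous fun z : ℝ × ℝ => w (c * z.1 - τ * s * z.2) (s * z.1 + τ * c * z.2) := fun hw =>
    hw.comp (f := fun z : ℝ × ℝ => (c * z.1 - τ * s * z.2, s * z.1 + τ * c * z.2)) (by fun_prop)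
  rw [← hφ]
  exact {
    cu := cvx hc.cu
    cv := cvx hc.cv
    uc := hcont hc.uc
    vc := hcont hc.vc
    us := ss hc.us
    vs := ss hc.vs
    oA := hc.oA.preimage φ.continuous
    oB := hc.oB.preimage φ.continuous
    cA := cset hc.cA
    cB := cset hc.cB
    zA := by rw [← φ.preimage_closure, mem_preimage, hz]; exact hc.zA
    zB := by rw [← φ.preimage_closure, mem_preimage, hz]; exact hc.zB
    nA := by rw [mem_preimage, hz]; exact hc.nA
    nB := by rw [mem_preimage, hz]; exact hc.nB
    u0 := by simp [hc.u0]
    v0 := by simp [hc.v0]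
    un := fun _ _ => hc.un _ _
    vn := fun _ _ => hc.vn _ _
    subB := fun a b p q hs => by
      rw [← φ.preimage_closure, mem_preimage, hφe]; exact hc.subB _ _ _ _ (sb.1 hs)
    subA := fun a b p q hs => by
      rw [← φ.preimage_closure, mem_preimage, hφe]; exact hc.subA _ _ _ _ (sb.1 hs)
    dualA := fun a b p q hm => by
      rw [sb, sb]; rw [mem_preimage, hφe] at hm; exact hc.dualA _ _ _ _ hm
    dualB := fun a b p q hm => by
      rw [sb, sb]; rw [mem_preimage, hφe] at hm; exact hc.dualB _ _ _ _ hm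
    eqA := fun a b p q hm hs => by
      rw [mem_preimage, hφe] at hm
      rw [← dot a b p q]; exact hc.eqA _ _ _ _ hm (sb.1 hs)
    eqB := fun a b p q hm hs => by
      rw [mem_preimage, hφe] at hm
      rw [← dot a b p q]; exact hc.eqB _ _ _ _ hm (sb.1 hs)
    massu := mass hc.massu
    massv := mass hc.massv }

/-- The rectangle with half-side `L` in direction `(c, s)` and `l` in direction `(-s, c)`. -/
def bxOf (c s L l : ℝ) (hcs : c ^ 2 + s ^ 2 = 1) (hL : 0 < L) (hl : 0 < l) : Bx where
  α := c / L
  β := s / L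
  γ := -s / l
  δ := c / l
  h := L * l
  hh := mul_pos hL hl
  hdet := by field_simp; linear_combination hcs

theorem bxOf_g_le {c s L l a b r : ℝ} (hcs : c ^ 2 + s ^ 2 = 1) (hL : 0 < L) (hl : 0 < l) :
    (bxOf c s L l hcs hL hl).g a b ≤ r ↔ |a * c + b * s| ≤ r * L ∧ |-a * s + b * c| ≤ r * l := by
  have e1 : c / L * a + s / L * b = (a * c + b * s) / L := by ring
  have e2 : -s / l * a + c / l * b = (-a * s + b * c) / l := by ring
  rw [Bx.g_le]
  simp only [bxOf]
  rw [e1, e2, abs_div, abs_div, abs_of_pos hL, abs_of_pos hl, div_le_iff₀ hL, div_le_iff₀ hl]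

/-- Normalization of `w` and `A` in the rectangle of direction `(c, s)` and half-sides `L`, `l`. -/
structure Half (w : ℝ → ℝ → ℝ) (A : Set (ℝ × ℝ)) (κ : ℝ) (M : ℝ → ℝ) (c s L l : ℝ) : Prop where
  bd : ∀ K a b, |a * c + b * s| ≤ K * L → |-a * s + b * c| ≤ K * l → w a b ≤ M K * (L * l)
  fat : ∃ a₀ b₀, ∀ a b, |(a - a₀) * c + (b - b₀) * s| ≤ κ * L →
    |-(a - a₀) * s + (b - b₀) * c| ≤ κ * l →
    (a, b) ∈ A ∧ |a * c + b * s| ≤ L / κ ∧ |-a * s + b * c| ≤ l / κ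

/-- A pair of dual potentials together with normalizing rectangles at all dyadic heights. -/
structure Sys (u v : ℝ → ℝ → ℝ) (A B : Set (ℝ × ℝ)) (κ D : ℝ) (M : ℝ → ℝ) (c s L l : ℕ → ℝ) :
    Prop where
  core : Core u v A B
  hκ : 0 < κ
  hκ1 : κ ≤ 1
  hD : 1 ≤ D
  cs : ∀ k, c k ^ 2 + s k ^ 2 = 1
  lpos : ∀ k, 0 < l k
  lL : ∀ k, l k ≤ L k
  Ll : ∀ k, L k * l k = (1 / 4) ^ k
  hu : ∀ k, Half u A κ M (c k) (s k) (L k) (l k)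
  hv : ∀ k, Half v B κ M (-s k) (c k) (L k) (l k)
  up : ∀ k j, L (k + j) ≤ D * L k
  dn : ∀ k, L k ≤ D * L (k + 1)
  rot : ∀ k, |c k * s (k + 1) - s k * c (k + 1)| * L k ≤ D * l k
  dec : ∀ ε, 0 < ε → ∃ n, ∀ k, L (k + n) ≤ ε * L k

theorem bxOf_length {c s L l c' s' L' l' D : ℝ} (hcs : c ^ 2 + s ^ 2 = 1) (hL : 0 < L) (hl : 0 < l)
    (hcs' : c' ^ 2 + s' ^ 2 = 1) (hL' : 0 < L') (hl' : 0 < l') (hlL' : l' ≤ L') (hD : 0 ≤ D)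
    (h : ∀ a b, (bxOf c' s' L' l' hcs' hL' hl').g a b ≤ D * (bxOf c s L l hcs hL hl).g a b) :
    L ≤ 2 * D * L' ∧ |c * s' - s * c'| * L ≤ D * l' := by
  have h1 : (bxOf c s L l hcs hL hl).g (L * c) (L * s) ≤ 1 := by
    rw [bxOf_g_le]
    constructor
    · rw [show L * c * c + L * s * s = L by linear_combination L * hcs, one_mul, abs_of_pos hL]
    · rw [show -(L * c) * s + L * s * c = 0 by ring, one_mul, abs_zero]; exact hl.le
  have h2 : (bxOf c' s' L' l' hcs' hL' hl').g (L * c) (L * s) ≤ D :=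
    (h _ _).trans (mul_le_of_le_one_right hD h1)
  obtain ⟨h3, h4⟩ := (bxOf_g_le hcs' hL' hl').1 h2
  constructor
  · have h5 := sq_le_sq' (neg_le_of_abs_le h3) (le_of_abs_le h3)
    have h6 := sq_le_sq' (neg_le_of_abs_le (h4.trans (mul_le_mul_of_nonneg_left hlL' hD)))
      (le_of_abs_le (h4.trans (mul_le_mul_of_nonneg_left hlL' hD)))
    have h7 : L ^ 2 = (L * c * c' + L * s * s') ^ 2 + (-(L * c) * s' + L * s * c') ^ 2 := by
      linear_combination (-L ^ 2 * (c' ^ 2 + s' ^ 2)) * hcs - L ^ 2 * hcs'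
    refine le_of_sq_le_sq ?_ (by positivity)
    linarith [sq_nonneg (D * L')]
  · rw [← abs_of_pos hL, ← abs_mul, ← abs_neg]
    refine le_trans (le_of_eq ?_) h4
    congr 1; ring

theorem exists_growth {w : ℝ → ℝ → ℝ} {A : Set (ℝ × ℝ)} {κ : ℝ} (hκ : 0 < κ) (hκ1 : κ ≤ 1)
    (hP : Pot w A) {X : ℕ → Bx}
    (hX : ∀ k, HS w A κ (X k)) (hh : ∀ k, (X k).h = (1 / 4) ^ k) (K : ℝ)
    (hbd : ∀ k, ∃ m, ∀ a b, (X k).g a b ≤ K → w a b ≤ m) :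
    ∃ m, ∀ k a b, (X k).g a b ≤ K → w a b ≤ m * (X k).h := by
  obtain ⟨n, hn⟩ := exists_contraction κ ((|K| + 1) / κ) hκ hκ1 (by positivity)
  choose m hm using hbd
  refine ⟨4 ^ n / κ + ∑ k ∈ Finset.range n, |m k| * 4 ^ k, fun k a b hg => ?_⟩
  have h4 : ∀ k : ℕ, (4 : ℝ) ^ k * (1 / 4) ^ k = 1 := fun k => by rw [← mul_pow]; norm_num
  have hS : 0 ≤ ∑ k ∈ Finset.range n, |m k| * (4 : ℝ) ^ k :=
    Finset.sum_nonneg fun i _ => by positivity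
  rw [hh, add_mul]
  rcases lt_or_ge k n with hk | hk
  · have h1 : |m k| * 4 ^ k ≤ ∑ k ∈ Finset.range n, |m k| * (4 : ℝ) ^ k :=
      Finset.single_le_sum (f := fun k => |m k| * (4 : ℝ) ^ k) (fun i _ => by positivity)
        (Finset.mem_range.2 hk)
    have h2 := mul_le_mul_of_nonneg_right h1 (by positivity : (0 : ℝ) ≤ (1 / 4) ^ k)
    rw [mul_assoc, h4, mul_one] at h2
    have h3 : 0 ≤ 4 ^ n / κ * (1 / 4) ^ k := by positivity
    linarith [hm k a b hg, le_abs_self (m k)]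
  · obtain ⟨j, rfl⟩ := Nat.exists_eq_add_of_le' hk
    have h1 := hn w A hP (fun i => X (j + i)) (fun i _ => hX _)
      (fun i _ => by simp only [hh, add_zero, pow_add]) a b
    simp only [add_zero] at h1
    have h2 : (|K| + 1) / κ * (X j).g a b ≤ |K| + 1 :=
      h1.trans (hg.trans ((le_abs_self K).trans (by linarith)))
    have h3 : (X j).g a b ≤ κ := by
      rw [div_mul_eq_mul_div, div_le_iff₀ hκ] at h2
      exact le_of_mul_le_mul_left h2 (by positivity)
    have h5 := (hX j).bd a b h3
    rw [hh] at h5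
    have h6 : 4 ^ n / κ * (1 / 4 : ℝ) ^ (j + n) = (1 / 4) ^ j / κ := by
      rw [pow_add]; linear_combination ((1 / 4) ^ j / κ) * h4 n
    rw [h6]
    linarith [mul_nonneg hS (by positivity : (0 : ℝ) ≤ (1 / 4) ^ (j + n))]

theorem exists_half {w : ℝ → ℝ → ℝ} {A : Set (ℝ × ℝ)} {κ : ℝ} (hκ : 0 < κ) (hκ1 : κ ≤ 1)
    (hP : Pot w A) (hw : Continuous fun z : ℝ × ℝ => w z.1 z.2) {c s L l : ℕ → ℝ}
    (hcs : ∀ k, c k ^ 2 + s k ^ 2 = 1) (hL : ∀ k, 0 < L k) (hl : ∀ k, 0 < l k)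
    (hLl : ∀ k, L k * l k = (1 / 4) ^ k)
    (hX : ∀ k, HS w A κ (bxOf (c k) (s k) (L k) (l k) (hcs k) (hL k) (hl k))) (K : ℝ) :
    ∃ m, ∀ k a b, |a * c k + b * s k| ≤ K * L k → |-a * s k + b * c k| ≤ K * l k →
      w a b ≤ m * (L k * l k) := by
  obtain ⟨m, hm⟩ := exists_growth hκ hκ1 hP hX hLl K (fun k => by
    obtain ⟨R, hR⟩ : ∃ R, R = K * L k + K * l k := ⟨_, rfl⟩
    obtain ⟨m, hm⟩ := (isCompact_Icc.prod isCompact_Icc :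
      IsCompact (Icc (-R) R ×ˢ Icc (-R) R)).bddAbove_image hw.continuousOn
    refine ⟨m, fun a b hg => hm ⟨(a, b), ?_, rfl⟩⟩
    obtain ⟨h1, h2⟩ := (bxOf_g_le (hcs k) (hL k) (hl k)).1 hg
    have hc1 : |c k| ≤ 1 := abs_le_one_iff_mul_self_le_one.2 (by linarith [hcs k, sq_nonneg (s k)])
    have hs1 : |s k| ≤ 1 := abs_le_one_iff_mul_self_le_one.2 (by linarith [hcs k, sq_nonneg (c k)])
    have e1 : a = c k * (a * c k + b * s k) - s k * (-a * s k + b * c k) := by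
      linear_combination -a * hcs k
    have e2 : b = s k * (a * c k + b * s k) + c k * (-a * s k + b * c k) := by
      linear_combination -b * hcs k
    generalize a * c k + b * s k = x at *
    generalize -a * s k + b * c k = y at *
    refine ⟨abs_le.1 ?_, abs_le.1 ?_⟩
    · simp only
      rw [e1, hR]
      refine (abs_sub _ _).trans (add_le_add ?_ ?_) <;> rw [abs_mul]
      · exact (mul_le_of_le_one_left (abs_nonneg _) hc1).trans h1
      · exact (mul_le_of_le_one_left (abs_nonneg _) hs1).trans h2
    · simp only
      rw [e2, hR]
      refine (abs_add_le _ _).trans (add_le_add ?_ ?_) <;> rw [abs_mul]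
      · exact (mul_le_of_le_one_left (abs_nonneg _) hs1).trans h1
      · exact (mul_le_of_le_one_left (abs_nonneg _) hc1).trans h2)
  exact ⟨m, fun k a b h1 h2 => hm k a b ((bxOf_g_le (hcs k) (hL k) (hl k)).2 ⟨h1, h2⟩)⟩

theorem HS.half {w : ℝ → ℝ → ℝ} {A : Set (ℝ × ℝ)} {κ c s L l : ℝ} {M : ℝ → ℝ}
    {hcs : c ^ 2 + s ^ 2 = 1} {hL : 0 < L} {hl : 0 < l} (h : HS w A κ (bxOf c s L l hcs hL hl))
    (hM : ∀ K a b, |a * c + b * s| ≤ K * L → |-a * s + b * c| ≤ K * l → w a b ≤ M K * (L * l)) :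
    Half w A κ M c s L l := by
  refine ⟨hM, ?_⟩
  obtain ⟨a₀, b₀, hf⟩ := h.fat
  refine ⟨a₀, b₀, fun a b h1 h2 => ?_⟩
  obtain ⟨h3, h4⟩ := hf a b ((bxOf_g_le hcs hL hl).2 ⟨h1, h2⟩)
  have h5 := (bxOf_g_le hcs hL hl).1 h4
  rw [one_div_mul_eq_div, one_div_mul_eq_div] at h5
  exact ⟨h3, h5.1, h5.2⟩

theorem Half.mono {w : ℝ → ℝ → ℝ} {A : Set (ℝ × ℝ)} {κ c s L l : ℝ} {M M' : ℝ → ℝ}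
    (h : Half w A κ M c s L l) (hL : 0 < L) (hl : 0 < l) (hM : ∀ K, M K ≤ M' K) :
    Half w A κ M' c s L l :=
  ⟨fun K a b h1 h2 => (h.bd K a b h1 h2).trans
    (mul_le_mul_of_nonneg_right (hM K) (mul_pos hL hl).le), h.fat⟩

theorem exists_sys {u v : ℝ → ℝ → ℝ} {A B : Set (ℝ × ℝ)} {κ : ℝ} (hc : Core u v A B) (hκ : 0 < κ)
    (hκ1 : κ ≤ 1) {c s L l : ℕ → ℝ} (hcs : ∀ k, c k ^ 2 + s k ^ 2 = 1)
    (hsc : ∀ k, (-s k) ^ 2 + c k ^ 2 = 1) (hL : ∀ k, 0 < L k) (hl : ∀ k, 0 < l k)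
    (hlL : ∀ k, l k ≤ L k) (hLl : ∀ k, L k * l k = (1 / 4) ^ k)
    (hX : ∀ k, HS u A κ (bxOf (c k) (s k) (L k) (l k) (hcs k) (hL k) (hl k)))
    (hY : ∀ k, HS v B κ (bxOf (-s k) (c k) (L k) (l k) (hsc k) (hL k) (hl k))) :
    ∃ D M, Sys u v A B κ D M c s L l := by
  choose M₁ hM₁ using exists_half hκ hκ1 hc.pot_u hc.uc hcs hL hl hLl hX
  choose M₂ hM₂ using exists_half hκ hκ1 hc.pot_v hc.vc hsc hL hl hLl hY
  have hlow : ∀ k j a b, (bxOf (c k) (s k) (L k) (l k) (hcs k) (hL k) (hl k)).g a b ≤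
      2 / κ ^ 3 * (bxOf (c (k + j)) (s (k + j)) (L (k + j)) (l (k + j)) (hcs _) (hL _) (hl _)).g
        a b := by
    intro k j a b
    have := (hX (k + j)).g_le_mul hc.cu hc.u0 hκ (hX k) (t := κ / 2) (by linarith) (by linarith) (by
      simp only [bxOf]
      rw [hLl, hLl, pow_add]
      have : (1 / 4 : ℝ) ^ j ≤ 1 := pow_le_one₀ (by norm_num) (by norm_num)
      have h2 : (0 : ℝ) < (1 / 4) ^ k := by positivity
      rw [show κ / 2 * ((1 / 4) ^ k * (1 / 4) ^ j / κ) = (1 / 4 : ℝ) ^ k * (1 / 4) ^ j / 2 by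
        field_simp]
      have := mul_le_mul_of_nonneg_left this h2.le
      linarith) a b
    rwa [show 1 / (κ ^ 2 * (κ / 2)) = 2 / κ ^ 3 by field_simp] at this
  have hup : ∀ k a b, (bxOf (c (k + 1)) (s (k + 1)) (L (k + 1)) (l (k + 1)) (hcs _) (hL _) (hl _)).g
      a b ≤ 8 / κ ^ 3 * (bxOf (c k) (s k) (L k) (l k) (hcs k) (hL k) (hl k)).g a b := by
    intro k a b
    have := (hX k).g_le_mul hc.cu hc.u0 hκ (hX (k + 1)) (t := κ / 8) (by linarith) (by linarith) (by
      simp only [bxOf]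
      rw [hLl, hLl, pow_succ]
      have h2 : (0 : ℝ) < (1 / 4) ^ k := by positivity
      rw [show κ / 8 * ((1 / 4) ^ k / κ) = (1 / 4 : ℝ) ^ k / 8 by field_simp]
      linarith) a b
    rwa [show 1 / (κ ^ 2 * (κ / 8)) = 8 / κ ^ 3 by field_simp] at this
  have hκ3 : 1 ≤ 1 / κ ^ 3 := by
    rw [le_div_iff₀ (by positivity), one_mul]; exact pow_le_one₀ hκ.le hκ1
  have hD8 : 8 / κ ^ 3 = 8 * (1 / κ ^ 3) := by ring
  have hD2 : 2 / κ ^ 3 = 2 * (1 / κ ^ 3) := by ring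
  obtain ⟨E, hE⟩ : ∃ E, E = 1 / κ ^ 3 := ⟨_, rfl⟩
  rw [← hE] at hκ3 hD8 hD2
  simp only [hD8] at hup
  simp only [hD2] at hlow
  have hdn : ∀ k, L k ≤ 16 * E * L (k + 1) ∧
      |c k * s (k + 1) - s k * c (k + 1)| * L k ≤ 8 * E * l (k + 1) := fun k => by
    have := bxOf_length (hcs k) (hL k) (hl k) (hcs _) (hL _) (hl _) (hlL _) (by positivity) (hup k)
    exact ⟨by linarith [this.1], this.2⟩
  have hln : ∀ k, l (k + 1) ≤ 4 * E * l k := fun k => by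
    have h1 := hLl (k + 1)
    rw [pow_succ, ← hLl k] at h1
    have h2 := mul_le_mul_of_nonneg_right (hdn k).1 (hl k).le
    have h3 : L (k + 1) * l (k + 1) ≤ L (k + 1) * (4 * E * l k) := by linarith
    exact le_of_mul_le_mul_left h3 (hL _)
  refine ⟨32 * E ^ 2, fun K => max (M₁ K) (M₂ K), hc, hκ, hκ1, by nlinarith, hcs, hl, hlL, hLl,
    fun k => ((hX k).half (hM₁ · k)).mono (hL k) (hl k) fun K => le_max_left _ _,
    fun k => ((hY k).half (hM₂ · k)).mono (hL k) (hl k) fun K => le_max_right _ _,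
    fun k j => ?_, fun k => ?_, fun k => ?_, fun ε hε => ?_⟩
  · have := (bxOf_length (hcs _) (hL _) (hl _) (hcs _) (hL _) (hl _) (hlL _) (by positivity)
      (hlow k j)).1
    refine this.trans (mul_le_mul_of_nonneg_right ?_ (hL k).le)
    nlinarith
  · refine (hdn k).1.trans (mul_le_mul_of_nonneg_right ?_ (hL _).le)
    nlinarith
  · refine (hdn k).2.trans ?_
    have := mul_le_mul_of_nonneg_left (hln k) (by positivity : 0 ≤ 8 * E)
    linarith
  · obtain ⟨n, hn⟩ := exists_contraction κ (2 / ε) hκ hκ1 (by positivity)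
    refine ⟨n, fun k => ?_⟩
    have := (bxOf_length (hcs _) (hL _) (hl _) (hcs _) (hL _) (hl _) (hlL _)
      (by positivity : 0 ≤ ε / 2) fun a b => by
      have := hn u A hc.pot_u
        (fun i => bxOf (c (k + i)) (s (k + i)) (L (k + i)) (l (k + i)) (hcs _) (hL _) (hl _))
        (fun i _ => hX _) (fun i _ => by
          simp only [bxOf]; rw [hLl, add_zero, hLl, pow_add]) a b
      rw [div_mul_eq_mul_div, div_le_iff₀ hε] at this
      show (bxOf (c k) (s k) (L k) (l k) (hcs k) (hL k) (hl k)).g a b ≤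
        ε / 2 * (bxOf (c (k + n)) (s (k + n)) (L (k + n)) (l (k + n)) (hcs _) (hL _) (hl _)).g a b
      simp only [add_zero] at this
      linarith).1
    linarith

/-- A pair of dual potentials normalized, at a single height, by the coordinate box with half-sides
`L`, `l` (for `u`) and `l`, `L` (for `v`). -/
structure Loc (u v : ℝ → ℝ → ℝ) (A B : Set (ℝ × ℝ)) (κ : ℝ) (M : ℝ → ℝ) (L l : ℝ) : Prop where
  core : Core u v A B
  hκ : 0 < κ
  hκ1 : κ ≤ 1
  lpos : 0 < l
  lL : l ≤ L
  bu : ∀ K a b, |a| ≤ K * L → |b| ≤ K * l → u a b ≤ M K * (L * l)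
  bv : ∀ K a b, |a| ≤ K * l → |b| ≤ K * L → v a b ≤ M K * (L * l)
  fatA : ∃ a₀ b₀, ∀ a b, |a - a₀| ≤ κ * L → |b - b₀| ≤ κ * l →
    (a, b) ∈ A ∧ |a| ≤ L / κ ∧ |b| ≤ l / κ
  fatB : ∃ a₀ b₀, ∀ a b, |a - a₀| ≤ κ * l → |b - b₀| ≤ κ * L →
    (a, b) ∈ B ∧ |a| ≤ l / κ ∧ |b| ≤ L / κ

theorem abs_add_mul_le {a b x y X Y : ℝ} (hx : |x| ≤ X) (hy : |y| ≤ Y) (ha : |a| ≤ 1)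
    (hb : |b| ≤ 1) : |a * x + b * y| ≤ X + Y := by
  refine (abs_add_le _ _).trans (add_le_add ?_ ?_) <;> rw [abs_mul]
  · exact (mul_le_of_le_one_left (abs_nonneg _) ha).trans hx
  · exact (mul_le_of_le_one_left (abs_nonneg _) hb).trans hy

theorem abs_le_one_of_sq {c s : ℝ} (h : c ^ 2 + s ^ 2 = 1) : |c| ≤ 1 ∧ |s| ≤ 1 :=
  ⟨abs_le_one_iff_mul_self_le_one.2 (by linarith [sq_nonneg s]),
    abs_le_one_iff_mul_self_le_one.2 (by linarith [sq_nonneg c])⟩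

theorem orthMap_apply (c s τ : ℝ) (h : c ^ 2 + s ^ 2 = 1) (hτ : τ ^ 2 = 1) (a b : ℝ) :
    orthMap c s τ h hτ (a, b) = (c * a - τ * s * b, s * a + τ * c * b) := rfl

/-- The normalization of `Half` in a nearly aligned frame. -/
theorem Half.frame {w : ℝ → ℝ → ℝ} {A : Set (ℝ × ℝ)} {κ c s L l c₀ s₀ K : ℝ} {M : ℝ → ℝ}
    (h : Half w A κ M c s L l) (hκ : 0 < κ) (hcs : c ^ 2 + s ^ 2 = 1) (hcs₀ : c₀ ^ 2 + s₀ ^ 2 = 1)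
    (hl : 0 < l) (hlL : l ≤ L) (hK : |c₀ * s - s₀ * c| * L ≤ K * l) :
    (∀ x a b, |a| ≤ x * L → |b| ≤ x * l →
      w (c₀ * a - s₀ * b) (s₀ * a + c₀ * b) ≤ M ((K + 2) * x) * (L * l)) ∧
    ∃ a₀ b₀, ∀ a b, |a - a₀| ≤ κ / (K + 2) * L → |b - b₀| ≤ κ / (K + 2) * l →
      (c₀ * a - s₀ * b, s₀ * a + c₀ * b) ∈ A ∧ |a| ≤ L / (κ / (K + 2)) ∧
        |b| ≤ l / (κ / (K + 2)) := by
  have hL : 0 < L := hl.trans_le hlL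
  have hK0 : 0 ≤ K := nonneg_of_mul_nonneg_left ((by positivity : (0 : ℝ) ≤ _).trans hK) hl
  obtain ⟨σ, hσ⟩ : ∃ σ, σ = c₀ * s - s₀ * c := ⟨_, rfl⟩
  obtain ⟨γ, hγ⟩ : ∃ γ, γ = c₀ * c + s₀ * s := ⟨_, rfl⟩
  have hγσ : γ ^ 2 + σ ^ 2 = 1 := by
    rw [hγ, hσ]; linear_combination (c ^ 2 + s ^ 2) * hcs₀ + hcs
  obtain ⟨hγ1, hσ1⟩ := abs_le_one_of_sq hγσ
  rw [← hσ] at hK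
  have hmul : ∀ {x y : ℝ}, 0 ≤ x → |y| ≤ x * L → |σ * y| ≤ x * (K * l) := by
    intro x y hx hy
    rw [abs_mul]
    refine (mul_le_mul_of_nonneg_left hy (abs_nonneg σ)).trans ?_
    linarith [mul_le_mul_of_nonneg_left hK hx]
  have e1 : ∀ a b, (c₀ * a - s₀ * b) * c + (s₀ * a + c₀ * b) * s = γ * a + σ * b := fun a b => by
    rw [hγ, hσ]; ring
  have e2 : ∀ a b, -(c₀ * a - s₀ * b) * s + (s₀ * a + c₀ * b) * c = -(σ * a) + γ * b :=
    fun a b => by rw [hγ, hσ]; ring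
  have hfr : ∀ x a b, 0 ≤ x → |a| ≤ x * L → |b| ≤ x * l → |γ * a + σ * b| ≤ (K + 2) * x * L ∧
      |-(σ * a) + γ * b| ≤ (K + 2) * x * l := by
    intro x a b hx ha hb
    have hxL : 0 ≤ x * L := by positivity
    have hxl : 0 ≤ x * l := by positivity
    constructor
    · have h1 := abs_add_mul_le ha hb hγ1 hσ1
      have h2 := mul_le_mul_of_nonneg_left hlL hx
      linarith [mul_nonneg hK0 hxL]
    · have h1 := abs_add_le (-(σ * a)) (γ * b)
      have h2 := hmul hx ha
      have h3 : |γ * b| ≤ x * l := by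
        rw [abs_mul]; exact (mul_le_of_le_one_left (abs_nonneg _) hγ1).trans hb
      rw [abs_neg] at h1
      linarith
  refine ⟨fun x a b ha hb => ?_, ?_⟩
  · have hx : 0 ≤ x := nonneg_of_mul_nonneg_left ((abs_nonneg a).trans ha) hL
    have := hfr x a b hx ha hb
    exact h.bd _ _ _ (by rw [e1]; exact this.1) (by rw [e2]; exact this.2)
  · obtain ⟨a₀, b₀, hf⟩ := h.fat
    have hr : (K + 2) * (κ / (K + 2)) = κ := by field_simp
    have hr' : ∀ y : ℝ, y / (κ / (K + 2)) = (K + 2) * (1 / κ * y) := fun y => by field_simp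
    refine ⟨c₀ * a₀ + s₀ * b₀, -s₀ * a₀ + c₀ * b₀, fun a b ha hb => ?_⟩
    have h1 := hfr _ _ _ (by positivity) ha hb
    rw [hr, ← e1, ← e2] at h1
    have e3 : c₀ * a - s₀ * b - a₀ = c₀ * (a - (c₀ * a₀ + s₀ * b₀)) -
        s₀ * (b - (-s₀ * a₀ + c₀ * b₀)) := by linear_combination a₀ * hcs₀
    have e4 : s₀ * a + c₀ * b - b₀ = s₀ * (a - (c₀ * a₀ + s₀ * b₀)) +
        c₀ * (b - (-s₀ * a₀ + c₀ * b₀)) := by linear_combination b₀ * hcs₀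
    rw [← e3, ← e4] at h1
    obtain ⟨hA, h2, h3⟩ := hf _ _ h1.1 h1.2
    rw [e1, div_eq_mul_one_div, mul_comm L] at h2
    rw [e2, div_eq_mul_one_div, mul_comm l] at h3
    refine ⟨hA, ?_, ?_⟩
    · have h4 := abs_add_mul_le h2 h3 hγ1 (show |-σ| ≤ 1 by rwa [abs_neg])
      rw [show γ * (γ * a + σ * b) + -σ * (-(σ * a) + γ * b) = a by
        linear_combination a * hγσ] at h4
      rw [hr']
      have h5 : 0 ≤ 1 / κ * L := by positivity
      have h6 := mul_le_mul_of_nonneg_left hlL (by positivity : 0 ≤ 1 / κ)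
      linarith [mul_nonneg hK0 h5]
    · have h4 := abs_add_le (σ * (γ * a + σ * b)) (γ * (-(σ * a) + γ * b))
      rw [show σ * (γ * a + σ * b) + γ * (-(σ * a) + γ * b) = b by
        linear_combination b * hγσ] at h4
      have h5 := hmul (by positivity : 0 ≤ 1 / κ) h2
      have h6 : |γ * (-(σ * a) + γ * b)| ≤ 1 / κ * l := by
        rw [abs_mul]; exact (mul_le_of_le_one_left (abs_nonneg _) hγ1).trans h3
      rw [hr']
      have h7 : 0 ≤ 1 / κ * l := by positivity
      linarith

theorem Sys.loc {u v : ℝ → ℝ → ℝ} {A B : Set (ℝ × ℝ)} {κ D : ℝ} {M : ℝ → ℝ} {c s L l : ℕ → ℝ}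
    (h : Sys u v A B κ D M c s L l) {c₀ s₀ τ K : ℝ} (hcs : c₀ ^ 2 + s₀ ^ 2 = 1) (hτ : τ ^ 2 = 1)
    {k : ℕ} (hK : |c₀ * s k - s₀ * c k| * L k ≤ K * l k) :
    Loc (fun a b => u (c₀ * a - τ * s₀ * b) (s₀ * a + τ * c₀ * b))
      (fun a b => v (c₀ * a - τ * s₀ * b) (s₀ * a + τ * c₀ * b))
      (orthMap c₀ s₀ τ hcs hτ ⁻¹' A) (orthMap c₀ s₀ τ hcs hτ ⁻¹' B) (κ / (K + 2))
      (fun x => M ((K + 2) * x)) (L k) (l k) := by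
  have hτ1 : |τ| = 1 := (pow_eq_one_iff_of_nonneg (abs_nonneg τ) two_ne_zero).1 (by
    rw [sq_abs]; exact hτ)
  have hK0 : 0 ≤ K := by
    have h1 := h.lpos k
    have h2 := h1.trans_le (h.lL k)
    exact nonneg_of_mul_nonneg_left ((by positivity : (0 : ℝ) ≤ _).trans hK) h1
  obtain ⟨hu1, a₀, b₀, hu2⟩ := (h.hu k).frame h.hκ (h.cs k) hcs (h.lpos k) (h.lL k) hK
  obtain ⟨hv1, a₁, b₁, hv2⟩ := (h.hv k).frame (c₀ := -s₀) (s₀ := c₀) (K := K) h.hκ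
    (by linarith [h.cs k]) (by linarith) (h.lpos k) (h.lL k)
    (by convert hK using 3; ring)
  have hτe : ∀ x : ℝ, |τ * x| = |x| := fun x => by rw [abs_mul, hτ1, one_mul]
  refine ⟨h.core.orth c₀ s₀ τ hcs hτ, div_pos h.hκ (by linarith),
    (div_le_one (by linarith)).2 (by linarith [h.hκ1]), h.lpos k, h.lL k, ?_, ?_, ?_, ?_⟩
  · intro x a b ha hb
    have := hu1 x a (τ * b) ha (by rwa [hτe])
    convert this using 2 <;> ring
  · intro x a b ha hb
    have := hv1 x (τ * b) (-a) (by rwa [hτe]) (by rwa [abs_neg])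
    convert this using 2 <;> ring
  · refine ⟨a₀, τ * b₀, fun a b ha hb => ?_⟩
    have h1 := hu2 a (τ * b) ha (by
      rwa [show τ * b - b₀ = τ * (b - τ * b₀) by linear_combination b₀ * hτ, hτe])
    rw [hτe] at h1
    refine ⟨?_, h1.2⟩
    rw [mem_preimage]
    convert h1.1 using 1
    rw [orthMap_apply]
    ext <;> simp <;> ring
  · refine ⟨-b₁, τ * a₁, fun a b ha hb => ?_⟩
    have h1 := hv2 (τ * b) (-a) (by
      rwa [show τ * b - a₁ = τ * (b - τ * a₁) by linear_combination a₁ * hτ, hτe]) (by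
      rwa [show -a - b₁ = -(a - -b₁) by ring, abs_neg])
    rw [hτe, abs_neg] at h1
    refine ⟨?_, h1.2.2, h1.2.1⟩
    rw [mem_preimage]
    convert h1.1 using 1
    rw [orthMap_apply]
    ext <;> simp <;> ring

open Filter Topology

theorem Core.disjoint_flat {u v : ℝ → ℝ → ℝ} {A B : Set (ℝ × ℝ)} (hc : Core u v A B)
    {E : Set (ℝ × ℝ)} (hE : IsOpen E) {y q : ℝ} (h : ∀ z ∈ E, Sb u z.1 z.2 y q) : E ∩ A = ∅ := by
  have hsub : {w : ℝ × ℝ | ∃ z ∈ E, Sb u z.1 z.2 w.1 w.2} ⊆ {(y, q)} := by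
    rintro ⟨y', q'⟩ ⟨z, hz, hs⟩
    have ht : Tendsto (fun t : ℝ => (z.1 + t * (y' - y), z.2 + t * (q' - q))) (𝓝[>] 0) (𝓝 z) := by
      have : Continuous fun t : ℝ => (z.1 + t * (y' - y), z.2 + t * (q' - q)) := by fun_prop
      have := this.tendsto 0
      simp only [zero_mul, add_zero] at this
      exact this.mono_left nhdsWithin_le_nhds
    obtain ⟨t, htE, ht0⟩ := ((ht.eventually (hE.mem_nhds hz)).and self_mem_nhdsWithin).exists
    have h1 := h _ htE z.1 z.2
    have h2 := hs (z.1 + t * (y' - y)) (z.2 + t * (q' - q))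
    simp only at h1 h2
    have h3 : t * ((y' - y) ^ 2 + (q' - q) ^ 2) ≤ 0 := by linarith
    have h4 : (y' - y) ^ 2 + (q' - q) ^ 2 ≤ 0 := by
      by_contra hcon
      push Not at hcon
      exact absurd h3 (not_le.2 (mul_pos ht0 hcon))
    have h5 : (y' - y) ^ 2 = 0 := le_antisymm (by linarith [sq_nonneg (q' - q)]) (sq_nonneg _)
    have h6 : (q' - q) ^ 2 = 0 := le_antisymm (by linarith [sq_nonneg (y' - y)]) (sq_nonneg _)
    rw [mem_singleton_iff, sub_eq_zero.1 (pow_eq_zero_iff two_ne_zero |>.1 h5),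
      sub_eq_zero.1 (pow_eq_zero_iff two_ne_zero |>.1 h6)]
  have h0 : volume (E ∩ A) = 0 := by
    rw [← hc.massu E hE.measurableSet]
    exact measure_mono_null hsub (measure_singleton _)
  exact ((hE.inter hc.oA).measure_eq_zero_iff volume).1 h0

theorem Sb.of_eq {u : ℝ → ℝ → ℝ} {a b p q a' b' : ℝ} (h : Sb u a b p q)
    (he : u a' b' ≤ u a b + p * (a' - a) + q * (b' - b)) : Sb u a' b' p q := fun s t => by
  linarith [h s t]

theorem Sb.combo {u : ℝ → ℝ → ℝ} (hu : Cvx u) {a b p q a' b' θ x y : ℝ} (h : Sb u a b p q)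
    (h' : Sb u a' b' p q) (h0 : 0 ≤ θ) (h1 : θ ≤ 1) (hx : x = (1 - θ) * a + θ * a')
    (hy : y = (1 - θ) * b + θ * b') : Sb u x y p q := by
  refine h.of_eq ?_
  have h2 := hu.combo h0 h1 hx hy
  have h3 := mul_le_mul_of_nonneg_left (h' a b) h0
  rw [hx, hy] at h2 ⊢
  linarith

/-- A horizontal contact segment through `A` forces the fibre over its interior to be a point. -/
theorem Core.fibre_unique {u v : ℝ → ℝ → ℝ} {A B : Set (ℝ × ℝ)} (hc : Core u v A B)
    {a b t y q : ℝ} (hs : ∀ p ∈ Icc a b, Sb u p t y q) {p : ℝ} (hp : p ∈ Ioo a b)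
    (hA : (p, t) ∈ A) {x' y' : ℝ} (h : Sb u p x' y' q) : x' = t ∧ y' = y := by
  have hab : a < b := hp.1.trans hp.2
  have h0 := hs p (Ioo_subset_Icc_self hp)
  constructor
  · by_contra hne
    have h1 : Sb u p x' y q := h.exchange h0
    let θ : ℝ → ℝ := fun r => (r - t) / (x' - t)
    have hx0 : x' - t ≠ 0 := sub_ne_zero.2 hne
    let E : Set (ℝ × ℝ) := {z | 0 < θ z.2 ∧ θ z.2 < 1 ∧ (1 - θ z.2) * a + θ z.2 * p < z.1 ∧
      z.1 < (1 - θ z.2) * b + θ z.2 * p}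
    have hθ : Continuous fun z : ℝ × ℝ => θ z.2 := by
      simp only [θ]; fun_prop
    have hE : IsOpen E :=
      (isOpen_lt continuous_const hθ).inter ((isOpen_lt hθ continuous_const).inter
        ((isOpen_lt (by fun_prop) continuous_fst).inter (isOpen_lt continuous_fst (by fun_prop))))
    have hES : ∀ z ∈ E, Sb u z.1 z.2 y q := by
      rintro ⟨z, r⟩ ⟨h2, h3, h4, h5⟩
      simp only at h2 h3 h4 h5 ⊢
      have h6 : 0 < 1 - θ r := by linarith
      refine Sb.combo hc.cu (hs ((z - θ r * p) / (1 - θ r)) ⟨?_, ?_⟩) h1 h2.le h3.le ?_ ?_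
      · rw [le_div_iff₀ h6]; linarith
      · rw [div_le_iff₀ h6]; linarith
      · field_simp; ring
      · simp only [θ]; field_simp; ring
    have hemp := hc.disjoint_flat hE hES
    have ht : Tendsto (fun r : ℝ => (p, t + r * (x' - t))) (𝓝[>] 0) (𝓝 (p, t)) := by
      have : Continuous fun r : ℝ => (p, t + r * (x' - t)) := by fun_prop
      have := this.tendsto 0
      simp only [zero_mul, add_zero] at this
      exact this.mono_left nhdsWithin_le_nhds
    obtain ⟨r, hrA, hr0, hr1⟩ := ((ht.eventually (hc.oA.mem_nhds hA)).and
      (Ioo_mem_nhdsGT (zero_lt_one' ℝ))).exists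
    have hθr : θ (t + r * (x' - t)) = r := by simp only [θ]; field_simp; ring
    have hmem : (p, t + r * (x' - t)) ∈ E := by
      refine ⟨?_, ?_, ?_, ?_⟩ <;> simp only [hθr]
      · exact hr0
      · exact hr1
      · linarith [mul_pos (sub_pos.2 hr1) (sub_pos.2 hp.1)]
      · linarith [mul_pos (sub_pos.2 hr1) (sub_pos.2 hp.2)]
    exact (hemp ▸ ⟨hmem, hrA⟩ : (p, t + r * (x' - t)) ∈ (∅ : Set (ℝ × ℝ)))
  · have h1 : Sb u p t y' q := h0.exchange h
    have h2 := h1 a t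
    have h3 := h1 b t
    have h4 := hs a ⟨le_rfl, hab.le⟩ p t
    have h5 := hs b ⟨hab.le, le_rfl⟩ p t
    refine le_antisymm ?_ ?_
    · exact le_of_mul_le_mul_right (by linarith) (sub_pos.2 hp.2)
    · exact le_of_mul_le_mul_right (by linarith) (sub_pos.2 hp.1)

theorem exists_Icc_of_nhds {p q : ℝ} {P : ℝ → ℝ → Prop}
    (h : ∀ᶠ z in 𝓝 (p, q), P z.1 z.2) :
    ∃ r, 0 < r ∧ ∀ p' ∈ Icc (p - r) (p + r), ∀ q' ∈ Icc (q - r) (q + r), P p' q' := by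
  obtain ⟨r, hr, hb⟩ := Metric.eventually_nhds_iff_ball.1 h
  refine ⟨r / 2, half_pos hr, fun p' hp q' hq => hb (p', q') ?_⟩
  rw [mem_ball, Prod.dist_eq, max_lt_iff, Real.dist_eq, Real.dist_eq]
  constructor <;> rw [abs_lt] <;> constructor <;> linarith [hp.1, hp.2, hq.1, hq.2]

/-- Near a singleton fibre inside `A` the hodograph map is holomorphic. -/
theorem Core.exists_holo {u v : ℝ → ℝ → ℝ} {A B : Set (ℝ × ℝ)} (hc : Core u v A B)
    {p t y q : ℝ} (h : Sb u p t y q) (hA : (p, t) ∈ A) (hun : ∀ x' y', Sb u p x' y' q → x' = t) :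
    ∃ r C, 0 < r ∧ Fib u (p - r) (p + r) (q - r) (q + r) C ∧
      ∀ p' ∈ Icc (p - r) (p + r), ∀ q' ∈ Icc (q - r) (q + r), ∀ x y, Sb u p' x y q' →
        (p', x) ∈ A := by
  obtain ⟨δ, hδ, hAδ⟩ := exists_Icc_of_nhds (P := fun a b => (a, b) ∈ A) (hc.oA.mem_nhds hA)
  have hstep : ∀ x, x ≠ t → u p t - q * t < u p x - q * x := by
    intro x hx
    by_contra hcon
    push Not at hcon
    exact hx (hun x y (h.of_eq (by linarith)))
  have hcont : ∀ x, Continuous fun z : ℝ × ℝ => u z.1 x - z.2 * x := fun x =>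
    (hc.uc.comp (continuous_fst.prodMk continuous_const)).sub (by fun_prop)
  have hev : ∀ x, x ≠ t → ∀ᶠ z in 𝓝 (p, q), u z.1 t - z.2 * t < u z.1 x - z.2 * x := fun x hx =>
    (hcont t).continuousAt.eventually_lt (hcont x).continuousAt (hstep x hx)
  obtain ⟨r, hr, hbox⟩ := exists_Icc_of_nhds
    (P := fun p' q' => u p' t - q' * t < u p' (t + δ) - q' * (t + δ) ∧
      u p' t - q' * t < u p' (t - δ) - q' * (t - δ))
    ((hev (t + δ) (by linarith)).and (hev (t - δ) (by linarith)))
  have hfar : ∀ p' ∈ Icc (p - r) (p + r), ∀ q' ∈ Icc (q - r) (q + r), ∀ x, δ ≤ |x - t| →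
      u p' t - q' * t < u p' x - q' * x := by
    intro p' hp' q' hq' x hx
    obtain ⟨h1, h2⟩ := hbox p' hp' q' hq'
    have hx0 : 0 < |x - t| := hδ.trans_le hx
    have hθ0 : 0 < δ / |x - t| := by positivity
    have hθ1 : δ / |x - t| ≤ 1 := (div_le_one hx0).2 hx
    have hθe : δ / |x - t| * |x - t| = δ := div_mul_cancel₀ _ hx0.ne'
    obtain ⟨θ, hθ⟩ : ∃ θ, θ = δ / |x - t| := ⟨_, rfl⟩
    rw [← hθ] at hθ0 hθ1 hθe
    have hpos : 0 < θ * ((u p' x - q' * x) - (u p' t - q' * t)) := by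
      rcases le_total 0 (x - t) with hs | hs
      · rw [abs_of_nonneg hs] at hθe
        have h3 := hc.cu.combo hθ0.le hθ1 (a := p') (b := t) (c := p') (d := x) (x := p')
          (y := t + δ) (by ring) (by linarith)
        linear_combination h1 + h3 + q' * hθe
      · rw [abs_of_nonpos hs] at hθe
        have h3 := hc.cu.combo hθ0.le hθ1 (a := p') (b := t) (c := p') (d := x) (x := p')
          (y := t - δ) (by ring) (by linarith)
        linear_combination h2 + h3 - q' * hθe
    linarith [pos_of_mul_pos_right hpos hθ0.le]
  have hnear : ∀ p' ∈ Icc (p - r) (p + r), ∀ q' ∈ Icc (q - r) (q + r), ∀ x y, Sb u p' x y q' →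
      |x - t| < δ := by
    intro p' hp' q' hq' x y' hs
    by_contra hcon
    push Not at hcon
    have h1 := hfar p' hp' q' hq' x hcon
    have h2 := hs p' t
    linarith
  obtain ⟨C, hC⟩ := ((isCompact_Icc (a := p - r - 1) (b := p + r + 1)).prod
    (isCompact_Icc (a := t - δ) (b := t + δ))).bddAbove_image hc.uc.continuousOn
  have hCu : ∀ a b, |a - p| ≤ r + 1 → |b - t| ≤ δ → u a b ≤ C := by
    intro a b ha hb
    rw [abs_le] at ha hb
    exact hC ⟨(a, b), ⟨⟨by simp only; linarith, by simp only; linarith⟩,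
      ⟨by simp only; linarith, by simp only; linarith⟩⟩, rfl⟩
  refine ⟨min r δ, max C (|t| + δ), lt_min hr hδ, ⟨?_, ?_⟩, ?_⟩
  · intro p' hp' q' hq'
    replace hp' : p' ∈ Icc (p - r) (p + r) :=
      ⟨by linarith [hp'.1, min_le_left r δ], by linarith [hp'.2, min_le_left r δ]⟩
    replace hq' : q' ∈ Icc (q - r) (q + r) :=
      ⟨by linarith [hq'.1, min_le_left r δ], by linarith [hq'.2, min_le_left r δ]⟩
    have hcx : Continuous fun x => u p' x - q' * x :=
      (hc.uc.comp (continuous_const.prodMk continuous_id)).sub (by fun_prop)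
    obtain ⟨x, hx, hmin⟩ := (isCompact_Icc (a := t - δ) (b := t + δ)).exists_isMinOn
      ⟨t, by linarith, by linarith⟩ hcx.continuousOn
    obtain ⟨y', hy'⟩ := hc.cu.exists_slope (p := p') (x := x) (q := q') (fun s => by
      by_cases hs : |s - t| ≤ δ
      · rw [abs_le] at hs
        exact hmin (show s ∈ Icc (t - δ) (t + δ) from ⟨by linarith, by linarith⟩)
      · push Not at hs
        have h1 := hfar p' hp' q' hq' s hs.le
        have h2 : u p' x - q' * x ≤ u p' t - q' * t :=
          hmin (show t ∈ Icc (t - δ) (t + δ) from ⟨by linarith, by linarith⟩)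
        linarith)
    exact ⟨x, y', hy'⟩
  · intro p' hp' q' hq' x y' hs
    replace hp' : p' ∈ Icc (p - r) (p + r) :=
      ⟨by linarith [hp'.1, min_le_left r δ], by linarith [hp'.2, min_le_left r δ]⟩
    replace hq' : q' ∈ Icc (q - r) (q + r) :=
      ⟨by linarith [hq'.1, min_le_left r δ], by linarith [hq'.2, min_le_left r δ]⟩
    have h1 := hnear p' hp' q' hq' x y' hs
    constructor
    · have := abs_add_le (x - t) t
      rw [sub_add_cancel] at this
      exact le_max_of_le_right (by linarith)
    · refine le_max_of_le_left (abs_le.2 ⟨?_, ?_⟩)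
      · have h2 := hs (p' - 1) x
        have h3 := hCu (p' - 1) x (abs_le.2 ⟨by linarith [hp'.1], by linarith [hp'.2]⟩) h1.le
        linarith [hc.un p' x]
      · have h2 := hs (p' + 1) x
        have h3 := hCu (p' + 1) x (abs_le.2 ⟨by linarith [hp'.1], by linarith [hp'.2]⟩) h1.le
        linarith [hc.un p' x]
  · intro p' hp' q' hq' x y' hs
    have h1 := hnear p' ⟨by linarith [hp'.1, min_le_left r δ], by linarith [hp'.2, min_le_left r δ]⟩
      q' ⟨by linarith [hq'.1, min_le_left r δ], by linarith [hq'.2, min_le_left r δ]⟩ x y' hs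
    rw [abs_lt] at h1
    exact hAδ p' ⟨by linarith [hp'.1, min_le_right r δ], by linarith [hp'.2, min_le_right r δ]⟩ x
      ⟨by linarith, by linarith⟩

/-- There is no horizontal contact segment inside `A`. -/
theorem Core.not_horizontal {u v : ℝ → ℝ → ℝ} {A B : Set (ℝ × ℝ)} (hc : Core u v A B)
    {a b t y q : ℝ} (hab : a < b) (hA : ∀ p ∈ Icc a b, (p, t) ∈ A)
    (hs : ∀ p ∈ Icc a b, Sb u p t y q) : False := by
  obtain ⟨p, hpe⟩ : ∃ p, p = (a + b) / 2 := ⟨_, rfl⟩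
  have hp : p ∈ Ioo a b := ⟨by linarith, by linarith⟩
  have hp' := Ioo_subset_Icc_self hp
  obtain ⟨S, hS⟩ : ∃ S : Set ℝ, S = {q' | Sb u p t y q'} := ⟨_, rfl⟩
  have hcl : IsClosed S := by
    have : Continuous fun q' : ℝ => (((p, q'), (t, y)) : (ℝ × ℝ) × (ℝ × ℝ)) := by fun_prop
    rw [hS]; exact (isClosed_fibre hc.uc).preimage this
  have hbdd : BddAbove S := ⟨u p (t + 1) - u p t, fun q' hq' => by
    rw [hS] at hq'
    have := hq' p (t + 1)
    linarith⟩
  have hne : S.Nonempty := ⟨q, by rw [hS]; exact hs p hp'⟩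
  have hQ := hcl.csSup_mem hne hbdd
  have hmax := fun q' (h : q' ∈ S) => le_csSup hbdd h
  obtain ⟨Q, hQe⟩ : ∃ Q, Q = sSup S := ⟨_, rfl⟩
  rw [← hQe] at hQ hmax
  have hsQ : ∀ p' ∈ Icc a b, Sb u p' t y Q := fun p' h' => by
    rw [hS] at hQ
    refine Sb.of_eq hQ ?_
    have := hs p' h' p t
    linarith
  have hun := fun x' y' (h : Sb u p x' y' Q) => hc.fibre_unique hsQ hp (hA p hp') h
  obtain ⟨r, C, hr, hF, hFA⟩ := hc.exists_holo (hsQ p hp') (hA p hp') fun x' y' h => (hun x' y' h).1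
  have hU := fun z hz => hc.holo hF (Or.inl hFA) (z := z) hz
  have hanal : AnalyticOnNhd ℂ (hodo u) (Ioo (p - r) (p + r) ×ℂ Ioo (Q - r) (Q + r)) :=
    DifferentiableOn.analyticOnNhd (fun z hz => (hU z hz).1.differentiableWithinAt)
      (isOpen_Ioo.reProdIm isOpen_Ioo)
  have hpre : IsPreconnected (Ioo (p - r) (p + r) ×ℂ Ioo (Q - r) (Q + r)) :=
    Convex.isPreconnected (by
      rw [← (convex_Ioo (𝕜 := ℝ) (p - r) (p + r)).convexHull_eq,
        ← (convex_Ioo (𝕜 := ℝ) (Q - r) (Q + r)).convexHull_eq, ← Complex.convexHull_reProdIm]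
      exact convex_convexHull ℝ _)
  have hmem0 : (⟨p, Q⟩ : ℂ) ∈ Ioo (p - r) (p + r) ×ℂ Ioo (Q - r) (Q + r) :=
    ⟨⟨by simp [hr], by simp [hr]⟩, ⟨by simp [hr], by simp [hr]⟩⟩
  have hfreq : ∃ᶠ z in 𝓝[≠] (⟨p, Q⟩ : ℂ), hodo u z = (fun _ => (⟨y, t⟩ : ℂ)) z := by
    have hline : Tendsto (fun x : ℝ => (⟨p + x, Q⟩ : ℂ)) (𝓝[≠] 0) (𝓝[≠] ⟨p, Q⟩) := by
      refine tendsto_nhdsWithin_iff.2 ⟨?_, ?_⟩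
      · have hcon : Continuous fun x : ℝ => (⟨p + x, Q⟩ : ℂ) := by
          have : (fun x : ℝ => (⟨p + x, Q⟩ : ℂ)) = fun x : ℝ => (⟨p, Q⟩ : ℂ) + (x : ℂ) := by
            ext x; apply Complex.ext <;> simp
          rw [this]; fun_prop
        have := hcon.tendsto 0
        simp only [add_zero] at this
        exact this.mono_left nhdsWithin_le_nhds
      · filter_upwards [self_mem_nhdsWithin] with x hx h0
        exact hx (by simpa using congrArg Complex.re h0)
    refine hline.frequently (Eventually.frequently ?_)
    have h1 : ∀ᶠ x in 𝓝[≠] (0 : ℝ), p + x ∈ Ioo (max a (p - r)) (min b (p + r)) := by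
      refine (Continuous.tendsto' (f := fun x : ℝ => p + x) (by fun_prop) 0 p (by simp)).mono_left
        nhdsWithin_le_nhds |>.eventually (Ioo_mem_nhds ?_ ?_)
      · exact max_lt hp.1 (by linarith)
      · exact lt_min hp.2 (by linarith)
    filter_upwards [h1] with x hx
    refine (hU ⟨p + x, Q⟩ ⟨⟨?_, ?_⟩, hmem0.2⟩).2 t y (hsQ _ ⟨?_, ?_⟩)
    · exact (le_max_right _ _).trans_lt hx.1
    · exact hx.2.trans_le (min_le_right _ _)
    · exact ((le_max_left _ _).trans_lt hx.1).le
    · exact (hx.2.trans_le (min_le_left _ _)).le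
  have heq := hanal.eqOn_of_preconnected_of_frequently_eq analyticOnNhd_const hpre hmem0 hfreq
  have hz : (⟨p, Q + r / 2⟩ : ℂ) ∈ Ioo (p - r) (p + r) ×ℂ Ioo (Q - r) (Q + r) :=
    ⟨hmem0.1, ⟨by simp only; linarith, by simp only; linarith⟩⟩
  obtain ⟨x', y', h'⟩ := hF.ex p (Ioo_subset_Icc_self hmem0.1) (Q + r / 2)
    (Ioo_subset_Icc_self hz.2)
  have h1 := (hU _ hz).2 x' y' h'
  rw [heq hz] at h1
  have h2 : y = y' := congrArg Complex.re h1
  have h3 : t = x' := congrArg Complex.im h1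
  rw [← h2, ← h3] at h'
  have := hmax (Q + r / 2) (by rw [hS]; exact h')
  linarith

/-- The potential `u` is strictly convex in `A`. -/
theorem Core.not_segment {u v : ℝ → ℝ → ℝ} {A B : Set (ℝ × ℝ)} (hc : Core u v A B)
    {x₁ x₂ d₁ d₂ y q : ℝ} (hd : d₁ ≠ 0)
    (hA : ∀ t ∈ Icc (0 : ℝ) 1, (x₁ + t * d₁, x₂ + t * d₂) ∈ A)
    (hs : ∀ t ∈ Icc (0 : ℝ) 1, Sb u (x₁ + t * d₁) (x₂ + t * d₂) y q) : False := by
  obtain ⟨n, hn⟩ : ∃ n, n = √(d₁ ^ 2 + d₂ ^ 2) := ⟨_, rfl⟩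
  have hn0 : 0 < n := by rw [hn]; positivity
  have hn2 : n ^ 2 = d₁ ^ 2 + d₂ ^ 2 := by rw [hn]; exact Real.sq_sqrt (by positivity)
  obtain ⟨c, hce⟩ : ∃ c, c = d₁ / n := ⟨_, rfl⟩
  obtain ⟨s, hse⟩ : ∃ s, s = d₂ / n := ⟨_, rfl⟩
  have hd1 : d₁ = n * c := by rw [hce]; field_simp
  have hd2 : d₂ = n * s := by rw [hse]; field_simp
  have hcs : c ^ 2 + s ^ 2 = 1 := by
    rw [hce, hse, div_pow, div_pow, ← add_div, hn2, div_self]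
    rw [← hn2]; positivity
  have hcore := hc.orth c s 1 hcs (by norm_num)
  have e : ∀ p, c * p - 1 * s * (-s * x₁ + c * x₂) = x₁ + (p - (c * x₁ + s * x₂)) / n * d₁ ∧
      s * p + 1 * c * (-s * x₁ + c * x₂) = x₂ + (p - (c * x₁ + s * x₂)) / n * d₂ := by
    intro p
    rw [hd1, hd2]
    constructor
    · field_simp; linear_combination x₁ * hcs
    · field_simp; linear_combination x₂ * hcs
  have ht : ∀ p ∈ Icc (c * x₁ + s * x₂) (c * x₁ + s * x₂ + n),
      (p - (c * x₁ + s * x₂)) / n ∈ Icc (0 : ℝ) 1 := fun p hp =>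
    ⟨div_nonneg (by linarith [hp.1]) hn0.le, (div_le_one hn0).2 (by linarith [hp.2])⟩
  refine hcore.not_horizontal (a := c * x₁ + s * x₂) (b := c * x₁ + s * x₂ + n)
    (t := -s * x₁ + c * x₂) (y := c * y + s * q) (q := -s * y + c * q) (by linarith) ?_ ?_
  · intro p hp
    rw [mem_preimage, orthMap_apply, (e p).1, (e p).2]
    exact hA _ (ht p hp)
  · intro p hp s' t'
    simp only
    have := hs _ (ht p hp) (c * s' - 1 * s * t') (s * s' + 1 * c * t')
    rw [← (e p).1, ← (e p).2] at this
    refine le_trans (le_of_eq ?_) this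
    linear_combination (y * (0 : ℝ)) * hcs

theorem exists_support {S : Set (ℝ × ℝ)} (ho : IsOpen S) (hc : Convex ℝ S) {a b : ℝ}
    (h : (a, b) ∉ S) : ∃ m n : ℝ, (∀ z ∈ S, m * a + n * b < m * z.1 + n * z.2) ∧
      ∀ z ∈ closure S, m * a + n * b ≤ m * z.1 + n * z.2 := by
  obtain ⟨f, hf⟩ := geometric_hahn_banach_point_open hc ho h
  have he : ∀ z : ℝ × ℝ, f z = f (1, 0) * z.1 + f (0, 1) * z.2 := fun z => by
    have : z = z.1 • ((1 : ℝ), (0 : ℝ)) + z.2 • ((0 : ℝ), (1 : ℝ)) := by ext <;> simp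
    conv_lhs => rw [this]
    rw [map_add, map_smul, map_smul, smul_eq_mul, smul_eq_mul]
    ring
  have hlt : ∀ z ∈ S, f (1, 0) * a + f (0, 1) * b < f (1, 0) * z.1 + f (0, 1) * z.2 := fun z hz => by
    have := hf z hz
    rwa [he z, he (a, b)] at this
  refine ⟨f (1, 0), f (0, 1), hlt, fun z hz => ?_⟩
  have hcl : IsClosed {z : ℝ × ℝ | f (1, 0) * a + f (0, 1) * b ≤ f (1, 0) * z.1 + f (0, 1) * z.2} :=
    isClosed_le continuous_const (by fun_prop)
  exact closure_minimal (fun z hz => (hlt z hz).le) hcl hz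

/-- A subgradient over a fibre through both `A` and `B` lies in `B`. -/
theorem Core.mem_of_hit {u v : ℝ → ℝ → ℝ} {A B : Set (ℝ × ℝ)} (hc : Core u v A B)
    (h0 : ∀ y₁ y₂, Sb u 0 0 y₁ y₂ → y₁ = 0 ∧ y₂ = 0) {p q x y X Y : ℝ} (hp : 0 < p) (hq : 0 < q)
    (h : Sb u p x y q) (hX : (p, X) ∈ A) (hxX : x < X) (hY : (Y, q) ∈ B) (hyY : y < Y) :
    (y, q) ∈ B := by
  by_contra hcon
  obtain ⟨m, n, hlt, hle⟩ := exists_support hc.oB hc.cB hcon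
  have hm : 0 < m := by
    have := hlt _ hY
    by_contra hm
    push Not at hm
    have := mul_nonneg_of_nonpos_of_nonpos hm (sub_nonpos.2 hyY.le)
    simp only at *
    nlinarith
  have hray : ∀ t, 0 ≤ t → Sb u (p - t * m) (x - t * n) y q := by
    intro t ht
    obtain ⟨y₁, y₂, hy⟩ := hc.us (p - t * m) (x - t * n)
    refine h.of_eq ?_
    have h1 := hy p x
    have h2 := mul_le_mul_of_nonneg_left (hle _ (hc.subB _ _ _ _ hy)) ht
    simp only at h2
    linarith
  have hX2 : 0 < x - p / m * n := by
    have h1 := hray (p / m) (by positivity)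
    rw [div_mul_cancel₀ _ hm.ne', sub_self] at h1
    have h2 := h1 0 0
    rw [hc.u0] at h2
    have h3 := hc.un 0 (x - p / m * n)
    rcases lt_trichotomy (x - p / m * n) 0 with h4 | h4 | h4
    · have := mul_pos_of_neg_of_neg (neg_neg_of_pos hq) h4
      nlinarith
    · rw [h4] at h1
      exact absurd (h0 _ _ h1).2 hq.ne'
    · exact h4
  obtain ⟨θ, hθ⟩ : ∃ θ, θ = (X - x) / (X - x + (x - p / m * n)) := ⟨_, rfl⟩
  have hden : 0 < X - x + (x - p / m * n) := by linarith
  have hθ0 : 0 < θ := by rw [hθ]; exact div_pos (by linarith) hden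
  have hθ1 : θ < 1 := by rw [hθ, div_lt_one hden]; linarith
  have hθe : θ * (X - x + (x - p / m * n)) = X - x := by rw [hθ, div_mul_cancel₀ _ hden.ne']
  have hmem : (p - θ * (p / m) * m, x - θ * (p / m) * n) ∈ A := by
    have h1 := hc.cA.openSegment_interior_closure_subset_interior
      (by rw [hc.oA.interior_eq]; exact hX) hc.zA
      (show ((1 - θ) * p + θ * 0, (1 - θ) * X + θ * 0) ∈ openSegment ℝ (p, X) (0, 0) from
        ⟨1 - θ, θ, by linarith, hθ0, by ring, by simp⟩)
    rw [hc.oA.interior_eq] at h1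
    convert h1 using 2
    · field_simp; ring
    · linear_combination hθe
  obtain ⟨r, hr, hball⟩ := exists_Icc_of_nhds (P := fun a b => (a, b) ∈ A) (hc.oA.mem_nhds hmem)
  obtain ⟨ε, hε⟩ : ∃ ε, ε = r / (m + |n|) := ⟨_, rfl⟩
  have hmn : 0 < m + |n| := by positivity
  have hε0 : 0 < ε := by rw [hε]; positivity
  have hεe : ε * m + ε * |n| = r := by rw [hε]; field_simp
  have hεm : 0 < ε * m := by positivity
  have hεn : 0 ≤ ε * |n| := by positivity
  refine hc.not_segment (x₁ := p - θ * (p / m) * m) (x₂ := x - θ * (p / m) * n)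
    (d₁ := -(ε * m)) (d₂ := -(ε * n)) (y := y) (q := q) (by linarith) ?_ ?_
  · intro t ht
    have h1 : |t * (ε * n)| ≤ r := by
      rw [abs_mul, abs_mul, abs_of_nonneg ht.1, abs_of_pos hε0]
      calc t * (ε * |n|) ≤ 1 * (ε * |n|) := mul_le_mul_of_nonneg_right ht.2 hεn
        _ ≤ r := by linarith
    have h2 : t * (ε * m) ≤ r :=
      calc t * (ε * m) ≤ 1 * (ε * m) := mul_le_mul_of_nonneg_right ht.2 hεm.le
        _ ≤ r := by linarith
    have h3 : 0 ≤ t * (ε * m) := mul_nonneg ht.1 hεm.le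
    rw [abs_le] at h1
    exact hball _ ⟨by linarith, by linarith⟩ _ ⟨by linarith, by linarith⟩
  · intro t ht
    have := hray (θ * (p / m) + t * ε) (add_nonneg (by positivity) (mul_nonneg ht.1 hε0.le))
    convert this using 1 <;> ring

theorem Core.negSnd {u v : ℝ → ℝ → ℝ} {A B : Set (ℝ × ℝ)} (hc : Core u v A B) :
    Core (fun a b => u a (-b)) (fun a b => v a (-b)) {z | (z.1, -z.2) ∈ A}
      {z | (z.1, -z.2) ∈ B} := by
  have h := hc.orth 1 0 (-1) (by norm_num) (by norm_num)
  have e : ∀ S : Set (ℝ × ℝ), orthMap 1 0 (-1) (by norm_num) (by norm_num) ⁻¹' S =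
      {z : ℝ × ℝ | (z.1, -z.2) ∈ S} := fun S => by
    ext ⟨a, b⟩
    rw [mem_preimage, orthMap_apply, mem_ofPred_eq]
    simp
  rw [e, e] at h
  simpa using h

theorem Core.negFst {u v : ℝ → ℝ → ℝ} {A B : Set (ℝ × ℝ)} (hc : Core u v A B) :
    Core (fun a b => u (-a) b) (fun a b => v (-a) b) {z | (-z.1, z.2) ∈ A}
      {z | (-z.1, z.2) ∈ B} := by
  have h := hc.orth (-1) 0 (-1) (by norm_num) (by norm_num)
  have e : ∀ S : Set (ℝ × ℝ), orthMap (-1) 0 (-1) (by norm_num) (by norm_num) ⁻¹' S =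
      {z : ℝ × ℝ | (-z.1, z.2) ∈ S} := fun S => by
    ext ⟨a, b⟩
    rw [mem_preimage, orthMap_apply, mem_ofPred_eq]
    simp
  rw [e, e] at h
  simpa using h

namespace Loc

variable {u v : ℝ → ℝ → ℝ} {A B : Set (ℝ × ℝ)} {κ L l : ℝ} {M : ℝ → ℝ}

theorem Lpos (h : Loc u v A B κ M L l) : 0 < L := h.lpos.trans_le h.lL

theorem negSnd (h : Loc u v A B κ M L l) :
    Loc (fun a b => u a (-b)) (fun a b => v a (-b)) {z | (z.1, -z.2) ∈ A} {z | (z.1, -z.2) ∈ B}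
      κ M L l where
  core := h.core.negSnd
  hκ := h.hκ
  hκ1 := h.hκ1
  lpos := h.lpos
  lL := h.lL
  bu K a b ha hb := h.bu K a (-b) ha (by rwa [abs_neg])
  bv K a b ha hb := h.bv K a (-b) ha (by rwa [abs_neg])
  fatA := by
    obtain ⟨a₀, b₀, hf⟩ := h.fatA
    refine ⟨a₀, -b₀, fun a b ha hb => ?_⟩
    have := hf a (-b) ha (by rwa [← abs_neg, neg_sub, sub_neg_eq_add, add_comm, ← sub_neg_eq_add])
    rwa [abs_neg] at this
  fatB := by
    obtain ⟨a₀, b₀, hf⟩ := h.fatB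
    refine ⟨a₀, -b₀, fun a b ha hb => ?_⟩
    have := hf a (-b) ha (by rwa [← abs_neg, neg_sub, sub_neg_eq_add, add_comm, ← sub_neg_eq_add])
    rwa [abs_neg] at this

theorem negFst (h : Loc u v A B κ M L l) :
    Loc (fun a b => u (-a) b) (fun a b => v (-a) b) {z | (-z.1, z.2) ∈ A} {z | (-z.1, z.2) ∈ B}
      κ M L l where
  core := h.core.negFst
  hκ := h.hκ
  hκ1 := h.hκ1
  lpos := h.lpos
  lL := h.lL
  bu K a b ha hb := h.bu K (-a) b (by rwa [abs_neg]) hb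
  bv K a b ha hb := h.bv K (-a) b (by rwa [abs_neg]) hb
  fatA := by
    obtain ⟨a₀, b₀, hf⟩ := h.fatA
    refine ⟨-a₀, b₀, fun a b ha hb => ?_⟩
    have := hf (-a) b (by rwa [← abs_neg, neg_sub, sub_neg_eq_add, add_comm, ← sub_neg_eq_add]) hb
    rwa [abs_neg] at this
  fatB := by
    obtain ⟨a₀, b₀, hf⟩ := h.fatB
    refine ⟨-a₀, b₀, fun a b ha hb => ?_⟩
    have := hf (-a) b (by rwa [← abs_neg, neg_sub, sub_neg_eq_add, add_comm, ← sub_neg_eq_add]) hb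
    rwa [abs_neg] at this

theorem swap (h : Loc u v A B κ M L l) :
    Loc (fun a b => v b a) (fun a b => u b a) (Prod.swap ⁻¹' B) (Prod.swap ⁻¹' A) κ M L l where
  core := h.core.swap
  hκ := h.hκ
  hκ1 := h.hκ1
  lpos := h.lpos
  lL := h.lL
  bu K a b ha hb := h.bv K b a hb ha
  bv K a b ha hb := h.bu K b a hb ha
  fatA := by
    obtain ⟨a₀, b₀, hf⟩ := h.fatB
    refine ⟨b₀, a₀, fun a b ha hb => ?_⟩
    obtain ⟨h1, h2, h3⟩ := hf b a hb ha
    exact ⟨h1, h3, h2⟩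
  fatB := by
    obtain ⟨a₀, b₀, hf⟩ := h.fatA
    refine ⟨b₀, a₀, fun a b ha hb => ?_⟩
    obtain ⟨h1, h2, h3⟩ := hf b a hb ha
    exact ⟨h1, h3, h2⟩

theorem grad_u (h : Loc u v A B κ M L l) {K x₁ x₂ y₁ y₂ : ℝ} (h1 : |x₁| ≤ K * L)
    (h2 : |x₂| ≤ K * l) (hs : Sb u x₁ x₂ y₁ y₂) :
    |y₁| ≤ M (K + 1) * l ∧ |y₂| ≤ M (K + 1) * L := by
  have hL := h.Lpos
  have hl := h.lpos
  have hu := h.core.un x₁ x₂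
  rw [abs_le] at h1 h2
  have hb : ∀ a b, |a - x₁| ≤ L → |b - x₂| ≤ l → u a b ≤ M (K + 1) * (L * l) := fun a b ha hb => by
    rw [abs_le] at ha hb
    exact h.bu _ _ _ (abs_le.2 ⟨by linarith, by linarith⟩) (abs_le.2 ⟨by linarith, by linarith⟩)
  have a0 : |L| ≤ L := (abs_of_pos hL).le
  have b0 : |l| ≤ l := (abs_of_pos hl).le
  have i1 := hs (x₁ + L) x₂
  have i2 := hs (x₁ - L) x₂
  have i3 := hs x₁ (x₂ + l)
  have i4 := hs x₁ (x₂ - l)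
  have j1 := hb (x₁ + L) x₂ (by simpa using a0) (by simpa using hl.le)
  have j2 := hb (x₁ - L) x₂ (by simpa using a0) (by simpa using hl.le)
  have j3 := hb x₁ (x₂ + l) (by simpa using hL.le) (by simpa using b0)
  have j4 := hb x₁ (x₂ - l) (by simpa using hL.le) (by simpa using b0)
  constructor
  · refine le_of_mul_le_mul_left ?_ hL
    rw [← abs_of_pos hL, ← abs_mul, abs_of_pos hL, abs_le]
    constructor <;> linarith
  · refine le_of_mul_le_mul_left ?_ hl
    rw [← abs_of_pos hl, ← abs_mul, abs_of_pos hl, abs_le]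
    constructor <;> linarith

theorem sb_swap {w : ℝ → ℝ → ℝ} {a b p q : ℝ} (h : Sb w a b p q) :
    Sb (fun a b => w b a) b a q p := fun s t => by linarith [h t s]

theorem grad_v (h : Loc u v A B κ M L l) {K x₁ x₂ y₁ y₂ : ℝ} (h1 : |y₁| ≤ K * l)
    (h2 : |y₂| ≤ K * L) (hs : Sb v y₁ y₂ x₁ x₂) :
    |x₁| ≤ M (K + 1) * L ∧ |x₂| ≤ M (K + 1) * l :=
  (h.swap.grad_u h2 h1 (sb_swap hs)).symm

theorem fibre (h : Loc u v A B κ M L l) {K p q y₁ y₂ : ℝ} (hy : (y₁, y₂) ∈ closure B)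
    (h1 : |y₁| ≤ K * l) (h2 : |y₂| ≤ K * L) (hp : |p| ≤ K * L) (hq : 0 < q) (hqy : 2 * q ≤ y₂) :
    (∃ x y, Sb u p x y q) ∧ ∀ x y, Sb u p x y q →
      q * |x| ≤ (M K + K ^ 2 + M (K + 1)) * (L * l) ∧ |y| ≤ (M K + K ^ 2 + M (K + 1)) * l := by
  have hL := h.Lpos
  have hl := h.lpos
  have hK : 0 ≤ K := nonneg_of_mul_nonneg_left ((abs_nonneg _).trans h1) hl
  obtain ⟨he, hb⟩ := h.core.fibre (V := (M K + K ^ 2) * (L * l)) (U := M (K + 1) * (L * l))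
    (p := p) hy hq hqy hL (by
      rw [abs_mul]
      have := mul_le_mul hp h1 (abs_nonneg _) (by positivity)
      have := h.bv K y₁ y₂ h1 h2
      linarith) (fun p' hp' => by
      refine h.bu _ _ _ ?_ (by simp; positivity)
      have := abs_sub_abs_le_abs_sub p' p
      linarith)
  refine ⟨he, fun x y hs => ?_⟩
  obtain ⟨h3, h4⟩ := hb x y hs
  exact ⟨by linarith, le_of_mul_le_mul_left (by linarith) hL⟩

theorem half_mem (hc : Core u v A B) {a b c d s t : ℝ} (h1 : (a, b) ∈ B) (h2 : (c, d) ∈ B)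
    (hs : 0 < s) (ht : 0 ≤ t) (hst : s + t < 1) : (s * a + t * c, s * b + t * d) ∈ B := by
  have hst' : 0 < s + t := by linarith
  have h3 : ((s / (s + t)) * a + (t / (s + t)) * c, (s / (s + t)) * b + (t / (s + t)) * d) ∈ B :=
    hc.cB h1 h2 (by positivity) (by positivity) (by field_simp)
  have h4 := hc.cB.openSegment_interior_closure_subset_interior
    (by rw [hc.oB.interior_eq]; exact h3) hc.zB
    (show ((s + t) * ((s / (s + t)) * a + (t / (s + t)) * c) + (1 - (s + t)) * 0,
        (s + t) * ((s / (s + t)) * b + (t / (s + t)) * d) + (1 - (s + t)) * 0) ∈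
        openSegment ℝ _ (0, 0) from
      ⟨s + t, 1 - (s + t), hst', by linarith, by ring, by simp⟩)
  rw [hc.oB.interior_eq] at h4
  convert h4 using 2 <;> field_simp <;> ring

theorem reach_aux (κ : ℝ) (hκ : 0 < κ) (M : ℝ → ℝ) (K n : ℝ) (hK : 0 ≤ K) (hn : 0 ≤ n) :
    ∃ C η, 0 < C ∧ 0 < η ∧ ∀ (u v : ℝ → ℝ → ℝ) (A B : Set (ℝ × ℝ)) (L l : ℝ),
      Loc u v A B κ M L l → η * l ≤ L → ∀ y₁ y₂, (y₁, y₂) ∈ B → |y₁| ≤ l / κ → κ * L ≤ y₂ →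
      y₂ ≤ L / κ → ∀ w₁ w₂, (w₁, w₂) ∈ B → |w₂| ≤ n * w₁ → C * l ≤ w₁ →
      ∃ x₁ x₂, (x₁, x₂) ∈ A ∧ K * L ≤ x₁ ∧ x₁ ≤ C * L ∧ |x₂| ≤ C * l := by
  obtain ⟨N, hN⟩ : ∃ N, N = K + 1 + 1 / κ := ⟨_, rfl⟩
  have hκi : 0 < 1 / κ := by positivity
  obtain ⟨C₁, hC₁⟩ : ∃ C₁, C₁ = |M N + N ^ 2 + M (N + 1)| := ⟨_, rfl⟩
  have hC₁0 : 0 ≤ C₁ := hC₁ ▸ abs_nonneg _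
  obtain ⟨T, hT⟩ : ∃ T, T = C₁ + 1 / κ + 1 := ⟨_, rfl⟩
  have hT0 : 0 < T := by linarith
  obtain ⟨C₂, hC₂⟩ : ∃ C₂, C₂ = |M (T + 1 / κ + 1)| := ⟨_, rfl⟩
  have hC₂0 : 0 ≤ C₂ := hC₂ ▸ abs_nonneg _
  refine ⟨4 * T + C₂ + 1, 8 * n * T / κ + 1, by linarith, by positivity, ?_⟩
  intro u v A B L l h hη y₁ y₂ hy hy1 hy2 hy2' w₁ w₂ hw hw2 hw1
  have hL := h.Lpos
  have hl := h.lpos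
  have hw0 : 0 < w₁ := lt_of_lt_of_le (by positivity) hw1
  obtain ⟨t, ht⟩ : ∃ t, t = T * l / w₁ := ⟨_, rfl⟩
  have ht0 : 0 ≤ t := by rw [ht]; positivity
  have htw : t * w₁ = T * l := by rw [ht]; field_simp
  have ht4 : t ≤ 1 / 4 := by
    rw [ht, div_le_iff₀ hw0]
    have : 0 ≤ C₂ * l := by positivity
    linarith
  have htw2 : |t * w₂| ≤ κ * L / 8 := by
    rw [abs_mul, abs_of_nonneg ht0]
    have h1 := mul_le_mul_of_nonneg_left hw2 ht0
    have h2 : 8 * n * T / κ * l ≤ L := by linarith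
    rw [div_mul_eq_mul_div, div_le_iff₀ hκ] at h2
    have h3 : t * (n * w₁) = n * (T * l) := by rw [← htw]; ring
    linarith
  rw [abs_le] at htw2
  have hmem := half_mem h.core hy hw (s := 1 / 4) (by norm_num) ht0 (by linarith)
  have hκL : 0 < κ * L := by positivity
  have ey1 : l / κ = 1 / κ * l := by ring
  have ey2 : L / κ = 1 / κ * L := by ring
  rw [ey1] at hy1
  rw [ey2] at hy2'
  have hKL : 0 ≤ K * L := by positivity
  have hKl : 0 ≤ K * l := by positivity
  have hKL' : 0 ≤ 1 / κ * L := by positivity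
  obtain ⟨⟨x, y, hs⟩, hb⟩ := h.fibre (K := N) (p := (K + 1) * L) (q := 1 / 4 * y₂ + t * w₂)
    (subset_closure hy) (by rw [hN]; linarith) (by
      rw [abs_of_pos (by linarith), hN]; linarith) (by
      rw [abs_of_nonneg (by positivity), hN]; linarith) (by linarith) (by linarith)
  have hyb := (hb x y hs).2
  have hyC : y ≤ C₁ * l := (le_abs_self y).trans (hyb.trans
    (mul_le_mul_of_nonneg_right (hC₁ ▸ le_abs_self _) hl.le))
  obtain ⟨a, b, hab⟩ := h.core.vs (1 / 4 * y₁ + t * w₁) (1 / 4 * y₂ + t * w₂)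
  have hab' := (h.core.dualB a b _ _ hmem).2 hab
  have hy1' := abs_le.1 hy1
  have hpa := hs.mono_fst_le hab' (by
    rw [htw, hT]
    linarith)
  have hCl : 0 ≤ C₁ * l := by positivity
  have hTL : 0 ≤ T * L := by positivity
  have hTl : 0 ≤ T * l := by positivity
  have hκl : 0 ≤ 1 / κ * l := by positivity
  obtain ⟨ha, hb'⟩ := h.grad_v (K := T + 1 / κ) (by
      rw [htw, abs_le]
      constructor <;> linarith) (by
      rw [abs_of_pos (by linarith)]
      linarith) hab
  replace ha := ha.trans (mul_le_mul_of_nonneg_right (hC₂ ▸ le_abs_self _) hL.le)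
  replace hb' := hb'.trans (mul_le_mul_of_nonneg_right (hC₂ ▸ le_abs_self _) hl.le)
  obtain ⟨⟨x₁, x₂⟩, hx, hd⟩ := Metric.mem_closure_iff.1 (h.core.subA _ _ _ _ hab) l hl
  rw [Prod.dist_eq, max_lt_iff, Real.dist_eq, Real.dist_eq, abs_lt, abs_lt] at hd
  rw [abs_le] at ha hb'
  have hlL := h.lL
  have hC2L : 0 ≤ C₂ * L := by positivity
  have hC2l : 0 ≤ C₂ * l := by positivity
  refine ⟨x₁, x₂, hx, ?_, ?_, abs_le.2 ⟨?_, ?_⟩⟩ <;> linarith [hd.1.1, hd.1.2, hd.2.1, hd.2.2]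

/-- A fixed point of `B` on the positive side forces `A` to reach far in the first direction. -/
theorem reach (κ : ℝ) (hκ : 0 < κ) (M : ℝ → ℝ) (K n : ℝ) (hK : 0 ≤ K) (hn : 0 ≤ n) :
    ∃ C η, 0 < C ∧ 0 < η ∧ ∀ (u v : ℝ → ℝ → ℝ) (A B : Set (ℝ × ℝ)) (L l : ℝ),
      Loc u v A B κ M L l → η * l ≤ L → ∀ w₁ w₂, (w₁, w₂) ∈ B → |w₂| ≤ n * w₁ → C * l ≤ w₁ →
      ∃ x₁ x₂, (x₁, x₂) ∈ A ∧ K * L ≤ x₁ ∧ x₁ ≤ C * L ∧ |x₂| ≤ C * l := by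
  obtain ⟨C, η, hC, hη, H⟩ := reach_aux κ hκ M K n hK hn
  refine ⟨C, η, hC, hη, fun u v A B L l h hηl w₁ w₂ hw hw2 hw1 => ?_⟩
  obtain ⟨a₀, b₀, hf⟩ := h.fatB
  have hL := h.Lpos
  have hl := h.lpos
  rcases le_total 0 b₀ with hb | hb
  · obtain ⟨h1, h2, h3⟩ := hf a₀ (b₀ + κ * L) (by simp; positivity)
      (by rw [add_sub_cancel_left, abs_of_pos (by positivity)])
    exact H u v A B L l h hηl _ _ h1 h2 (by linarith) ((le_abs_self _).trans h3) _ _ hw hw2 hw1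
  · obtain ⟨h1, h2, h3⟩ := hf a₀ (b₀ - κ * L) (by simp; positivity)
      (by rw [sub_sub_cancel_left, abs_neg, abs_of_pos (by positivity)])
    obtain ⟨x₁, x₂, hx, hx1, hx1', hx2⟩ := H _ _ _ _ L l h.negSnd hηl a₀ (-(b₀ - κ * L))
      (by rwa [mem_ofPred_eq, neg_neg]) h2 (by linarith) ((neg_le_abs _).trans h3) w₁ (-w₂)
      (by rwa [mem_ofPred_eq, neg_neg]) (by rwa [abs_neg]) hw1
    exact ⟨x₁, -x₂, hx, hx1, hx1', by rwa [abs_neg]⟩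

end Loc

theorem exists_scale {L : ℕ → ℝ} {i J : ℕ} {r K : ℝ} (hi : r < K * L i) (hiJ : i ≤ J) :
    ∃ k, i ≤ k ∧ k ≤ J ∧ r < K * L k ∧ (k < J → K * L (k + 1) ≤ r) := by
  induction J, hiJ using Nat.le_induction with
  | base => exact ⟨i, le_rfl, le_rfl, hi, fun h => absurd h (lt_irrefl _)⟩
  | succ J hJ ih =>
    obtain ⟨k, h1, h2, h3, h4⟩ := ih
    by_cases h5 : r < K * L (J + 1)
    · exact ⟨J + 1, by omega, le_rfl, h5, fun h => absurd h (lt_irrefl _)⟩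
    · rcases h2.lt_or_eq with h6 | h6
      · exact ⟨k, h1, by omega, h3, fun _ => h4 h6⟩
      · subst h6
        exact ⟨k, h1, by omega, h3, fun _ => not_lt.1 h5⟩

/-- Harnack decay through a chain of comparable scales. -/
theorem chain_harnack {s κ D c₀ C₁ : ℝ} (hs : 1 ≤ s) (hκ : 0 < κ) (hκ1 : κ ≤ 1) (hD : 1 ≤ D)
    (hc₀ : 0 < c₀) (hC₁ : 0 < C₁) :
    ∃ c t K C : ℝ, 0 < c ∧ c < t ∧ t < K ∧ 0 < C ∧ c < c₀ ∧ C₁ < K ∧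
    ∀ (θ : ℝ) (f : ℂ → ℂ) (L : ℕ → ℝ) (i J : ℕ), i ≤ J → (∀ k, 0 < L k) →
      (∀ k, L k ≤ D * L (k + 1)) → L J ≤ D * L i →
      (∀ k r ψ, i ≤ k → k ≤ J → c * L k < r → r < K * L k → s * |ψ - θ| < Real.pi / 2 →
        DifferentiableAt ℂ f ⟨r * Real.cos ψ, r * Real.sin ψ⟩ ∧
          0 ≤ (f ⟨r * Real.cos ψ, r * Real.sin ψ⟩).re) →
      ∀ ρ φ, c₀ * L i ≤ ρ → ρ ≤ C₁ * L i → κ ≤ Real.cos (s * (φ - θ)) →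
        s * |φ - θ| < Real.pi / 2 →
        C * (L J / L i) ^ s * (f ⟨ρ * Real.cos φ, ρ * Real.sin φ⟩).re ≤
          (f ⟨t * L J * Real.cos θ, t * L J * Real.sin θ⟩).re := by
  have hD0 : 0 < D := by linarith
  have hs0 : 0 < s := by linarith
  obtain ⟨c', hc'⟩ : ∃ c', c' = κ / 4 * (c₀ / D) := ⟨_, rfl⟩
  have hc'0 : 0 < c' := by rw [hc']; positivity
  obtain ⟨K, hK⟩ : ∃ K, K = 2 / κ * C₁ + 4 * c' := ⟨_, rfl⟩
  have hK0 : 0 < K := by rw [hK]; positivity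
  have hcc : c' < c₀ := by
    have h1 : c₀ / D ≤ c₀ := div_le_self hc₀.le hD
    have h2 : κ / 4 * (c₀ / D) ≤ 1 / 4 * c₀ :=
      mul_le_mul (by linarith) h1 (by positivity) (by norm_num)
    rw [hc']; linarith
  have hCK : C₁ < K := by
    have : 1 ≤ 2 / κ := by rw [le_div_iff₀ hκ]; linarith
    have := mul_le_mul_of_nonneg_right this hC₁.le
    rw [hK]; linarith
  have htwo : (1 : ℝ) < 2 ^ (1 / s) := Real.one_lt_rpow (by norm_num) (by positivity)
  have htwo' : (2 : ℝ) ^ (1 / s) ≤ 2 := by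
    conv_rhs => rw [← Real.rpow_one 2]
    exact Real.rpow_le_rpow_of_exponent_le (by norm_num) ((div_le_one hs0).2 hs)
  refine ⟨min c' (K / (2 * D)), 2 ^ (1 / s) * c', K, κ ^ 3 / 16 * (c' / C₁) ^ s,
    lt_min hc'0 (by positivity), (min_le_left _ _).trans_lt (by nlinarith), ?_, by positivity,
    (min_le_left _ _).trans_lt hcc, hCK, ?_⟩
  · have : 0 < 2 / κ * C₁ := by positivity
    have := mul_le_mul_of_nonneg_right htwo' hc'0.le
    linarith
  intro θ f L i J hiJ hL0 hLD hLJ hreg ρ φ hρ hρ' hφ hφ'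
  have hLi := hL0 i
  have hLJ0 := hL0 J
  have hρ0 : 0 < ρ := lt_of_lt_of_le (by positivity) hρ
  have key := sector_harnack (f := f) (R₁ := c' * L J) (R₀ := K * L i) (θ := θ) (φ := φ) (ρ := ρ)
    (κ := κ) hs (by positivity) ?_ hκ hφ hφ' hρ0 ?_ ?_ (by positivity)
  · rw [← mul_assoc] at key
    refine le_trans ?_ key
    have hre : 0 ≤ (f ⟨ρ * Real.cos φ, ρ * Real.sin φ⟩).re := by
      refine (hreg i ρ φ le_rfl hiJ ?_ ?_ hφ').2
      · refine lt_of_lt_of_le (mul_lt_mul_of_pos_right ?_ hLi) hρ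
        exact (min_le_left _ _).trans_lt hcc
      · exact lt_of_le_of_lt hρ' (mul_lt_mul_of_pos_right hCK hLi)
    refine mul_le_mul_of_nonneg_right ?_ hre
    rw [mul_assoc]
    refine mul_le_mul_of_nonneg_left ?_ (by positivity)
    rw [← Real.mul_rpow (by positivity) (by positivity)]
    refine Real.rpow_le_rpow (by positivity) ?_ hs0.le
    rw [div_mul_div_comm]
    exact div_le_div_of_nonneg_left (by positivity) hρ0 hρ'
  · intro r ψ hr hr' hψ
    obtain ⟨k, h1, h2, h3, h4⟩ := exists_scale hr' hiJ
    refine hreg k r ψ h1 h2 ?_ h3 hψ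
    rcases h2.lt_or_eq with h5 | h5
    · refine lt_of_lt_of_le ?_ (h4 h5)
      have h6 := hL0 (k + 1)
      calc min c' (K / (2 * D)) * L k ≤ K / (2 * D) * L k :=
            mul_le_mul_of_nonneg_right (min_le_right _ _) (hL0 k).le
        _ ≤ K / (2 * D) * (D * L (k + 1)) := mul_le_mul_of_nonneg_left (hLD k) (by positivity)
        _ = K * L (k + 1) / 2 := by field_simp
        _ < K * L (k + 1) := half_lt_self (by positivity)
    · rw [h5]
      exact (mul_le_mul_of_nonneg_right (min_le_left _ _) hLJ0.le).trans_lt hr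
  · have h1 : c' * L J ≤ κ / 4 * ρ := by
      rw [hc', mul_assoc]
      refine mul_le_mul_of_nonneg_left ?_ (by positivity)
      calc c₀ / D * L J ≤ c₀ / D * (D * L i) := mul_le_mul_of_nonneg_left hLJ (by positivity)
        _ = c₀ * L i := by field_simp
        _ ≤ ρ := hρ
    have h2 := Real.rpow_le_rpow (by positivity) h1 hs0.le
    rw [Real.mul_rpow (by positivity) hρ0.le] at h2
    have h3 : (κ / 4) ^ s ≤ κ / 4 := by
      conv_rhs => rw [← Real.rpow_one (κ / 4)]
      exact Real.rpow_le_rpow_of_exponent_ge (by positivity) (by linarith) hs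
    have h4 := mul_le_mul_of_nonneg_right h3 (by positivity : 0 ≤ ρ ^ s)
    linarith
  · have h1 : 2 / κ * ρ ≤ K * L i := by
      have h5 := mul_le_mul_of_nonneg_left hρ' (by positivity : 0 ≤ 2 / κ)
      have h6 : 0 ≤ 4 * c' * L i := by positivity
      rw [hK]; linarith
    have h2 := Real.rpow_le_rpow (by positivity) h1 hs0.le
    rw [Real.mul_rpow (by positivity) hρ0.le] at h2
    have h3 : 2 / κ ≤ (2 / κ) ^ s := by
      conv_lhs => rw [← Real.rpow_one (2 / κ)]
      exact Real.rpow_le_rpow_of_exponent_le (by rw [le_div_iff₀ hκ]; linarith) hs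
    have h4 := mul_le_mul_of_nonneg_right h3 (by positivity : 0 ≤ ρ ^ s)
    have h5 := mul_le_mul_of_nonneg_left (h4.trans h2) hκ.le
    rw [show κ * (2 / κ * ρ ^ s) = 2 * ρ ^ s by field_simp] at h5
    exact h5

theorem exists_angle_gap {c ε : ℝ} (hc : 0 < c) (hε : 0 < ε) :
    ∃ σ κ : ℝ, 1 < σ ∧ σ ≤ 1 + ε ∧ 0 < κ ∧ κ ≤ 1 ∧ ∀ x, |x| ≤ Real.pi → c ≤ Real.cos x →
      σ * |x| < Real.pi / 2 ∧ κ ≤ Real.cos (σ * x) := by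
  obtain ⟨x₀, hx₀⟩ : ∃ x₀, x₀ = Real.arccos c := ⟨_, rfl⟩
  have h1 : x₀ < Real.pi / 2 := by rw [hx₀]; exact Real.arccos_lt_pi_div_two.2 hc
  have h0 : 0 ≤ x₀ := by rw [hx₀]; exact Real.arccos_nonneg _
  have hpi := Real.pi_pos
  obtain ⟨m, hm⟩ : ∃ m, m = (x₀ + Real.pi / 2) / 2 := ⟨_, rfl⟩
  obtain ⟨δ, hδ⟩ : ∃ δ, δ = min ε ((Real.pi / 2 - x₀) / Real.pi) := ⟨_, rfl⟩
  have hδ0 : 0 < δ := by rw [hδ]; exact lt_min hε (div_pos (by linarith) hpi)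
  have hδπ : δ * Real.pi ≤ Real.pi / 2 - x₀ := by
    have : δ ≤ (Real.pi / 2 - x₀) / Real.pi := hδ ▸ min_le_right _ _
    rwa [le_div_iff₀ hpi] at this
  refine ⟨1 + δ, Real.cos m, by linarith, by linarith [hδ ▸ min_le_left ε _],
    Real.cos_pos_of_mem_Ioo ⟨by linarith, by linarith⟩, Real.cos_le_one _, fun x hx hcx => ?_⟩
  have hx0 : |x| ≤ x₀ := by
    rw [hx₀, ← Real.arccos_cos (abs_nonneg x) hx, Real.cos_abs]
    exact Real.arccos_le_arccos hcx
  have hxm : (1 + δ) * |x| ≤ m := by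
    have := mul_le_mul_of_nonneg_left (hx0.trans h1.le) hδ0.le
    linarith
  refine ⟨by linarith, ?_⟩
  rw [← Real.cos_abs ((1 + δ) * x), abs_mul, abs_of_pos (by linarith : 0 < 1 + δ)]
  exact Real.cos_le_cos_of_nonneg_of_le_pi (by positivity) (by linarith) hxm

theorem exists_polar {a b : ℝ} (hb : 0 ≤ b) :
    ∃ φ, 0 ≤ φ ∧ φ ≤ Real.pi ∧ a = √(a ^ 2 + b ^ 2) * Real.cos φ ∧
      b = √(a ^ 2 + b ^ 2) * Real.sin φ ∧ (0 ≤ a → φ ≤ Real.pi / 2) := by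
  have hn : ‖(⟨a, b⟩ : ℂ)‖ = √(a ^ 2 + b ^ 2) := by
    rw [Complex.norm_def, Complex.normSq_mk]; congr 1; ring
  refine ⟨Complex.arg ⟨a, b⟩, Complex.arg_nonneg_iff.2 hb, Complex.arg_le_pi _, ?_, ?_,
    fun h0 => (abs_le.1 (Complex.abs_arg_le_pi_div_two_iff.2 h0)).2⟩
  · rw [← hn, Complex.norm_mul_cos_arg]
  · rw [← hn, Complex.norm_mul_sin_arg]

theorem half_harnack {ε c₁ C₁ D : ℝ} (hε : 0 < ε) (hc₁ : 0 < c₁) (hC₁ : 0 < C₁) (hD : 1 ≤ D) :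
    ∃ σ c t K C : ℝ, 1 < σ ∧ σ ≤ 1 + ε ∧ 0 < c ∧ c < t ∧ t < K ∧ 0 < C ∧
      c < c₁ ∧ C₁ < K ∧
    ∀ (f : ℂ → ℂ) (L : ℕ → ℝ) (i J : ℕ), i ≤ J → (∀ k, 0 < L k) →
      (∀ k, L k ≤ D * L (k + 1)) → L J ≤ D * L i →
      (∀ k p q, i ≤ k → k ≤ J → |p| < K * L k → c * L k < q → q < K * L k →
        DifferentiableAt ℂ f ⟨p, q⟩ ∧ 0 ≤ (f ⟨p, q⟩).re) →
      ∀ a b, |a| ≤ C₁ * L i → c₁ * L i ≤ b → b ≤ C₁ * L i →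
        C * (L J / L i) ^ σ * (f ⟨a, b⟩).re ≤ (f ⟨0, t * L J⟩).re := by
  obtain ⟨σ, κ, hσ1, hσ, hκ, hκ1, hgap⟩ := exists_angle_gap (c := c₁ / (2 * C₁)) (by positivity) hε
  obtain ⟨c, t, K, C, hc, hct, htK, hC, hcc, hCK, H⟩ := chain_harnack (C₁ := 2 * C₁) hσ1.le hκ hκ1 hD hc₁
    (by positivity)
  have hpi := Real.pi_pos
  have hσ0 : 0 < σ := by linarith
  have hm : Real.pi / 2 / σ < Real.pi / 2 := div_lt_self (by positivity) hσ1
  have hm0 : 0 < Real.pi / 2 / σ := by positivity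
  have hc2 : 0 < Real.cos (Real.pi / 2 / σ) := Real.cos_pos_of_mem_Ioo ⟨by linarith, hm⟩
  have hc2' := Real.cos_le_one (Real.pi / 2 / σ)
  refine ⟨σ, c * Real.cos (Real.pi / 2 / σ), t, K, C, hσ1, hσ, by positivity,
    (mul_le_of_le_one_right hc.le hc2').trans_lt hct, htK, hC,
    (mul_le_of_le_one_right hc.le hc2').trans_lt hcc, by linarith, ?_⟩
  intro f L i J hiJ hL0 hLD hLJ hreg a b ha hb hb'
  have hLi := hL0 i
  have hb0 : 0 < b := lt_of_lt_of_le (by positivity) hb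
  obtain ⟨ρ, hρ⟩ : ∃ ρ, ρ = √(a ^ 2 + b ^ 2) := ⟨_, rfl⟩
  obtain ⟨φ, hφ0, hφπ, ea, eb, -⟩ := exists_polar (a := a) hb0.le
  rw [← hρ] at ea eb
  have hρb : b ≤ ρ := by rw [hρ]; exact Real.le_sqrt_of_sq_le (by linarith [sq_nonneg a])
  have hρ' : ρ ≤ 2 * C₁ * L i := by
    rw [hρ]
    refine (Real.sqrt_le_left (by positivity)).2 ?_
    have h1 : a ^ 2 ≤ (C₁ * L i) ^ 2 := sq_le_sq' (abs_le.1 ha).1 (abs_le.1 ha).2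
    have h2 : b ^ 2 ≤ (C₁ * L i) ^ 2 := pow_le_pow_left₀ hb0.le hb' 2
    have h3 := sq_nonneg (C₁ * L i)
    linarith
  have hρ0 : 0 < ρ := hb0.trans_le hρb
  have hsin : c₁ / (2 * C₁) ≤ Real.cos (φ - Real.pi / 2) := by
    rw [Real.cos_sub_pi_div_two, div_le_iff₀ (by positivity)]
    refine le_of_mul_le_mul_right ?_ hLi
    have h3 : 0 ≤ Real.sin φ := Real.sin_nonneg_of_nonneg_of_le_pi hφ0 hφπ
    have := mul_le_mul_of_nonneg_left hρ' h3
    linarith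
  obtain ⟨g1, g2⟩ := hgap _ (abs_le.2 ⟨by linarith, by linarith⟩) hsin
  have key := H (Real.pi / 2) f L i J hiJ hL0 hLD hLJ ?_ ρ φ (hb.trans hρb) hρ' g2 g1
  · rw [Real.cos_pi_div_two, Real.sin_pi_div_two, mul_zero, mul_one, ← ea, ← eb] at key
    exact key
  · intro k r ψ h1 h2 h3 h4 h5
    have hLk := hL0 k
    have hr0 : 0 < r := lt_trans (by positivity) h3
    have h6 : |ψ - Real.pi / 2| < Real.pi / 2 / σ := by rw [lt_div_iff₀ hσ0]; linarith
    have h7 : Real.cos (Real.pi / 2 / σ) ≤ Real.sin ψ := by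
      rw [← Real.cos_sub_pi_div_two, ← Real.cos_abs (ψ - _)]
      exact Real.cos_le_cos_of_nonneg_of_le_pi (abs_nonneg _) (by linarith) h6.le
    refine hreg k _ _ h1 h2 ?_ ?_ ?_
    · rw [abs_mul, abs_of_pos hr0]
      exact (mul_le_of_le_one_right hr0.le (Real.abs_cos_le_one ψ)).trans_lt h4
    · calc c * Real.cos (Real.pi / 2 / σ) * L k = c * L k * Real.cos (Real.pi / 2 / σ) := by ring
        _ < r * Real.cos (Real.pi / 2 / σ) := mul_lt_mul_of_pos_right h3 hc2
        _ ≤ r * Real.sin ψ := mul_le_mul_of_nonneg_left h7 hr0.le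
    · exact (mul_le_of_le_one_right hr0.le (Real.sin_le_one ψ)).trans_lt h4

theorem quarter_harnack {ε c₁ C₁ D : ℝ} (hε : 0 < ε) (hc₁ : 0 < c₁) (hC₁ : 0 < C₁) (hD : 1 ≤ D) :
    ∃ σ c t K C : ℝ, 1 < σ ∧ σ ≤ 1 + ε ∧ 0 < c ∧ c < t ∧ t < K ∧ 0 < C ∧
      c < c₁ ∧ C₁ < K ∧
    ∀ (f : ℂ → ℂ) (L : ℕ → ℝ) (i J : ℕ), i ≤ J → (∀ k, 0 < L k) →
      (∀ k, L k ≤ D * L (k + 1)) → L J ≤ D * L i →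
      (∀ k p q, i ≤ k → k ≤ J → c * L k < p → p < K * L k → c * L k < q → q < K * L k →
        DifferentiableAt ℂ f ⟨p, q⟩ ∧ 0 ≤ (f ⟨p, q⟩).re) →
      ∀ a b, c₁ * L i ≤ a → a ≤ C₁ * L i → c₁ * L i ≤ b → b ≤ C₁ * L i →
        C * (L J / L i) ^ (2 * σ) * (f ⟨a, b⟩).re ≤ (f ⟨t * L J, t * L J⟩).re := by
  obtain ⟨σ, κ, hσ1, hσ, hκ, hκ1, hgap⟩ := exists_angle_gap (c := (c₁ / C₁) ^ 2) (by positivity) hε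
  obtain ⟨c, t, K, C, hc, hct, htK, hC, hcc, hCK, H⟩ := chain_harnack (s := 2 * σ) (C₁ := 2 * C₁)
    (by linarith) hκ hκ1 hD hc₁ (by positivity)
  have hpi := Real.pi_pos
  have hσ0 : 0 < σ := by linarith
  obtain ⟨m, hme⟩ : ∃ m, m = Real.pi / 4 / σ := ⟨_, rfl⟩
  have hm : m < Real.pi / 4 := hme ▸ div_lt_self (by positivity) hσ1
  have hm0 : 0 < m := by rw [hme]; positivity
  have hc2 : 0 < Real.cos (Real.pi / 4 + m) :=
    Real.cos_pos_of_mem_Ioo ⟨by linarith, by linarith⟩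
  have hc2' : Real.cos (Real.pi / 4 + m) < Real.cos (Real.pi / 4) :=
    Real.cos_lt_cos_of_nonneg_of_le_pi (by linarith) (by linarith) (by linarith)
  have hc4 := Real.cos_le_one (Real.pi / 4)
  have ht0 : 0 < t := hc.trans hct
  refine ⟨σ, c * Real.cos (Real.pi / 4 + m), t * Real.cos (Real.pi / 4), K, C, hσ1, hσ,
    by positivity, mul_lt_mul'' hct hc2' hc.le hc2.le,
    (mul_le_of_le_one_right ht0.le hc4).trans_lt htK, hC,
    (mul_le_of_le_one_right hc.le (hc2'.le.trans hc4)).trans_lt hcc, by linarith, ?_⟩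
  intro f L i J hiJ hL0 hLD hLJ hreg a b ha ha' hb hb'
  have hLi := hL0 i
  have ha0 : 0 < a := lt_of_lt_of_le (by positivity) ha
  have hb0 : 0 < b := lt_of_lt_of_le (by positivity) hb
  obtain ⟨ρ, hρ⟩ : ∃ ρ, ρ = √(a ^ 2 + b ^ 2) := ⟨_, rfl⟩
  have hρ2 : ρ ^ 2 = a ^ 2 + b ^ 2 := by rw [hρ, Real.sq_sqrt (by positivity)]
  obtain ⟨φ, hφ0, -, ea, eb, hφπ⟩ := exists_polar (a := a) hb0.le
  replace hφπ := hφπ ha0.le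
  rw [← hρ] at ea eb
  have hρb : b ≤ ρ := by rw [hρ]; exact Real.le_sqrt_of_sq_le (by linarith [sq_nonneg a])
  have h1 : a ^ 2 ≤ (C₁ * L i) ^ 2 := pow_le_pow_left₀ ha0.le ha' 2
  have h2 : b ^ 2 ≤ (C₁ * L i) ^ 2 := pow_le_pow_left₀ hb0.le hb' 2
  have hρ' : ρ ≤ 2 * C₁ * L i := by
    rw [hρ]
    refine (Real.sqrt_le_left (by positivity)).2 ?_
    have h3 := sq_nonneg (C₁ * L i)
    linarith
  have hρ0 : 0 < ρ := hb0.trans_le hρb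
  have hsin : (c₁ / C₁) ^ 2 ≤ Real.cos (2 * (φ - Real.pi / 4)) := by
    rw [show 2 * (φ - Real.pi / 4) = 2 * φ - Real.pi / 2 by ring, Real.cos_sub_pi_div_two,
      Real.sin_two_mul, div_pow, div_le_iff₀ (by positivity)]
    have h3 : 0 ≤ Real.sin φ := Real.sin_nonneg_of_nonneg_of_le_pi hφ0 (by linarith)
    have h4 : 0 ≤ Real.cos φ := Real.cos_nonneg_of_mem_Icc ⟨by linarith, hφπ⟩
    have h5 : (c₁ * L i) * (c₁ * L i) ≤ a * b := mul_le_mul ha hb (by positivity) ha0.le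
    have h6 : a * b = ρ ^ 2 * (Real.cos φ * Real.sin φ) := by
      rw [ea, eb]
      ring
    have h7 : ρ ^ 2 * (Real.cos φ * Real.sin φ) ≤
        2 * (C₁ * L i) ^ 2 * (Real.cos φ * Real.sin φ) :=
      mul_le_mul_of_nonneg_right (by linarith) (by positivity)
    refine le_of_mul_le_mul_right ?_ (by positivity : 0 < L i ^ 2)
    linarith
  obtain ⟨g1, g2⟩ := hgap _ (abs_le.2 ⟨by linarith, by linarith⟩) hsin
  have key := H (Real.pi / 4) f L i J hiJ hL0 hLD hLJ ?_ ρ φ (hb.trans hρb) hρ'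
    (by rwa [← mul_assoc, mul_comm σ 2] at g2)
    (by rwa [abs_mul, abs_two, ← mul_assoc, mul_comm σ 2] at g1)
  · rw [← ea, ← eb, show Real.sin (Real.pi / 4) = Real.cos (Real.pi / 4) by simp] at key
    rwa [mul_right_comm t (Real.cos _)]
  · intro k r ψ h1 h2 h3 h4 h5
    have hLk := hL0 k
    have hr0 : 0 < r := lt_trans (by positivity) h3
    have h6 : |ψ - Real.pi / 4| < m := by rw [hme, lt_div_iff₀ hσ0]; linarith
    rw [abs_lt] at h6
    have h7 : Real.cos (Real.pi / 4 + m) ≤ Real.cos ψ :=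
      Real.cos_le_cos_of_nonneg_of_le_pi (by linarith) (by linarith) (by linarith)
    have h8 : Real.cos (Real.pi / 4 + m) ≤ Real.sin ψ := by
      rw [← Real.cos_pi_div_two_sub]
      exact Real.cos_le_cos_of_nonneg_of_le_pi (by linarith) (by linarith) (by linarith)
    have h9 : ∀ x, Real.cos (Real.pi / 4 + m) ≤ x → c * Real.cos (Real.pi / 4 + m) * L k < r * x :=
      fun x hx => calc
        c * Real.cos (Real.pi / 4 + m) * L k = c * L k * Real.cos (Real.pi / 4 + m) := by ring
        _ < r * Real.cos (Real.pi / 4 + m) := mul_lt_mul_of_pos_right h3 hc2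
        _ ≤ r * x := mul_le_mul_of_nonneg_left hx hr0.le
    exact hreg k _ _ h1 h2 (h9 _ h7)
      ((mul_le_of_le_one_right hr0.le (Real.cos_le_one ψ)).trans_lt h4) (h9 _ h8)
      ((mul_le_of_le_one_right hr0.le (Real.sin_le_one ψ)).trans_lt h4)

theorem Core.exists_deep {u v : ℝ → ℝ → ℝ} {A B : Set (ℝ × ℝ)} (hc : Core u v A B)
    {a₀ b₀ r₁ r₂ P δ : ℝ} (hr₁ : 0 ≤ r₁) (hr₂ : 0 ≤ r₂) (hP : 0 ≤ P)
    (hY : ∀ a b, |a - a₀| ≤ r₁ → |b - b₀| ≤ r₂ → (a, b) ∈ B)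
    (hx : ∀ a b x₁ x₂, |a - a₀| ≤ r₁ → |b - b₀| ≤ r₂ → Sb v a b x₁ x₂ → |x₁| ≤ P ∧ 0 ≤ x₂)
    (hδ : 2 * P * δ < 2 * r₁ * (2 * r₂)) :
    ∃ a b x₁ x₂, |a - a₀| ≤ r₁ ∧ |b - b₀| ≤ r₂ ∧ Sb v a b x₁ x₂ ∧ δ ≤ x₂ := by
  by_contra hcon
  push Not at hcon
  have hmem : ∀ y : ℝ × ℝ, y ∈ Icc (a₀ - r₁) (a₀ + r₁) ×ˢ Icc (b₀ - r₂) (b₀ + r₂) →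
      |y.1 - a₀| ≤ r₁ ∧ |y.2 - b₀| ≤ r₂ := fun y hy =>
    ⟨abs_le.2 ⟨by linarith [hy.1.1], by linarith [hy.1.2]⟩,
      abs_le.2 ⟨by linarith [hy.2.1], by linarith [hy.2.2]⟩⟩
  have h1 := hc.massv (Icc (a₀ - r₁) (a₀ + r₁) ×ˢ Icc (b₀ - r₂) (b₀ + r₂))
    (measurableSet_Icc.prod measurableSet_Icc)
  rw [inter_eq_left.2 (fun y hy => hY y.1 y.2 (hmem y hy).1 (hmem y hy).2)] at h1
  have h2 : {x : ℝ × ℝ | ∃ y ∈ Icc (a₀ - r₁) (a₀ + r₁) ×ˢ Icc (b₀ - r₂) (b₀ + r₂),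
      Sb v y.1 y.2 x.1 x.2} ⊆ Icc (-P) P ×ˢ Icc 0 δ := by
    rintro x ⟨y, hy, hs⟩
    obtain ⟨hy1, hy2⟩ := hmem y hy
    obtain ⟨h3, h4⟩ := hx _ _ _ _ hy1 hy2 hs
    exact ⟨abs_le.1 h3, h4, (hcon _ _ _ _ hy1 hy2 hs).le⟩
  have h3 := measure_mono (μ := volume) h2
  rw [h1, Measure.volume_eq_prod, Measure.prod_prod, Measure.prod_prod, Real.volume_Icc,
    Real.volume_Icc, Real.volume_Icc, Real.volume_Icc, ← ENNReal.ofReal_mul (by linarith),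
    ← ENNReal.ofReal_mul (by linarith)] at h3
  rcases le_total 0 δ with h4 | h4
  · rw [ENNReal.ofReal_le_ofReal_iff (mul_nonneg (by linarith) (by linarith))] at h3
    linarith
  · obtain ⟨x₁, x₂, hs⟩ := hc.vs a₀ b₀
    have h5 := hcon a₀ b₀ x₁ x₂ (by simpa using hr₁) (by simpa using hr₂) hs
    have h6 := (hx a₀ b₀ x₁ x₂ (by simpa using hr₁) (by simpa using hr₂) hs).2
    linarith

/-- An open convex set with `0` in its closure contains a cone around each of its points. -/
theorem exists_cone {S : Set (ℝ × ℝ)} (ho : IsOpen S) (hc : Convex ℝ S)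
    (hz : (0, 0) ∈ closure S) {τ : ℝ} (hτ : 0 < τ) (h : (0, τ) ∈ S) :
    ∃ ρ r : ℝ, 0 < ρ ∧ 0 < r ∧ ∀ a b, 0 < b → b < ρ → |a| ≤ r * b → (a, b) ∈ S := by
  obtain ⟨r, hr, hb⟩ := exists_Icc_of_nhds (P := fun a b => (a, b) ∈ S) (ho.mem_nhds h)
  refine ⟨τ, r / τ, hτ, by positivity, fun a b hb0 hbτ hab => ?_⟩
  have h1 : (a * τ / b, τ) ∈ S := by
    refine hb _ ?_ _ ⟨by linarith, by linarith⟩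
    have h2 : |a * τ / b| ≤ r := by
      rw [abs_div, abs_mul, abs_of_pos hτ, abs_of_pos hb0, div_le_iff₀ hb0]
      have := mul_le_mul_of_nonneg_right hab hτ.le
      rwa [show r / τ * b * τ = r * b by field_simp] at this
    rw [abs_le] at h2
    exact ⟨by linarith, by linarith⟩
  have h4 := hc.openSegment_interior_closure_subset_interior
    (by rw [ho.interior_eq]; exact h1) hz
    (show (b / τ * (a * τ / b) + (1 - b / τ) * 0, b / τ * τ + (1 - b / τ) * 0) ∈
        openSegment ℝ _ (0, 0) from
      ⟨b / τ, 1 - b / τ, by positivity, by rw [sub_pos, div_lt_one hτ]; exact hbτ, by ring,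
        by simp⟩)
  rw [ho.interior_eq] at h4
  convert h4 using 2 <;> field_simp <;> ring

theorem Core.snd_nonneg {u v : ℝ → ℝ → ℝ} {A B : Set (ℝ × ℝ)} (hc : Core u v A B)
    (hA : ∀ z ∈ A, 0 ≤ z.2) {a b x₁ x₂ : ℝ} (h : Sb v a b x₁ x₂) : 0 ≤ x₂ :=
  closure_minimal hA (isClosed_le continuous_const continuous_snd) (hc.subA _ _ _ _ h)

/-- A window of scales in which one coordinate frame normalizes the pair. -/
structure Win (u v : ℝ → ℝ → ℝ) (A B : Set (ℝ × ℝ)) (κ : ℝ) (M : ℝ → ℝ) (D η ρ : ℝ) (L l : ℕ → ℝ)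
    (i J : ℕ) : Prop where
  iJ : i ≤ J
  Lpos : ∀ k, 0 < L k
  dn : ∀ k, L k ≤ D * L (k + 1)
  up : L J ≤ D * L i
  loc : ∀ k, i ≤ k → k ≤ J → Loc u v A B κ M (L k) (l k)
  ecc : ∀ k, i ≤ k → k ≤ J → η * l k ≤ L k
  small : ∀ k, i ≤ k → k ≤ J → L k ≤ ρ

/-- The estimate when `B` contains points on the axis normal to the line supporting `A`. -/
theorem Core.window_half {u v : ℝ → ℝ → ℝ} {A B : Set (ℝ × ℝ)} (hc : Core u v A B)
    (hA : ∀ z ∈ A, 0 ≤ z.2) {τ : ℝ} (hτ : 0 < τ) (hB : (0, τ) ∈ B) (κ : ℝ) (M : ℝ → ℝ) {D ε : ℝ}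
    (hD : 1 ≤ D) (hε : 0 < ε) :
    ∃ η ρ C σ : ℝ, 0 < η ∧ 0 < ρ ∧ 0 < C ∧ 1 < σ ∧ σ ≤ 1 + ε ∧ ∀ (L l : ℕ → ℝ) (i J : ℕ),
      Win u v A B κ M D η ρ L l i J → l i * (L J / L i) ^ σ ≤ C * l J := by
  obtain ⟨ρ₀, r₀, hρ₀, hr₀, hcone⟩ := exists_cone hc.oB hc.cB hc.zB hτ hB
  obtain ⟨P, hP⟩ : ∃ P, P = |M 3| + 1 := ⟨_, rfl⟩
  have hP0 : 0 < P := by rw [hP]; positivity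
  obtain ⟨δ, hδ⟩ : ∃ δ, δ = 1 / (2 * P) := ⟨_, rfl⟩
  have hδ0 : 0 < δ := by rw [hδ]; positivity
  obtain ⟨σ, c, t, K, C, hσ1, hσ, hc0, hct, htK, hC, hcc, hCK, H⟩ :=
    half_harnack hε one_pos (by positivity : 0 < P + 2) hD
  have ht0 : 0 < t := hc0.trans hct
  have hK0 : 0 < K := ht0.trans htK
  obtain ⟨C₃, hC₃⟩ : ∃ C₃, C₃ = |M (2 * K) + (2 * K) ^ 2 + M (2 * K + 1)| + 1 := ⟨_, rfl⟩
  have hC₃0 : 0 < C₃ := by rw [hC₃]; positivity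
  refine ⟨C₃ / (r₀ * c) + 1 / r₀, min (ρ₀ / 3) (ρ₀ / (4 * K)), C₃ / c / (C * δ), σ, by positivity,
    by positivity, by positivity, hσ1, hσ, fun L l i J hw => ?_⟩
  have hfib : ∀ k, i ≤ k → k ≤ J → ∀ p q, |p| ≤ K * L k → c * L k ≤ q → q ≤ K * L k →
      (∃ x y, Sb u p x y q) ∧ ∀ x y, Sb u p x y q → |x| ≤ C₃ / c * l k ∧ |y| ≤ C₃ * l k ∧
        (y, q) ∈ B := by
    intro k hk hk' p q hp hq hq'
    have hloc := hw.loc k hk hk'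
    have hL := hloc.Lpos
    have hl := hloc.lpos
    have hq0 : 0 < q := lt_of_lt_of_le (by positivity) hq
    have hKL : 0 < K * L k := by positivity
    have h2q : 2 * q < ρ₀ := by
      have h1 := (hw.small k hk hk').trans (min_le_right _ _)
      rw [le_div_iff₀ (by positivity)] at h1
      linarith
    obtain ⟨h1, h2⟩ := hloc.fibre (K := 2 * K) (y₁ := 0) (y₂ := 2 * q) (p := p) (q := q)
      (subset_closure (hcone 0 (2 * q) (by linarith) h2q (by simp; positivity)))
      (by simp; positivity) (by rw [abs_of_pos (by linarith)]; linarith) (by linarith) hq0 le_rfl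
    refine ⟨h1, fun x y hs => ?_⟩
    obtain ⟨h3, h4⟩ := h2 x y hs
    have h5 : M (2 * K) + (2 * K) ^ 2 + M (2 * K + 1) ≤ C₃ := by
      rw [hC₃]; linarith [le_abs_self (M (2 * K) + (2 * K) ^ 2 + M (2 * K + 1))]
    have h6 : |y| ≤ C₃ * l k := h4.trans (mul_le_mul_of_nonneg_right h5 hl.le)
    refine ⟨?_, h6, hcone _ _ hq0 (by linarith) (h6.trans ?_)⟩
    · have h7 : c * L k * |x| ≤ C₃ * (L k * l k) :=
        (mul_le_mul_of_nonneg_right hq (abs_nonneg x)).trans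
          (h3.trans (mul_le_mul_of_nonneg_right h5 (by positivity)))
      rw [div_mul_eq_mul_div, le_div_iff₀ hc0]
      refine le_of_mul_le_mul_left ?_ hL
      linarith
    · have h7 := hw.ecc k hk hk'
      have h8 : 0 < 1 / r₀ * l k := by positivity
      have h9 : C₃ / (r₀ * c) * l k ≤ L k := by linarith
      rw [div_mul_eq_mul_div, div_le_iff₀ (by positivity)] at h9
      have h10 := mul_le_mul_of_nonneg_left hq hr₀.le
      linarith
  have hholo : ∀ k p q, i ≤ k → k ≤ J → |p| < K * L k → c * L k < q → q < K * L k →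
      DifferentiableAt ℂ (hodo u) ⟨p, q⟩ ∧ ∀ x y, Sb u p x y q → hodo u ⟨p, q⟩ = ⟨y, x⟩ := by
    intro k p q hk hk' hp hq hq'
    have hL := hw.Lpos k
    have hl := (hw.loc k hk hk').lpos
    refine hc.holo (a := -(K * L k)) (b := K * L k) (c := c * L k) (d := K * L k)
      (C := C₃ / c * l k + C₃ * l k) ⟨?_, ?_⟩ (Or.inr ?_) ⟨abs_lt.1 hp, hq, hq'⟩
    · intro p hp q hq
      exact (hfib k hk hk' p q (abs_le.2 hp) hq.1 hq.2).1
    · intro p hp q hq x y hs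
      obtain ⟨h1, h2, -⟩ := (hfib k hk hk' p q (abs_le.2 hp) hq.1 hq.2).2 x y hs
      have h3 : 0 ≤ C₃ * l k := by positivity
      have h4 : 0 ≤ C₃ / c * l k := by positivity
      exact ⟨by linarith, by linarith⟩
    · intro p hp q hq x y hs
      exact ((hfib k hk hk' p q (abs_le.2 hp) hq.1 hq.2).2 x y hs).2.2
  have hre : ∀ p x y q, hodo u ⟨p, q⟩ = ⟨y, x⟩ → (-Complex.I * hodo u ⟨p, q⟩).re = x := by
    intro p x y q h
    rw [h]; simp
  have hloc := hw.loc i le_rfl hw.iJ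
  have hL := hloc.Lpos
  have hl := hloc.lpos
  have hLρ : L i ≤ ρ₀ / 3 := (hw.small i le_rfl hw.iJ).trans (min_le_left _ _)
  have hlr : l i ≤ r₀ * L i := by
    have h7 := hw.ecc i le_rfl hw.iJ
    have h8 : 0 < C₃ / (r₀ * c) * l i := by positivity
    have h9 : 1 / r₀ * l i ≤ L i := by linarith
    rw [div_mul_eq_mul_div, div_le_iff₀ (by positivity)] at h9
    linarith
  have hgr : ∀ a b x₁ x₂, |a - 0| ≤ l i → |b - 3 / 2 * L i| ≤ L i / 2 → Sb v a b x₁ x₂ →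
      |x₁| ≤ P * L i := by
    intro a b x₁ x₂ ha hb hs
    rw [sub_zero] at ha
    rw [abs_le] at hb
    refine (hloc.grad_v (K := 2) (by linarith) (abs_le.2 ⟨by linarith, by linarith⟩) hs).1.trans
      (mul_le_mul_of_nonneg_right ?_ hL.le)
    rw [hP]; norm_num; linarith [le_abs_self (M 3)]
  have hYB : ∀ a b, |a - 0| ≤ l i → |b - 3 / 2 * L i| ≤ L i / 2 → (a, b) ∈ B := by
    intro a b ha hb
    rw [sub_zero] at ha
    rw [abs_le] at hb
    have h1 : r₀ * L i ≤ r₀ * b := mul_le_mul_of_nonneg_left (by linarith) hr₀.le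
    exact hcone a b (by linarith) (by linarith) (by linarith)
  obtain ⟨a, b, x₁, x₂, ha, hb, hs, hx₂⟩ := hc.exists_deep (P := P * L i) (δ := δ * l i) hl.le
    (half_pos hL).le (by positivity) hYB
    (fun a b x₁ x₂ ha hb hs => ⟨hgr a b x₁ x₂ ha hb hs, hc.snd_nonneg hA hs⟩) (by
      rw [show 2 * (P * L i) * (δ * l i) = 2 * P * δ * (L i * l i) by ring, hδ]
      field_simp; norm_num)
  have hx₁ := hgr a b x₁ x₂ ha hb hs
  have hu := (hc.dualB x₁ x₂ a b (hYB a b ha hb)).2 hs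
  rw [abs_le] at hb
  have hPL : 0 < P * L i := by positivity
  have key := H (fun z => -Complex.I * hodo u z) L i J hw.iJ hw.Lpos hw.dn hw.up
    (fun k p q hk hk' hp hq hq' => by
      obtain ⟨h1, h2⟩ := hholo k p q hk hk' hp hq hq'
      refine ⟨h1.const_mul _, ?_⟩
      obtain ⟨⟨x, y, hs⟩, h3⟩ := hfib k hk hk' p q hp.le hq.le hq'.le
      rw [hre p x y q (h2 x y hs)]
      exact hc.snd_nonneg hA ((hc.dualB _ _ _ _ (h3 x y hs).2.2).1 hs))
    x₁ b (by linarith) (by linarith) (by linarith)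
  have hJL := hw.Lpos J
  have hJl := (hw.loc J hw.iJ le_rfl).lpos
  have hcL := mul_lt_mul_of_pos_right hcc hL
  have hKL := mul_lt_mul_of_pos_right hCK hL
  have hdeep := (hholo i x₁ b le_rfl hw.iJ (by linarith) (by linarith) (by linarith)).2 x₂ a hu
  have htJ := mul_lt_mul_of_pos_right hct hJL
  have hKJ := mul_lt_mul_of_pos_right htK hJL
  have hbot := hholo J 0 (t * L J) hw.iJ le_rfl (by simp; positivity) htJ hKJ
  obtain ⟨⟨x, y, hs'⟩, h3⟩ := hfib J hw.iJ le_rfl 0 (t * L J) (by simp; positivity) htJ.le hKJ.le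
  simp only [hre _ _ _ _ hdeep, hre _ _ _ _ (hbot.2 x y hs')] at key
  have hx := (le_abs_self x).trans (h3 x y hs').1
  have hpow : 0 ≤ C * (L J / L i) ^ σ := by positivity
  have h4 := mul_le_mul_of_nonneg_left hx₂ hpow
  rw [div_mul_eq_mul_div, le_div_iff₀ (by positivity)]
  linarith

namespace Loc

theorem reach_swap (κ : ℝ) (hκ : 0 < κ) (M : ℝ → ℝ) (K n : ℝ) (hK : 0 ≤ K) (hn : 0 ≤ n) :
    ∃ C η, 0 < C ∧ 0 < η ∧ ∀ (u v : ℝ → ℝ → ℝ) (A B : Set (ℝ × ℝ)) (L l : ℝ),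
      Loc u v A B κ M L l → η * l ≤ L → ∀ z₁ z₂, (z₁, z₂) ∈ A → |z₁| ≤ n * z₂ → C * l ≤ z₂ →
      ∃ y₁ y₂, (y₁, y₂) ∈ B ∧ K * L ≤ y₂ ∧ y₂ ≤ C * L ∧ |y₁| ≤ C * l := by
  obtain ⟨C, η, hC, hη, H⟩ := reach κ hκ M K n hK hn
  refine ⟨C, η, hC, hη, fun u v A B L l h hl z₁ z₂ hz h1 h2 => ?_⟩
  obtain ⟨a, b, hab, h3, h4, h5⟩ := H _ _ _ _ L l h.swap hl z₂ z₁ hz h1 h2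
  exact ⟨b, a, hab, h3, h4, h5⟩

theorem fibre_all (κ : ℝ) (hκ : 0 < κ) (M : ℝ → ℝ) (K n : ℝ) (hK : 0 ≤ K) (hn : 0 ≤ n) :
    ∃ C η, 0 < C ∧ 0 < η ∧ ∀ (u v : ℝ → ℝ → ℝ) (A B : Set (ℝ × ℝ)) (L l : ℝ),
      Loc u v A B κ M L l → η * l ≤ L → ∀ z₁ z₂, (z₁, z₂) ∈ A → |z₁| ≤ n * z₂ → C * l ≤ z₂ →
      ∀ p q, |p| ≤ K * L → 0 < q → q ≤ K * L → (∃ x y, Sb u p x y q) ∧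
        ∀ x y, Sb u p x y q → q * |x| ≤ C * (L * l) ∧ |y| ≤ C * l := by
  obtain ⟨C, η, hC, hη, H⟩ := reach_swap κ hκ M (2 * K) n (by linarith) hn
  obtain ⟨N, hN⟩ : ∃ N, N = C + K := ⟨_, rfl⟩
  have habs := abs_nonneg (M N + N ^ 2 + M (N + 1))
  refine ⟨C + |M N + N ^ 2 + M (N + 1)|, η, by linarith, hη,
    fun u v A B L l h hl z₁ z₂ hz h1 h2 p q hp hq hq' => ?_⟩
  have hL0 := h.Lpos
  have hl0 := h.lpos
  have h3 : 0 ≤ |M N + N ^ 2 + M (N + 1)| * l := by positivity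
  obtain ⟨y₁, y₂, hy, hy2, hy2', hy1⟩ := H u v A B L l h hl z₁ z₂ hz h1 (by linarith)
  have hKl : 0 ≤ K * l := by positivity
  have hKL : 0 ≤ K * L := by positivity
  have hCL : 0 ≤ C * L := by positivity
  obtain ⟨h4, h5⟩ := h.fibre (K := N) (p := p) (q := q) (subset_closure hy)
    (by rw [hN]; linarith) (by rw [abs_of_pos (by linarith), hN]; linarith)
    (by rw [hN]; linarith) hq (by linarith)
  refine ⟨h4, fun x y hs => ?_⟩
  obtain ⟨h6, h7⟩ := h5 x y hs
  have h8 : M N + N ^ 2 + M (N + 1) ≤ C + |M N + N ^ 2 + M (N + 1)| := by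
    linarith [le_abs_self (M N + N ^ 2 + M (N + 1))]
  exact ⟨h6.trans (mul_le_mul_of_nonneg_right h8 (by positivity)),
    h7.trans (mul_le_mul_of_nonneg_right h8 hl0.le)⟩

/-- Points of `B` at prescribed height and far in the short direction. -/
theorem reach_at (κ : ℝ) (hκ : 0 < κ) (M : ℝ → ℝ) (c K T n : ℝ) (hc : 0 < c) (hK : 0 ≤ K)
    (hT : 0 ≤ T) (hn : 0 ≤ n) :
    ∃ C η, 0 < C ∧ 0 < η ∧ ∀ (u v : ℝ → ℝ → ℝ) (A B : Set (ℝ × ℝ)) (L l : ℝ),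
      Loc u v A B κ M L l → η * l ≤ L → ∀ w₁ w₂, (w₁, w₂) ∈ B → |w₂| ≤ n * w₁ → C * l ≤ w₁ →
      ∀ z₁ z₂, (z₁, z₂) ∈ A → |z₁| ≤ n * z₂ → C * l ≤ z₂ →
      ∀ q, c * L ≤ q → q ≤ K * L → ∃ Y, (Y, q) ∈ B ∧ T * l < Y ∧ Y ≤ C * l := by
  obtain ⟨C, η, hC, hη, H⟩ := reach_swap κ hκ M (2 * K + 2 * c) n (by positivity) hn
  obtain ⟨N, hN⟩ : ∃ N, N = T + C := ⟨_, rfl⟩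
  have hN0 : 0 < N := by linarith
  refine ⟨C + 4 * N, η + 2 * n * N / c, by positivity, by positivity,
    fun u v A B L l h hl w₁ w₂ hw hw2 hw1 z₁ z₂ hz hz1 hz2 q hq hq' => ?_⟩
  have hL0 := h.Lpos
  have hl0 := h.lpos
  have hNl : 0 < N * l := by positivity
  have hCl : 0 < C * l := by positivity
  have hcL : 0 < c * L := by positivity
  have hKL : 0 ≤ K * L := by positivity
  have hηl : 0 < η * l := by positivity
  have hnl : 0 ≤ 2 * n * N / c * l := by positivity
  obtain ⟨y₁, y₂, hy, hy2, hy2', hy1⟩ := H u v A B L l h (by linarith) z₁ z₂ hz hz1 (by linarith)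
  have hw0 : 0 < w₁ := by linarith
  have hy0 : 0 < y₂ := by linarith
  obtain ⟨t, ht⟩ : ∃ t, t = N * l / w₁ := ⟨_, rfl⟩
  have ht0 : 0 ≤ t := by rw [ht]; positivity
  have htw : t * w₁ = N * l := by rw [ht]; field_simp
  have ht4 : t ≤ 1 / 4 := by
    rw [ht, div_le_iff₀ hw0]; linarith
  have htw2 : |t * w₂| ≤ c * L / 2 := by
    rw [abs_mul, abs_of_nonneg ht0]
    have h1 := mul_le_mul_of_nonneg_left hw2 ht0
    have h2 : 2 * n * N / c * l ≤ L := by linarith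
    rw [div_mul_eq_mul_div, div_le_iff₀ hc] at h2
    have h3 : t * (n * w₁) = n * (N * l) := by rw [← htw]; ring
    linarith
  rw [abs_le] at htw2
  obtain ⟨s, hs⟩ : ∃ s, s = (q - t * w₂) / y₂ := ⟨_, rfl⟩
  have hs0 : 0 < s := by rw [hs]; exact div_pos (by linarith) hy0
  have hs2 : s ≤ 1 / 2 := by rw [hs, div_le_iff₀ hy0]; linarith
  have hsy : s * y₂ = q - t * w₂ := by rw [hs]; field_simp
  have hmem := half_mem h.core hy hw hs0 ht0 (by linarith)
  rw [hsy, sub_add_cancel, htw] at hmem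
  have h5 : |s * y₁| ≤ C * l / 2 := by
    rw [abs_mul, abs_of_pos hs0]
    have := mul_le_mul hs2 hy1 (abs_nonneg _) (by norm_num)
    linarith
  rw [abs_le] at h5
  have h6 : N * l = T * l + C * l := by rw [hN]; ring
  exact ⟨_, hmem, by linarith, by linarith⟩

theorem reach_at_swap (κ : ℝ) (hκ : 0 < κ) (M : ℝ → ℝ) (c K T n : ℝ) (hc : 0 < c) (hK : 0 ≤ K)
    (hT : 0 ≤ T) (hn : 0 ≤ n) :
    ∃ C η, 0 < C ∧ 0 < η ∧ ∀ (u v : ℝ → ℝ → ℝ) (A B : Set (ℝ × ℝ)) (L l : ℝ),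
      Loc u v A B κ M L l → η * l ≤ L → ∀ w₁ w₂, (w₁, w₂) ∈ B → |w₂| ≤ n * w₁ → C * l ≤ w₁ →
      ∀ z₁ z₂, (z₁, z₂) ∈ A → |z₁| ≤ n * z₂ → C * l ≤ z₂ →
      ∀ p, c * L ≤ p → p ≤ K * L → ∃ X, (p, X) ∈ A ∧ T * l < X ∧ X ≤ C * l := by
  obtain ⟨C, η, hC, hη, H⟩ := reach_at κ hκ M c K T n hc hK hT hn
  refine ⟨C, η, hC, hη, fun u v A B L l h hl w₁ w₂ hw hw2 hw1 z₁ z₂ hz hz1 hz2 p hp hp' => ?_⟩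
  exact H _ _ _ _ L l h.swap hl z₂ z₁ hz hz1 hz2 w₂ w₁ hw hw2 hw1 p hp hp'

/-- A pair of dual points with all four coordinates comparable to the normalizing sides. -/
theorem exists_deep (κ : ℝ) (hκ : 0 < κ) (M : ℝ → ℝ) (n : ℝ) (hn : 0 ≤ n) :
    ∃ δ C η, 0 < δ ∧ 0 < C ∧ 0 < η ∧ ∀ (u v : ℝ → ℝ → ℝ) (A B : Set (ℝ × ℝ)) (L l : ℝ),
      Loc u v A B κ M L l → η * l ≤ L → (∀ z ∈ A, 0 ≤ z.2) →
      ∀ w₁ w₂, (w₁, w₂) ∈ B → |w₂| ≤ n * w₁ → C * l ≤ w₁ →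
      ∀ z₁ z₂, (z₁, z₂) ∈ A → |z₁| ≤ n * z₂ → C * l ≤ z₂ →
      ∃ x₁ x₂ y₁ y₂, Sb u x₁ x₂ y₁ y₂ ∧ L ≤ x₁ ∧ x₁ ≤ C * L ∧ L ≤ y₂ ∧ y₂ ≤ C * L ∧
        δ * l ≤ x₂ ∧ l ≤ y₁ := by
  have hκi : 0 < 1 / κ := by positivity
  obtain ⟨Q, hQ⟩ : ∃ Q, Q = 2 + 1 / κ := ⟨_, rfl⟩
  have hQ0 : 0 < Q := by linarith
  obtain ⟨F, η₁, hF, hη₁, HF⟩ := fibre_all κ hκ M Q n hQ0.le hn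
  obtain ⟨T, hT⟩ : ∃ T, T = 2 * (F + 1 / κ + 1) := ⟨_, rfl⟩
  obtain ⟨C, η₂, hC, hη₂, H⟩ := reach_at κ hκ M 1 Q T n one_pos hQ0.le (by linarith) hn
  obtain ⟨N, hN⟩ : ∃ N, N = C + Q := ⟨_, rfl⟩
  obtain ⟨P, hP⟩ : ∃ P, P = |M (N + 1)| + 1 := ⟨_, rfl⟩
  have hP0 : 0 < P := by rw [hP]; positivity
  obtain ⟨δ, hδ⟩ : ∃ δ, δ = κ ^ 2 / (64 * P) := ⟨_, rfl⟩
  refine ⟨δ, C + F + P + Q, η₁ + η₂, by rw [hδ]; positivity, by positivity, by positivity,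
    fun u v A B L l h hl hA w₁ w₂ hw hw2 hw1 z₁ z₂ hz hz1 hz2 => ?_⟩
  have hL0 := h.Lpos
  have hl0 := h.lpos
  have p1 : 0 < η₁ * l := by positivity
  have p2 : 0 < η₂ * l := by positivity
  have p3 : 0 < C * l := by positivity
  have p4 : 0 < F * l := by positivity
  have p5 : 0 < P * l := by positivity
  have p6 : 0 < Q * l := by positivity
  have p7 : 0 < C * L := by positivity
  have p8 : 0 < F * L := by positivity
  have p9 : 0 < P * L := by positivity
  have p10 : 0 < 1 / κ * L := by positivity
  have p11 : 0 < 1 / κ * l := by positivity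
  have eQ : Q * L = 2 * L + 1 / κ * L := by rw [hQ]; ring
  have eT : T * l = 2 * (F * l) + 2 * (1 / κ * l) + 2 * l := by rw [hT]; ring
  obtain ⟨Y, hY, hTY, hYC⟩ := H u v A B L l h (by linarith) w₁ w₂ hw hw2 (by linarith) z₁ z₂ hz hz1
    (by linarith) (Q * L) (by linarith) le_rfl
  obtain ⟨a₀, b₀, hf⟩ := h.fatB
  have hbox : ∀ a b, |a - (1 / 8 * a₀ + 1 / 2 * Y)| ≤ κ / 8 * l →
      |b - (1 / 8 * b₀ + 1 / 2 * (Q * L))| ≤ κ / 8 * L →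
      (a, b) ∈ B ∧ (F + 1) * l < a ∧ a ≤ N * l ∧ L ≤ b ∧ b ≤ Q * L := by
    intro a b ha hb
    obtain ⟨h1, h2, h3⟩ := hf (8 * a - 4 * Y) (8 * b - 4 * (Q * L))
      (by rw [abs_le] at ha ⊢; constructor <;> linarith)
      (by rw [abs_le] at hb ⊢; constructor <;> linarith)
    rw [show l / κ = 1 / κ * l by ring, abs_le] at h2
    rw [show L / κ = 1 / κ * L by ring, abs_le] at h3
    have h4 := half_mem h.core h1 hY (s := 1 / 8) (t := 1 / 2) (by norm_num) (by norm_num)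
      (by norm_num)
    have eN : N * l = C * l + 2 * l + 1 / κ * l := by rw [hN, hQ]; ring
    refine ⟨?_, by linarith, by linarith, by linarith, by linarith⟩
    convert h4 using 2 <;> ring
  have hgr : ∀ a b x₁ x₂, |a - (1 / 8 * a₀ + 1 / 2 * Y)| ≤ κ / 8 * l →
      |b - (1 / 8 * b₀ + 1 / 2 * (Q * L))| ≤ κ / 8 * L → Sb v a b x₁ x₂ → |x₁| ≤ P * L := by
    intro a b x₁ x₂ ha hb hs
    obtain ⟨-, h1, h2, h3, h4⟩ := hbox a b ha hb
    have eN : N * L = C * L + Q * L := by rw [hN]; ring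
    refine (h.grad_v (K := N) (by rw [abs_of_pos (by linarith)]; exact h2)
      (by rw [abs_of_pos (by linarith)]; linarith) hs).1.trans
      (mul_le_mul_of_nonneg_right ?_ hL0.le)
    rw [hP]; linarith [le_abs_self (M (N + 1))]
  obtain ⟨a, b, x₁, x₂, ha, hb, hs, hx₂⟩ := h.core.exists_deep (P := P * L) (δ := δ * l)
    (by positivity) (by positivity) p9.le (fun a b ha hb => (hbox a b ha hb).1)
    (fun a b x₁ x₂ ha hb hs => ⟨hgr a b x₁ x₂ ha hb hs, h.core.snd_nonneg hA hs⟩) (by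
      rw [hδ]
      have e1 : 2 * (P * L) * (κ ^ 2 / (64 * P) * l) = κ ^ 2 * L * l / 32 := by field_simp; norm_num
      have e2 : 0 < κ ^ 2 * L * l := by positivity
      rw [e1]
      linarith)
  obtain ⟨h1, h2, h3, h4, h5⟩ := hbox a b ha hb
  have hu := (h.core.dualB x₁ x₂ a b h1).2 hs
  obtain ⟨⟨x, y, hs'⟩, h6⟩ := HF u v A B L l h (by linarith) z₁ z₂ hz hz1 (by linarith) L b
    (by rw [abs_of_pos hL0]; linarith) (by linarith) h5
  have h7 := (le_abs_self y).trans (h6 x y hs').2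
  have h8 := hs'.mono_fst_le hu (by linarith)
  have h9 := (le_abs_self _).trans (hgr a b x₁ x₂ ha hb hs)
  exact ⟨x₁, x₂, a, b, hu, h8, by linarith, h4, by linarith, hx₂, by linarith⟩

end Loc

/-- The estimate when `B` lies on one side of the axis normal to the line supporting `A`. -/
theorem Core.window_quarter {u v : ℝ → ℝ → ℝ} {A B : Set (ℝ × ℝ)} (hc : Core u v A B)
    (hA : ∀ z ∈ A, 0 ≤ z.2) (hB : ∀ z ∈ B, 0 ≤ z.1) {w₁ w₂ z₁ z₂ : ℝ} (hw : (w₁, w₂) ∈ B)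
    (hw0 : 0 < w₁) (hz : (z₁, z₂) ∈ A) (hz0 : 0 < z₂)
    (h0 : ∀ y₁ y₂, Sb u 0 0 y₁ y₂ → y₁ = 0 ∧ y₂ = 0) {κ : ℝ} (hκ : 0 < κ) (M : ℝ → ℝ) {D ε : ℝ}
    (hD : 1 ≤ D) (hε : 0 < ε) :
    ∃ η ρ C σ : ℝ, 0 < η ∧ 0 < ρ ∧ 0 < C ∧ 1 < σ ∧ σ ≤ 1 + ε ∧ ∀ (L l : ℕ → ℝ) (i J : ℕ),
      Win u v A B κ M D η ρ L l i J → l i * (L J / L i) ^ σ ≤ C * l J := by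
  obtain ⟨n, hn⟩ : ∃ n, n = |w₂| / w₁ + |z₁| / z₂ := ⟨_, rfl⟩
  have hn0 : 0 ≤ n := by rw [hn]; positivity
  have hnw : |w₂| ≤ n * w₁ := by
    rw [hn, add_mul, div_mul_cancel₀ _ hw0.ne']
    have : 0 ≤ |z₁| / z₂ * w₁ := by positivity
    linarith
  have hnz : |z₁| ≤ n * z₂ := by
    rw [hn, add_mul, div_mul_cancel₀ _ hz0.ne']
    have : 0 ≤ |w₂| / w₁ * z₂ := by positivity
    linarith
  obtain ⟨δ, C₁, η₁, hδ, hC₁, hη₁, Hdeep⟩ := Loc.exists_deep κ hκ M n hn0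
  obtain ⟨σ, c, t, K, C, hσ1, hσ, hc0, hct, htK, hC, hcc, hCK, H⟩ :=
    quarter_harnack hε one_pos hC₁ hD
  have ht0 : 0 < t := hc0.trans hct
  have hK0 : 0 < K := ht0.trans htK
  obtain ⟨F, η₂, hF, hη₂, HF⟩ := Loc.fibre_all κ hκ M K n hK0.le hn0
  obtain ⟨T, hT⟩ : ∃ T, T = F / c + F := ⟨_, rfl⟩
  have hT0 : 0 < T := by rw [hT]; positivity
  obtain ⟨C₃, η₃, hC₃, hη₃, HB⟩ := Loc.reach_at κ hκ M c K T n hc0 hK0.le hT0.le hn0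
  obtain ⟨C₄, η₄, hC₄, hη₄, HA⟩ := Loc.reach_at_swap κ hκ M c K T n hc0 hK0.le hT0.le hn0
  obtain ⟨N, hN⟩ : ∃ N, N = C₁ + F + C₃ + C₄ := ⟨_, rfl⟩
  have hN0 : 0 < N := by linarith
  obtain ⟨Q, hQ⟩ : ∃ Q, Q = F / c * F / (C * δ) := ⟨_, rfl⟩
  have hQ0 : 0 < Q := by rw [hQ]; positivity
  refine ⟨η₁ + η₂ + η₃ + η₄, min (w₁ / N) (z₂ / N), √Q, σ, by positivity, by positivity,
    by positivity, hσ1, hσ, fun L l i J hW => ?_⟩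
  have hecc : ∀ k, i ≤ k → k ≤ J → η₁ * l k ≤ L k ∧ η₂ * l k ≤ L k ∧ η₃ * l k ≤ L k ∧
      η₄ * l k ≤ L k := by
    intro k hk hk'
    have h1 := hW.ecc k hk hk'
    have hl := (hW.loc k hk hk').lpos
    have h2 := mul_pos hη₁ hl
    have h3 := mul_pos hη₂ hl
    have h4 := mul_pos hη₃ hl
    have h5 := mul_pos hη₄ hl
    refine ⟨?_, ?_, ?_, ?_⟩ <;> linarith
  have hsm : ∀ k, i ≤ k → k ≤ J → ∀ R, 0 < R → R ≤ N → R * l k ≤ w₁ ∧ R * l k ≤ z₂ := by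
    intro k hk hk' R hR hRN
    have hl := (hW.loc k hk hk').lpos
    have hlL := (hW.loc k hk hk').lL
    have h1 := hW.small k hk hk'
    have h2 := h1.trans (min_le_left _ _)
    have h3 := h1.trans (min_le_right _ _)
    rw [le_div_iff₀ hN0] at h2 h3
    have h4 := mul_le_mul_of_nonneg_right hRN hl.le
    have h5 := mul_le_mul_of_nonneg_left hlL hN0.le
    exact ⟨by linarith, by linarith⟩
  have hfib : ∀ k, i ≤ k → k ≤ J → ∀ p q, c * L k ≤ p → p ≤ K * L k → c * L k ≤ q → q ≤ K * L k →
      (∃ x y, Sb u p x y q) ∧ ∀ x y, Sb u p x y q → |x| ≤ F / c * l k ∧ |y| ≤ F * l k ∧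
        (y, q) ∈ B := by
    intro k hk hk' p q hp hp' hq hq'
    have hloc := hW.loc k hk hk'
    have hL := hloc.Lpos
    have hl := hloc.lpos
    obtain ⟨-, e2, e3, e4⟩ := hecc k hk hk'
    have hp0 : 0 < p := lt_of_lt_of_le (by positivity) hp
    have hq0 : 0 < q := lt_of_lt_of_le (by positivity) hq
    have s2 := hsm k hk hk' F hF (by linarith)
    have s3 := hsm k hk hk' C₃ hC₃ (by linarith)
    have s4 := hsm k hk hk' C₄ hC₄ (by linarith)
    obtain ⟨h1, h2⟩ := HF u v A B _ _ hloc e2 z₁ z₂ hz hnz s2.2 p q (by rwa [abs_of_pos hp0]) hq0 hq'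
    refine ⟨h1, fun x y hs => ?_⟩
    obtain ⟨h3, h4⟩ := h2 x y hs
    have h5 : |x| ≤ F / c * l k := by
      have h7 : c * L k * |x| ≤ F * (L k * l k) :=
        (mul_le_mul_of_nonneg_right hq (abs_nonneg x)).trans h3
      rw [div_mul_eq_mul_div, le_div_iff₀ hc0]
      refine le_of_mul_le_mul_left ?_ hL
      linarith
    obtain ⟨Y, hY, hY', -⟩ := HB u v A B _ _ hloc e3 w₁ w₂ hw hnw s3.1 z₁ z₂ hz hnz s3.2 q hq hq'
    obtain ⟨X, hX, hX', -⟩ := HA u v A B _ _ hloc e4 w₁ w₂ hw hnw s4.1 z₁ z₂ hz hnz s4.2 p hp hp'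
    have h6 : 0 < F / c * l k := by positivity
    have h7 : 0 < F * l k := by positivity
    rw [hT, add_mul] at hX' hY'
    exact ⟨h5, h4, hc.mem_of_hit h0 hp0 hq0 hs hX (by linarith [le_abs_self x]) hY
      (by linarith [le_abs_self y])⟩
  have hholo : ∀ k p q, i ≤ k → k ≤ J → c * L k < p → p < K * L k → c * L k < q → q < K * L k →
      DifferentiableAt ℂ (hodo u) ⟨p, q⟩ ∧ ∀ x y, Sb u p x y q → hodo u ⟨p, q⟩ = ⟨y, x⟩ := by
    intro k p q hk hk' hp hp' hq hq'
    have hL := hW.Lpos k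
    have hl := (hW.loc k hk hk').lpos
    refine hc.holo (a := c * L k) (b := K * L k) (c := c * L k) (d := K * L k)
      (C := F / c * l k + F * l k) ⟨?_, ?_⟩ (Or.inr ?_) ⟨⟨hp, hp'⟩, hq, hq'⟩
    · intro p hp q hq
      exact (hfib k hk hk' p q hp.1 hp.2 hq.1 hq.2).1
    · intro p hp q hq x y hs
      obtain ⟨h1, h2, -⟩ := (hfib k hk hk' p q hp.1 hp.2 hq.1 hq.2).2 x y hs
      have h3 : 0 ≤ F * l k := by positivity
      have h4 : 0 ≤ F / c * l k := by positivity
      exact ⟨by linarith, by linarith⟩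
    · intro p hp q hq x y hs
      exact ((hfib k hk hk' p q hp.1 hp.2 hq.1 hq.2).2 x y hs).2.2
  have hre : ∀ p x y q, hodo u ⟨p, q⟩ = ⟨y, x⟩ →
      (-Complex.I / 2 * hodo u ⟨p, q⟩ ^ 2).re = x * y := by
    intro p x y q h
    rw [h]
    simp [pow_two, Complex.mul_re, Complex.mul_im]
    ring
  have hloc := hW.loc i le_rfl hW.iJ
  have hL := hloc.Lpos
  have hl := hloc.lpos
  have s1 := hsm i le_rfl hW.iJ C₁ hC₁ (by linarith)
  obtain ⟨x₁, x₂, y₁, y₂, hs, hx₁, hx₁', hy₂, hy₂', hx₂, hy₁⟩ := Hdeep u v A B _ _ hloc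
    (hecc i le_rfl hW.iJ).1 hA w₁ w₂ hw hnw s1.1 z₁ z₂ hz hnz s1.2
  have key := H (fun z => -Complex.I / 2 * hodo u z ^ 2) L i J hW.iJ hW.Lpos hW.dn hW.up
    (fun k p q hk hk' hp hp' hq hq' => by
      obtain ⟨h1, h2⟩ := hholo k p q hk hk' hp hp' hq hq'
      refine ⟨(h1.pow 2).const_mul _, ?_⟩
      obtain ⟨⟨x, y, hs⟩, h3⟩ := hfib k hk hk' p q hp.le hp'.le hq.le hq'.le
      have h4 := (h3 x y hs).2.2
      rw [hre p x y q (h2 x y hs)]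
      exact mul_nonneg (hc.snd_nonneg hA ((hc.dualB _ _ _ _ h4).1 hs)) (hB _ h4))
    x₁ y₂ (by linarith) hx₁' (by linarith) hy₂'
  have hJL := hW.Lpos J
  have hJl := (hW.loc J hW.iJ le_rfl).lpos
  have hcL := mul_lt_mul_of_pos_right hcc hL
  have hKL := mul_lt_mul_of_pos_right hCK hL
  have hdeep := (hholo i x₁ y₂ le_rfl hW.iJ (by linarith) (by linarith) (by linarith)
    (by linarith)).2 x₂ y₁ hs
  have htJ := mul_lt_mul_of_pos_right hct hJL
  have hKJ := mul_lt_mul_of_pos_right htK hJL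
  have hbot := hholo J (t * L J) (t * L J) hW.iJ le_rfl htJ hKJ htJ hKJ
  obtain ⟨⟨x, y, hs'⟩, h3⟩ := hfib J hW.iJ le_rfl (t * L J) (t * L J) htJ.le hKJ.le htJ.le hKJ.le
  simp only [hre _ _ _ _ hdeep, hre _ _ _ _ (hbot.2 x y hs')] at key
  obtain ⟨hx, hy, -⟩ := h3 x y hs'
  have hxy : x * y ≤ F / c * l J * (F * l J) := by
    refine (le_abs_self _).trans ?_
    rw [abs_mul]
    exact mul_le_mul hx hy (abs_nonneg _) (by positivity)
  have hdd : δ * l i * l i ≤ x₂ * y₁ := mul_le_mul hx₂ hy₁ hl.le (by linarith [mul_pos hδ hl])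
  have hr : 0 < L J / L i := by positivity
  have hpow : (L J / L i) ^ (2 * σ) = ((L J / L i) ^ σ) ^ 2 := by
    rw [mul_comm, Real.rpow_mul hr.le]; norm_cast
  refine abs_le_of_sq_le_sq' ?_ (by positivity) |>.2
  rw [mul_pow, mul_pow, Real.sq_sqrt hQ0.le, ← hpow, hQ, div_mul_eq_mul_div,
    le_div_iff₀ (by positivity)]
  have h4 := mul_le_mul_of_nonneg_left hdd (by positivity : 0 ≤ C * (L J / L i) ^ (2 * σ))
  calc l i ^ 2 * (L J / L i) ^ (2 * σ) * (C * δ) = C * (L J / L i) ^ (2 * σ) * (δ * l i * l i) := by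
        ring
    _ ≤ F / c * l J * (F * l J) := by linarith
    _ = _ := by ring

theorem Core.window_line {u v : ℝ → ℝ → ℝ} {A B : Set (ℝ × ℝ)} (hc : Core u v A B)
    (hA : ∀ z ∈ A, 0 ≤ z.2) (h0 : ∀ y₁ y₂, Sb u 0 0 y₁ y₂ → y₁ = 0 ∧ y₂ = 0) {κ : ℝ} (hκ : 0 < κ)
    (M : ℝ → ℝ) {D ε : ℝ} (hD : 1 ≤ D) (hε : 0 < ε) :
    ∃ η ρ C σ : ℝ, 0 < η ∧ 0 < ρ ∧ 0 < C ∧ 1 < σ ∧ σ ≤ 1 + ε ∧ ∀ (L l : ℕ → ℝ) (i J : ℕ),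
      Win u v A B κ M D η ρ L l i J → l i * (L J / L i) ^ σ ≤ C * l J := by
  by_cases h1 : ∃ τ, 0 < τ ∧ (0, τ) ∈ B
  · obtain ⟨τ, hτ, h⟩ := h1
    exact hc.window_half hA hτ h κ M hD hε
  push Not at h1
  obtain ⟨z₁, z₂, hz, hz0⟩ : ∃ z₁ z₂, (z₁, z₂) ∈ A ∧ 0 < z₂ := by
    obtain ⟨⟨a, b⟩, h⟩ := closure_nonempty_iff.1 ⟨_, hc.zA⟩
    obtain ⟨r, hr, h2⟩ := Metric.isOpen_iff.1 hc.oA _ h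
    refine ⟨a, b + r / 2, h2 ?_, ?_⟩
    · rw [mem_ball, Prod.dist_eq]
      simp [abs_of_pos hr, hr]
    · have := hA _ h
      simp only at this
      linarith
  have hB0 : ∀ τ, (0, τ) ∉ B := by
    intro τ hτ
    rcases lt_trichotomy τ 0 with h2 | h2 | h2
    · obtain ⟨x₁, x₂, hs⟩ := hc.vs 0 τ
      have hs' := (hc.dualB _ _ _ _ hτ).2 hs
      have h3 := hc.eqB _ _ _ _ hτ hs'
      have h4 := hc.snd_nonneg hA hs
      have h5 := hc.un x₁ x₂
      have h6 : x₂ * τ ≤ 0 := mul_nonpos_of_nonneg_of_nonpos h4 h2.le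
      have h7 : Sb v 0 τ 0 0 := by
        intro s t
        have := hc.vn s t
        linarith
      have := (h0 _ _ ((hc.dualB _ _ _ _ hτ).2 h7)).2
      exact h2.ne this
    · rw [h2] at hτ
      exact hc.nB hτ
    · exact h1 τ h2 hτ
  have hsep : ∀ p q p' q' : ℝ, (p, q) ∈ B → (p', q') ∈ B → p < 0 → 0 < p' → False := by
    intro p q p' q' h2 h3 h4 h5
    refine hB0 (p' / (p' - p) * q + -p / (p' - p) * q') ?_
    have h6 : 0 < p' - p := by linarith
    have h7 := hc.cB h2 h3 (a := p' / (p' - p)) (b := -p / (p' - p)) (by positivity)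
      (div_nonneg (by linarith) h6.le) (by field_simp; ring)
    convert h7 using 1
    ext
    · simp; field_simp; ring
    · simp
  obtain ⟨⟨w₁, w₂⟩, hw⟩ := closure_nonempty_iff.1 ⟨_, hc.zB⟩
  have hne : ∀ p q, (p, q) ∈ B → p ≠ 0 := fun p q h h2 => hB0 q (h2 ▸ h)
  rcases (hne _ _ hw).lt_or_gt with hw0 | hw0
  · obtain ⟨η, ρ, C, σ, e1, e2, e3, e4, e5, H⟩ := hc.negFst.window_quarter (w₁ := -w₁) (w₂ := w₂)
      (z₁ := -z₁) (z₂ := z₂) (fun z hz => hA (-z.1, z.2) hz) (fun z hz => by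
        by_contra h2
        push Not at h2
        exact hsep _ _ _ _ hw hz hw0 (by linarith))
      (by simpa using hw) (by linarith) (by simpa using hz) hz0
      (fun y₁ y₂ h => by
        have := h0 (-y₁) y₂ (fun s t => by
          have := h (-s) t
          simp only [neg_zero, neg_neg] at this
          linarith)
        simpa using this) hκ M hD hε
    exact ⟨η, ρ, C, σ, e1, e2, e3, e4, e5, fun L l i J hW => H L l i J
      ⟨hW.iJ, hW.Lpos, hW.dn, hW.up, fun k hk hk' => (hW.loc k hk hk').negFst, hW.ecc, hW.small⟩⟩
  · refine hc.window_quarter hA (fun z hz => ?_) hw hw0 hz hz0 h0 hκ M hD hε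
    by_contra h2
    push Not at h2
    exact hsep _ _ _ _ hz hw h2 hw0

theorem Sb.orth_zero {u : ℝ → ℝ → ℝ} {c s τ p q : ℝ} (h : c ^ 2 + s ^ 2 = 1) (hτ : τ ^ 2 = 1) :
    Sb (fun a b => u (c * a - τ * s * b) (s * a + τ * c * b)) 0 0 p q ↔
      Sb u 0 0 (c * p - τ * s * q) (s * p + τ * c * q) := by
  constructor
  · intro hs a b
    have h1 := hs (c * a + s * b) (τ * (-s * a + c * b))
    have e1 : c * (c * a + s * b) - τ * s * (τ * (-s * a + c * b)) = a := by
      linear_combination a * h + (s ^ 2 * a - s * c * b) * hτ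
    have e2 : s * (c * a + s * b) + τ * c * (τ * (-s * a + c * b)) = b := by
      linear_combination b * h + (c ^ 2 * b - s * c * a) * hτ
    simp only [mul_zero, sub_zero, add_zero] at h1
    rw [e1, e2] at h1
    simp only [sub_zero]
    linarith
  · intro hs a b
    have h1 := hs (c * a - τ * s * b) (s * a + τ * c * b)
    simp only [mul_zero, sub_zero, add_zero] at h1 ⊢
    have e : (c * p - τ * s * q) * (c * a - τ * s * b) + (s * p + τ * c * q) * (s * a + τ * c * b) =
        p * a + q * b := by
      linear_combination (p * a + τ ^ 2 * q * b) * h + q * b * hτ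
    linarith

namespace Sys

variable {u v : ℝ → ℝ → ℝ} {A B : Set (ℝ × ℝ)} {κ D : ℝ} {M : ℝ → ℝ} {c s L l : ℕ → ℝ}

theorem Lpos (h : Sys u v A B κ D M c s L l) (k : ℕ) : 0 < L k := (h.lpos k).trans_le (h.lL k)

theorem exists_le (h : Sys u v A B κ D M c s L l) {ρ : ℝ} (hρ : 0 < ρ) :
    ∃ n, ∀ k, n ≤ k → L k ≤ ρ := by
  have hL := h.Lpos 0
  have hD := zero_lt_one.trans_le h.hD
  obtain ⟨n, hn⟩ := h.dec (ρ / (D * L 0)) (by positivity)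
  refine ⟨n, fun k hk => ?_⟩
  obtain ⟨j, rfl⟩ := Nat.exists_eq_add_of_le hk
  rw [add_comm]
  have h1 := h.up 0 j
  rw [zero_add] at h1
  calc L (j + n) ≤ ρ / (D * L 0) * L j := hn j
    _ ≤ ρ / (D * L 0) * (D * L 0) := by gcongr
    _ = ρ := by field_simp

theorem exists_ecc (h : Sys u v A B κ D M c s L l) {ρ : ℝ} (hρ : 0 < ρ) :
    ∃ η, 0 < η ∧ ∀ k, η * l k ≤ L k → L k ≤ ρ := by
  obtain ⟨n, hn⟩ := h.exists_le hρ
  have hp : ∀ k, 0 < L k / l k := fun k => div_pos (h.Lpos k) (h.lpos k)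
  have hs : 0 ≤ ∑ k ∈ Finset.range n, L k / l k := Finset.sum_nonneg fun k _ => (hp k).le
  refine ⟨∑ k ∈ Finset.range n, L k / l k + 1, by linarith, fun k hk => ?_⟩
  refine hn k (le_of_not_gt fun hkn => ?_)
  rw [← le_div_iff₀ (h.lpos k)] at hk
  have := Finset.single_le_sum (fun k _ => (hp k).le) (Finset.mem_range.2 hkn)
  linarith

theorem eq_zero (h : Sys u v A B κ D M c s L l) {w : ℝ → ℝ → ℝ} {P : ℝ}
    (H : ∀ k p q, Sb (fun a b => w (c k * a - 1 * s k * b) (s k * a + 1 * c k * b)) 0 0 p q →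
      |p| ≤ P * L k ∧ |q| ≤ P * L k) {y₁ y₂ : ℝ} (hs : Sb w 0 0 y₁ y₂) : y₁ = 0 ∧ y₂ = 0 := by
  have hkey : ∀ k, y₁ ^ 2 + y₂ ^ 2 ≤ 2 * (P * L k) ^ 2 := by
    intro k
    obtain ⟨h4, h3⟩ := H k (c k * y₁ + s k * y₂) (-s k * y₁ + c k * y₂) (by
      rw [Sb.orth_zero (h.cs k) (by norm_num)]
      have e1 : c k * (c k * y₁ + s k * y₂) - 1 * s k * (-s k * y₁ + c k * y₂) = y₁ := by
        linear_combination y₁ * h.cs k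
      have e2 : s k * (c k * y₁ + s k * y₂) + 1 * c k * (-s k * y₁ + c k * y₂) = y₂ := by
        linear_combination y₂ * h.cs k
      rwa [e1, e2])
    have h5 := sq_le_sq' (abs_le.1 h4).1 (abs_le.1 h4).2
    have h6 := sq_le_sq' (abs_le.1 h3).1 (abs_le.1 h3).2
    have e : y₁ ^ 2 + y₂ ^ 2 = (c k * y₁ + s k * y₂) ^ 2 + (-s k * y₁ + c k * y₂) ^ 2 := by
      linear_combination -(y₁ ^ 2 + y₂ ^ 2) * h.cs k
    linarith
  have hz : y₁ ^ 2 + y₂ ^ 2 ≤ 0 := by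
    refine le_of_forall_pos_le_add fun ε hε => ?_
    obtain ⟨n, hn⟩ := h.exists_le (ρ := √ε / (2 * (|P| + 1))) (by positivity)
    have h1 := hn n le_rfl
    rw [le_div_iff₀ (by positivity)] at h1
    have h2 : |2 * (P * L n)| ≤ √ε := by
      have hL := h.Lpos n
      rw [abs_mul, abs_mul, abs_of_pos hL, abs_two]
      linarith
    have h3 := sq_le_sq' (abs_le.1 h2).1 (abs_le.1 h2).2
    rw [Real.sq_sqrt hε.le] at h3
    have h4 := hkey n
    have h5 := sq_nonneg (P * L n)
    linarith
  have h1 := sq_nonneg y₁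
  have h2 := sq_nonneg y₂
  exact ⟨pow_eq_zero_iff two_ne_zero |>.1 (by linarith),
    pow_eq_zero_iff two_ne_zero |>.1 (by linarith)⟩

theorem own_loc (h : Sys u v A B κ D M c s L l) (k : ℕ) {σ τ : ℝ} (hσ : σ ^ 2 = 1)
    (hτ : τ ^ 2 = 1) :
    Loc (fun a b => u (σ * c k * a - τ * (σ * s k) * b) (σ * s k * a + τ * (σ * c k) * b))
      (fun a b => v (σ * c k * a - τ * (σ * s k) * b) (σ * s k * a + τ * (σ * c k) * b))
      (orthMap (σ * c k) (σ * s k) τ (by linear_combination h.cs k + (c k ^ 2 + s k ^ 2) * hσ) hτ ⁻¹' A)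
      (orthMap (σ * c k) (σ * s k) τ (by linear_combination h.cs k + (c k ^ 2 + s k ^ 2) * hσ) hτ ⁻¹' B)
      (κ / 2) (fun x => M (2 * x)) (L k) (l k) := by
  have := h.loc (c₀ := σ * c k) (s₀ := σ * s k) (τ := τ) (K := 0) (k := k)
    (by linear_combination h.cs k + (c k ^ 2 + s k ^ 2) * hσ) hτ (by
      rw [show σ * c k * s k - σ * s k * c k = 0 by ring]; simp)
  simpa only [zero_add] using this

theorem eq_zero_u (h : Sys u v A B κ D M c s L l) {y₁ y₂ : ℝ} (hs : Sb u 0 0 y₁ y₂) :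
    y₁ = 0 ∧ y₂ = 0 := by
  refine h.eq_zero (P := M 2) (fun k p q hs => ?_) hs
  have hloc := h.own_loc k (σ := 1) (τ := 1) (by norm_num) (by norm_num)
  simp only [one_mul] at hloc
  simp only [one_mul] at hs
  obtain ⟨h2, h3⟩ := hloc.grad_u (K := 0) (by simp) (by simp) hs
  norm_num at h2 h3
  have hM : 0 ≤ M 2 := nonneg_of_mul_nonneg_left ((abs_nonneg _).trans h2) (h.lpos k)
  exact ⟨h2.trans (mul_le_mul_of_nonneg_left (h.lL k) hM), h3⟩

theorem eq_zero_v (h : Sys u v A B κ D M c s L l) {x₁ x₂ : ℝ} (hs : Sb v 0 0 x₁ x₂) :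
    x₁ = 0 ∧ x₂ = 0 := by
  refine h.eq_zero (P := M 2) (fun k p q hs => ?_) hs
  have hloc := h.own_loc k (σ := 1) (τ := 1) (by norm_num) (by norm_num)
  simp only [one_mul] at hloc
  simp only [one_mul] at hs
  obtain ⟨h2, h3⟩ := hloc.grad_v (K := 0) (by simp) (by simp) hs
  norm_num at h2 h3
  have hM : 0 ≤ M 2 := nonneg_of_mul_nonneg_left ((abs_nonneg _).trans h2) (h.Lpos k)
  exact ⟨h2, h3.trans (mul_le_mul_of_nonneg_left (h.lL k) hM)⟩

/-- Along a run of scales aligned with a line supporting `A` or `B`, the short sides decay almost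
linearly in the long ones. -/
theorem window (h : Sys u v A B κ D M c s L l) {c₀ s₀ K ε : ℝ} (hcs : c₀ ^ 2 + s₀ ^ 2 = 1)
    (hAB : (∀ z ∈ A, 0 ≤ -s₀ * z.1 + c₀ * z.2) ∨ ∀ z ∈ B, 0 ≤ c₀ * z.1 + s₀ * z.2)
    (hK : 0 ≤ K) (hε : 0 < ε) :
    ∃ η C, 0 < η ∧ 0 < C ∧ ∀ i J, i ≤ J →
      (∀ k, i ≤ k → k ≤ J → |c₀ * s k - s₀ * c k| * L k ≤ K * l k ∧ η * l k ≤ L k) →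
      l i * (L J / L i) ^ (1 + ε) ≤ C * l J := by
  have hκ : 0 < κ / (K + 2) := by have := h.hκ; positivity
  obtain ⟨M', hM'⟩ : ∃ M' : ℝ → ℝ, M' = fun x => M ((K + 2) * x) := ⟨_, rfl⟩
  obtain ⟨u', hu'⟩ : ∃ u' : ℝ → ℝ → ℝ,
    u' = fun a b => u (c₀ * a - 1 * s₀ * b) (s₀ * a + 1 * c₀ * b) := ⟨_, rfl⟩
  obtain ⟨v', hv'⟩ : ∃ v' : ℝ → ℝ → ℝ,
    v' = fun a b => v (c₀ * a - 1 * s₀ * b) (s₀ * a + 1 * c₀ * b) := ⟨_, rfl⟩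
  have h1 : (1 : ℝ) ^ 2 = 1 := by norm_num
  have hfix : ∀ w : ℝ → ℝ → ℝ, (∀ y₁ y₂, Sb w 0 0 y₁ y₂ → y₁ = 0 ∧ y₂ = 0) → ∀ y₁ y₂,
      Sb (fun a b => w (c₀ * a - 1 * s₀ * b) (s₀ * a + 1 * c₀ * b)) 0 0 y₁ y₂ →
      y₁ = 0 ∧ y₂ = 0 := by
    intro w hw y₁ y₂ hs
    obtain ⟨h2, h3⟩ := hw _ _ ((Sb.orth_zero hcs h1).1 hs)
    constructor
    · linear_combination -y₁ * hcs + c₀ * h2 + s₀ * h3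
    · linear_combination -y₂ * hcs - s₀ * h2 + c₀ * h3
  have hcore := h.core.orth c₀ s₀ 1 hcs h1
  rw [← hu', ← hv'] at hcore
  obtain ⟨η, ρ, C, σ, hη, hρ, hC, hσ1, hσ, H⟩ : ∃ η ρ C σ : ℝ, 0 < η ∧ 0 < ρ ∧ 0 < C ∧ 1 < σ ∧
      σ ≤ 1 + ε ∧ ∀ (L l : ℕ → ℝ) (i J : ℕ),
      Win u' v' (orthMap c₀ s₀ 1 hcs h1 ⁻¹' A) (orthMap c₀ s₀ 1 hcs h1 ⁻¹' B) (κ / (K + 2)) M' D η ρ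
        L l i J → l i * (L J / L i) ^ σ ≤ C * l J := by
    rcases hAB with hA | hB
    · refine hcore.window_line (fun z hz => ?_) (hu' ▸ hfix u fun _ _ => h.eq_zero_u) hκ M' h.hD hε
      have h2 := hA _ hz
      rw [orthMap_apply] at h2
      linear_combination h2 + z.2 * hcs
    · obtain ⟨η, ρ, C, σ, e1, e2, e3, e4, e5, H⟩ := hcore.swap.window_line (fun z hz => by
          have h2 := hB _ hz
          rw [orthMap_apply] at h2
          simp only [Prod.fst_swap, Prod.snd_swap] at h2
          linear_combination h2 + z.2 * hcs)
        (fun y₁ y₂ hs => (hfix v (fun _ _ => h.eq_zero_v) y₂ y₁ (fun a b => by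
          have h2 := hs b a
          simp only [hv'] at h2
          linarith)).symm) hκ M' h.hD hε
      exact ⟨η, ρ, C, σ, e1, e2, e3, e4, e5, fun L l i J hW => H L l i J
        ⟨hW.iJ, hW.Lpos, hW.dn, hW.up, fun k hk hk' => (hW.loc k hk hk').swap, hW.ecc, hW.small⟩⟩
  obtain ⟨η', hη', Hη⟩ := h.exists_ecc hρ
  have hD0 := zero_lt_one.trans_le h.hD
  refine ⟨η + η', C * D ^ (1 + ε - σ), by linarith, by positivity, fun i J hiJ hk => ?_⟩
  have hecc : ∀ k, i ≤ k → k ≤ J → η * l k ≤ L k ∧ η' * l k ≤ L k := by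
    intro k hik hkJ
    have h2 := (hk k hik hkJ).2
    have hl := h.lpos k
    have h3 := mul_pos hη hl
    have h4 := mul_pos hη' hl
    exact ⟨by linarith, by linarith⟩
  have hup : L J ≤ D * L i := by
    have := h.up i (J - i)
    rwa [Nat.add_sub_cancel' hiJ] at this
  have key := H L l i J ⟨hiJ, h.Lpos, h.dn, hup, fun k hik hkJ => by
    rw [hu', hv', hM']
    exact h.loc hcs h1 (hk k hik hkJ).1, fun k hik hkJ => (hecc k hik hkJ).1,
    fun k hik hkJ => Hη k (hecc k hik hkJ).2⟩
  have hLi := h.Lpos i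
  have hLJ := h.Lpos J
  have hr : 0 < L J / L i := by positivity
  have hr' : L J / L i ≤ D := by rwa [div_le_iff₀ hLi]
  have hli := h.lpos i
  calc l i * (L J / L i) ^ (1 + ε) = l i * (L J / L i) ^ σ * (L J / L i) ^ (1 + ε - σ) := by
        rw [mul_assoc, ← Real.rpow_add hr]; ring_nf
    _ ≤ C * l J * D ^ (1 + ε - σ) := by
        refine mul_le_mul key (Real.rpow_le_rpow hr.le hr' (by linarith)) (by positivity) ?_
        have := h.lpos J
        positivity
    _ = _ := by ring

end Sys

theorem pos_of_nonneg_on_isOpen {S : Set (ℝ × ℝ)} (ho : IsOpen S) {m n : ℝ}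
    (h : ∀ z ∈ S, 0 ≤ m * z.1 + n * z.2) (hmn : m ≠ 0 ∨ n ≠ 0) {z : ℝ × ℝ} (hz : z ∈ S) :
    0 < m * z.1 + n * z.2 := by
  obtain ⟨r, hr, hb⟩ := Metric.isOpen_iff.1 ho z hz
  have hN : 0 < m ^ 2 + n ^ 2 := by
    rcases hmn with h1 | h1
    · have := sq_nonneg n; positivity
    · have := sq_nonneg m; positivity
  obtain ⟨t, ht⟩ : ∃ t, t = r / (2 * (|m| + |n| + 1)) := ⟨_, rfl⟩
  have ht0 : 0 < t := by rw [ht]; positivity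
  have htr : t * (2 * (|m| + |n| + 1)) = r := by rw [ht]; field_simp
  have h1 : (z.1 - t * m, z.2 - t * n) ∈ S := by
    refine hb ?_
    rw [mem_ball, Prod.dist_eq, Real.dist_eq, Real.dist_eq, max_lt_iff]
    simp only [sub_sub_cancel_left, abs_neg, abs_mul, abs_of_pos ht0]
    have h2 := mul_nonneg ht0.le (abs_nonneg m)
    have h3 := mul_nonneg ht0.le (abs_nonneg n)
    exact ⟨by linarith, by linarith⟩
  have h2 := h _ h1
  have h3 := mul_pos ht0 hN
  simp only at h2
  linarith

/-- The polar cone of a planar open convex set that misses the origin is spanned by two unit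
vectors. -/
theorem exists_extreme {S : Set (ℝ × ℝ)} (ho : IsOpen S) (hc : Convex ℝ S) (hne : S.Nonempty)
    (h0 : (0, 0) ∉ S) : ∃ p q p' q' : ℝ, p ^ 2 + q ^ 2 = 1 ∧ p' ^ 2 + q' ^ 2 = 1 ∧
      (∀ z ∈ S, 0 ≤ p * z.1 + q * z.2) ∧ (∀ z ∈ S, 0 ≤ p' * z.1 + q' * z.2) ∧
      ∀ m n, (∀ z ∈ S, 0 ≤ m * z.1 + n * z.2) →
        ∃ x y, 0 ≤ x ∧ 0 ≤ y ∧ m = x * p + y * p' ∧ n = x * q + y * q' := by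
  obtain ⟨⟨a, b⟩, hab⟩ := hne
  have hN : 0 < a ^ 2 + b ^ 2 := by
    by_contra h
    have h1 := sq_nonneg a
    have h2 := sq_nonneg b
    have ha : a = 0 := pow_eq_zero_iff two_ne_zero |>.1 (by linarith)
    have hb : b = 0 := pow_eq_zero_iff two_ne_zero |>.1 (by linarith)
    exact h0 (by rwa [ha, hb] at hab)
  obtain ⟨I, hI⟩ : ∃ I : Set ℝ, I = {t | ∀ z ∈ S, 0 ≤ (a - t * b) * z.1 + (b + t * a) * z.2} :=
    ⟨_, rfl⟩
  have hmem : ∀ m n, (∀ z ∈ S, 0 ≤ m * z.1 + n * z.2) → m ≠ 0 ∨ n ≠ 0 → ∃ r t, 0 < r ∧ t ∈ I ∧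
      m = r * (a - t * b) ∧ n = r * (b + t * a) := by
    intro m n hmn hmn0
    have h1 := pos_of_nonneg_on_isOpen ho hmn hmn0 hab
    simp only at h1
    obtain ⟨r, hr⟩ : ∃ r, r = (m * a + n * b) / (a ^ 2 + b ^ 2) := ⟨_, rfl⟩
    obtain ⟨t, ht⟩ : ∃ t, t = (n * a - m * b) / (m * a + n * b) := ⟨_, rfl⟩
    have hr0 : 0 < r := hr ▸ div_pos h1 hN
    have e1 : m = r * (a - t * b) := by rw [hr, ht]; field_simp; ring
    have e2 : n = r * (b + t * a) := by rw [hr, ht]; field_simp; ring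
    refine ⟨r, t, hr0, ?_, e1, e2⟩
    rw [hI]
    intro z hz
    have h2 := hmn z hz
    rw [e1, e2, mul_assoc, mul_assoc, ← mul_add] at h2
    exact nonneg_of_mul_nonneg_right h2 hr0
  have hIc : IsCompact I := by
    rw [Metric.isCompact_iff_isClosed_bounded]
    constructor
    · rw [hI]
      simp only [ofPred_forall]
      exact isClosed_biInter fun z _ => isClosed_le continuous_const (by fun_prop)
    · obtain ⟨r, hr, hb⟩ := Metric.isOpen_iff.1 ho _ hab
      obtain ⟨w, hw⟩ : ∃ w, w = r / (2 * (|a| + |b| + 1)) := ⟨_, rfl⟩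
      have hw0 : 0 < w := by rw [hw]; positivity
      have hwr : w * (2 * (|a| + |b| + 1)) = r := by rw [hw]; field_simp
      have hin : ∀ x, |x| = w → (a - x * b, b + x * a) ∈ S := by
        intro x hx
        refine hb ?_
        rw [mem_ball, Prod.dist_eq, Real.dist_eq, Real.dist_eq, max_lt_iff]
        simp only [sub_sub_cancel_left, abs_neg, abs_mul, add_sub_cancel_left, hx]
        have h2 := mul_nonneg hw0.le (abs_nonneg a)
        have h3 := mul_nonneg hw0.le (abs_nonneg b)
        exact ⟨by linarith, by linarith⟩
      refine (Metric.isBounded_Icc (-(1 / w)) (1 / w)).subset fun t ht => ?_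
      rw [hI] at ht
      have h1 := ht _ (hin w (abs_of_pos hw0))
      have h2 := ht _ (hin (-w) (by rw [abs_neg, abs_of_pos hw0]))
      simp only at h1 h2
      have h3 : 0 ≤ 1 + t * w := by
        refine nonneg_of_mul_nonneg_right (b := 1 + t * w) ?_ hN
        linarith
      have h4 : 0 ≤ 1 - t * w := by
        refine nonneg_of_mul_nonneg_right (b := 1 - t * w) ?_ hN
        linarith
      rw [mem_Icc, ← neg_div, div_le_iff₀ hw0, le_div_iff₀ hw0]
      exact ⟨by linarith, by linarith⟩
  have hIne : I.Nonempty := by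
    obtain ⟨m, n, h1, -⟩ := exists_support ho hc h0
    simp only [mul_zero, add_zero] at h1
    obtain ⟨-, t, -, ht, -⟩ := hmem m n (fun z hz => (h1 z hz).le) (by
      by_contra! h
      have := h1 _ hab
      simp [h.1, h.2] at this)
    exact ⟨t, ht⟩
  obtain ⟨t₁, ht₁, hmin⟩ := hIc.exists_isLeast hIne
  obtain ⟨t₂, ht₂, hmax⟩ := hIc.exists_isGreatest hIne
  have hunit : ∀ t ∈ I, ∃ p q r : ℝ, 0 < r ∧ p ^ 2 + q ^ 2 = 1 ∧ (∀ z ∈ S, 0 ≤ p * z.1 + q * z.2) ∧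
      a - t * b = r * p ∧ b + t * a = r * q := by
    intro t ht
    have h1 : 0 < (a - t * b) ^ 2 + (b + t * a) ^ 2 := by
      have e : (a - t * b) ^ 2 + (b + t * a) ^ 2 = (1 + t ^ 2) * (a ^ 2 + b ^ 2) := by ring
      rw [e]; positivity
    have hr := Real.sqrt_pos.2 h1
    have hr2 := Real.sq_sqrt h1.le
    refine ⟨(a - t * b) / √((a - t * b) ^ 2 + (b + t * a) ^ 2),
      (b + t * a) / √((a - t * b) ^ 2 + (b + t * a) ^ 2), _, hr, ?_, ?_, ?_, ?_⟩
    · rw [div_pow, div_pow, hr2, ← add_div, div_self h1.ne']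
    · intro z hz
      rw [hI] at ht
      rw [div_mul_eq_mul_div, div_mul_eq_mul_div, ← add_div]
      exact div_nonneg (ht z hz) hr.le
    · rw [mul_div_cancel₀ _ hr.ne']
    · rw [mul_div_cancel₀ _ hr.ne']
  obtain ⟨p, q, r, hr, hpq, hpS, hp, hq⟩ := hunit t₁ ht₁
  obtain ⟨p', q', r', hr', hpq', hpS', hp', hq'⟩ := hunit t₂ ht₂
  refine ⟨p, q, p', q', hpq, hpq', hpS, hpS', fun m n hmn => ?_⟩
  by_cases hmn0 : m ≠ 0 ∨ n ≠ 0
  · obtain ⟨R, t, hR, ht, rfl, rfl⟩ := hmem m n hmn hmn0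
    have h1 := hmin ht
    have h2 := hmax ht
    obtain ⟨θ, hθ0, hθ1, hθ⟩ : ∃ θ, 0 ≤ θ ∧ θ ≤ 1 ∧ t = (1 - θ) * t₁ + θ * t₂ := by
      rcases (h1.trans h2).eq_or_lt with h3 | h3
      · exact ⟨0, le_rfl, zero_le_one, by linarith⟩
      · have h4 : 0 < t₂ - t₁ := by linarith
        refine ⟨(t - t₁) / (t₂ - t₁), div_nonneg (by linarith) h4.le, ?_, ?_⟩
        · rw [div_le_one h4]; linarith
        · field_simp; ring
    have h3 : 0 ≤ 1 - θ := by linarith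
    refine ⟨R * (1 - θ) * r, R * θ * r', by positivity, by positivity, ?_, ?_⟩
    · rw [hθ]; linear_combination R * (1 - θ) * hp + R * θ * hp'
    · rw [hθ]; linear_combination R * (1 - θ) * hq + R * θ * hq'
  · push Not at hmn0
    exact ⟨0, 0, le_rfl, le_rfl, by simp [hmn0.1], by simp [hmn0.2]⟩

theorem exists_tilt {A B : Set (ℝ × ℝ)} {p q p' q' m n m' n' : ℝ}
    (hA : ∀ a b, (∀ z ∈ A, 0 ≤ a * z.1 + b * z.2) →
      ∃ x y, 0 ≤ x ∧ 0 ≤ y ∧ a = x * p + y * p' ∧ b = x * q + y * q')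
    (hB : ∀ a b, (∀ z ∈ B, 0 ≤ a * z.1 + b * z.2) →
      ∃ x y, 0 ≤ x ∧ 0 ≤ y ∧ a = x * m + y * m' ∧ b = x * n + y * n') {τ : ℝ} (hτ : τ ^ 2 = 1) :
    ∃ N : ℝ, 0 < N ∧ ∀ c s : ℝ, c ^ 2 + s ^ 2 = 1 → 0 < p * c + q * s → 0 < p' * c + q' * s →
      0 < τ * (-m * s + n * c) → 0 < τ * (-m' * s + n' * c) →
      (∃ z ∈ A, 1 ≤ N * -(τ * (-s * z.1 + c * z.2)) ∧
        |c * z.1 + s * z.2| ≤ N * -(τ * (-s * z.1 + c * z.2))) ∨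
      ∃ z ∈ B, 1 ≤ N * -(c * z.1 + s * z.2) ∧
        |τ * (-s * z.1 + c * z.2)| ≤ N * -(c * z.1 + s * z.2) := by
  by_contra! H
  choose c s hcs h1 h2 h3 h4 h5 h6 using fun k : ℕ => H (k + 1) (by positivity)
  have hτ1 : |τ| = 1 := (pow_eq_one_iff_of_nonneg (abs_nonneg τ) two_ne_zero).1 (by
    rw [sq_abs]; exact hτ)
  have hc1 : ∀ k, |c k| ≤ 1 := fun k => (abs_le_one_of_sq (hcs k)).1
  have hs1 : ∀ k, |s k| ≤ 1 := fun k => (abs_le_one_of_sq (hcs k)).2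
  obtain ⟨⟨C, S⟩, -, φ, hφ, hlim⟩ :=
    (isCompact_Icc (a := ((-1 : ℝ), (-1 : ℝ))) (b := (1, 1))).tendsto_subseq (x := fun k => (c k, s k)) (fun k => ⟨⟨(abs_le.1 (hc1 k)).1, (abs_le.1 (hs1 k)).1⟩,
      (abs_le.1 (hc1 k)).2, (abs_le.1 (hs1 k)).2⟩)
  have hC : Tendsto (fun k => c (φ k)) atTop (𝓝 C) := (continuous_fst.tendsto _).comp hlim
  have hS : Tendsto (fun k => s (φ k)) atTop (𝓝 S) := (continuous_snd.tendsto _).comp hlim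
  have hCS : C ^ 2 + S ^ 2 = 1 := tendsto_nhds_unique ((hC.pow 2).add (hS.pow 2)) (by simp [hcs])
  have hinv : ∀ X : ℝ, Tendsto (fun k => X / ((φ k : ℝ) + 1)) atTop (𝓝 0) := fun X =>
    (tendsto_const_div_atTop_nhds_zero_nat X).comp ((tendsto_add_atTop_nat 1).comp hφ.tendsto_atTop)
      |>.congr fun k => by simp
  have hbd : ∀ (X : ℝ) (k : ℕ) (a b : ℝ), (1 ≤ ((k : ℝ) + 1) * a → ((k : ℝ) + 1) * a < |b|) →
      |b| ≤ X → a ≤ (1 + X) / ((k : ℝ) + 1) := by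
    intro X k a b h7 h8
    rw [le_div_iff₀ (by positivity)]
    have := abs_nonneg b
    by_contra! h9
    have := h7 (by linarith)
    linarith
  have hl1 : ∀ k (z : ℝ × ℝ), |c k * z.1 + s k * z.2| ≤ |z.1| + |z.2| := fun k z =>
    (abs_add_le _ _).trans (add_le_add (by
      rw [abs_mul]; exact mul_le_of_le_one_left (abs_nonneg _) (hc1 k)) (by
      rw [abs_mul]; exact mul_le_of_le_one_left (abs_nonneg _) (hs1 k)))
  have hl2 : ∀ k (z : ℝ × ℝ), |τ * (-s k * z.1 + c k * z.2)| ≤ |z.1| + |z.2| := fun k z => by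
    rw [abs_mul, hτ1, one_mul]
    exact (abs_add_le _ _).trans (add_le_add (by
      rw [abs_mul, abs_neg]; exact mul_le_of_le_one_left (abs_nonneg _) (hs1 k)) (by
      rw [abs_mul]; exact mul_le_of_le_one_left (abs_nonneg _) (hc1 k)))
  have hfA : ∀ z ∈ A, 0 ≤ -τ * S * z.1 + τ * C * z.2 := by
    intro z hz
    have h7 : -(τ * (-S * z.1 + C * z.2)) ≤ 0 :=
      le_of_tendsto_of_tendsto' (((hS.neg.mul_const z.1).add (hC.mul_const z.2)).const_mul τ).neg
        (hinv (1 + (|z.1| + |z.2|)))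
        (fun k => hbd _ (φ k) _ _ (h5 (φ k) z hz) (hl1 _ z))
    linarith
  have hfB : ∀ z ∈ B, 0 ≤ C * z.1 + S * z.2 := by
    intro z hz
    have h7 : -(C * z.1 + S * z.2) ≤ 0 :=
      le_of_tendsto_of_tendsto' ((hC.mul_const z.1).add (hS.mul_const z.2)).neg
        (hinv (1 + (|z.1| + |z.2|)))
        (fun k => hbd _ (φ k) _ _ (h6 (φ k) z hz) (hl2 _ z))
    linarith
  obtain ⟨x, y, hx, hy, e1, e2⟩ := hA _ _ hfA
  obtain ⟨x', y', hx', hy', e3, e4⟩ := hB _ _ hfB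
  have i1 := mul_nonneg hx (h1 0).le
  have i2 := mul_nonneg hy (h2 0).le
  have i3 := mul_nonneg hx' (h3 0).le
  have i4 := mul_nonneg hy' (h4 0).le
  have k1 : x * (p * c 0 + q * s 0) + y * (p' * c 0 + q' * s 0) = τ * (C * s 0 - S * c 0) := by
    linear_combination -c 0 * e1 - s 0 * e2
  have k2 : x' * (τ * (-m * s 0 + n * c 0)) + y' * (τ * (-m' * s 0 + n' * c 0)) =
      -(τ * (C * s 0 - S * c 0)) := by
    linear_combination τ * s 0 * e3 - τ * c 0 * e4
  have j1 : x * (p * c 0 + q * s 0) = 0 := by linarith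
  have j2 : y * (p' * c 0 + q' * s 0) = 0 := by linarith
  have j3 : x = 0 := (mul_eq_zero.1 j1).resolve_right (h1 0).ne'
  have j4 : y = 0 := (mul_eq_zero.1 j2).resolve_right (h2 0).ne'
  rw [j3, j4] at e1 e2
  have : (0 : ℝ) = 1 := by
    linear_combination hCS - τ * C * e2 + τ * S * e1 + (C ^ 2 + S ^ 2) * hτ
  norm_num at this

namespace Loc

theorem same_sign {u v : ℝ → ℝ → ℝ} {A B : Set (ℝ × ℝ)} {κ L l : ℝ} {M : ℝ → ℝ}
    (h : Loc u v A B κ M L l) {α₁ α₂ β₁ β₂ : ℝ} (hα : ∀ z ∈ A, 0 ≤ α₁ * z.1 + α₂ * z.2)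
    (hβ : ∀ z ∈ A, 0 ≤ β₁ * z.1 + β₂ * z.2) (hα₂ : |α₂| ≤ 1) (hβ₂ : |β₂| ≤ 1)
    (hα₁ : l < κ ^ 2 * (|α₁| * L)) (hβ₁ : l < κ ^ 2 * (|β₁| * L)) : 0 < α₁ * β₁ := by
  obtain ⟨a₀, b₀, hf⟩ := h.fatA
  have hκ := h.hκ
  have hL := h.Lpos
  have hl := h.lpos
  have key : ∀ γ₁ γ₂ : ℝ, (∀ z ∈ A, 0 ≤ γ₁ * z.1 + γ₂ * z.2) → |γ₂| ≤ 1 →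
      l < κ ^ 2 * (|γ₁| * L) → 0 < γ₁ * a₀ := by
    intro γ₁ γ₂ hγ hγ₂ hγ₁
    have hκL : 0 < κ * L := by positivity
    have hb₀ : |b₀| ≤ l / κ := (hf a₀ b₀ (by simp; positivity) (by simp; positivity)).2.2
    have h1 : γ₂ * b₀ ≤ l / κ := (le_abs_self _).trans (by
      rw [abs_mul]
      exact (mul_le_of_le_one_left (abs_nonneg _) hγ₂).trans hb₀)
    have h2 : l / κ < κ * (|γ₁| * L) := by
      rw [div_lt_iff₀ hκ]
      linarith
    rcases le_total 0 γ₁ with h3 | h3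
    · have h4 := hγ _ (hf (a₀ - κ * L) b₀ (by rw [sub_sub_cancel_left, abs_neg, abs_of_pos hκL])
        (by simp; positivity)).1
      rw [abs_of_nonneg h3] at h2
      simp only at h4
      linarith
    · have h4 := hγ _ (hf (a₀ + κ * L) b₀ (by rw [add_sub_cancel_left, abs_of_pos hκL])
        (by simp; positivity)).1
      rw [abs_of_nonpos h3] at h2
      simp only at h4
      linarith
  have h1 := mul_pos (key _ _ hα hα₂ hα₁) (key _ _ hβ hβ₂ hβ₁)
  have h2 : 0 < α₁ * β₁ * a₀ ^ 2 := by linarith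
  exact pos_of_mul_pos_left h2 (sq_nonneg _)

theorem not_tilt (κ : ℝ) (hκ : 0 < κ) (M : ℝ → ℝ) (n : ℝ) (hn : 0 < n) :
    ∃ C η, 0 < C ∧ 0 < η ∧ ∀ (u v : ℝ → ℝ → ℝ) (A B : Set (ℝ × ℝ)) (L l : ℝ),
      Loc u v A B κ M L l → η * l ≤ L → C * l * n ≤ 1 → ∀ α₁ α₂ : ℝ,
      (∀ z ∈ A, 0 ≤ α₁ * z.1 + α₂ * z.2) → |α₂| ≤ 1 → C * l < α₁ * L → ∀ w₁ w₂, (w₁, w₂) ∈ B →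
      1 ≤ n * -w₁ → |w₂| ≤ n * -w₁ → False := by
  obtain ⟨C, η, hC, hη, H⟩ := reach κ hκ M 1 n zero_le_one hn.le
  refine ⟨C, η, hC, hη, fun u v A B L l h hl hCl α₁ α₂ hα hα₂ hα₁ w₁ w₂ hw h1 h2 => ?_⟩
  have hl0 := h.lpos
  have hL0 := h.Lpos
  obtain ⟨x₁, x₂, hx, h3, -, h5⟩ := H _ _ _ _ L l h.negFst hl (-w₁) w₂ (by simpa using hw) h2
    (le_of_mul_le_mul_right (by linarith) hn)
  have h6 := hα (-x₁, x₂) hx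
  simp only at h6
  have h7 : α₂ * x₂ ≤ C * l := (le_abs_self _).trans (by
    rw [abs_mul]
    exact (mul_le_of_le_one_left (abs_nonneg _) hα₂).trans h5)
  have h8 : 0 < α₁ := pos_of_mul_pos_left ((by positivity : 0 < C * l).trans hα₁) hL0.le
  have h9 := mul_le_mul_of_nonneg_left h3 h8.le
  linarith

end Loc

theorem exists_sign {x y : ℝ} (h : 0 < x * y) : ∃ σ : ℝ, σ ^ 2 = 1 ∧ σ * x = |x| ∧ σ * y = |y| := by
  rcases mul_pos_iff.1 h with ⟨h1, h2⟩ | ⟨h1, h2⟩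
  · exact ⟨1, by norm_num, by rw [abs_of_pos h1, one_mul], by rw [abs_of_pos h2, one_mul]⟩
  · exact ⟨-1, by norm_num, by rw [abs_of_neg h1, neg_one_mul], by rw [abs_of_neg h2, neg_one_mul]⟩

/-- At every scale of large eccentricity the normalizing frame is aligned with one of finitely many
lines supporting `A` or `B` at the origin. -/
theorem Sys.align {u v : ℝ → ℝ → ℝ} {A B : Set (ℝ × ℝ)} {κ D : ℝ} {M : ℝ → ℝ} {c s L l : ℕ → ℝ}
    (h : Sys u v A B κ D M c s L l) :
    ∃ (S : Finset (ℝ × ℝ)) (K η : ℝ), 0 ≤ K ∧ 0 < η ∧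
      (∀ z ∈ S, z.1 ^ 2 + z.2 ^ 2 = 1 ∧
        ((∀ x ∈ A, 0 ≤ -z.2 * x.1 + z.1 * x.2) ∨ ∀ x ∈ B, 0 ≤ z.1 * x.1 + z.2 * x.2)) ∧
      ∀ k, η * l k ≤ L k → ∃ z ∈ S, |z.1 * s k - z.2 * c k| * L k ≤ K * l k := by
  have hc := h.core
  obtain ⟨p, q, p', q', u1, u1', hp, hp', hA⟩ :=
    exists_extreme hc.oA hc.cA (closure_nonempty_iff.1 ⟨_, hc.zA⟩) hc.nA
  obtain ⟨m, n, m', n', u2, u2', hm, hm', hB⟩ :=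
    exists_extreme hc.oB hc.cB (closure_nonempty_iff.1 ⟨_, hc.zB⟩) hc.nB
  have hκ := half_pos h.hκ
  choose N hN HN using fun (τ : ℝ) (hτ : τ ^ 2 = 1) => exists_tilt hA hB hτ
  obtain ⟨R, hR⟩ : ∃ R, R = N 1 (by norm_num) + N (-1) (by norm_num) := ⟨_, rfl⟩
  have hN1 := hN 1 (by norm_num)
  have hN2 := hN (-1) (by norm_num)
  have hR0 : 0 < R := by linarith
  have hNR : ∀ τ (hτ : τ ^ 2 = 1) X, 1 ≤ N τ hτ * X → N τ hτ * X ≤ R * X := by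
    intro τ hτ X hX
    have hX0 : 0 < X := pos_of_mul_pos_right (zero_lt_one.trans_le hX) (hN τ hτ).le
    refine mul_le_mul_of_nonneg_right ?_ hX0.le
    rcases mul_self_eq_one_iff.1 ((sq τ).symm.trans hτ) with rfl | rfl <;> linarith
  obtain ⟨C, η, hC, hη, HC⟩ := Loc.not_tilt (κ / 2) hκ (fun x => M (2 * x)) R hR0
  obtain ⟨η', hη', Hη⟩ := h.exists_ecc (ρ := 1 / (C * R)) (by positivity)
  refine ⟨{(q, -p), (q', -p'), (m, n), (m', n')}, C + 1 / (κ / 2) ^ 2, η + η', by positivity,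
    by positivity, ?_, fun k hk => ?_⟩
  · simp only [Finset.mem_insert, Finset.mem_singleton]
    rintro z (rfl | rfl | rfl | rfl)
    · exact ⟨by linear_combination u1, Or.inl (by simpa using hp)⟩
    · exact ⟨by linear_combination u1', Or.inl (by simpa using hp')⟩
    · exact ⟨u2, Or.inr hm⟩
    · exact ⟨u2', Or.inr hm'⟩
  by_contra! hno
  have hl := h.lpos k
  have hL := h.Lpos k
  have hcs := h.cs k
  have hηl := mul_pos hη hl
  have hηl' := mul_pos hη' hl
  have hCR : C * l k * R ≤ 1 := by
    have h1 := (h.lL k).trans (Hη k (by linarith))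
    rw [le_div_iff₀ (by positivity)] at h1
    linarith
  have hkl : 0 < 1 / (κ / 2) ^ 2 * l k := by positivity
  have hCl : 0 < C * l k := by positivity
  have hbig : ∀ x, (C + 1 / (κ / 2) ^ 2) * l k < |x| * L k →
      C * l k < |x| * L k ∧ l k < (κ / 2) ^ 2 * (|x| * L k) := by
    intro x hx
    refine ⟨by linarith, ?_⟩
    have h1 : 1 / (κ / 2) ^ 2 * l k < |x| * L k := by linarith
    rwa [one_div_mul_eq_div, div_lt_iff₀ (by positivity), mul_comm] at h1
  have g1 := hbig (p * c k + q * s k) (by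
    have := hno (q, -p) (by simp)
    rwa [show (q, -p).1 * s k - (q, -p).2 * c k = p * c k + q * s k by ring] at this)
  have g2 := hbig (p' * c k + q' * s k) (by
    have := hno (q', -p') (by simp)
    rwa [show (q', -p').1 * s k - (q', -p').2 * c k = p' * c k + q' * s k by ring] at this)
  have g3 := hbig (-m * s k + n * c k) (by
    have := hno (m, n) (by simp)
    rwa [← abs_neg, show -((m, n).1 * s k - (m, n).2 * c k) = -m * s k + n * c k by ring] at this)
  have g4 := hbig (-m' * s k + n' * c k) (by
    have := hno (m', n') (by simp)
    rwa [← abs_neg, show -((m', n').1 * s k - (m', n').2 * c k) = -m' * s k + n' * c k by ring]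
      at this)
  have hunit : ∀ a b x y σ : ℝ, a ^ 2 + b ^ 2 = 1 → x ^ 2 + y ^ 2 = 1 → σ ^ 2 = 1 →
      |σ * (a * x + b * y)| ≤ 1 := by
    intro a b x y σ h1 h2 h3
    refine abs_le_one_iff_mul_self_le_one.2 ?_
    have e : σ * (a * x + b * y) * (σ * (a * x + b * y)) = 1 - (a * y - b * x) ^ 2 := by
      linear_combination h1 + (a ^ 2 + b ^ 2) * h2 + (a * x + b * y) ^ 2 * h3
    rw [e]
    linarith [sq_nonneg (a * y - b * x)]
  have hfr : ∀ (T : Set (ℝ × ℝ)) (a b : ℝ), (∀ z ∈ T, 0 ≤ a * z.1 + b * z.2) → ∀ (σ τ : ℝ) h1 h2,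
      ∀ z ∈ orthMap (σ * c k) (σ * s k) τ h1 h2 ⁻¹' T,
        0 ≤ σ * (a * c k + b * s k) * z.1 + τ * σ * (-a * s k + b * c k) * z.2 := by
    intro T a b hT σ τ h1 h2 z hz
    have h3 := hT _ hz
    rw [orthMap_apply] at h3
    linarith
  have i1 : (1 : ℝ) ^ 2 = 1 := by norm_num
  have hloc := h.own_loc k i1 i1
  have s1 := hloc.same_sign (hfr A p q hp 1 1 _ _) (hfr A p' q' hp' 1 1 _ _)
    (by
      have := hunit q p (c k) (-s k) (1 * 1) (by linarith) (by linarith) (by norm_num)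
      rwa [show 1 * 1 * (q * c k + p * -s k) = 1 * 1 * (-p * s k + q * c k) by ring] at this)
    (by
      have := hunit q' p' (c k) (-s k) (1 * 1) (by linarith) (by linarith) (by norm_num)
      rwa [show 1 * 1 * (q' * c k + p' * -s k) = 1 * 1 * (-p' * s k + q' * c k) by ring] at this)
    (by rw [one_mul]; exact g1.2) (by rw [one_mul]; exact g2.2)
  have s2 := hloc.swap.same_sign
    (α₁ := 1 * 1 * (-m * s k + n * c k)) (α₂ := 1 * (m * c k + n * s k))
    (β₁ := 1 * 1 * (-m' * s k + n' * c k)) (β₂ := 1 * (m' * c k + n' * s k))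
    (fun z hz => by linarith [hfr B m n hm 1 1 _ _ (z.2, z.1) hz])
    (fun z hz => by linarith [hfr B m' n' hm' 1 1 _ _ (z.2, z.1) hz])
    (hunit _ _ _ _ _ u2 hcs i1) (hunit _ _ _ _ _ u2' hcs i1)
    (by rw [one_mul, one_mul]; exact g3.2) (by rw [one_mul, one_mul]; exact g4.2)
  simp only [one_mul] at s1 s2
  obtain ⟨σ, hσ, e1, e2⟩ := exists_sign s1
  obtain ⟨τ', hτ', e3, e4⟩ := exists_sign s2
  obtain ⟨τ, hττ⟩ : ∃ τ, τ = τ' * σ := ⟨_, rfl⟩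
  have hτ : τ ^ 2 = 1 := by rw [hττ, mul_pow, hσ, hτ', one_mul]
  have hτσ : τ * σ = τ' := by rw [hττ]; linear_combination τ' * hσ
  have hcs' : (σ * c k) ^ 2 + (σ * s k) ^ 2 = 1 := by
    linear_combination hcs + (c k ^ 2 + s k ^ 2) * hσ
  have hloc' := h.own_loc k hσ hτ
  have hap : ∀ x, C * l k < |x| * L k → 0 < |x| := fun x hx =>
    pos_of_mul_pos_left (hCl.trans hx) hL.le
  have hin : ∀ (T : Set (ℝ × ℝ)), ∀ z ∈ T, (σ * c k * z.1 + σ * s k * z.2,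
      τ * (-(σ * s k) * z.1 + σ * c k * z.2)) ∈ orthMap (σ * c k) (σ * s k) τ hcs' hτ ⁻¹' T := by
    intro T z hz
    rw [mem_preimage]
    change orthMap (σ * c k) (σ * s k) τ hcs' hτ ((orthMap (σ * c k) (σ * s k) τ hcs' hτ).symm z) ∈ T
    rwa [Homeomorph.apply_symm_apply]
  rcases HN τ hτ (σ * c k) (σ * s k) hcs'
    (by rw [show p * (σ * c k) + q * (σ * s k) = σ * (p * c k + q * s k) by ring, e1]
        exact hap _ g1.1)
    (by rw [show p' * (σ * c k) + q' * (σ * s k) = σ * (p' * c k + q' * s k) by ring, e2]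
        exact hap _ g2.1)
    (by rw [show τ * (-m * (σ * s k) + n * (σ * c k)) = τ * σ * (-m * s k + n * c k) by ring,
          hτσ, e3]
        exact hap _ g3.1)
    (by rw [show τ * (-m' * (σ * s k) + n' * (σ * c k)) = τ * σ * (-m' * s k + n' * c k) by ring,
          hτσ, e4]
        exact hap _ g4.1) with ⟨z, hz, h1, h2⟩ | ⟨z, hz, h1, h2⟩
  · refine HC _ _ _ _ _ _ hloc'.swap (by linarith) hCR (τ * σ * (-m * s k + n * c k))
      (σ * (m * c k + n * s k)) (fun x hx => ?_) (hunit _ _ _ _ _ u2 hcs hσ)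
      (by rw [hτσ, e3]; exact g3.1) _ _ (hin A z hz) (h1.trans (hNR _ hτ _ h1))
      (h2.trans (hNR _ hτ _ h1))
    linarith [hfr B m n hm σ τ _ _ (x.2, x.1) hx]
  · refine HC _ _ _ _ _ _ hloc' (by linarith) hCR (σ * (p * c k + q * s k))
      (τ * σ * (-p * s k + q * c k)) (hfr A p q hp σ τ _ _) ?_ (by rw [e1]; exact g1.1) _ _
      (hin B z hz) (h1.trans (hNR _ hτ _ h1)) (h2.trans (hNR _ hτ _ h1))
    have := hunit q p (c k) (-s k) (τ * σ) (by linarith) (by linarith) (by rw [hτσ, hτ'])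
    rwa [show τ * σ * (q * c k + p * -s k) = τ * σ * (-p * s k + q * c k) by ring] at this

theorem abs_cross_le {a b c d e f : ℝ} (h1 : a ^ 2 + b ^ 2 = 1) (h2 : c ^ 2 + d ^ 2 = 1)
    (h3 : e ^ 2 + f ^ 2 = 1) : |a * f - b * e| ≤ |a * d - b * c| + |c * f - d * e| := by
  have hunit : ∀ x y z w : ℝ, x ^ 2 + y ^ 2 = 1 → z ^ 2 + w ^ 2 = 1 → |x * z + y * w| ≤ 1 := by
    intro x y z w hx hz
    refine abs_le_one_iff_mul_self_le_one.2 ?_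
    have e : (x * z + y * w) * (x * z + y * w) = 1 - (x * w - y * z) ^ 2 := by
      linear_combination hx + (x ^ 2 + y ^ 2) * hz
    rw [e]
    linarith [sq_nonneg (x * w - y * z)]
  rw [show a * f - b * e = (a * d - b * c) * (c * e + d * f) + (a * c + b * d) * (c * f - d * e) by
    linear_combination -(a * f - b * e) * h2]
  refine (abs_add_le _ _).trans (add_le_add ?_ ?_)
  · rw [abs_mul]
    exact mul_le_of_le_one_right (abs_nonneg _) (hunit _ _ _ _ h2 h3)
  · rw [abs_mul]
    exact mul_le_of_le_one_left (abs_nonneg _) (hunit _ _ _ _ h1 h2)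

namespace Sys

variable {u v : ℝ → ℝ → ℝ} {A B : Set (ℝ × ℝ)} {κ D : ℝ} {M : ℝ → ℝ} {c s L l : ℕ → ℝ}

theorem ecc_succ (h : Sys u v A B κ D M c s L l) {R : ℝ} {k : ℕ} (hk : L k ≤ R * l k) :
    L (k + 1) ≤ 4 * D ^ 2 * R * l (k + 1) := by
  have hL := h.Lpos k
  have hL' := h.Lpos (k + 1)
  have h1 := h.Ll k
  have h2 := h.Ll (k + 1)
  rw [pow_succ] at h2
  have h3 : L (k + 1) ^ 2 ≤ (D * L k) ^ 2 := pow_le_pow_left₀ hL'.le (h.up k 1) 2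
  have h4 : D ^ 2 * L k * L k ≤ D ^ 2 * L k * (R * l k) :=
    mul_le_mul_of_nonneg_left hk (by positivity)
  refine le_of_mul_le_mul_left ?_ hL'
  have e : L (k + 1) * (4 * D ^ 2 * R * l (k + 1)) = D ^ 2 * L k * (R * l k) := by
    linear_combination 4 * D ^ 2 * R * h2 - D ^ 2 * R * h1
  rw [e]
  linarith

theorem lock (h : Sys u v A B κ D M c s L l) {S : Finset (ℝ × ℝ)} {K R : ℝ}
    (hS : ∀ z ∈ S, z.1 ^ 2 + z.2 ^ 2 = 1)
    (hgap : ∀ z ∈ S, ∀ w ∈ S, z.1 * w.2 - z.2 * w.1 = 0 ∨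
      2 * K + D < R * |z.1 * w.2 - z.2 * w.1|) (hR : 0 < R)
    {z w : ℝ × ℝ} (hz : z ∈ S) (hw : w ∈ S) {k : ℕ} (hk : R * l k ≤ L k)
    (hk' : R * l (k + 1) ≤ L (k + 1)) (hzk : |z.1 * s k - z.2 * c k| * L k ≤ K * l k)
    (hwk : |w.1 * s (k + 1) - w.2 * c (k + 1)| * L (k + 1) ≤ K * l (k + 1)) :
    |z.1 * s (k + 1) - z.2 * c (k + 1)| * L (k + 1) ≤ K * l (k + 1) := by
  have hb : ∀ j x N, R * l j ≤ L j → |x| * L j ≤ N * l j → R * |x| ≤ N := by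
    intro j x N h1 h2
    refine le_of_mul_le_mul_right ?_ (h.lpos j)
    have := mul_le_mul_of_nonneg_left h1 (abs_nonneg x)
    linarith
  have b1 := hb k _ _ hk hzk
  have b2 := hb k _ _ hk (h.rot k)
  have b3 := hb (k + 1) _ _ hk' hwk
  have t1 := abs_cross_le (hS z hz) (h.cs k) (hS w hw)
  have t2 := abs_cross_le (h.cs k) (h.cs (k + 1)) (hS w hw)
  have t3 := abs_cross_le (hS z hz) (hS w hw) (h.cs (k + 1))
  have t4 : |c (k + 1) * w.2 - s (k + 1) * w.1| = |w.1 * s (k + 1) - w.2 * c (k + 1)| := by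
    rw [← abs_neg]
    congr 1
    ring
  rw [t4] at t2
  rcases hgap z hz w hw with h0 | h0
  · rw [h0, abs_zero, zero_add] at t3
    exact (mul_le_mul_of_nonneg_right t3 (h.Lpos _).le).trans hwk
  · have := mul_le_mul_of_nonneg_left (t1.trans (add_le_add le_rfl t2)) hR.le
    linarith

/-- The eccentricities grow slower than any power of the inverse scale. -/
theorem growth (h : Sys u v A B κ D M c s L l) {ε : ℝ} (hε : 0 < ε) :
    ∃ C, 0 < C ∧ ∀ k, L k ≤ C * ((2 : ℝ) ^ k) ^ ε * l k := by
  obtain ⟨S, K, η, hK, hη, hS, hal⟩ := h.align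
  have hwin : ∀ᶠ R : ℝ in atTop, ∀ z ∈ S, ∀ i J, i ≤ J →
      (∀ k, i ≤ k → k ≤ J → |z.1 * s k - z.2 * c k| * L k ≤ K * l k ∧ R * l k ≤ L k) →
      l i * (L J / L i) ^ (1 + ε) ≤ R * l J := by
    refine (Filter.eventually_all_finset S).2 fun z hz => ?_
    obtain ⟨η', C, -, -, H⟩ := h.window (hS z hz).1 (hS z hz).2 hK hε
    filter_upwards [eventually_ge_atTop η', eventually_ge_atTop C] with R h1 h2 i J hiJ hk
    refine (H i J hiJ fun k hik hkJ => ⟨(hk k hik hkJ).1, ?_⟩).trans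
      (mul_le_mul_of_nonneg_right h2 (h.lpos J).le)
    exact (mul_le_mul_of_nonneg_right h1 (h.lpos k).le).trans (hk k hik hkJ).2
  have hgap : ∀ᶠ R : ℝ in atTop, ∀ z ∈ S, ∀ w ∈ S, z.1 * w.2 - z.2 * w.1 = 0 ∨
      2 * K + D < R * |z.1 * w.2 - z.2 * w.1| := by
    refine (Filter.eventually_all_finset S).2 fun z _ => (Filter.eventually_all_finset S).2 fun w _ => ?_
    by_cases h0 : z.1 * w.2 - z.2 * w.1 = 0
    · exact Eventually.of_forall fun _ => Or.inl h0
    · filter_upwards [eventually_gt_atTop ((2 * K + D) / |z.1 * w.2 - z.2 * w.1|)] with R hR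
      exact Or.inr ((div_lt_iff₀ (abs_pos.2 h0)).1 hR)
  obtain ⟨R, hwin, hgap, hRη⟩ := (hwin.and (hgap.and (eventually_ge_atTop η))).exists
  have hR : 0 < R := hη.trans_le hRη
  have hD := zero_lt_one.trans_le h.hD
  have hL0 := h.Lpos 0
  have hl0 := h.lpos 0
  obtain ⟨Q, hQ⟩ : ∃ Q, Q = L 0 / l 0 + 4 * D ^ 2 * R := ⟨_, rfl⟩
  have hQ0 : 0 < Q := by rw [hQ]; positivity
  have hal' : ∀ k, R * l k ≤ L k → ∃ z ∈ S, |z.1 * s k - z.2 * c k| * L k ≤ K * l k := fun k hk =>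
    hal k ((mul_le_mul_of_nonneg_right hRη (h.lpos k).le).trans hk)
  have hstart : ∀ J, R * l J ≤ L J → L J ≤ Q * l J → ∃ i ≤ J, ∃ z ∈ S,
      (∀ k, i ≤ k → k ≤ J → |z.1 * s k - z.2 * c k| * L k ≤ K * l k ∧ R * l k ≤ L k) ∧
        L i ≤ Q * l i := by
    intro J hJ hJQ
    obtain ⟨z, hz, hzk⟩ := hal' J hJ
    refine ⟨J, le_rfl, z, hz, fun k h1 h2 => ?_, hJQ⟩
    rw [le_antisymm h2 h1]
    exact ⟨hzk, hJ⟩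
  have hrun : ∀ J, R * l J ≤ L J → ∃ i ≤ J, ∃ z ∈ S,
      (∀ k, i ≤ k → k ≤ J → |z.1 * s k - z.2 * c k| * L k ≤ K * l k ∧ R * l k ≤ L k) ∧
        L i ≤ Q * l i := by
    intro J
    induction J with
    | zero =>
      intro hJ
      refine hstart 0 hJ ?_
      rw [hQ, add_mul, div_mul_cancel₀ _ hl0.ne']
      have : 0 < 4 * D ^ 2 * R * l 0 := by positivity
      linarith
    | succ J ih =>
      intro hJ
      by_cases hJ' : R * l J ≤ L J
      · obtain ⟨i, hi, z, hz, hk, hiQ⟩ := ih hJ'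
        refine ⟨i, hi.trans J.le_succ, z, hz, fun k h1 h2 => ?_, hiQ⟩
        rcases Nat.le_succ_iff.1 h2 with h2 | rfl
        · exact hk k h1 h2
        · obtain ⟨w, hw, hwk⟩ := hal' _ hJ
          exact ⟨h.lock (fun z hz => (hS z hz).1) hgap hR hz hw hJ' hJ (hk J hi le_rfl).1 hwk, hJ⟩
      · refine hstart _ hJ ((h.ecc_succ (not_le.1 hJ').le).trans ?_)
        have h1 := h.lpos (J + 1)
        have : 0 < L 0 / l 0 * l (J + 1) := by positivity
        rw [hQ, add_mul]
        linarith
  refine ⟨R + R * Q * (D * L 0) ^ ε, by positivity, fun J => ?_⟩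
  have hlJ := h.lpos J
  have hLJ := h.Lpos J
  have h2J : (1 : ℝ) ≤ (2 : ℝ) ^ J := one_le_pow₀ (by norm_num)
  have h2ε : 1 ≤ ((2 : ℝ) ^ J) ^ ε := Real.one_le_rpow h2J hε.le
  have hpos : 0 < R * Q * (D * L 0) ^ ε * ((2 : ℝ) ^ J) ^ ε * l J := by positivity
  by_cases hJ : R * l J ≤ L J
  · obtain ⟨i, hi, z, hz, hk, hiQ⟩ := hrun J hJ
    have hw := hwin z hz i J hi hk
    have hLi := h.Lpos i
    have hli := h.lpos i
    have hup := h.up 0 i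
    rw [zero_add] at hup
    have hsq : 1 ≤ 2 ^ J * L J := by
      refine (one_le_sq_iff₀ (by positivity)).1 ?_
      have h1 := mul_le_mul_of_nonneg_left (h.lL J) hLJ.le
      rw [h.Ll J] at h1
      have h2 := mul_le_mul_of_nonneg_left h1 (by positivity : (0 : ℝ) ≤ 4 ^ J)
      rw [← mul_pow, show (4 : ℝ) * (1 / 4) = 1 by norm_num, one_pow] at h2
      rw [mul_pow, ← pow_mul, mul_comm J 2, pow_mul, show (2 : ℝ) ^ 2 = 4 by norm_num, sq (L J)]
      exact h2
    have hratio : 1 ≤ L J / L i * (D * L 0 * 2 ^ J) := by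
      rw [div_mul_eq_mul_div, le_div_iff₀ hLi, one_mul]
      have := mul_le_mul_of_nonneg_left hsq (by positivity : 0 ≤ D * L 0)
      linarith
    have hr := Real.one_le_rpow hratio hε.le
    rw [Real.mul_rpow (by positivity) (by positivity), Real.mul_rpow (by positivity) (by positivity)]
      at hr
    have hmain : L J * (L J / L i) ^ ε ≤ R * Q * l J := by
      rw [Real.rpow_add (by positivity), Real.rpow_one] at hw
      have h1 : L J * (L J / L i) ^ ε ≤ Q * (l i * (L J / L i * (L J / L i) ^ ε)) := by
        have e : Q * (l i * (L J / L i * (L J / L i) ^ ε)) =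
            Q * l i / L i * (L J * (L J / L i) ^ ε) := by field_simp
        rw [e]
        refine le_mul_of_one_le_left (by positivity) ?_
        rwa [le_div_iff₀ hLi, one_mul]
      have h2 := mul_le_mul_of_nonneg_left hw hQ0.le
      linarith
    have h3 := mul_le_mul_of_nonneg_left hr hLJ.le
    have h4 := mul_le_mul_of_nonneg_right hmain
      (by positivity : 0 ≤ (D * L 0) ^ ε * ((2 : ℝ) ^ J) ^ ε)
    have h5 : 0 < R * ((2 : ℝ) ^ J) ^ ε * l J := by positivity
    linarith
  · have h1 := mul_le_mul_of_nonneg_left h2ε (by positivity : 0 ≤ R * l J)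
    linarith

end Sys

theorem HalfScale.hs {w : R2 → ℝ} {Ω : Set R2} {c s κ M m : ℝ} {X : Bx} (hcs : c ^ 2 + s ^ 2 = 1)
    (h1 : (1 : ℝ) ^ 2 + 0 ^ 2 = 1)
    (hX : ∀ a b r, X.g a b ≤ r ↔ |a * c + b * s| ≤ r * M ∧ |-a * s + b * c| ≤ r * m)
    (h : HalfScale (fun a b => w (frameMap c s hcs (a, b))) (frameMap c s hcs ⁻¹' Ω) κ M m X.h) :
    HS (fun a b => w (frameMap 1 0 h1 (a, b))) (frameMap 1 0 h1 ⁻¹' Ω) κ X := by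
  have hrot : ∀ a b, frameMap 1 0 h1 (a, b) = frameMap c s hcs (a * c + b * s, -a * s + b * c) := by
    intro a b
    ext i
    fin_cases i
    · simp [frameMap]; linear_combination -a * hcs
    · simp [frameMap]; linear_combination -b * hcs
  have hinv : ∀ r, r / κ = 1 / κ * r := fun r => by ring
  obtain ⟨a₀, b₀, hf⟩ := h.fat
  refine ⟨fun a b hab => ?_, ⟨a₀ * c - b₀ * s, a₀ * s + b₀ * c, fun a b hab => ?_⟩,
    fun a b h2 h3 => ?_⟩
  · rw [hX] at hab
    rw [hrot]
    exact h.bd _ _ hab.1 hab.2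
  · rw [hX] at hab
    have := hf (a * c + b * s) (-a * s + b * c)
      (by convert hab.1 using 2; linear_combination a₀ * hcs)
      (by convert hab.2 using 2; linear_combination b₀ * hcs)
    rw [mem_preimage, hrot, hX, ← hinv, ← hinv]
    exact this
  · rw [hrot] at h2 h3
    rw [hX, ← hinv, ← hinv]
    refine h.out _ _ h2 ?_
    convert h3 using 3
    ext <;> ring

theorem HS.of_inSFamily {δb : ℝ} (hδ : 0 < δb) {u v : R2 → ℝ} {Ω₁ Ω₂ : Set R2} {L l : ℝ → ℝ}
    {e f : ℝ → R2} (hS : InSFamily δb u v Ω₁ Ω₂ L l e f) (h1 : (1 : ℝ) ^ 2 + 0 ^ 2 = 1) {h : ℝ}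
    (hh : h ∈ Ioc (0 : ℝ) 1) (hL : 0 < L h) (hl : 0 < l h) :
    ∃ c s, ∃ (hcs : c ^ 2 + s ^ 2 = 1) (hsc : (-s) ^ 2 + c ^ 2 = 1),
      HS (fun a b => u (frameMap 1 0 h1 (a, b))) (frameMap 1 0 h1 ⁻¹' interior Ω₁)
        (min δb 1 ^ 5 / 128) (bxOf c s (L h) (l h) hcs hL hl) ∧
      HS (fun a b => v (frameMap 1 0 h1 (a, b))) (frameMap 1 0 h1 ⁻¹' interior Ω₂)
        (min δb 1 ^ 5 / 128) (bxOf (-s) c (L h) (l h) hsc hL hl) := by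
  obtain ⟨c, s, hcs, hsc⟩ := Scale.of_inSFamily hδ hS hh
  refine ⟨c, s, hcs, by linear_combination hcs,
    HalfScale.hs hcs h1 (fun a b r => bxOf_g_le hcs hL hl) hsc.hu,
    HalfScale.hs hcs h1 (fun a b r => ?_) hsc.hv⟩
  rw [bxOf_g_le, and_comm, show -a * c + b * -s = -(a * c + b * s) by ring, abs_neg,
    show a * -s + b * c = -a * s + b * c by ring]

theorem exists_ecc_le {δb : ℝ} (hδ : 0 < δb) {u v : R2 → ℝ} {Ω₁ Ω₂ : Set R2} {L l : ℝ → ℝ}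
    {e f : ℝ → R2} (hS : InSFamily δb u v Ω₁ Ω₂ L l e f) {ε : ℝ} (hε : 0 < ε) :
    ∃ C, 0 < C ∧ ∀ h, 0 < h → h ≤ 1 → L h / l h * h ^ (ε / 2) ≤ C := by
  have hc := (DualPair.of_inSFamily hS).core 1 0 (by norm_num)
  have hbase : ∀ h, h ∈ Ioc (0 : ℝ) 1 → 0 < l h ∧ l h ≤ L h ∧ L h * l h = h := by
    obtain ⟨-, -, -, -, -, -, -, -, -, -, -, -, -, -, -, -, -, -, -, hall⟩ := hS
    intro h hh
    obtain ⟨-, -, -, h1, h2, h3, -⟩ := hall h hh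
    exact ⟨h1, h2, h3⟩
  have hpow : ∀ k : ℕ, ((1 : ℝ) / 4) ^ k ∈ Ioc (0 : ℝ) 1 := fun k =>
    ⟨by positivity, pow_le_one₀ (by norm_num) (by norm_num)⟩
  have hl : ∀ h, h ∈ Ioc (0 : ℝ) 1 → 0 < l h := fun h hh => (hbase h hh).1
  have hL : ∀ h, h ∈ Ioc (0 : ℝ) 1 → 0 < L h := fun h hh => (hl h hh).trans_le (hbase h hh).2.1
  choose c s hcs hsc hX hY using fun (h : ℝ) (hh : h ∈ Ioc (0 : ℝ) 1) =>
    HS.of_inSFamily hδ hS (by norm_num) hh (hL h hh) (hl h hh)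
  obtain ⟨κ, hκe⟩ : ∃ κ, κ = min δb 1 ^ 5 / 128 := ⟨_, rfl⟩
  have hm : 0 < min δb 1 := lt_min hδ one_pos
  have hκ : 0 < κ := by rw [hκe]; positivity
  have hκ1 : κ ≤ 1 := by
    have : min δb 1 ^ 5 ≤ 1 := pow_le_one₀ hm.le (min_le_right _ _)
    rw [hκe]
    linarith
  rw [← hκe] at hX hY
  obtain ⟨D, M, hsys⟩ := exists_sys hc hκ hκ1 (fun k => hcs _ (hpow k)) (fun k => hsc _ (hpow k))
    (fun k => hL _ (hpow k)) (fun k => hl _ (hpow k)) (fun k => (hbase _ (hpow k)).2.1)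
    (fun k => (hbase _ (hpow k)).2.2) (fun k => hX _ (hpow k)) (fun k => hY _ (hpow k))
  obtain ⟨C, hC, hg⟩ := hsys.growth hε
  obtain ⟨E, hE⟩ : ∃ E, E = 2 * (1 / (κ ^ 2 * (κ / 2))) := ⟨_, rfl⟩
  have hE0 : 0 < E := by rw [hE]; positivity
  refine ⟨4 * E ^ 2 * C, by positivity, fun h h0 h1 => ?_⟩
  have hh : h ∈ Ioc (0 : ℝ) 1 := ⟨h0, h1⟩
  obtain ⟨k, hk, hk'⟩ := exists_nat_pow_near_of_lt_one h0 h1 (by norm_num : (0 : ℝ) < 1 / 4)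
    (by norm_num)
  have hLk := hL _ (hpow k)
  have hLh := hL h hh
  have hlh := hl h hh
  have hcmp : L h ≤ E * L ((1 / 4) ^ k) := by
    rw [hE]
    refine (bxOf_length (hcs h hh) hLh hlh (hcs _ (hpow k)) hLk (hl _ (hpow k))
      (hbase _ (hpow k)).2.1 (by positivity) fun a b => ?_).1
    refine (hX h hh).g_le_mul hc.cu hc.u0 hκ (hX _ (hpow k)) (half_pos hκ) (by linarith) ?_ a b
    change κ / 2 * (L h * l h / κ) < L ((1 / 4) ^ k) * l ((1 / 4) ^ k)
    rw [(hbase h hh).2.2, (hbase _ (hpow k)).2.2, show κ / 2 * (h / κ) = h / 2 by field_simp]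
    linarith
  have h2 : L h ^ 2 ≤ (E * L ((1 / 4) ^ k)) ^ 2 := pow_le_pow_left₀ hLh.le hcmp 2
  have h3 := mul_le_mul_of_nonneg_left (hg k) hLk.le
  rw [show L ((1 / 4) ^ k) * (C * ((2 : ℝ) ^ k) ^ ε * l ((1 / 4) ^ k)) =
    C * ((2 : ℝ) ^ k) ^ ε * (L ((1 / 4) ^ k) * l ((1 / 4) ^ k)) by ring, (hbase _ (hpow k)).2.2] at h3
  have h4 : ((1 : ℝ) / 4) ^ k ≤ 4 * (L h * l h) := by
    rw [(hbase h hh).2.2]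
    rw [pow_succ] at hk
    linarith
  have h5 : L h ≤ 4 * E ^ 2 * C * ((2 : ℝ) ^ k) ^ ε * l h := by
    refine le_of_mul_le_mul_left ?_ hLh
    have h6 := mul_le_mul_of_nonneg_left h3 (sq_nonneg E)
    have h7 := mul_le_mul_of_nonneg_left h4 (by positivity : 0 ≤ E ^ 2 * (C * ((2 : ℝ) ^ k) ^ ε))
    linarith
  have h8 : ((2 : ℝ) ^ k) ^ ε * h ^ (ε / 2) ≤ 1 := by
    have e1 : ((2 : ℝ) ^ k) ^ ε = (4 ^ k) ^ (ε / 2) := by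
      rw [show (4 : ℝ) ^ k = ((2 : ℝ) ^ k) ^ (2 : ℝ) by
        rw [Real.rpow_two, ← pow_mul, mul_comm, pow_mul]; norm_num, ← Real.rpow_mul (by positivity)]
      congr 1
      ring
    rw [e1, ← Real.mul_rpow (by positivity) h0.le]
    refine Real.rpow_le_one (by positivity) ?_ (by positivity)
    have := mul_le_mul_of_nonneg_left hk' (by positivity : (0 : ℝ) ≤ 4 ^ k)
    rwa [← mul_pow, show (4 : ℝ) * (1 / 4) = 1 by norm_num, one_pow] at this
  rw [div_mul_eq_mul_div, div_le_iff₀ hlh]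
  have h9 := mul_le_mul_of_nonneg_right h5 (by positivity : 0 ≤ h ^ (ε / 2))
  have h10 := mul_le_mul_of_nonneg_left h8 (by positivity : 0 ≤ 4 * E ^ 2 * C * l h)
  linarith

/-- for `(u, v) ∈ S(δ̄)` and `ε > 0` there is `h₁ > 0` (depending on `δ̄`, `ε`
and the pair `(u, v)`) such that `η_u(h) ≤ (1/2) h^{-ε}` whenever `0 < h < h₁`. -/
theorem stmt_15 (δb : ℝ) (hδb : 0 < δb)
    (u v : R2 → ℝ) (Ω₁ Ω₂ : Set R2) (L l : ℝ → ℝ) (e f : ℝ → R2)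
    (hmem : InSFamily δb u v Ω₁ Ω₂ L l e f)
    (ε : ℝ) (hε : 0 < ε) :
    ∃ h₁ : ℝ, 0 < h₁ ∧ h₁ ≤ 1 ∧
      ∀ h : ℝ, 0 < h → h < h₁ → L h / l h ≤ (1 / 2) * h ^ (-ε) := by
  obtain ⟨C, hC, hb⟩ := exists_ecc_le hδb hmem hε
  refine ⟨min 1 ((1 / (2 * C)) ^ (2 / ε)), by positivity, min_le_left _ _, fun h h0 hh => ?_⟩
  have h1 := hb h h0 (hh.le.trans (min_le_left _ _))
  have h2 : h ^ (ε / 2) ≤ 1 / (2 * C) := by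
    have := Real.rpow_le_rpow h0.le (hh.le.trans (min_le_right _ _)) (half_pos hε).le
    rwa [← Real.rpow_mul (by positivity), show 2 / ε * (ε / 2) = 1 by field_simp, Real.rpow_one]
      at this
  rw [le_div_iff₀ (by positivity)] at h2
  have hp : 0 < h ^ (ε / 2) := by positivity
  rw [Real.rpow_neg h0.le, ← add_halves ε, Real.rpow_add h0, ← div_eq_mul_inv,
    le_div_iff₀ (by positivity)]
  have h3 := mul_le_mul_of_nonneg_right h1 hp.le
  linarith
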